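/- Let V be a smoothly bounded strictly pseudoconvex domain in ℂ^n and let φ be a function on Δ × V (Δ the unit disk in ℂ) which is smooth up to the boundary. Let K_t(ζ,z) be the Bergman kernel of V with weight φ^t = φ(t,·). Then for each fixed z ∈ V, the function ζ ↦ K_t(ζ,z) is smooth up to the boundary of V, and moreover depends smoothly on t. -/

import Mathlib

open MeasureTheory Filter Set Metric Complex
open scoped ENNReal NNReal Topology

noncomputable section

namespace Berndtsson

instance (n : ℕ) : MeasurableSpace (EuclideanSpace ℂ (Fin n)) := borel _
instance (n : ℕ) : BorelSpace (EuclideanSpace ℂ (Fin n)) := ⟨rfl⟩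
instance (n : ℕ) : MeasureSpace (EuclideanSpace ℂ (Fin n)) :=
  ⟨Measure.map (EuclideanSpace.equiv (Fin n) ℂ).symm volume⟩

abbrev Cn (n : ℕ) := EuclideanSpace ℂ (Fin n)

/-- A function `f`, with values in `EReal`, is plurisubharmonic on `s` if it is upper
semicontinuous on `s` and satisfies the sub-mean value inequality on every complex circle
whose corresponding closed disk is contained in `s` (formulated via continuous majorants,
which for upper semicontinuous integrands is equivalent to the upper-integral form). -/
def PlurisubharmonicOn {E : Type*} [NormedAddCommGroup E] [NormedSpace ℂ E]
    (f : E → EReal) (s : Set E) : Prop :=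
  UpperSemicontinuousOn f s ∧
    ∀ z ∈ s, ∀ w : E, ∀ r : ℝ, 0 < r →
      (∀ l : ℂ, ‖l‖ ≤ r → z + l • w ∈ s) →
      ∀ h : ℝ → ℝ, Continuous h →
        (∀ θ : ℝ, f (z + ((r : ℂ) * Complex.exp (θ * Complex.I)) • w) ≤ (h θ : EReal)) →
        f z ≤ (((2 * Real.pi)⁻¹ * ∫ θ in (0:ℝ)..(2 * Real.pi), h θ : ℝ) : EReal)

/-- Plurisubharmonicity for real-valued functions. -/
def PshOn {E : Type*} [NormedAddCommGroup E] [NormedSpace ℂ E] (f : E → ℝ) (s : Set E) : Prop :=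
  PlurisubharmonicOn (fun z => (f z : EReal)) s

/-- A pseudoconvex domain: an open set admitting a plurisubharmonic exhaustion function. -/
def Pseudoconvex {E : Type*} [NormedAddCommGroup E] [NormedSpace ℂ E] (D : Set E) : Prop :=
  IsOpen D ∧ ∃ u : E → ℝ, PshOn u D ∧ ∀ c : ℝ, IsCompact {z ∈ D | u z ≤ c}

/-- `log` with values in `EReal`, sending nonpositive reals to `⊥`. -/
def elog (x : ℝ) : EReal := if 0 < x then ((Real.log x : ℝ) : EReal) else ⊥

/-- Membership in the weighted Bergman space `A²(Ω, e^{-φ})`. -/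
def MemA2 {n : ℕ} (Ω : Set (Cn n)) (φ : Cn n → ℝ) (h : Cn n → ℂ) : Prop :=
  DifferentiableOn ℂ h Ω ∧
    IntegrableOn (fun ζ => ‖h ζ‖ ^ 2 * Real.exp (-φ ζ)) Ω volume

/-- `Kz` is the Bergman kernel of `A²(Ω, e^{-φ})` at the point `z`:
it belongs to the space and reproduces the value at `z` of every member. -/
def IsBergmanKernelAt {n : ℕ} (Ω : Set (Cn n)) (φ : Cn n → ℝ) (z : Cn n)
    (Kz : Cn n → ℂ) : Prop :=
  MemA2 Ω φ Kz ∧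
    ∀ h : Cn n → ℂ, MemA2 Ω φ h →
      ∫ ζ in Ω, h ζ * (starRingEnd ℂ) (Kz ζ) * (Real.exp (-φ ζ) : ℂ) = h z

/-- The Bergman kernel on the diagonal, via its extremal characterization
`K(z,z) = sup {|h(z)|² : h holomorphic on Ω, ∫_Ω |h|² e^{-φ} ≤ 1}`. -/
def bergmanDiag {n : ℕ} (Ω : Set (Cn n)) (φ : Cn n → ℝ) (z : Cn n) : ℝ :=
  sSup {v : ℝ | ∃ h : Cn n → ℂ, DifferentiableOn ℂ h Ω ∧
    IntegrableOn (fun ζ => ‖h ζ‖ ^ 2 * Real.exp (-φ ζ)) Ω volume ∧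
    (∫ ζ in Ω, ‖h ζ‖ ^ 2 * Real.exp (-φ ζ)) ≤ 1 ∧ v = ‖h z‖ ^ 2}

end Berndtsson

namespace Berndtsson

/-- Strict plurisubharmonicity of a (C²) function: positivity of the Levi form, expressed by
`4 ∂∂̄f(z)(w,w̄) = D²f(z)(w,w) + D²f(z)(iw,iw) > 0` for all `w ≠ 0`. -/
def StrictPlurisubharmonicOn {E : Type*} [NormedAddCommGroup E] [NormedSpace ℂ E]
    (f : E → ℝ) (s : Set E) : Prop :=
  ∀ z ∈ s, ∀ w : E, w ≠ 0 →
    0 < iteratedFDeriv ℝ 2 f z ![w, w] +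
        iteratedFDeriv ℝ 2 f z ![Complex.I • w, Complex.I • w]

open scoped ContDiff
open Finset (sum_congr mul_sum sum_mul sum_add_distrib sum_nonneg sum_sub_distrib sum_le_sum sum_comm)
open ENNReal (mul_lt_top ofReal_lt_top ofReal_le_ofReal add_lt_top ofReal_ne_top)
open Real (smoothTransition norm_eq_abs norm_of_nonneg sq_sqrt exp_pos)
open Real renaming exp_add → rexp_add
open ENNReal renaming ofReal → ofR, ofReal_mul → eofReal_mul, ofReal_pow → eofReal_pow
open MeasureTheory renaming AEStronglyMeasurable → AESM

local notation "conj" => starRingEnd ℂ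
local notation "Δ" => ball (0 : ℂ) 1
local notation "expR" => Real.exp
local notation "SmoothOn" => ContDiffOn ℝ ∞
local notation "HolOn" => DifferentiableOn ℂ
local notation:max "♯" f:max => fun y => ((f y : ℝ) : ℂ)
local notation:max "Fn" n:max => Cn n → ℂ

variable {n : ℕ} {V W U K : Set (Cn n)} {x z : Cn n} {f g θ F u v γ χ q : Fn n}
  {β : Fin n → Fn n} {ρ φ Φ Ψ w B : Cn n → ℝ} {r R τ η A P δ σ C : ℝ} {c : ℂ} {j k : Fin n} {M m : ℕ}

instance : (volume : Measure (Cn n)).IsAddHaarMeasure := by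
  change (Measure.map (EuclideanSpace.equiv (Fin n) ℂ).symm volume).IsAddHaarMeasure
  exact ContinuousLinearEquiv.isAddHaarMeasure_map (EuclideanSpace.equiv (Fin n) ℂ).symm volume

/-- A linear isometry preserves the volume. -/
theorem integral_congr_all {α E : Type*} [MeasurableSpace α] {μ : Measure α} [NormedAddCommGroup E]
    [NormedSpace ℝ E] {f g : α → E} (h : ∀ x, f x = g x) : ∫ x, f x ∂μ = ∫ x, g x ∂μ :=
  congrArg _ (funext h)

theorem enorm_sq_eq {E : Type*} [SeminormedAddCommGroup E] (v : E) :
    ‖v‖ₑ ^ 2 = ofR (‖v‖ ^ 2) := by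
  rw [← ofReal_norm, eofReal_pow (norm_nonneg _)]

theorem measurePreserving_linearIsometryEquiv (L : Cn n ≃ₗᵢ[ℝ] Cn n) :
    MeasurePreserving L (volume : Measure (Cn n)) volume := by
  refine ⟨L.continuous.measurable, ?_⟩
  have : (Measure.map L (volume : Measure (Cn n))).IsAddHaarMeasure :=
    ContinuousLinearEquiv.isAddHaarMeasure_map L.toContinuousLinearEquiv volume
  rw [Measure.isAddLeftInvariant_eq_smul (Measure.map L (volume : Measure (Cn n))) volume]
  have h := congrArg (fun ν : Measure (Cn n) => ν (ball 0 1))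
    (Measure.isAddLeftInvariant_eq_smul (Measure.map L (volume : Measure (Cn n))) volume)
  rw [Measure.map_apply L.continuous.measurable measurableSet_ball,
    L.preimage_ball, map_zero] at h
  have h0 : volume (ball (0 : Cn n) 1) ≠ 0 := (measure_ball_pos volume 0 one_pos).ne'
  have h1 : volume (ball (0 : Cn n) 1) ≠ ⊤ := measure_ball_lt_top.ne
  set c := Measure.addHaarScalarFactor (Measure.map L (volume : Measure (Cn n))) volume
  have : (c : ℝ≥0∞) = 1 := by
    rw [Measure.smul_apply, ENNReal.smul_def, smul_eq_mul] at h
    rw [← ENNReal.mul_left_inj h0 h1, one_mul]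
    exact h.symm
  rw [show c = 1 by exact_mod_cast this, one_smul]

/-- The `j`-th coordinate vector. -/
def eb (j : Fin n) : Cn n := EuclideanSpace.single j 1

/-- The operator `(∂/∂x_j + c ∂/∂y_j) / 2`. -/
def dd (c : ℂ) (j : Fin n) (f : Fn n) (x : Cn n) : ℂ :=
  (fderiv ℝ f x (eb j) + c * fderiv ℝ f x (I • eb j)) / 2

/-- The Wirtinger derivative `∂/∂z_j`. -/
abbrev dz (j : Fin n) (f : Fn n) : Fn n := dd (-I) j f

/-- The Wirtinger derivative `∂/∂z̄_j`. -/
abbrev dzb (j : Fin n) (f : Fn n) : Fn n := dd I j f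

theorem dd_congr (h : f =ᶠ[𝓝 x] g) : dd c j f x = dd c j g x := by
  simp only [dd, h.fderiv_eq]

theorem dd_congr_on (hU : IsOpen U) (h : EqOn f g U) : EqOn (dd c j f) (dd c j g) U :=
  fun _ hx => dd_congr (h.eventuallyEq_of_mem (hU.mem_nhds hx))

@[simp] theorem dd_const (a : ℂ) : dd c j (fun _ => a) x = 0 := by
  simp [dd]

theorem dd_add (hf : DifferentiableAt ℝ f x) (hg : DifferentiableAt ℝ g x) :
    dd c j (fun y => f y + g y) x = dd c j f x + dd c j g x := by
  simp only [dd, fderiv_fun_add hf hg, _root_.add_apply]; ring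

theorem dd_sub (hf : DifferentiableAt ℝ f x) (hg : DifferentiableAt ℝ g x) :
    dd c j (fun y => f y - g y) x = dd c j f x - dd c j g x := by
  simp only [dd, fderiv_fun_sub hf hg, _root_.sub_apply]; ring

theorem dd_neg : dd c j (fun y => -f y) x = -dd c j f x := by
  simp only [dd, fderiv_fun_neg, _root_.neg_apply]; ring

theorem dd_mul (hf : DifferentiableAt ℝ f x) (hg : DifferentiableAt ℝ g x) :
    dd c j (fun y => f y * g y) x = dd c j f x * g x + f x * dd c j g x := by
  simp only [dd, fderiv_fun_mul hf hg, _root_.add_apply,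
    _root_.smul_apply, smul_eq_mul]; ring

theorem dd_const_mul (a : ℂ) (hf : DifferentiableAt ℝ f x) :
    dd c j (fun y => a * f y) x = a * dd c j f x := by
  rw [dd_mul (differentiableAt_const a) hf]; simp

theorem dd_conj : dd c j (fun y => conj (f y)) x =
    conj (dd (conj c) j f x) := by
  have h : fderiv ℝ (fun y => conj (f y)) x =
      (conjCLE : ℂ →L[ℝ] ℂ).comp (fderiv ℝ f x) := by
    have := (conjCLE : ℂ ≃L[ℝ] ℂ).comp_fderiv (f := f) (x := x)
    exact this
  have h2 : conj 2 = 2 := Complex.conj_ofNat 2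
  simp [dd, h, h2]

/-- Chain rule for a real function of a real function. -/
theorem dd_comp_real {r : Cn n → ℝ} {F : ℝ → ℝ} {F' : ℝ} (hF : HasDerivAt F F' (r x))
    (hr : DifferentiableAt ℝ r x) :
    dd c j (fun y => ((F (r y) : ℝ) : ℂ)) x = (F' : ℂ) * dd c j (fun y => ((r y : ℝ) : ℂ)) x := by
  have h1 : HasFDerivAt (fun y => ((r y : ℝ) : ℂ)) (ofRealCLM.comp (fderiv ℝ r x)) x :=
    ofRealCLM.hasFDerivAt.comp x hr.hasFDerivAt
  have h2 : HasFDerivAt (fun y => ((F (r y) : ℝ) : ℂ))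
      (ofRealCLM.comp (F' • (fderiv ℝ r x))) x :=
    ofRealCLM.hasFDerivAt.comp x (hF.comp_hasFDerivAt x hr.hasFDerivAt)
  simp only [dd, h1.fderiv, h2.fderiv]
  simp; ring

theorem fderiv_I_smul (hf : DifferentiableAt ℂ f x) (v : Cn n) :
    fderiv ℝ f x (I • v) = I * fderiv ℝ f x v := by
  rw [hf.fderiv_restrictScalars ℝ]; simp

theorem dzb_eq_zero (hf : DifferentiableAt ℂ f x) : dzb j f x = 0 := by
  simp only [dd, fderiv_I_smul hf]
  rw [← mul_assoc, I_mul_I]; ring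

theorem dz_eq_fderiv (hf : DifferentiableAt ℂ f x) : dz j f x = fderiv ℂ f x (eb j) := by
  simp only [dd, fderiv_I_smul hf]
  rw [hf.fderiv_restrictScalars ℝ, neg_mul, ← mul_assoc, I_mul_I]
  simp

theorem contDiffOn_dd (hU : IsOpen U) (hf : SmoothOn f U) : SmoothOn (dd c j f) U := by
  have h : SmoothOn (fderiv ℝ f) U := hf.fderiv_of_isOpen hU le_rfl
  exact (((h.clm_apply contDiffOn_const).add
    (contDiffOn_const.mul (h.clm_apply contDiffOn_const))).div_const 2)

theorem contDiff_dd (hf : ContDiff ℝ ∞ f) : ContDiff ℝ ∞ (dd c j f) :=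
  contDiffOn_univ.1 (contDiffOn_dd isOpen_univ (contDiffOn_univ.2 hf))

theorem dd_dd (hf : ContDiffAt ℝ ∞ f x) {d : ℂ} : dd c j (dd d k f) x =
    (fderiv ℝ (fderiv ℝ f) x (eb j) (eb k) + d * fderiv ℝ (fderiv ℝ f) x (eb j) (I • eb k)
    + c * fderiv ℝ (fderiv ℝ f) x (I • eb j) (eb k)
    + c * d * fderiv ℝ (fderiv ℝ f) x (I • eb j) (I • eb k)) / 4 := by
  have h : DifferentiableAt ℝ (fderiv ℝ f) x :=
    (hf.fderiv_right (m := ∞) le_rfl).differentiableAt (by simp)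
  have h1 : ∀ v w, fderiv ℝ (fun y => fderiv ℝ f y v) x w = fderiv ℝ (fderiv ℝ f) x w v := by
    intro v w
    rw [fderiv_clm_apply h (differentiableAt_const v)]; simp
  have h2 : ∀ v, DifferentiableAt ℝ (fun y => fderiv ℝ f y v) x :=
    fun v => h.clm_apply (differentiableAt_const v)
  have h3 : fderiv ℝ (Berndtsson.dd d k f) x = (2 : ℂ)⁻¹ • (fderiv ℝ (fun y => fderiv ℝ f y (eb k)) x
      + d • fderiv ℝ (fun y => fderiv ℝ f y (I • eb k)) x) := by
    have : Berndtsson.dd d k f = fun y => (2 : ℂ)⁻¹ • (fderiv ℝ f y (eb k)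
      + d • fderiv ℝ f y (I • eb k)) := by
      funext y; simp [Berndtsson.dd]; ring
    rw [this]
    exact (((h2 _).hasFDerivAt.add ((h2 _).hasFDerivAt.const_smul d)).const_smul
      (2 : ℂ)⁻¹).fderiv
  simp only [Berndtsson.dd, h3]
  simp [h1]; ring

theorem dd_comm (hf : ContDiffAt ℝ ∞ f x) {d : ℂ} :
    dd c j (dd d k f) x = dd d k (dd c j f) x := by
  have hs : IsSymmSndFDerivAt ℝ f x := hf.isSymmSndFDerivAt (by simp; norm_cast)
  rw [dd_dd hf, dd_dd hf, hs (eb j) (eb k), hs (eb j) (I • eb k), hs (I • eb j) (eb k),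
    hs (I • eb j) (I • eb k)]
  ring

/-- Test functions on `V`. -/
structure IsTest (V : Set (Cn n)) (θ : Fn n) : Prop where
  smooth : ContDiff ℝ ∞ θ
  comp : HasCompactSupport θ
  supp : tsupport θ ⊆ V

namespace IsTest

theorem diff (h : IsTest V θ) (x : Cn n) : DifferentiableAt ℝ θ x :=
  h.smooth.contDiffAt.differentiableAt (by simp)

theorem contDiff_mul (hV : IsOpen V) (hs : tsupport θ ⊆ V) (h : SmoothOn (fun x => θ x * f x) V) :
    ContDiff ℝ ∞ (fun x => θ x * f x) := by
  rw [contDiff_iff_contDiffAt]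
  intro x
  by_cases hx : x ∈ V
  · exact h.contDiffAt (hV.mem_nhds hx)
  · have : (fun x => θ x * f x) =ᶠ[𝓝 x] fun _ => 0 := by
      have : θ =ᶠ[𝓝 x] 0 := notMem_tsupport_iff_eventuallyEq.1 (fun h => hx (hs h))
      filter_upwards [this] with y hy
      simp [hy]
    exact contDiffAt_const.congr_of_eventuallyEq this

theorem mul (h : IsTest V θ) (hV : IsOpen V) (hf : SmoothOn f V) :
    IsTest V (fun x => θ x * f x) :=
  ⟨contDiff_mul hV h.supp (h.smooth.contDiffOn.mul hf), h.comp.mul_right,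
    (closure_mono (Function.support_mul_subset_left _ _)).trans h.supp⟩

theorem mul' (h : IsTest V θ) (hV : IsOpen V) (hf : SmoothOn f V) :
    IsTest V (fun x => f x * θ x) := by
  simpa only [mul_comm] using h.mul hV hf

theorem add (h : IsTest V f) (h' : IsTest V g) : IsTest V (fun x => f x + g x) :=
  ⟨h.smooth.add h'.smooth, h.comp.add h'.comp,
    (closure_mono (Function.support_add _ _)).trans (by
      rw [closure_union]; exact union_subset h.supp h'.supp)⟩

theorem zero : IsTest V (fun _ => 0) := by
  refine ⟨contDiff_const, HasCompactSupport.zero, ?_⟩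
  simp [tsupport]

theorem sum {ι : Type*} {s : Finset ι} {F : ι → Fn n} (h : ∀ i ∈ s, IsTest V (F i)) :
    IsTest V (fun x => ∑ i ∈ s, F i x) := by
  classical
  induction s using Finset.induction_on with
  | empty => simpa using zero
  | insert a s ha ih =>
    simp only [Finset.sum_insert ha]
    exact (h a (by simp)).add (ih fun i hi => h i (by simp [hi]))

theorem const_mul (h : IsTest V θ) (a : ℂ) : IsTest V (fun x => a * θ x) :=
  ⟨contDiff_const.mul h.smooth, h.comp.mul_left,
    (closure_mono (Function.support_mul_subset_right _ _)).trans h.supp⟩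

theorem neg (h : IsTest V θ) : IsTest V (fun x => -θ x) := by
  simpa using h.const_mul (-1)

theorem sub (h : IsTest V f) (h' : IsTest V g) : IsTest V (fun x => f x - g x) := by
  simpa [sub_eq_add_neg] using h.add h'.neg

theorem star (h : IsTest V θ) : IsTest V (fun x => conj (θ x)) := by
  have hs : Function.support (fun x => conj (θ x)) = Function.support θ := by
    ext x; simp
  refine ⟨conjCLE.contDiff.comp h.smooth, ?_, ?_⟩
  · unfold HasCompactSupport tsupport; rw [hs]; exact h.comp
  · unfold tsupport; rw [hs]; exact h.supp

theorem support_dd : tsupport (dd c j θ) ⊆ tsupport θ := by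
  refine closure_minimal (fun x hx => ?_) (isClosed_tsupport θ)
  by_contra h
  exact hx (by
    have : θ =ᶠ[𝓝 x] fun _ => 0 := notMem_tsupport_iff_eventuallyEq.1 h
    rw [dd_congr this]; simp)

theorem dd (h : IsTest V θ) : IsTest V (dd c j θ) :=
  ⟨contDiff_dd h.smooth, h.comp.of_isClosed_subset (isClosed_tsupport _) support_dd,
    support_dd.trans h.supp⟩

theorem continuous (h : IsTest V θ) : Continuous θ := h.smooth.continuous

theorem integrable (h : IsTest V θ) : Integrable θ :=
  h.continuous.integrable_of_hasCompactSupport h.comp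

theorem mono {V' : Set (Cn n)} (h : IsTest V θ) (hV : V ⊆ V') : IsTest V' θ :=
  ⟨h.smooth, h.comp, h.supp.trans hV⟩

theorem eq_zero (h : IsTest V θ) (hx : x ∉ V) : θ x = 0 :=
  image_eq_zero_of_notMem_tsupport fun h' => hx (h.supp h')

theorem integral_dd (h : IsTest V θ) : ∫ x, Berndtsson.dd c j θ x = 0 := by
  have key : ∀ v, ∫ x, fderiv ℝ θ x v = 0 := by
    intro v
    have hc : HasCompactSupport (fun x => fderiv ℝ θ x v) := h.comp.fderiv_apply (𝕜 := ℝ) v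
    have hcont : Continuous (fun x => fderiv ℝ θ x v) :=
      (h.smooth.continuous_fderiv (by simp)).clm_apply continuous_const
    have := integral_mul_fderiv_eq_neg_fderiv_mul_of_integrable (μ := (volume : Measure (Cn n)))
      (f := fun _ => (1 : ℂ)) (g := θ) (v := v) (by simp)
      (by simpa using hcont.integrable_of_hasCompactSupport hc) (by simpa using h.integrable)
      (fun x _ => differentiableAt_const _) (fun x _ => h.diff x)
    simpa using this
  have hi : ∀ v, Integrable (fun x => fderiv ℝ θ x v) := fun v =>
    Continuous.integrable_of_hasCompactSupport
      ((h.smooth.continuous_fderiv (by simp)).clm_apply continuous_const)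
      (h.comp.fderiv_apply (𝕜 := ℝ) v)
  simp only [Berndtsson.dd]
  rw [integral_div, integral_add (hi _) ((hi _).const_mul c), integral_const_mul, key, key]
  simp

/-- Integration by parts against a test function. -/
theorem ibp (h : IsTest V θ) (hV : IsOpen V) (hf : SmoothOn f V) :
    ∫ x, Berndtsson.dd c j θ x * f x = -∫ x, θ x * Berndtsson.dd c j f x := by
  have h0 := (h.mul hV hf).integral_dd (c := c) (j := j)
  have e : ∀ x, Berndtsson.dd c j (fun x => θ x * f x) x =
      Berndtsson.dd c j θ x * f x + θ x * Berndtsson.dd c j f x := by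
    intro x
    by_cases hx : x ∈ V
    · exact dd_mul (h.diff x) ((hf.contDiffAt (hV.mem_nhds hx)).differentiableAt (by simp))
    · rw [h.eq_zero hx, h.dd.eq_zero hx]
      have : (fun x => θ x * f x) =ᶠ[𝓝 x] fun _ => 0 := by
        have : θ =ᶠ[𝓝 x] 0 := notMem_tsupport_iff_eventuallyEq.1 (fun h' => hx (h.supp h'))
        filter_upwards [this] with y hy
        simp [hy]
      rw [dd_congr this]; simp
  simp only [e] at h0
  rw [integral_add (h.dd.mul hV hf).integrable (h.mul hV (contDiffOn_dd hV hf)).integrable] at h0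
  exact eq_neg_of_add_eq_zero_left h0

end IsTest

/-- A radial bump function, not normalised. -/
def mo0 (r : ℝ) (w : Cn n) : ℝ := smoothTransition (1 - ‖w‖ ^ 2 / r ^ 2)

theorem mo0_smooth (r : ℝ) : ContDiff ℝ ∞ (mo0 (n := n) r) :=
  smoothTransition.contDiff.comp
    (contDiff_const.sub ((contDiff_norm_sq ℂ).div_const _))

theorem mo0_zero (hr : 0 < r) {w : Cn n} (h : r ≤ ‖w‖) : mo0 r w = 0 := by
  apply smoothTransition.zero_of_nonpos
  rw [sub_nonpos, one_le_div (by positivity)]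
  gcongr

theorem mo0_compact (hr : 0 < r) : HasCompactSupport (mo0 (n := n) r) := by
  refine HasCompactSupport.intro (isCompact_closedBall 0 r) fun x hx => mo0_zero hr ?_
  simp at hx; exact hx.le

theorem mo0_nonneg (r : ℝ) (w : Cn n) : 0 ≤ mo0 r w := smoothTransition.nonneg _

theorem mo0_le_one (r : ℝ) (w : Cn n) : mo0 r w ≤ 1 := smoothTransition.le_one _

theorem mo0_integrable (hr : 0 < r) : Integrable (mo0 (n := n) r) :=
  (mo0_smooth r).continuous.integrable_of_hasCompactSupport (mo0_compact hr)

theorem mo0_integral_pos (hr : 0 < r) : 0 < ∫ w, mo0 (n := n) r w := by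
  rw [integral_pos_iff_support_of_nonneg (mo0_nonneg r) (mo0_integrable hr)]
  refine lt_of_lt_of_le (measure_ball_pos volume (0 : Cn n) hr) (measure_mono fun x hx => ?_)
  have hx : ‖x‖ < r := by simpa using hx
  have : 0 < 1 - ‖x‖ ^ 2 / r ^ 2 := by
    rw [sub_pos, div_lt_one (by positivity)]
    gcongr
  exact (smoothTransition.pos_of_pos this).ne'

theorem mo0_integral (hr : 0 < r) : ∫ w, mo0 (n := n) r w =
    r ^ (Module.finrank ℝ (Cn n)) * ∫ w, mo0 (n := n) 1 w := by
  have := Measure.integral_comp_inv_smul_of_nonneg (volume : Measure (Cn n))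
    (fun w => mo0 (n := n) 1 w) hr.le
  rw [smul_eq_mul] at this
  rw [← this]
  congr 1; funext w
  simp [mo0, norm_smul, mul_pow, abs_of_pos hr, div_eq_mul_inv, mul_comm]

/-- The normalised radial bump function. -/
def mo (r : ℝ) (w : Cn n) : ℝ := mo0 r w / ∫ x, mo0 (n := n) r x

theorem mo_nonneg (r : ℝ) (w : Cn n) : 0 ≤ mo r w :=
  div_nonneg (mo0_nonneg r w) (integral_nonneg fun _ => mo0_nonneg _ _)

theorem mo_zero (hr : 0 < r) {w : Cn n} (h : r ≤ ‖w‖) : mo r w = 0 := by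
  simp [mo, mo0_zero hr h]

theorem mo_smooth (r : ℝ) : ContDiff ℝ ∞ (mo (n := n) r) := (mo0_smooth r).div_const _

theorem mo_compact (hr : 0 < r) : HasCompactSupport (mo (n := n) r) := by
  refine HasCompactSupport.intro (isCompact_closedBall 0 r) fun x hx => mo_zero hr ?_
  simp at hx; exact hx.le

theorem mo_integral (hr : 0 < r) : ∫ w, mo (n := n) r w = 1 := by
  simp only [mo]
  rw [integral_div, div_self (mo0_integral_pos hr).ne']

theorem mo_norm_eq {w w' : Cn n} (h : ‖w‖ = ‖w'‖) : mo r w = mo r w' := by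
  simp [mo, mo0, h]

/-- The complex valued mollifier. -/
def moC (r : ℝ) (w : Cn n) : ℂ := (mo r w : ℂ)

theorem moC_smooth (r : ℝ) : ContDiff ℝ ∞ (moC (n := n) r) :=
  ofRealCLM.contDiff.comp (mo_smooth r)

theorem moC_compact (hr : 0 < r) : HasCompactSupport (moC (n := n) r) :=
  (mo_compact hr).comp_left (g := fun x : ℝ => (x : ℂ)) rfl

theorem moC_zero (hr : 0 < r) {w : Cn n} (h : r ≤ ‖w‖) : moC r w = 0 := by
  simp [moC, mo_zero hr h]

theorem moC_support (hr : 0 < r) : Function.support (moC (n := n) r) ⊆ ball 0 r := by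
  intro x hx
  by_contra h
  exact hx (moC_zero hr (by simpa using h))

theorem moC_tsupport (hr : 0 < r) : tsupport (moC (n := n) r) ⊆ closedBall 0 r :=
  closure_minimal ((moC_support hr).trans ball_subset_closedBall) isClosed_closedBall

theorem moC_integral (hr : 0 < r) : ∫ w, moC (n := n) r w = 1 := by
  simp only [moC]
  rw [integral_complex_ofReal, mo_integral hr, ofReal_one]

theorem moC_integrable (hr : 0 < r) : Integrable (moC (n := n) r) :=
  (moC_smooth r).continuous.integrable_of_hasCompactSupport (moC_compact hr)

/-- Multiplication by `e^{iθ}` as a real linear isometry. -/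
def rotE (θ : ℝ) : Cn n ≃ₗᵢ[ℝ] Cn n where
  toLinearEquiv :=
    { toFun := fun v => exp (θ * I) • v
      invFun := fun v => exp (-(θ * I)) • v
      map_add' := by intro a b; simp
      map_smul' := fun a b => smul_comm _ _ _
      left_inv := by intro v; simp [smul_smul, ← Complex.exp_add]
      right_inv := by intro v; simp [smul_smul, ← Complex.exp_add] }
  norm_map' := by intro v; simp [norm_smul]

@[simp] theorem rotE_apply (θ : ℝ) (v : Cn n) : rotE θ v = exp (θ * I) • v := by
  simp [rotE]

theorem continuous_moC_mul (hr : 0 < r) (hU : IsOpen U)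
    (hzU : closedBall z r ⊆ U) (hf : ContinuousOn f U) :
    Continuous fun w => moC r w * f (z - w) := by
  rw [continuous_iff_continuousAt]
  intro w
  by_cases hw : w ∈ tsupport (moC (n := n) r)
  · have hw' := moC_tsupport hr hw
    have : z - w ∈ U := hzU (by simpa [dist_eq_norm] using hw')
    exact (moC_smooth r).continuous.continuousAt.mul
      (ContinuousAt.comp (f := fun w => z - w) (hf.continuousAt (hU.mem_nhds this)) (by fun_prop))
  · have : (fun w => moC r w * f (z - w)) =ᶠ[𝓝 w] fun _ => 0 := by
      filter_upwards [notMem_tsupport_iff_eventuallyEq.1 hw] with y hy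
      simp [hy]
    exact continuousAt_const.congr this.symm

/-- The mean value property of holomorphic functions with respect to the radial mollifier. -/
theorem mean_value (hr : 0 < r) (hU : IsOpen U)
    (hzU : closedBall z r ⊆ U) (hf : HolOn f U) :
    ∫ w, moC r w * f (z - w) = f z := by
  set h : Fn n := fun w => moC r w * f (z - w) with hh
  have hc : Continuous h := continuous_moC_mul hr hU hzU hf.continuousOn
  have hz : ∀ w, r ≤ ‖w‖ → h w = 0 := fun w hw => by simp [hh, moC_zero hr hw]
  have hrot : ∀ θ : ℝ, ∫ w, h (rotE θ w) = ∫ w, h w := fun θ =>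
    (measurePreserving_linearIsometryEquiv (rotE θ)).integral_comp
      (rotE θ).toHomeomorph.measurableEmbedding h
  have hpi : 0 ≤ 2 * Real.pi := by positivity
  have hcirc : ∀ w, ∫ θ in (0:ℝ)..2 * Real.pi, h (rotE θ w) = moC r w * (2 * Real.pi * f z) := by
    intro w
    have e : ∀ θ : ℝ, h (rotE θ w) = moC r w * f (z - rotE θ w) := by
      intro θ
      simp only [hh, moC]
      rw [mo_norm_eq ((rotE θ).norm_map w)]
    simp only [e]
    rw [intervalIntegral.integral_const_mul]
    by_cases hw : r ≤ ‖w‖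
    · simp [moC_zero hr hw]
    congr 1
    push Not at hw
    have hd : ∀ l ∈ closedBall (0 : ℂ) 1, z - l • w ∈ U := by
      intro l hl
      apply hzU
      simp only [mem_closedBall, dist_eq_norm, sub_sub_cancel_left, norm_neg, norm_smul, sub_zero] at hl ⊢
      nlinarith [norm_nonneg w, norm_nonneg l]
    have hD : ∀ l ∈ closedBall (0 : ℂ) 1, DifferentiableAt ℂ (fun l : ℂ => f (z - l • w)) l := by
      intro l hl
      refine DifferentiableAt.comp (f := fun l : ℂ => z - l • w) l
        (hf.differentiableAt (hU.mem_nhds (hd l hl))) ?_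
      fun_prop
    have key := circleAverage_of_differentiable_on_off_countable (c := (0:ℂ)) (R := 1)
      (f := fun l : ℂ => f (z - l • w)) (s := ∅) countable_empty
      (fun l hl => (hD l (by simpa using hl)).continuousAt.continuousWithinAt)
      (fun l hl => hD l (ball_subset_closedBall (by simpa using hl)))
    rw [Real.circleAverage_def] at key
    simp only [circleMap, zero_add, ofReal_one, one_mul, zero_smul, sub_zero] at key
    simp only [rotE_apply]
    rw [← key, Complex.real_smul]
    have : (Real.pi : ℂ) ≠ 0 := by exact_mod_cast Real.pi_ne_zero
    generalize (∫ θ in (0:ℝ)..2 * Real.pi, f (z - exp (θ * I) • w)) = J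
    push_cast
    field_simp
  have hint : Integrable (fun p : ℝ × Cn n => h (rotE p.1 p.2))
      ((volume.restrict (Ioc 0 (2 * Real.pi))).prod volume) := by
    have hcont : Continuous (fun p : ℝ × Cn n => h (rotE p.1 p.2)) := by
      simp only [rotE_apply]
      exact hc.comp (by fun_prop)
    have hK : IsCompact (Icc (0:ℝ) (2 * Real.pi) ×ˢ closedBall (0 : Cn n) r) :=
      isCompact_Icc.prod (isCompact_closedBall _ _)
    have h1 : IntegrableOn (fun p : ℝ × Cn n => h (rotE p.1 p.2))
      (Icc (0:ℝ) (2 * Real.pi) ×ˢ closedBall (0 : Cn n) r) (volume.prod volume) :=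
      hcont.continuousOn.integrableOn_compact hK
    have h2 : IntegrableOn (fun p : ℝ × Cn n => h (rotE p.1 p.2))
      (Ioc (0:ℝ) (2 * Real.pi) ×ˢ univ) (volume.prod volume) := by
      refine (h1.of_forall_sdiff_eq_zero (measurableSet_Ioc.prod MeasurableSet.univ) ?_)
      rintro ⟨a, b⟩ ⟨⟨h3, -⟩, h4⟩
      apply hz
      simp only [mem_prod, Ioc_subset_Icc_self h3, true_and, mem_closedBall_zero_iff, not_le] at h4
      simpa [norm_smul] using h4.le
    rw [IntegrableOn, ← Measure.prod_restrict, Measure.restrict_univ] at h2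
    exact h2
  have hsw : ∫ θ in Ioc (0:ℝ) (2 * Real.pi), ∫ w, h (rotE θ w) =
      ∫ w, ∫ θ in Ioc (0:ℝ) (2 * Real.pi), h (rotE θ w) :=
    integral_integral_swap hint
  simp only [hrot, ← intervalIntegral.integral_of_le hpi, hcirc] at hsw
  rw [intervalIntegral.integral_const, integral_mul_const, moC_integral hr, one_mul,
    Complex.real_smul] at hsw
  have : (Real.pi : ℂ) ≠ 0 := by exact_mod_cast Real.pi_ne_zero
  push_cast at hsw
  simp only [sub_zero] at hsw
  exact mul_left_cancel₀ (by simp [this]) hsw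

theorem eLpNorm_two_sq {α E : Type*} [MeasurableSpace α] [NormedAddCommGroup E] (μ : Measure α)
    (f : α → E) : eLpNorm f 2 μ ^ 2 = ∫⁻ x, ‖f x‖ₑ ^ 2 ∂μ := by
  rw [eLpNorm_eq_lintegral_rpow_enorm_toReal (by simp) (by simp)]
  simp only [ENNReal.toReal_ofNat, ENNReal.rpow_ofNat]
  rw [← ENNReal.rpow_natCast, ← ENNReal.rpow_mul]
  simp

theorem memLp_two_iff {α E : Type*} [MeasurableSpace α] [NormedAddCommGroup E] {μ : Measure α}
    {f : α → E} (hf : AESM f μ) :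
    MemLp f 2 μ ↔ ∫⁻ x, ‖f x‖ₑ ^ 2 ∂μ < ⊤ := by
  rw [← eLpNorm_two_sq]
  simp [MemLp, hf]

/-- Cauchy--Schwarz for a probability measure. -/
theorem enorm_integral_sq_le {α : Type*} [MeasurableSpace α] (ν : Measure α)
    [IsProbabilityMeasure ν] {f : α → ℂ} (hf : AESM f ν) :
    ‖∫ x, f x ∂ν‖ₑ ^ 2 ≤ ∫⁻ x, ‖f x‖ₑ ^ 2 ∂ν := by
  rw [← eLpNorm_two_sq]
  gcongr
  calc ‖∫ x, f x ∂ν‖ₑ ≤ ∫⁻ x, ‖f x‖ₑ ∂ν := enorm_integral_le_lintegral_enorm _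
    _ = eLpNorm f 1 ν := eLpNorm_one_eq_lintegral_enorm.symm
    _ ≤ _ := eLpNorm_le_eLpNorm_of_exponent_le (by norm_num) hf

/-- The probability measure with density `mo r`. -/
def moM (n : ℕ) (r : ℝ) : Measure (Cn n) := volume.withDensity fun w => ofR (mo r w)

theorem moM_prob (hr : 0 < r) : IsProbabilityMeasure (moM n r) := by
  refine ⟨?_⟩
  rw [moM, withDensity_apply _ MeasurableSet.univ, setLIntegral_univ,
    ← ofReal_integral_eq_lintegral_ofReal, mo_integral hr, ENNReal.ofReal_one]
  · exact (mo_smooth r).continuous.integrable_of_hasCompactSupport (mo_compact hr)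
  · exact .of_forall (mo_nonneg r)

theorem moM_integral (f : Fn n) : ∫ w, f w ∂(moM n r) = ∫ w, moC r w * f w := by
  rw [moM, integral_withDensity_eq_integral_toReal_smul]
  · congr 1; funext w
    rw [ENNReal.toReal_ofReal (mo_nonneg r w)]; simp [moC]
  · exact (mo_smooth r).continuous.measurable.ennreal_ofReal
  · exact .of_forall fun x => ofReal_lt_top

theorem moM_lintegral {f : Cn n → ℝ≥0∞} (hf : Measurable f) :
    ∫⁻ w, f w ∂(moM n r) = ∫⁻ w, ofR (mo r w) * f w := by
  rw [moM, lintegral_withDensity_eq_lintegral_mul _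
    (mo_smooth r).continuous.measurable.ennreal_ofReal hf]
  rfl

theorem moC_jensen (hr : 0 < r) (hf : Measurable f) :
    ‖∫ w, moC r w * f w‖ₑ ^ 2 ≤ ∫⁻ w, ofR (mo r w) * ‖f w‖ₑ ^ 2 := by
  have := moM_prob (n := n) hr
  rw [← moM_integral, ← moM_lintegral (hf.enorm.pow_const 2)]
  exact enorm_integral_sq_le _ hf.aestronglyMeasurable

/-- Mollification. -/
def moll (r : ℝ) (F : Fn n) (x : Cn n) : ℂ := ∫ w, moC r w * F (x - w)

theorem moll_swap (x : Cn n) : moll r F x = ∫ y, moC r (x - y) * F y := by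
  rw [moll, ← integral_sub_left_eq_self (fun y => moC r (x - y) * F y) volume x]
  simp

theorem moll_eq_conv : moll r F = convolution (moC r) F (ContinuousLinearMap.mul ℝ ℂ) volume := rfl

theorem moll_smooth (hr : 0 < r) (hF : LocallyIntegrable F) : ContDiff ℝ ∞ (moll r F) :=
  (moC_compact hr).contDiff_convolution_left (n := ⊤) (ContinuousLinearMap.mul ℝ ℂ)
    (moC_smooth r) hF

theorem measurable_sub_left_comp (hF : Measurable F) (x : Cn n) : Measurable fun w => F (x - w) :=
  hF.comp (measurable_const.sub measurable_id)

theorem tendsto_translation (hF2 : MemLp F 2) :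
    Tendsto (fun w : Cn n => ∫⁻ x, ‖F (x - w) - F x‖ₑ ^ 2) (𝓝 0) (𝓝 0) := by
  let g : Cn n → C(Cn n, Cn n) := fun w => ⟨fun x => x - w, by fun_prop⟩
  have hgc : Continuous g := by
    apply ContinuousMap.continuous_of_continuous_uncurry
    exact (continuous_snd.sub continuous_fst)
  have hgm : ∀ w, MeasurePreserving (g w) (volume : Measure (Cn n)) volume := fun w =>
    measurePreserving_sub_right volume w
  have hc : Continuous fun w => Lp.compMeasurePreserving (g w) (hgm w) hF2.toLp :=
    continuous_const.compMeasurePreservingLp hgc hgm (by simp)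
  have h0 : Lp.compMeasurePreserving (g 0) (hgm 0) hF2.toLp = hF2.toLp := by
    apply Lp.ext
    filter_upwards [Lp.coeFn_compMeasurePreserving hF2.toLp (hgm 0)] with x hx
    rw [hx]; simp [g]
  have ht := (hc.tendsto 0).sub_const hF2.toLp
  rw [h0, sub_self] at ht
  have ht2 := ht.enorm
  rw [enorm_zero] at ht2
  have ht3 := ENNReal.Tendsto.pow (n := 2) ht2
  simp only [ne_eq, OfNat.ofNat_ne_zero, not_false_eq_true, zero_pow] at ht3
  refine ht3.congr fun w => ?_
  rw [Lp.enorm_def, eLpNorm_two_sq]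
  refine lintegral_congr_ae ?_
  have h1 : hF2.toLp ∘ g w =ᵐ[volume] F ∘ g w :=
    (hgm w).quasiMeasurePreserving.ae_eq_comp hF2.coeFn_toLp
  filter_upwards [Lp.coeFn_sub (Lp.compMeasurePreserving (g w) (hgm w) hF2.toLp) hF2.toLp,
    Lp.coeFn_compMeasurePreserving hF2.toLp (hgm w), hF2.coeFn_toLp, h1] with x h2 h3 h4 h5
  rw [h2, Pi.sub_apply, h3, h4, h5]
  rfl

theorem lintegral_moll_sub_le (hr : 0 < r) (hF : Measurable F) (hF2 : LocallyIntegrable F)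
    {ε : ℝ≥0∞} (h : ∀ w : Cn n, ‖w‖ < r → ∫⁻ x, ‖F (x - w) - F x‖ₑ ^ 2 ≤ ε) :
    ∫⁻ x, ‖moll r F x - F x‖ₑ ^ 2 ≤ ε := by
  have e : ∀ x, moll r F x - F x = ∫ w, moC r w * (F (x - w) - F x) := by
    intro x
    have hi : Integrable fun w => moC r w * F (x - w) :=
      (moC_compact hr).convolutionExists_left (ContinuousLinearMap.mul ℝ ℂ)
        (moC_smooth r).continuous hF2 x
    simp only [mul_sub]
    rw [integral_sub hi ((moC_integrable hr).mul_const _), integral_mul_const, moC_integral hr,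
      one_mul, moll]
  have hm : Measurable fun p : Cn n × Cn n => ofR (mo r p.2) * ‖F (p.1 - p.2) - F p.1‖ₑ ^ 2 := by
    have h1 : Measurable fun p : Cn n × Cn n => F (p.1 - p.2) :=
      hF.comp (measurable_fst.sub measurable_snd)
    have h2 : Measurable fun p : Cn n × Cn n => mo r p.2 :=
      (mo_smooth r).continuous.measurable.comp measurable_snd
    exact h2.ennreal_ofReal.mul ((h1.sub (hF.comp measurable_fst)).enorm.pow_const 2)
  have := moM_prob (n := n) hr
  calc ∫⁻ x, ‖moll r F x - F x‖ₑ ^ 2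
      ≤ ∫⁻ x, ∫⁻ w, ofR (mo r w) * ‖F (x - w) - F x‖ₑ ^ 2 := by
        refine lintegral_mono fun x => ?_
        rw [e]
        exact moC_jensen hr ((measurable_sub_left_comp hF x).sub measurable_const)
    _ = ∫⁻ w, ∫⁻ x, ofR (mo r w) * ‖F (x - w) - F x‖ₑ ^ 2 :=
        lintegral_lintegral_swap hm.aemeasurable
    _ ≤ ∫⁻ w, ofR (mo (n := n) r w) * ε := by
        refine lintegral_mono fun w => ?_
        rw [lintegral_const_mul' _ _ ofReal_ne_top]
        by_cases hw : r ≤ ‖w‖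
        · simp [mo_zero hr hw]
        · gcongr; exact h w (not_le.1 hw)
    _ = ε := by
        rw [← moM_lintegral measurable_const]; simp

/-- Mollifications converge in `L²`. -/
theorem tendsto_moll (hF : Measurable F) (hF2 : MemLp F 2) :
    Tendsto (fun r => ∫⁻ x, ‖moll r F x - F x‖ₑ ^ 2) (𝓝[>] 0) (𝓝 0) := by
  rw [ENNReal.tendsto_nhds_zero]
  intro ε hε
  have h := (ENNReal.tendsto_nhds_zero.1 (tendsto_translation hF2)) ε hε
  obtain ⟨δ, hδ, hδ'⟩ := Metric.eventually_nhds_iff.1 h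
  filter_upwards [Ioo_mem_nhdsGT hδ] with r hr
  refine lintegral_moll_sub_le hr.1 hF (hF2.locallyIntegrable (by norm_num)) fun w hw => hδ' ?_
  rw [dist_zero_right]; exact hw.trans hr.2

theorem isTest_moC_sub (hr : 0 < r) (x : Cn n) :
    IsTest univ (fun y => moC r (x - y)) := by
  refine ⟨(moC_smooth r).comp (contDiff_const.sub contDiff_id), ?_, subset_univ _⟩
  exact (moC_compact hr).comp_homeomorph (Homeomorph.subLeft x)

theorem tsupport_moC_sub (hr : 0 < r) (x : Cn n) :
    tsupport (fun y => moC r (x - y)) ⊆ closedBall x r := by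
  refine closure_minimal (fun y hy => ?_) isClosed_closedBall
  have := moC_support hr hy
  rw [mem_ball_zero_iff] at this
  rw [mem_closedBall, dist_comm, dist_eq_norm]; exact this.le

theorem isTest_moC_sub' (hr : 0 < r) (h : closedBall x r ⊆ U) :
    IsTest U (fun y => moC r (x - y)) :=
  ⟨(isTest_moC_sub hr x).smooth, (isTest_moC_sub hr x).comp, (tsupport_moC_sub hr x).trans h⟩

/-- Derivatives of a mollification fall on the mollifier. -/
theorem dd_moll (hr : 0 < r) (hF : LocallyIntegrable F) (x : Cn n) :
    dd c j (moll r F) x = -∫ y, F y * dd c j (fun y => moC r (x - y)) y := by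
  have hd := (moC_compact hr).hasFDerivAt_convolution_left (ContinuousLinearMap.mul ℝ ℂ)
    ((moC_smooth (n := n) r).of_le (by simp)) hF x
  rw [convolution_eq_swap] at hd
  have hi : Integrable fun y => ((ContinuousLinearMap.mul ℝ ℂ).precompL (Cn n))
      (fderiv ℝ (moC r) (x - y)) (F y) :=
    (((moC_compact hr).fderiv (𝕜 := ℝ)).convolutionExists_left _
      ((moC_smooth r).continuous_fderiv (by simp)) hF x).integrable_swap
  have e : ∀ v, fderiv ℝ (moll r F) x v = ∫ y, F y * fderiv ℝ (moC r) (x - y) v := by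
    intro v
    rw [moll_eq_conv, hd.fderiv, ContinuousLinearMap.integral_apply hi]
    congr 1; funext y
    rw [ContinuousLinearMap.precompL_apply, ContinuousLinearMap.mul_apply', mul_comm]
  have e2 : ∀ y v, fderiv ℝ (fun y => moC r (x - y)) y v = -fderiv ℝ (moC r) (x - y) v := by
    intro y v
    have h1 : HasFDerivAt (fun y : Cn n => x - y) (-ContinuousLinearMap.id ℝ (Cn n)) y :=
      (hasFDerivAt_id y).const_sub x
    have h2 : HasFDerivAt (moC r) (fderiv ℝ (moC r) (x - y)) (x - y) :=
      ((moC_smooth r).differentiable (by simp) _).hasFDerivAt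
    rw [show fderiv ℝ (fun y => moC r (x - y)) y = _ from (h2.comp y h1).fderiv]; simp
  have hi' : ∀ v, Integrable fun y => F y * fderiv ℝ (moC r) (x - y) v := by
    intro v
    have := hi.apply_continuousLinearMap v
    refine this.congr (.of_forall fun y => ?_)
    simp only
    rw [ContinuousLinearMap.precompL_apply, ContinuousLinearMap.mul_apply', mul_comm]
  simp only [dd, e, e2]
  rw [← integral_neg, ← integral_const_mul, ← integral_add (hi' _) ((hi' _).const_mul c),
    ← integral_div]
  congr 1; funext y; ring

theorem sum_smul_eb (v : Cn n) : v = ∑ j, v j • eb j := by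
  ext k
  simp [eb, Pi.single_apply]

theorem clm_sum_eb {E : Type*} [NormedAddCommGroup E] [NormedSpace ℂ E] (L : Cn n →L[ℂ] E)
    (v : Cn n) : L v = ∑ j, v j • L (eb j) := by
  conv_lhs => rw [sum_smul_eb v]
  simp

/-- The Cauchy--Riemann equations imply complex differentiability. -/
theorem differentiableAt_complex (hf : DifferentiableAt ℝ f x) (h : ∀ j, dzb j f x = 0) :
    DifferentiableAt ℂ f x := by
  set L := fderiv ℝ f x with hL
  have h1 : ∀ j, L (I • eb j) = I * L (eb j) := by
    intro j
    have := h j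
    simp only [dd, ← hL, div_eq_zero_iff, OfNat.ofNat_ne_zero, or_false] at this
    have h2 : I * (L (eb j) + I * L (I • eb j)) = 0 := by rw [this, mul_zero]
    rw [mul_add, ← mul_assoc, I_mul_I] at h2
    linear_combination -h2
  have h2 : ∀ (c : ℂ) (j : Fin n), L (c • eb j) = c * L (eb j) := by
    intro c j
    have e : c • eb j = c.re • eb j + c.im • (I • eb (n := n) j) := by
      conv_lhs => rw [← re_add_im c]
      rw [add_smul, mul_smul]; rfl
    rw [e, map_add, map_smul, map_smul, h1]
    conv_rhs => rw [← re_add_im c]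
    simp only [real_smul]; ring
  have h3 : ∀ (c : ℂ) (v : Cn n), L (c • v) = c * L v := by
    intro c v
    conv_lhs => rw [sum_smul_eb v]
    conv_rhs => rw [sum_smul_eb v]
    rw [Finset.smul_sum, map_sum, map_sum, mul_sum]
    refine sum_congr rfl fun k _ => ?_
    rw [smul_smul, h2, h2, mul_assoc]
  let L' : Cn n →L[ℂ] ℂ := ⟨⟨⟨L, L.map_add⟩, h3⟩, L.continuous⟩
  exact (hasFDerivAt_of_restrictScalars ℝ (f' := L') hf.hasFDerivAt (by ext; rfl)).differentiableAt

theorem locallyIntegrable_indicator_ball (hf : ContinuousOn f U)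
    (hz : closedBall z r ⊆ U) : Integrable (indicator (ball z r) f) :=
  (integrable_indicator_iff measurableSet_ball).2
    (((hf.mono hz).integrableOn_compact (isCompact_closedBall z r)).mono_set ball_subset_closedBall)

theorem moll_indicator (hr : 0 < r) (h : ball x r ⊆ ball z R) :
    moll r (indicator (ball z R) F) x = moll r F x := by
  rw [moll_swap, moll_swap]
  congr 1; funext y
  by_cases hy : y ∈ ball z R
  · rw [indicator_of_mem hy]
  · rw [moC_zero hr, zero_mul, zero_mul]
    by_contra hlt
    exact hy (h (by rw [mem_ball, dist_comm, dist_eq_norm]; exact not_le.1 hlt))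

/-- Holomorphic functions are smooth. -/
theorem hol_smooth (hU : IsOpen U) (hf : HolOn f U) : SmoothOn f U := by
  intro x hx
  obtain ⟨R, hR, hxR⟩ := Metric.nhds_basis_closedBall.mem_iff.1 (hU.mem_nhds hx)
  have hi := locallyIntegrable_indicator_ball hf.continuousOn hxR
  have hs := moll_smooth (r := R / 2) (by positivity) hi.locallyIntegrable
  refine (hs.contDiffAt.congr_of_eventuallyEq ?_).contDiffWithinAt
  filter_upwards [ball_mem_nhds x (half_pos hR)] with y hy
  have h1 : ball y (R / 2) ⊆ ball x R := ball_subset_ball' (by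
    rw [mem_ball] at hy; linarith)
  have h2 : closedBall y (R / 2) ⊆ closedBall x R := closedBall_subset_closedBall' (by
    rw [mem_ball] at hy; linarith)
  rw [moll_indicator (by positivity) h1]
  exact (mean_value (by positivity) hU (h2.trans hxR) hf).symm

theorem hol_dzb (hU : IsOpen U) (hf : HolOn f U) (hx : x ∈ U) : dzb j f x = 0 :=
  dzb_eq_zero (hf.differentiableAt (hU.mem_nhds hx))

theorem hol_of_dzb (hU : IsOpen U) (hf : SmoothOn f U)
    (h : ∀ j, ∀ x ∈ U, dzb j f x = 0) : HolOn f U := fun x hx =>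
  (differentiableAt_complex ((hf.contDiffAt (hU.mem_nhds hx)).differentiableAt (by simp))
    fun j => h j x hx).differentiableWithinAt

/-- Derivatives of holomorphic functions are holomorphic. -/
theorem hol_dz (hU : IsOpen U) (hf : HolOn f U) : HolOn (dz j f) U := by
  have hs := hol_smooth hU hf
  refine hol_of_dzb hU (contDiffOn_dd hU hs) fun k x hx => ?_
  rw [dzb, dz, dd_comm (hs.contDiffAt (hU.mem_nhds hx))]
  rw [dd_congr (g := fun _ => 0), dd_const]
  filter_upwards [hU.mem_nhds hx] with y hy
  exact hol_dzb hU hf hy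

/-- Pointwise estimate of holomorphic functions by their `L²` norm on a ball. -/
theorem hol_interior (n : ℕ) : ∃ C : ℝ, 0 < C ∧ ∀ (r : ℝ) (U : Set (Cn n)) (f : Fn n) (z : Cn n),
    0 < r → IsOpen U → closedBall z r ⊆ U → HolOn f U →
    ‖f z‖ₑ ^ 2 ≤ ofR (C / r ^ (Module.finrank ℝ (Cn n))) *
      ∫⁻ x in ball z r, ‖f x‖ₑ ^ 2 := by
  have h1 := mo0_integral_pos (n := n) one_pos
  refine ⟨(∫ w, mo0 (n := n) 1 w)⁻¹, by positivity, fun r U f z hr hU hz hf => ?_⟩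
  set g := indicator (ball z r) f with hg
  have hgm : Measurable g := by
    classical
    have : StronglyMeasurable g := by
      have : ContinuousOn f (ball z r) := hf.continuousOn.mono (ball_subset_closedBall.trans hz)
      exact (this.measurable_piecewise (g := 0) continuousOn_const measurableSet_ball).stronglyMeasurable
    exact this.measurable
  have e : f z = ∫ w, moC r w * g (z - w) := by
    rw [← mean_value hr hU hz hf]
    exact (moll_indicator (F := f) hr subset_rfl).symm
  calc ‖f z‖ₑ ^ 2 ≤ ∫⁻ w, ofR (mo r w) * ‖g (z - w)‖ₑ ^ 2 := by
        rw [e]; exact moC_jensen hr (measurable_sub_left_comp hgm z)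
    _ ≤ ∫⁻ w, ofR ((∫ w, mo0 (n := n) 1 w)⁻¹ / r ^ (Module.finrank ℝ (Cn n))) *
          ‖g (z - w)‖ₑ ^ 2 := by
        refine lintegral_mono fun w => ?_
        gcongr
        rw [mo, mo0_integral hr, inv_eq_one_div, div_div, mul_comm]
        gcongr
        exact mo0_le_one _ _
    _ = ofR ((∫ w, mo0 (n := n) 1 w)⁻¹ / r ^ (Module.finrank ℝ (Cn n))) *
          ∫⁻ x, ‖g x‖ₑ ^ 2 := by
        rw [lintegral_const_mul' _ _ ofReal_ne_top]
        congr 1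
        exact lintegral_sub_left_eq_self (fun y => ‖g y‖ₑ ^ 2) z
    _ = _ := by
        congr 1
        rw [← lintegral_indicator measurableSet_ball]
        congr 1; funext x
        rw [hg]
        by_cases hx : x ∈ ball z r <;> simp [hx]

theorem moll_comm {s : ℝ} (hr : 0 < r) (hs : 0 < s) (hF : Integrable F) :
    moll r (moll s F) = moll s (moll r F) := by
  have key : ∀ {a b : ℝ}, 0 < a → 0 < b → ∀ x, moll a (moll b F) x =
      ∫ w, ∫ v, moC a w * moC b v * F (x - w - v) := by
    intro a b ha hb x
    simp only [moll]
    congr 1; funext w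
    rw [← integral_const_mul]
    simp only [mul_assoc]
  funext x
  rw [key hr hs, key hs hr, integral_integral_swap]
  · congr 1; funext v; congr 1; funext w
    rw [sub_right_comm]; ring
  · have h1 : Integrable fun p : Cn n × Cn n => moC r p.1 * moC s p.2 :=
      (moC_integrable hr).mul_prod (moC_integrable hs)
    have h2 : Integrable (fun p : Cn n × Cn n => moC r p.1 * F p.2) (volume.prod volume) :=
      (moC_integrable hr).mul_prod hF
    have mp : MeasurePreserving (fun p : Cn n × Cn n => (p.1, x - p.1 - p.2))
        (volume.prod volume) (volume.prod volume) := by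
      refine MeasurePreserving.skew_product (g := fun a b => x - a - b) (MeasurePreserving.id volume) ?_ ?_
      · fun_prop
      · filter_upwards with a
        have := (measurePreserving_add_left volume (x - a)).comp
          (Measure.measurePreserving_neg (volume : Measure (Cn n)))
        simpa [Function.comp_def, sub_eq_add_neg] using this.map_eq
    have h3 := mp.integrable_comp_of_integrable h2
    have hb : ∃ C, ∀ w, ‖moC (n := n) s w‖ ≤ C :=
      (moC_compact hs).exists_bound_of_continuous (moC_smooth s).continuous
    obtain ⟨C, hC⟩ := hb
    have h4 : Integrable (fun p : Cn n × Cn n => moC s p.2 * (moC r p.1 * F (x - p.1 - p.2)))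
        (volume.prod volume) :=
      h3.bdd_mul (c := C) ((moC_smooth s).continuous.comp continuous_snd).aestronglyMeasurable
        (.of_forall fun p => hC _)
    refine h4.congr (.of_forall fun p => ?_)
    simp only [Function.uncurry]; ring

/-- A function whose weak `∂̄` derivatives vanish. -/
def WeakHol (V : Set (Cn n)) (F : Fn n) : Prop :=
  ∀ θ, IsTest V θ → ∀ k, ∫ x, F x * dzb k θ x = 0

theorem moll_hol (hr : 0 < r) (hF : WeakHol V F) (hi : Integrable (indicator (ball z R) F))
    (hV : ball z R ⊆ V) : HolOn (moll r (indicator (ball z R) F)) (ball z (R - r)) := by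
  refine hol_of_dzb isOpen_ball (moll_smooth hr hi.locallyIntegrable).contDiffOn fun k x hx => ?_
  rw [dzb, dd_moll hr hi.locallyIntegrable, neg_eq_zero]
  have hb : closedBall x r ⊆ ball z R := by
    intro y hy
    rw [mem_closedBall] at hy; rw [mem_ball] at hx ⊢
    linarith [dist_triangle y x z]
  have ht := isTest_moC_sub' hr hb
  rw [← hF _ (ht.mono hV) k]
  congr 1; funext y
  by_cases hy : y ∈ ball z R
  · rw [indicator_of_mem hy]
  · rw [dzb, (ht.dd (c := I) (j := k)).eq_zero hy]; simp

theorem moll_const_radius {s : ℝ} (hr : 0 < r) (hs : 0 < s)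
    (hF : WeakHol V F) (hi : Integrable (indicator (ball z R) F))
    (hV : ball z R ⊆ V) (hx : x ∈ ball z (R - r - s)) :
    moll r (indicator (ball z R) F) x = moll s (indicator (ball z R) F) x := by
  rw [mem_ball] at hx
  have key : ∀ {a b : ℝ}, 0 < a → 0 < b → dist x z < R - a - b →
      moll a (indicator (ball z R) F) x = moll b (moll a (indicator (ball z R) F)) x := by
    intro a b ha hb h
    refine (mean_value hb isOpen_ball ?_ (moll_hol ha hF hi hV)).symm
    intro y hy
    rw [mem_closedBall] at hy; rw [mem_ball]
    linarith [dist_triangle y x z]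
  rw [key hr hs hx, moll_comm hs hr hi, ← key hs hr (by linarith)]

/-- Local form of Weyl's lemma. -/
theorem weyl_local (hR : 0 < R) (hF : WeakHol V F) (hm : Measurable F)
    (hi : ∫⁻ x in ball z R, ‖F x‖ₑ ^ 2 < ⊤) (hV : ball z R ⊆ V) :
    (∀ x ∈ ball z (R / 2), ∀ r ∈ Ioo 0 (R / 4), moll r F x = moll (R / 4) (indicator (ball z R) F) x) ∧
    HolOn (moll (R / 4) (indicator (ball z R) F)) (ball z (R / 2)) ∧
    ∀ᵐ x ∂(volume.restrict (ball z (R / 2))), F x = moll (R / 4) (indicator (ball z R) F) x := by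
  set G := indicator (ball z R) F with hG
  have hGm : Measurable G := hm.indicator measurableSet_ball
  have hGs : ∀ x, ‖G x‖ₑ ^ 2 = indicator (ball z R) (fun x => ‖F x‖ₑ ^ 2) x := by
    intro x
    by_cases hx : x ∈ ball z R <;> simp [hG, hx]
  have hG2 : MemLp G 2 := by
    rw [memLp_two_iff hGm.aestronglyMeasurable]
    simp only [hGs]
    rwa [lintegral_indicator measurableSet_ball]
  have hG1 : Integrable G := by
    have : MemLp G 2 (volume.restrict (ball z R)) := hG2.restrict _
    have h1 : MemLp G 1 (volume.restrict (ball z R)) := by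
      have : IsFiniteMeasure (volume.restrict (ball z R)) := ⟨by simpa using measure_ball_lt_top⟩
      exact (hG2.restrict (ball z R)).mono_exponent (by norm_num)
    rw [memLp_one_iff_integrable] at h1
    have h2 : Integrable (indicator (ball z R) G) := (integrable_indicator_iff measurableSet_ball).2 h1
    rwa [hG, indicator_indicator, inter_self] at h2
  have hc : ∀ x ∈ ball z (R / 2), ∀ r ∈ Ioo 0 (R / 4), moll r G x = moll (R / 4) G x := by
    intro x hx r hr
    refine moll_const_radius hr.1 (by linarith) hF hG1 hV ?_
    rw [mem_ball] at hx ⊢; linarith [hr.2]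
  have hd : HolOn (moll (R / 4) G) (ball z (R / 2)) :=
    (moll_hol (by linarith) hF hG1 hV).mono (ball_subset_ball (by linarith))
  refine ⟨fun x hx r hr => ?_, hd, ?_⟩
  · rw [← hc x hx r hr]
    refine (moll_indicator hr.1 (ball_subset_ball' ?_)).symm
    rw [mem_ball] at hx; linarith [hr.2]
  have ht := tendsto_moll hGm hG2
  have hz : ∫⁻ x in ball z (R / 2), ‖moll (R / 4) G x - G x‖ₑ ^ 2 = 0 := by
    refine le_antisymm (ge_of_tendsto ht ?_) zero_le
    filter_upwards [Ioo_mem_nhdsGT (show 0 < R / 4 by linarith)] with r hr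
    calc ∫⁻ x in ball z (R / 2), ‖moll (R / 4) G x - G x‖ₑ ^ 2
        = ∫⁻ x in ball z (R / 2), ‖moll r G x - G x‖ₑ ^ 2 := by
          refine setLIntegral_congr_fun measurableSet_ball fun x hx => ?_
          simp only [hc x hx r hr]
      _ ≤ _ := setLIntegral_le_lintegral _ _
  have hmm : Measurable fun x => ‖moll (R / 4) G x - G x‖ₑ ^ 2 :=
    ((((moll_smooth (by linarith) hG1.locallyIntegrable).continuous.measurable).sub hGm).enorm.pow_const 2)
  rw [lintegral_eq_zero_iff hmm] at hz
  filter_upwards [hz, ae_restrict_mem measurableSet_ball] with x hx hxb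
  have hx' : moll (R / 4) G x - G x = 0 := by simpa using hx
  rw [sub_eq_zero.1 hx', hG, indicator_of_mem]
  exact ball_subset_ball (by linarith) hxb

/-- Weyl's lemma: locally square integrable weakly holomorphic functions are holomorphic. -/
theorem weyl (hV : IsOpen V) (hF : WeakHol V F) (hm : Measurable F)
    (hi : ∀ K ⊆ V, IsCompact K → ∫⁻ x in K, ‖F x‖ₑ ^ 2 < ⊤) :
    ∃ g, HolOn g V ∧ ∀ᵐ x ∂(volume.restrict V), F x = g x := by
  let g : Fn n := fun x => limUnder (𝓝[>] 0) fun r => moll r F x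
  have key : ∀ z ∈ V, ∃ R > 0, HolOn g (ball z R) ∧
      ∀ᵐ x ∂(volume.restrict (ball z R)), F x = g x := by
    intro z hz
    obtain ⟨R, hR, hzR⟩ := Metric.nhds_basis_closedBall.mem_iff.1 (hV.mem_nhds hz)
    obtain ⟨h1, h2, h3⟩ := weyl_local hR hF hm
      ((lintegral_mono_set ball_subset_closedBall).trans_lt (hi _ hzR (isCompact_closedBall z R)))
      (ball_subset_closedBall.trans hzR)
    have hg : ∀ x ∈ ball z (R / 2), g x = moll (R / 4) (indicator (ball z R) F) x := by
      intro x hx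
      refine Tendsto.limUnder_eq (Tendsto.congr' ?_ tendsto_const_nhds)
      filter_upwards [Ioo_mem_nhdsGT (show 0 < R / 4 by linarith)] with r hr
      exact (h1 x hx r hr).symm
    refine ⟨R / 2, by positivity, h2.congr hg, ?_⟩
    filter_upwards [h3, ae_restrict_mem measurableSet_ball] with x hx hxb
    rw [hx, hg x hxb]
  refine ⟨g, fun z hz => ?_, ?_⟩
  · obtain ⟨R, hR, h, -⟩ := key z hz
    exact (h.differentiableAt (ball_mem_nhds z hR)).differentiableWithinAt
  · rw [ae_restrict_iff' hV.measurableSet]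
    have : ∀ z ∈ V, ∃ u ∈ 𝓝[V] z, volume (u ∩ {x | ¬ F x = g x}) = 0 := by
      intro z hz
      obtain ⟨R, hR, -, h⟩ := key z hz
      refine ⟨ball z R, mem_nhdsWithin_of_mem_nhds (ball_mem_nhds z hR), ?_⟩
      rw [ae_restrict_iff' measurableSet_ball, ae_iff] at h
      refine measure_mono_null (fun x hx => ?_) h
      simpa using hx
    have h0 : volume (V ∩ {x | ¬ F x = g x}) = 0 := by
      refine measure_null_of_locally_null _ fun z hz => ?_
      obtain ⟨u, hu, h⟩ := this z hz.1
      exact ⟨u ∩ (V ∩ {x | ¬ F x = g x}), inter_mem (nhdsWithin_mono _ inter_subset_left hu)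
        self_mem_nhdsWithin, measure_mono_null (by intro x hx; exact ⟨hx.1, hx.2.2⟩) h⟩
    rw [ae_iff]
    refine measure_mono_null (fun x hx => ?_) h0
    simpa using hx

/-- A functional dominated by the norm of a linear map to a Hilbert space is represented there. -/
theorem exists_repr_of_bound {M H : Type*} [AddCommGroup M] [Module ℂ M] [NormedAddCommGroup H]
    [InnerProductSpace ℂ H] [CompleteSpace H] (T : M →ₗ[ℂ] H) (l : M →ₗ[ℂ] ℂ) (hC : 0 ≤ C)
    (h : ∀ m, ‖l m‖ ≤ C * ‖T m‖) : ∃ y : H, ‖y‖ ≤ C ∧ ∀ m, l m = inner ℂ y (T m) := by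
  have hker : LinearMap.ker T ≤ LinearMap.ker l := by
    intro m hm
    rw [LinearMap.mem_ker] at hm ⊢
    have := h m
    rw [hm, norm_zero, mul_zero] at this
    exact norm_le_zero_iff.1 this
  let g : LinearMap.range T →ₗ[ℂ] ℂ :=
    ((LinearMap.ker T).liftQ l hker).comp (T.quotKerEquivRange.symm : _ →ₗ[ℂ] _)
  have hg : ∀ m, g ⟨T m, m, rfl⟩ = l m := by
    intro m
    have : T.quotKerEquivRange.symm ⟨T m, m, rfl⟩ = (LinearMap.ker T).mkQ m := by
      rw [LinearEquiv.symm_apply_eq]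
      ext; simp
    simp only [g, LinearMap.comp_apply, LinearEquiv.coe_coe, this]
    simp
  let G : StrongDual ℂ (LinearMap.range T) := g.mkContinuous C (by
    rintro ⟨_, m, rfl⟩
    rw [hg]; exact h m)
  obtain ⟨E, hE, hEn⟩ := exists_extension_norm_eq (LinearMap.range T) G
  refine ⟨(InnerProductSpace.toDual ℂ H).symm E, ?_, fun m => ?_⟩
  · rw [LinearIsometryEquiv.norm_map, hEn]
    exact LinearMap.mkContinuous_norm_le _ hC _
  · rw [InnerProductSpace.toDual_symm_apply]
    exact (hg m).symm.trans (hE ⟨T m, m, rfl⟩).symm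

/-- The squared weighted `L²` norm on `V`. -/
def NV {E : Type*} [NormedAddCommGroup E] (V : Set (Cn n)) (w : Cn n → ℝ) (f : Cn n → E) : ℝ≥0∞ :=
  ∫⁻ x in V, ‖f x‖ₑ ^ 2 * ofR (w x)

section NV

variable {E : Type*} [NormedAddCommGroup E] {w' : Cn n → ℝ} {f g : Cn n → E}

theorem NV_congr (hV : MeasurableSet V) (h : EqOn f g V) : NV V w f = NV V w g :=
  setLIntegral_congr_fun hV fun x hx => by simp only [h hx]

theorem NV_congr_ae (h : f =ᵐ[volume.restrict V] g) : NV V w f = NV V w g :=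
  lintegral_congr_ae (by filter_upwards [h] with x hx; rw [hx])

/-- Comparison of weighted norms from a pointwise inequality. -/
theorem NV_mono {E' : Type*} [NormedAddCommGroup E'] (hV : MeasurableSet V) {f : Cn n → E}
    {g : Cn n → E'} (hC : 0 ≤ C)
    (h : ∀ x ∈ V, ‖f x‖ ^ 2 * w x ≤ C * (‖g x‖ ^ 2 * w' x)) :
    NV V w f ≤ ofR C * NV V w' g := by
  rw [NV, NV, ← lintegral_const_mul' _ _ ofReal_ne_top]
  refine setLIntegral_mono' hV fun x hx => ?_
  rw [enorm_sq_eq, enorm_sq_eq, ← eofReal_mul (by positivity),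
    ← eofReal_mul (by positivity), ← eofReal_mul hC]
  exact ofReal_le_ofReal (h x hx)

theorem NV_add_le (hV : MeasurableSet V) (hw : ∀ x ∈ V, 0 ≤ w x)
    (hf : AESM f (volume.restrict V)) (hwm : AEMeasurable w (volume.restrict V)) :
    NV V w (fun x => f x + g x) ≤ 2 * NV V w f + 2 * NV V w g := by
  have h2 : (2 : ℝ≥0∞) ≠ ⊤ := by simp
  rw [NV, NV, NV, ← lintegral_const_mul' _ _ h2, ← lintegral_const_mul' _ _ h2, ← lintegral_add_left']
  · refine setLIntegral_mono' hV fun x hx => ?_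
    have hw := hw x hx
    have key : ‖f x + g x‖ ^ 2 * w x ≤ 2 * (‖f x‖ ^ 2 * w x) + 2 * (‖g x‖ ^ 2 * w x) := by
      have : ‖f x + g x‖ ^ 2 ≤ 2 * ‖f x‖ ^ 2 + 2 * ‖g x‖ ^ 2 := by
        nlinarith [norm_add_le (f x) (g x), sq_nonneg (‖f x‖ - ‖g x‖), norm_nonneg (f x + g x),
          norm_nonneg (f x), norm_nonneg (g x)]
      nlinarith
    have e2 : (2 : ℝ≥0∞) = ofR 2 := by simp
    simp only [enorm_sq_eq]
    rw [e2, ← eofReal_mul (by positivity), ← eofReal_mul (by positivity),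
      ← eofReal_mul (by positivity), ← eofReal_mul (by positivity),
      ← eofReal_mul (by positivity), ← ENNReal.ofReal_add (by positivity) (by positivity)]
    exact ofReal_le_ofReal key
  · exact (((hf.enorm).pow_const 2).mul hwm.ennreal_ofReal).const_mul 2

theorem NV_neg : NV V w (fun x => -f x) = NV V w f := by simp [NV]

end NV

section hilbert2

variable {E : Type*} [NormedAddCommGroup E] [InnerProductSpace ℂ E]
  {f g : Cn n → E}

/-- The measure on which all weighted spaces live. -/
abbrev vol (V : Set (Cn n)) : Measure (Cn n) := volume.restrict V

theorem memLp_sqrt (hV : MeasurableSet V) (hw : ∀ x ∈ V, 0 < w x) (hwm : AEMeasurable w (vol V))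
    (hf : AESM f (vol V)) :
    MemLp (fun x => (√(w x) : ℂ) • f x) 2 (vol V) ↔ NV V w f < ⊤ := by
  rw [memLp_two_iff]
  · have : ∫⁻ x in V, ‖(√(w x) : ℂ) • f x‖ₑ ^ 2 = NV V w f := by
      refine setLIntegral_congr_fun hV fun x hx => ?_
      simp only [enorm_sq_eq]
      rw [← eofReal_mul (by positivity), norm_smul, mul_pow]
      simp [sq_sqrt (hw x hx).le, mul_comm]
    rw [this]
  · exact (hwm.sqrt.complex_ofReal.aestronglyMeasurable).smul hf

theorem NV_eq_enorm (hV : MeasurableSet V) (hw : ∀ x ∈ V, 0 < w x)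
    (h : MemLp (fun x => (√(w x) : ℂ) • f x) 2 (vol V)) :
    NV V w f = ‖h.toLp‖ₑ ^ 2 := by
  rw [Lp.enorm_toLp, eLpNorm_two_sq]
  refine setLIntegral_congr_fun hV fun x hx => ?_
  simp only [enorm_sq_eq]
  rw [← eofReal_mul (by positivity), norm_smul, mul_pow]
  simp [sq_sqrt (hw x hx).le, mul_comm]

theorem inner_toLp (hV : MeasurableSet V) {a b : Cn n → E} (ha : MemLp a 2 (vol V)) (hb : MemLp b 2 (vol V))
    (h : ∀ x ∈ V, inner ℂ (a x) (b x) = u x) :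
    inner ℂ ha.toLp hb.toLp = ∫ x in V, u x := by
  rw [L2.inner_def]
  refine integral_congr_ae ?_
  filter_upwards [ha.coeFn_toLp, hb.coeFn_toLp, ae_restrict_mem hV] with x h1 h2 h3
  rw [h1, h2, h x h3]

theorem inner_sqrt_smul {a b : ℝ} (x y : E) (h : √a * √b = 1) :
    inner ℂ ((√a : ℂ) • x) ((√b : ℂ) • y) = inner ℂ x y := by
  rw [inner_smul_left, inner_smul_right, conj_ofReal, ← mul_assoc, ← ofReal_mul, h]
  simp

variable [CompleteSpace E]

/-- Orthogonal projection in a weighted space onto the annihilator of a family of fields. -/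
theorem exists_proj (hV : MeasurableSet V) (hw : ∀ x ∈ V, 0 < w x) (hwm : AEMeasurable w (vol V))
    (S : Set (Cn n → E)) (hS : ∀ σ ∈ S, AESM σ (vol V))
    (hS' : ∀ σ ∈ S, NV V (fun x => (w x)⁻¹) σ < ⊤) {X : Cn n → E}
    (hX : AESM X (vol V)) (hX' : NV V w X < ⊤) :
    ∃ p : Cn n → E, StronglyMeasurable p ∧ NV V w p ≤ NV V w X ∧
      (∀ σ ∈ S, ∫ x in V, inner ℂ (σ x) (p x) = 0) ∧
      ∀ h : Cn n → E, AESM h (vol V) → NV V w h < ⊤ →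
        (∀ σ ∈ S, ∫ x in V, inner ℂ (σ x) (h x) = 0) →
        ∫ x in V, inner ℂ (h x) (X x - p x) * w x = 0 := by
  have hwi : ∀ x ∈ V, 0 < (w x)⁻¹ := fun x hx => inv_pos.2 (hw x hx)
  have hsq : ∀ x ∈ V, √(w x)⁻¹ * √(w x) = 1 := fun x hx => by
    rw [← Real.sqrt_mul (hwi x hx).le, inv_mul_cancel₀ (hw x hx).ne', Real.sqrt_one]
  have mem := fun (f : Cn n → E) (h1 : AESM f (vol V)) (h2 : NV V w f < ⊤) =>
    (memLp_sqrt hV hw hwm h1).2 h2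
  have memi := fun σ (h : σ ∈ S) => (memLp_sqrt hV hwi hwm.inv (hS σ h)).2 (hS' σ h)
  let A : Set (Lp E 2 (vol V)) := {a | ∃ σ, ∃ h : σ ∈ S, (memi σ h).toLp = a}
  let K : Submodule ℂ (Lp E 2 (vol V)) := (Submodule.span ℂ A)ᗮ
  let X' := (mem X hX hX').toLp
  let p' : Lp E 2 (vol V) := K.starProjection X'
  have hp'K : p' ∈ K := Submodule.starProjection_apply_mem _ _
  have hp'O : X' - p' ∈ Kᗮ := Submodule.sub_starProjection_mem_orthogonal _
  obtain ⟨m0, hm0, hm0'⟩ : ∃ m0 : Cn n → ℝ, Measurable m0 ∧ w =ᵐ[vol V] m0 :=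
    ⟨hwm.mk w, hwm.measurable_mk, hwm.ae_eq_mk⟩
  let p : Cn n → E := fun x => (√((m0 x)⁻¹) : ℂ) • p' x
  have hp : StronglyMeasurable p :=
    (hm0.inv.sqrt.complex_ofReal.stronglyMeasurable).smul (Lp.stronglyMeasurable p')
  have hpp : (fun x => (√(w x) : ℂ) • p x) =ᵐ[vol V] p' := by
    filter_upwards [hm0', ae_restrict_mem hV] with x h1 h2
    simp only [p]
    rw [smul_smul, ← h1, ← ofReal_mul, mul_comm, hsq x h2, ofReal_one, one_smul]
  have hpm : MemLp (fun x => (√(w x) : ℂ) • p x) 2 (vol V) := (Lp.memLp p').ae_eq hpp.symm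
  have hpl : hpm.toLp = p' := by
    rw [Lp.ext_iff]; exact hpm.coeFn_toLp.trans hpp
  refine ⟨p, hp, ?_, fun σ hσ => ?_, fun h h1 h2 h3 => ?_⟩
  · rw [NV_eq_enorm hV hw hpm, NV_eq_enorm hV hw (mem X hX hX'), hpl]
    have h := Submodule.norm_starProjection_apply_le K X'
    gcongr
    rw [← ofReal_norm, ← ofReal_norm]
    exact ofReal_le_ofReal h
  · rw [← inner_toLp hV (memi σ hσ) hpm fun x hx => inner_sqrt_smul _ _ (hsq x hx),
      hpl]
    exact Submodule.inner_right_of_mem_orthogonal (K := Submodule.span ℂ A)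
      (Submodule.subset_span ⟨σ, hσ, rfl⟩) hp'K
  · have hK : (mem h h1 h2).toLp ∈ K := by
      rw [Submodule.mem_orthogonal]
      intro u hu
      induction hu using Submodule.span_induction with
      | mem u hu =>
        obtain ⟨σ, hσ, rfl⟩ := hu
        rw [inner_toLp hV (memi σ hσ) (mem h h1 h2)
          fun x hx => inner_sqrt_smul _ _ (hsq x hx)]
        exact h3 σ hσ
      | zero => simp
      | add a b _ _ ha hb => rw [inner_add_left, ha, hb, add_zero]
      | smul c a _ ha => rw [inner_smul_left, ha, mul_zero]
    have := Submodule.inner_right_of_mem_orthogonal hK hp'O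
    have e : X' - p' = ((mem X hX hX').sub hpm).toLp := by
      rw [MemLp.toLp_sub (mem X hX hX') hpm, hpl]
    rw [e] at this
    rw [← this]
    refine (inner_toLp hV _ _ fun x hx => ?_).symm
    simp only [Pi.sub_apply]
    rw [← smul_sub, inner_smul_left, inner_smul_right, conj_ofReal, ← mul_assoc, ← ofReal_mul,
      Real.mul_self_sqrt (hw x hx).le, mul_comm]

/-- Riesz representation in a weighted space. -/
theorem exists_riesz (hV : MeasurableSet V) (hw : ∀ x ∈ V, 0 < w x) (hwm : AEMeasurable w (vol V))
    (S : Submodule ℂ (Fn n)) (hS : ∀ u ∈ S, AESM u (vol V))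
    (hS' : ∀ u ∈ S, NV V (fun x => (w x)⁻¹) u < ⊤) (hq : ∀ u ∈ S, IntegrableOn (fun x => q x * u x) V) (hR : 0 ≤ R)
    (hb : ∀ u ∈ S, ‖∫ x in V, q x * u x‖ₑ ^ 2 ≤ ofR R * NV V (fun x => (w x)⁻¹) u) :
    ∃ U : Fn n, StronglyMeasurable U ∧ NV V w U ≤ ofR R ∧
      ∀ u ∈ S, ∫ x in V, U x * u x = ∫ x in V, q x * u x := by
  have hwi : ∀ x ∈ V, 0 < (w x)⁻¹ := fun x hx => inv_pos.2 (hw x hx)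
  have hsq : ∀ x ∈ V, √(w x)⁻¹ * √(w x) = 1 := fun x hx => by
    rw [← Real.sqrt_mul (hwi x hx).le, inv_mul_cancel₀ (hw x hx).ne', Real.sqrt_one]
  have memi := fun σ (h : σ ∈ S) => (memLp_sqrt hV hwi hwm.inv (hS σ h)).2 (hS' σ h)
  let T : S →ₗ[ℂ] Lp ℂ 2 (vol V) :=
    { toFun := fun u => (memi u u.2).toLp
      map_add' := fun u v => by
        rw [← MemLp.toLp_add]
        congr 1
        ext x; simp [mul_add]
      map_smul' := fun c u => by
        rw [RingHom.id_apply, ← MemLp.toLp_const_smul]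
        congr 1
        ext x; simp; ring }
  let l : S →ₗ[ℂ] ℂ :=
    { toFun := fun u => ∫ x in V, q x * (u : Fn n) x
      map_add' := fun u v => by
        rw [← integral_add (hq u u.2) (hq v v.2)]
        congr 1; ext x; simp [mul_add]
      map_smul' := fun c u => by
        rw [RingHom.id_apply, smul_eq_mul, ← integral_const_mul]
        congr 1; ext x; simp; ring }
  obtain ⟨y, hy, hyl⟩ := exists_repr_of_bound T l (Real.sqrt_nonneg R) (fun u => by
    have h1 := hb u u.2
    rw [NV_eq_enorm hV hwi (memi u u.2)] at h1
    change ‖l u‖ₑ ^ 2 ≤ _ * ‖T u‖ₑ ^ 2 at h1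
    rw [enorm_sq_eq, enorm_sq_eq, ← eofReal_mul hR,
      ENNReal.ofReal_le_ofReal_iff (by positivity)] at h1
    refine le_of_sq_le_sq ?_ (by positivity)
    rw [mul_pow, sq_sqrt hR]; exact h1)
  obtain ⟨m0, hm0, hm0'⟩ : ∃ m0 : Cn n → ℝ, Measurable m0 ∧ w =ᵐ[vol V] m0 :=
    ⟨hwm.mk w, hwm.measurable_mk, hwm.ae_eq_mk⟩
  let U : Fn n := fun x => (√((m0 x)⁻¹) : ℂ) * conj (y x)
  have hUU : ∀ᵐ x ∂vol V, U x = (√((w x)⁻¹) : ℂ) * conj (y x) := by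
    filter_upwards [hm0'] with x h1
    simp only [U, h1]
  refine ⟨U, ?_, ?_, fun u hu => ?_⟩
  · exact (hm0.inv.sqrt.complex_ofReal.stronglyMeasurable).mul
      (continuous_conj.comp_stronglyMeasurable (Lp.stronglyMeasurable y))
  · have : NV V w U = ‖y‖ₑ ^ 2 := by
      rw [Lp.enorm_def, eLpNorm_two_sq]
      refine lintegral_congr_ae ?_
      filter_upwards [hUU, ae_restrict_mem hV] with x h1 h2
      rw [h1]
      simp only [enorm_sq_eq]
      rw [← eofReal_mul (by positivity), norm_mul, mul_pow]
      congr 1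
      rw [RCLike.norm_conj, norm_real, norm_of_nonneg (Real.sqrt_nonneg _),
        sq_sqrt (hwi x h2).le]
      field_simp [(hw x h2).ne']
    rw [this, enorm_sq_eq]
    refine ofReal_le_ofReal ?_
    calc ‖y‖ ^ 2 ≤ √R ^ 2 := by gcongr
      _ = R := sq_sqrt hR
  · have := hyl ⟨u, hu⟩
    change ∫ x in V, q x * u x = _ at this
    rw [this, L2.inner_def]
    refine integral_congr_ae ?_
    filter_upwards [hUU, (memi u hu).coeFn_toLp] with x h1 h2
    have h2' : (T ⟨u, hu⟩ : Fn n) x = _ := h2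
    rw [h1, h2']
    simp only [smul_eq_mul, RCLike.inner_apply]
    ring

end hilbert2

/-- The weight `e^{-Ψ}` as a complex function. -/
def wt (Ψ : Cn n → ℝ) (x : Cn n) : ℂ := (expR (-Ψ x) : ℂ)

/-- The formal adjoint `δ_k = ∂_k - ∂_kΨ` of `-∂̄_k` with respect to the weight `e^{-Ψ}`. -/
def dl (Ψ : Cn n → ℝ) (k : Fin n) (f : Fn n) (x : Cn n) : ℂ :=
  dz k f x - dz k ♯Ψ x * f x

/-- The Levi form. -/
def levi (Ψ : Cn n → ℝ) (x : Cn n) (β : Fin n → ℂ) : ℝ :=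
  (∑ j, ∑ k, dzb j (dz k ♯Ψ) x * β k * conj (β j)).re

theorem contDiffOn_ofReal (h : SmoothOn Ψ V) : SmoothOn ♯Ψ V :=
  ofRealCLM.contDiff.comp_contDiffOn h

theorem contDiffOn_conj (h : SmoothOn f V) : SmoothOn (fun y => conj (f y)) V :=
  conjCLE.contDiff.comp_contDiffOn h

theorem dzb_ofReal : dzb k ♯Ψ x = conj (dz k ♯Ψ x) := by
  have := dd_conj (f := ♯Ψ) (c := I) (j := k) (x := x)
  simpa using this

theorem contDiffOn_wt (h : SmoothOn Ψ V) : SmoothOn (wt Ψ) V :=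
  contDiffOn_ofReal h.neg.exp

theorem diffAt (hV : IsOpen V) {F : Type*} [NormedAddCommGroup F] [NormedSpace ℝ F] {f : Cn n → F}
    (h : SmoothOn f V) (hx : x ∈ V) : DifferentiableAt ℝ f x :=
  (h.contDiffAt (hV.mem_nhds hx)).differentiableAt (by simp)

theorem dd_wt (hV : IsOpen V) (h : SmoothOn Ψ V) (hx : x ∈ V) :
    dd c j (wt Ψ) x = -dd c j ♯Ψ x * wt Ψ x := by
  have hF : HasDerivAt (fun t => expR (-t)) (-expR (-Ψ x)) (Ψ x) := by
    have := (hasDerivAt_neg (Ψ x)).exp; simpa using this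
  have := dd_comp_real (c := c) (j := j) hF (diffAt hV h hx)
  unfold wt
  rw [this]; push_cast; ring

theorem IsTest.dl (hV : IsOpen V) (h : SmoothOn Ψ V) (hf : IsTest V f) :
    IsTest V (dl Ψ k f) :=
  hf.dd.sub (hf.mul' hV (contDiffOn_dd hV (contDiffOn_ofReal h)))

theorem integral_dzb_mul (hV : IsOpen V) (h : SmoothOn Ψ V) (hf : IsTest V f)
    (hg : SmoothOn g V) :
    ∫ x, dzb k f x * (conj (g x) * wt Ψ x) = -∫ x, f x * (conj (dl Ψ k g x) * wt Ψ x) := by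
  rw [hf.ibp hV ((contDiffOn_conj hg).mul (contDiffOn_wt h))]
  congr 1
  refine integral_congr_all fun x => ?_
  by_cases hx : x ∈ V
  · rw [dd_mul (diffAt hV (contDiffOn_conj hg) hx) (diffAt hV (contDiffOn_wt h) hx),
      dd_wt hV h hx, dd_conj]
    simp only [dl, map_sub, map_mul, conj_I, dz, ← dzb_ofReal]
    ring
  · simp [hf.eq_zero hx]

theorem integral_dl_mul (hV : IsOpen V) (h : SmoothOn Ψ V) (hf : IsTest V f)
    (hg : SmoothOn g V) :
    ∫ x, dl Ψ k f x * (conj (g x) * wt Ψ x) = -∫ x, f x * (conj (dzb k g x) * wt Ψ x) := by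
  have h1 := (hf.mul hV (contDiffOn_wt h)).ibp (c := -I) (j := k) hV (contDiffOn_conj hg)
  calc _ = ∫ x, dz k (fun x => f x * wt Ψ x) x * conj (g x) := by
        refine integral_congr_all fun x => ?_
        by_cases hx : x ∈ V
        · rw [dz, dd_mul (hf.diff x) (diffAt hV (contDiffOn_wt h) hx), dd_wt hV h hx, dl]
          ring
        · rw [(hf.dl hV h).eq_zero hx, show dz k (fun x => f x * wt Ψ x) x = 0 from
            ((hf.mul hV (contDiffOn_wt h)).dd).eq_zero hx]
          simp
    _ = _ := by
        rw [h1]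
        congr 1
        refine integral_congr_all fun x => ?_
        simp only [dd_conj, map_neg, conj_I, neg_neg]
        ring

theorem dzb_dl (hV : IsOpen V) (h : SmoothOn Ψ V) (hf : SmoothOn f V) (hx : x ∈ V) :
    dzb j (dl Ψ k f) x =
      dl Ψ k (dzb j f) x - dzb j (dz k ♯Ψ) x * f x := by
  have hP := contDiffOn_dd (c := -I) (j := k) hV (contDiffOn_ofReal h)
  have e1 : dd I j (fun y => dz k ♯Ψ y * f y) x = _ :=
    dd_mul (diffAt hV hP hx) (diffAt hV hf hx)
  have e2 : dd I j (fun y => dz k f y - dz k ♯Ψ y * f y) x = _ :=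
    dd_sub (diffAt hV (contDiffOn_dd hV hf) hx) ((diffAt hV hP hx).fun_mul (diffAt hV hf hx))
  have e3 : dd I j (dz k f) x = dz k (dzb j f) x := dd_comm (hf.contDiffAt (hV.mem_nhds hx))
  have e4 : dd I j (dl Ψ k f) x = _ := e2
  simp only [dzb] at e1 e3 ⊢
  rw [e4, e1, e3, dl]
  ring

theorem IsTest.integrable_mul (hV : IsOpen V) (hf : IsTest V f) (hg : SmoothOn g V) :
    Integrable (fun x => f x * g x) :=
  (hf.mul hV hg).integrable

theorem bochner_pair (hV : IsOpen V) (h : SmoothOn Ψ V) (hf : IsTest V f)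
    (hg : IsTest V g) :
    ∫ x, dl Ψ k f x * (conj (dl Ψ j g x) * wt Ψ x) =
      (∫ x, dzb j f x * (conj (dzb k g x) * wt Ψ x)) +
      ∫ x, f x * (dzb j (dz k ♯Ψ) x * conj (g x) * wt Ψ x) := by
  have hgs := hg.smooth.contDiffOn (s := V)
  have h1 := integral_dzb_mul (k := j) hV h (hf.dl (k := k) hV h) hgs
  have h2 := integral_dl_mul (k := k) hV h (hf.dd (c := I) (j := j)) hgs
  have e : ∫ x, dzb j (dl Ψ k f) x * (conj (g x) * wt Ψ x) =
      (∫ x, dl Ψ k (dzb j f) x * (conj (g x) * wt Ψ x)) -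
      ∫ x, f x * (dzb j (dz k ♯Ψ) x * conj (g x) * wt Ψ x) := by
    have hc := (contDiffOn_conj hgs).mul (contDiffOn_wt h)
    rw [← integral_sub ((hf.dd.dl hV h).integrable_mul hV hc) (hf.integrable_mul hV
      (((contDiffOn_dd hV (contDiffOn_dd hV (contDiffOn_ofReal h))).mul
        (contDiffOn_conj hgs)).mul (contDiffOn_wt h)))]
    refine integral_congr_all fun x => ?_
    by_cases hx : x ∈ V
    · rw [dzb_dl hV h hf.smooth.contDiffOn hx]; ring
    · simp [hg.eq_zero hx]
  rw [h2] at e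
  rw [eq_comm, ← neg_neg (∫ x, dl Ψ k f x * _), ← h1, e]
  ring

theorem re_integral_nonneg (f : Fn n) : 0 ≤ (∫ x, f x * (conj (f x) * wt Ψ x)).re := by
  have : ∀ x, f x * (conj (f x) * wt Ψ x) = ((‖f x‖ ^ 2 * expR (-Ψ x) : ℝ) : ℂ) := by
    intro x
    rw [← mul_assoc, mul_conj, normSq_eq_norm_sq, wt]; push_cast; rfl
  simp only [this]
  rw [integral_complex_ofReal, ofReal_re]
  exact integral_nonneg fun x => by positivity

/-- The Bochner-Kodaira inequality for compactly supported forms. -/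
theorem bochner (hV : IsOpen V) (h : SmoothOn Ψ V) {f : Fin n → Fn n}
    (hf : ∀ k, IsTest V (f k)) :
    (∑ j, ∑ k, ∫ x, f k x * (dzb j (dz k ♯Ψ) x * conj (f j x) * wt Ψ x)).re ≤
      (∫ x, (∑ k, dl Ψ k (f k) x) * (conj (∑ k, dl Ψ k (f k) x) * wt Ψ x)).re +
      (∑ j, ∑ k, ∫ x, (dzb j (f k) x - dzb k (f j) x) *
        (conj (dzb j (f k) x - dzb k (f j) x) * wt Ψ x)).re / 2 := by
  have hw := contDiffOn_wt h
  let J : Fin n → Fin n → Fin n → Fin n → ℂ := fun j k j' k' =>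
    ∫ x, dzb j (f k) x * (conj (dzb j' (f k') x) * wt Ψ x)
  have i1 : ∀ {u v : Fn n}, IsTest V u → IsTest V v →
      Integrable fun x => u x * (conj (v x) * wt Ψ x) := fun hu hv =>
    hu.integrable_mul hV ((contDiffOn_conj hv.smooth.contDiffOn).mul hw)
  have e1 : ∫ x, (∑ k, dl Ψ k (f k) x) * (conj (∑ k, dl Ψ k (f k) x) * wt Ψ x) =
      ∑ j, ∑ k, ∫ x, dl Ψ k (f k) x * (conj (dl Ψ j (f j) x) * wt Ψ x) := by
    have ii := fun j k => i1 ((hf k).dl (k := k) hV h) ((hf j).dl (k := j) hV h)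
    simp_rw [← integral_finsetSum Finset.univ fun k _ => ii _ k]
    rw [← integral_finsetSum _ fun j _ => integrable_finsetSum _ fun k _ => ii j k]
    refine integral_congr_all fun x => ?_
    simp only [map_sum, sum_mul, mul_sum]
  have e2 : ∀ j k, ∫ x, (dzb j (f k) x - dzb k (f j) x) *
      (conj (dzb j (f k) x - dzb k (f j) x) * wt Ψ x) =
      J j k j k - J j k k j - J k j j k + J k j k j := by
    intro j k
    have ii := fun j k j' k' => i1 ((hf k).dd (c := I) (j := j)) ((hf k').dd (c := I) (j := j'))
    simp only [J]
    rw [← integral_sub (ii _ _ _ _) (ii _ _ _ _), ← integral_sub ((ii _ _ _ _).sub' (ii _ _ _ _))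
      (ii _ _ _ _), ← integral_add (((ii _ _ _ _).sub' (ii _ _ _ _)).sub' (ii _ _ _ _)) (ii _ _ _ _)]
    refine integral_congr_all fun x => ?_
    simp only [map_sub]
    ring
  have e3 : (∑ j, ∑ k, (J j k j k - J j k k j - J k j j k + J k j k j)) =
      2 * (∑ j, ∑ k, J j k j k) - 2 * ∑ j, ∑ k, J j k k j := by
    simp only [sum_add_distrib, sum_sub_distrib]
    rw [sum_comm (f := fun j k => J k j k j), sum_comm (f := fun j k => J k j j k)]
    ring
  have e4 : 0 ≤ (∑ j, ∑ k, J j k j k).re := by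
    simp only [re_sum]
    exact sum_nonneg fun j _ => sum_nonneg fun k _ => re_integral_nonneg _
  simp_rw [e2]
  rw [e3, e1]
  simp_rw [bochner_pair hV h (hf _) (hf _)]
  simp only [sum_add_distrib, add_re, sub_re, mul_re]
  norm_num
  norm_num at e4
  simp only [J] at e4 ⊢
  linarith

/-- Convergence in `L²` of a sequence of functions. -/
def TL2 (u : ℕ → Fn n) (U : Fn n) : Prop :=
  ∃ (h : ∀ i, MemLp (u i) 2 volume) (H : MemLp U 2 volume),
    Tendsto (fun i => (h i).toLp (u i)) atTop (𝓝 (H.toLp U))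

namespace TL2

variable {u v : ℕ → Fn n} {U W : Fn n}

theorem sub (h : TL2 u U) (h' : TL2 v W) : TL2 (fun i x => u i x - v i x) (fun x => U x - W x) := by
  obtain ⟨a, b, c⟩ := h
  obtain ⟨a', b', c'⟩ := h'
  exact ⟨fun i => (a i).sub (a' i), b.sub b', (c.sub c').congr fun i => by rfl⟩

theorem add (h : TL2 u U) (h' : TL2 v W) : TL2 (fun i x => u i x + v i x) (fun x => U x + W x) := by
  obtain ⟨a, b, c⟩ := h
  obtain ⟨a', b', c'⟩ := h'
  exact ⟨fun i => (a i).add (a' i), b.add b', (c.add c').congr fun i => by rfl⟩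

theorem zero : TL2 (n := n) (fun _ _ => 0) (fun _ => 0) :=
  ⟨fun _ => MemLp.zero', MemLp.zero', tendsto_const_nhds⟩

theorem sum {ι : Type*} {s : Finset ι} {u : ι → ℕ → Fn n} {U : ι → Fn n}
    (h : ∀ k ∈ s, TL2 (u k) (U k)) : TL2 (fun i x => ∑ k ∈ s, u k i x) (fun x => ∑ k ∈ s, U k x) := by
  classical
  induction s using Finset.induction_on with
  | empty => simpa using zero
  | insert a s ha ih =>
    simp only [Finset.sum_insert ha]
    exact (h a (Finset.mem_insert_self _ _)).add
      (ih fun k hk => h k (Finset.mem_insert_of_mem hk))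

/-- Multiplication by a function continuous on a compact set containing all supports. -/
theorem mul_on (hK : IsCompact K) {m : Fn n} (hm : ContinuousOn m K)
    (h : TL2 u U) (hu : ∀ i, ∀ x ∉ K, u i x = 0) (hU : ∀ x ∉ K, U x = 0) :
    TL2 (fun i x => m x * u i x) (fun x => m x * U x) := by
  obtain ⟨a, b, c⟩ := h
  obtain ⟨C, hC⟩ := hK.exists_bound_of_continuousOn hm
  have hms : AESM (K.indicator m) volume :=
    (aestronglyMeasurable_indicator_iff hK.measurableSet).2
      (hm.aestronglyMeasurable hK.measurableSet)
  have e : ∀ w : Fn n, (∀ x ∉ K, w x = 0) →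
      (fun x => m x * w x) = fun x => K.indicator m x * w x := by
    intro w hw
    ext x
    by_cases hx : x ∈ K
    · simp [hx]
    · simp [hw x hx]
  have hb : ∀ (w : Fn n) (x : Cn n), (∀ x ∉ K, w x = 0) → ‖m x * w x‖ ≤ C * ‖w x‖ := by
    intro w x hw
    by_cases hx : x ∈ K
    · rw [norm_mul]; exact mul_le_mul_of_nonneg_right (hC x hx) (norm_nonneg _)
    · simp [hw x hx]
  have mem : ∀ w : Fn n, MemLp w 2 volume → (∀ x ∉ K, w x = 0) →
      MemLp (fun x => m x * w x) 2 volume := fun w hw h0 =>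
    hw.of_le_mul (c := C) (by rw [e w h0]; exact hms.mul hw.1)
      (.of_forall fun x => hb w x h0)
  refine ⟨fun i => mem _ (a i) (hu i), mem _ b hU, ?_⟩
  rw [tendsto_iff_norm_sub_tendsto_zero] at c ⊢
  have := c.const_mul C
  rw [mul_zero] at this
  refine squeeze_zero (fun _ => norm_nonneg _) (fun i => ?_) this
  refine Lp.norm_le_mul_norm_of_ae_le_mul ?_
  filter_upwards [Lp.coeFn_sub ((mem _ (a i) (hu i)).toLp _) ((mem _ b hU).toLp _),
    Lp.coeFn_sub ((a i).toLp _) (b.toLp _), (a i).coeFn_toLp, b.coeFn_toLp,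
    (mem _ (a i) (hu i)).coeFn_toLp, (mem _ b hU).coeFn_toLp] with x h1 h2 h3 h4 h5 h6
  rw [h1, h2, Pi.sub_apply, Pi.sub_apply, h3, h4, h5, h6, ← mul_sub]
  exact hb (fun x => u i x - U x) x fun x hx => by simp [hu i x hx, hU x hx]

theorem pair (h : TL2 u U) (h' : TL2 v W) :
    Tendsto (fun i => ∫ x, u i x * conj (v i x)) atTop (𝓝 (∫ x, U x * conj (W x))) := by
  obtain ⟨a, b, c⟩ := h
  obtain ⟨a', b', c'⟩ := h'
  have key : ∀ {f g : Fn n} (hf : MemLp f 2 volume) (hg : MemLp g 2 volume),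
      ∫ x, f x * conj (g x) = inner ℂ (hg.toLp g) (hf.toLp f) := by
    intro f g hf hg
    rw [L2.inner_def]
    refine integral_congr_ae ?_
    filter_upwards [hf.coeFn_toLp, hg.coeFn_toLp] with x h1 h2
    rw [h1, h2]; rfl
  simp_rw [fun i => key (a i) (a' i), key b b']
  exact c'.inner c

theorem pair_on (hK : IsCompact K) {m : Fn n} (hm : ContinuousOn m K)
    (h : TL2 u U) (h' : TL2 v W) (hu : ∀ i, ∀ x ∉ K, u i x = 0) (hU : ∀ x ∉ K, U x = 0) :
    Tendsto (fun i => ∫ x, u i x * (conj (v i x) * m x)) atTop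
      (𝓝 (∫ x, U x * (conj (W x) * m x))) := by
  have e : ∀ a b : Fn n, ∫ x, a x * (conj (b x) * m x) = ∫ x, m x * a x * conj (b x) :=
    fun a b => integral_congr_all fun x => by ring
  simp_rw [e]
  exact (h.mul_on hK hm hu hU).pair h'

end TL2

/-- Local square integrability. -/
def LL (V : Set (Cn n)) (f : Fn n) : Prop :=
  ∀ K ⊆ V, IsCompact K → ∫⁻ x in K, ‖f x‖ₑ ^ 2 < ⊤

theorem LL.memLp (hF : Measurable F) (h : LL V F) (hθ : IsTest V θ) :
    MemLp (fun x => θ x * F x) 2 volume := by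
  have hc : IsCompact (tsupport θ) := hθ.comp
  have h1 : MemLp ((tsupport θ).indicator F) 2 volume := by
    rw [memLp_indicator_iff_restrict hc.measurableSet, memLp_two_iff hF.aestronglyMeasurable]
    exact h _ hθ.supp hc
  obtain ⟨C, hC⟩ := hc.exists_bound_of_continuousOn hθ.continuous.continuousOn
  refine h1.of_le_mul (c := C) (hθ.continuous.aestronglyMeasurable.mul hF.aestronglyMeasurable)
    (.of_forall fun x => ?_)
  by_cases hx : x ∈ tsupport θ
  · rw [indicator_of_mem hx, norm_mul]
    exact mul_le_mul_of_nonneg_right (hC x hx) (norm_nonneg _)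
  · simp [image_eq_zero_of_notMem_tsupport hx, indicator_of_notMem hx]

theorem LL.integrable (hF : Measurable F) (h : LL V F) (hθ : IsTest V θ) :
    Integrable (fun x => F x * θ x) := by
  have hc : IsCompact (tsupport θ) := hθ.comp
  have h1 : IntegrableOn (fun x => θ x * F x) (tsupport θ) := by
    have := (LL.memLp hF h hθ).restrict (tsupport θ)
    have hf : IsFiniteMeasure (volume.restrict (tsupport θ)) :=
      ⟨by simpa using hc.measure_lt_top⟩
    exact this.integrable (by norm_num)
  rw [integrableOn_iff_integrable_of_support_subset] at h1
  · simpa only [mul_comm] using h1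
  · exact (Function.support_mul_subset_left _ _).trans subset_closure

theorem moll_eq_zero (hr : 0 < r) (h : ∀ x ∉ K, F x = 0) (hx : x ∉ thickening r K) :
    moll r F x = 0 := by
  rw [moll]
  refine integral_eq_zero_of_ae (.of_forall fun w => ?_)
  by_cases hw : r ≤ ‖w‖
  · simp [moC_zero hr hw]
  · have : x - w ∉ K := fun hk => hx (mem_thickening_iff.2 ⟨x - w, hk, by
      rw [dist_eq_norm]; simpa using hw⟩)
    simp [h _ this]

theorem isTest_moll (hr : 0 < r) (hK : IsCompact K) (hKV : cthickening r K ⊆ V)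
    (hF : LocallyIntegrable F) (h : ∀ x ∉ K, F x = 0) : IsTest V (moll r F) := by
  have hs : tsupport (moll r F) ⊆ cthickening r K := by
    refine closure_minimal (fun x hx => ?_) isClosed_cthickening
    by_contra h'
    exact hx (moll_eq_zero hr h fun h'' => h' (thickening_subset_cthickening _ _ h''))
  exact ⟨moll_smooth hr hF, hK.cthickening.of_isClosed_subset (isClosed_tsupport _) hs, hs.trans hKV⟩

theorem IsTest.memLp (h : IsTest V θ) : MemLp θ 2 volume :=
  h.continuous.memLp_of_hasCompactSupport h.comp

theorem tL2_moll {r : ℕ → ℝ} (hr : ∀ i, 0 < r i) (hr0 : Tendsto r atTop (𝓝 0)) (hF : Measurable F)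
    (hF2 : MemLp F 2 volume) (hm : ∀ i, MemLp (moll (r i) F) 2 volume) :
    TL2 (fun i => moll (r i) F) F := by
  refine ⟨hm, hF2, ?_⟩
  rw [Lp.tendsto_Lp_iff_tendsto_eLpNorm'']
  have h1 := (tendsto_moll hF hF2).comp
    (tendsto_nhdsWithin_iff.2 ⟨hr0, .of_forall hr⟩)
  have h2 : Tendsto (fun i => (eLpNorm (moll (r i) F - F) 2 volume ^ 2) ^ (1 / 2 : ℝ)) atTop
      (𝓝 ((0 : ℝ≥0∞) ^ (1 / 2 : ℝ))) := by
    refine (ENNReal.continuous_rpow_const.tendsto 0).comp (h1.congr fun i => ?_)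
    rw [eLpNorm_two_sq]; rfl
  simp only [one_div] at h2
  rw [ENNReal.zero_rpow_of_pos (by norm_num)] at h2
  refine h2.congr fun i => ?_
  rw [← ENNReal.rpow_natCast, ← ENNReal.rpow_mul]
  norm_num

/-- Weak closedness of a `(0,1)`-form. -/
def WeakClosed (V : Set (Cn n)) (β : Fin n → Fn n) : Prop :=
  ∀ θ, IsTest V θ → ∀ j k, ∫ x, β k x * dzb j θ x = ∫ x, β j x * dzb k θ x

/-- `γ` is the weak adjoint `∂̄*β` with respect to the weight `e^{-Ψ}`. -/
def WeakAdj (V : Set (Cn n)) (Ψ : Cn n → ℝ) (β : Fin n → Fn n) (γ : Fn n) : Prop :=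
  ∀ v, IsTest V v → ∑ k, ∫ x, β k x * (dz k v x * wt Ψ x) = ∫ x, γ x * (v x * wt Ψ x)

theorem dd_mul_test (hχ : IsTest V χ) (hθ : ContDiff ℝ ∞ θ) (x : Cn n) :
    dd c j (fun y => χ y * θ y) x = dd c j χ x * θ x + χ x * dd c j θ x :=
  dd_mul (hχ.diff x) (hθ.contDiffAt.differentiableAt (by simp))

theorem WeakClosed.cutoff (h : WeakClosed V β) (hm : ∀ k, Measurable (β k)) (hβ : ∀ k, LL V (β k))
    (hV : IsOpen V) (hχ : IsTest V χ) (hθ : IsTest univ θ) :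
    (∫ x, χ x * β k x * dzb j θ x) - ∫ x, χ x * β j x * dzb k θ x =
      -∫ x, (dzb j χ x * β k x - dzb k χ x * β j x) * θ x := by
  have h0 := h _ (hχ.mul hV (hθ.smooth.contDiffOn)) j k
  have e : ∀ j k, ∫ x, χ x * β k x * dzb j θ x =
      (∫ x, β k x * dzb j (fun x => χ x * θ x) x) - ∫ x, β k x * (dzb j χ x * θ x) := by
    intro j k
    rw [← integral_sub ((hβ k).integrable (hm k) (hχ.mul hV hθ.smooth.contDiffOn).dd)
      ((hβ k).integrable (hm k) (hχ.dd.mul hV hθ.smooth.contDiffOn))]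
    refine integral_congr_all fun x => ?_
    simp only [dzb, dd_mul_test hχ hθ.smooth]
    ring
  rw [e, e, h0, sub_sub_sub_cancel_left, ← integral_sub, ← integral_neg]
  · refine integral_congr_all fun x => ?_
    ring
  · exact (hβ j).integrable (hm j) (hχ.dd.mul hV hθ.smooth.contDiffOn)
  · exact (hβ k).integrable (hm k) (hχ.dd.mul hV hθ.smooth.contDiffOn)

theorem WeakAdj.cutoff (h : WeakAdj V Ψ β γ) (hm : ∀ k, Measurable (β k)) (hβ : ∀ k, LL V (β k))
    (hV : IsOpen V) (hΨ : SmoothOn Ψ V) (hγ : IsTest V γ) (hχ : IsTest V χ)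
    (hθ : IsTest univ θ) :
    -∑ k, ∫ x, χ x * β k x * dz k θ x =
      ∫ x, ((∑ k, (dz k χ x * β k x + χ x * dz k ♯Ψ x * β k x)) - χ x * γ x)
        * θ x := by
  have hχθ := hχ.mul hV (hθ.smooth.contDiffOn)
  have hwi : SmoothOn (fun x => wt (fun y => -Ψ y) x) V := contDiffOn_wt hΨ.neg
  have h0 := h _ (hχθ.mul hV hwi)
  have hww : ∀ x, wt (fun y => -Ψ y) x * wt Ψ x = 1 := fun x => by
    rw [wt, wt, ← ofReal_mul, ← rexp_add]; simp
  have i1 : ∀ k, Integrable fun x => β k x * (dz k χ x * θ x) := fun k =>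
    (hβ k).integrable (hm k) (hχ.dd.mul hV hθ.smooth.contDiffOn)
  have i2 : ∀ k, Integrable fun x => β k x * (χ x * dz k θ x) := fun k =>
    (hβ k).integrable (hm k) (hχ.mul hV (hθ.dd.smooth.contDiffOn))
  have i3 : ∀ k, Integrable fun x => β k x * ((χ x * dz k ♯Ψ x) * θ x) := fun k =>
    (hβ k).integrable (hm k) ((hχ.mul hV
      (contDiffOn_dd hV (contDiffOn_ofReal hΨ))).mul hV hθ.smooth.contDiffOn)
  have i4 : Integrable fun x => χ x * γ x * θ x :=
    ((hχ.mul hV hγ.smooth.contDiffOn).mul hV hθ.smooth.contDiffOn).integrable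
  have e1 : ∀ k, ∫ x, β k x * (dz k (fun x => χ x * θ x * wt (fun y => -Ψ y) x) x * wt Ψ x) =
      (∫ x, χ x * β k x * dz k θ x) + ∫ x, ((dz k χ x * β k x +
        χ x * dz k ♯Ψ x * β k x) * θ x) := by
    intro k
    rw [← integral_add]
    · refine integral_congr_all fun x => ?_
      by_cases hx : x ∈ V
      · have e : dd (-I) k (fun x => χ x * θ x * wt (fun y => -Ψ y) x) x = _ :=
          dd_mul (hχθ.diff x) (diffAt hV hwi hx)
        have e' : dd (-I) k (fun x => wt (fun y => -Ψ y) x) x = _ := dd_wt hV hΨ.neg hx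
        have e'' : dd (-I) k (fun y => ((-Ψ y : ℝ) : ℂ)) x =
            -dd (-I) k ♯Ψ x := by
          simp only [ofReal_neg]; exact dd_neg
        simp only [dz]
        rw [e, e', e'', dd_mul_test hχ hθ.smooth]
        linear_combination (dd (-I) k χ x * θ x + χ x * dd (-I) k θ x +
          χ x * θ x * dd (-I) k ♯Ψ x) * β k x * hww x
      · simp only [dz]
        rw [(hχθ.mul hV hwi).dd.eq_zero hx, hχ.dd.eq_zero hx, hχ.eq_zero hx]
        ring
    · exact (i2 k).congr (.of_forall fun x => by simp only; ring)
    · exact ((i1 k).add (i3 k)).congr (.of_forall fun x => by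
        simp only [Pi.add_apply]; ring)
  simp_rw [e1] at h0
  rw [sum_add_distrib] at h0
  have e2 : ∫ x, γ x * (χ x * θ x * wt (fun y => -Ψ y) x * wt Ψ x) = ∫ x, χ x * γ x * θ x :=
    integral_congr_ae (.of_forall fun x => by
      simp only; linear_combination (γ x * χ x * θ x) * hww x)
  rw [e2] at h0
  have i5 : ∀ k, Integrable fun x => (dz k χ x * β k x +
        χ x * dz k ♯Ψ x * β k x) * θ x := fun k =>
    ((i1 k).add (i3 k)).congr (.of_forall fun x => by
        simp only [Pi.add_apply]; ring)
  have e3 : ∫ x, ((∑ k, (dz k χ x * β k x + χ x * dz k ♯Ψ x * β k x)) -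
      χ x * γ x) * θ x = (∑ k, ∫ x, (dz k χ x * β k x +
        χ x * dz k ♯Ψ x * β k x) * θ x) - ∫ x, χ x * γ x * θ x := by
    rw [← integral_finsetSum _ fun k _ => i5 k, ← integral_sub (integrable_finsetSum _ fun k _ => i5 k) i4]
    refine integral_congr_all fun x => ?_
    simp only [sub_mul, sum_mul]
  rw [e3, ← h0]; ring

theorem moll_weak (hr : 0 < r) {ι : Type*} [Fintype ι] {F : ι → Fn n} {G : Fn n}
    (hF : ∀ i, LocallyIntegrable (F i)) (c : ι → ℂ) (a : ι → ℂ) (d : ι → Fin n)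
    (h : ∀ θ, IsTest univ θ → -∑ i, a i * ∫ x, F i x * dd (c i) (d i) θ x = ∫ x, G x * θ x)
    (x : Cn n) : ∑ i, a i * dd (c i) (d i) (moll r (F i)) x = moll r G x := by
  have := h _ (isTest_moC_sub hr x)
  rw [moll_swap]
  simp_rw [fun i => dd_moll (c := c i) (j := d i) hr (hF i) x, mul_neg, Finset.sum_neg_distrib]
  rw [this]
  simp only [mul_comm]

/-- The Bochner-Kodaira inequality for cutoffs of forms in the weak domain. -/
theorem bochner_weak (hV : IsOpen V) (hΨ : SmoothOn Ψ V) (hm : ∀ k, Measurable (β k))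
    (hβ : ∀ k, LL V (β k)) (hc : WeakClosed V β) (ha : WeakAdj V Ψ β γ) (hγ : IsTest V γ)
    (hχ : IsTest V χ) :
    (∑ j, ∑ k, ∫ x, χ x * β k x * (conj (χ x * β j x) *
        (dzb j (dz k ♯Ψ) x * wt Ψ x))).re ≤
      (∫ x, ((∑ k, dz k χ x * β k x) - χ x * γ x) *
        (conj ((∑ k, dz k χ x * β k x) - χ x * γ x) * wt Ψ x)).re +
      (∑ j, ∑ k, ∫ x, (dzb j χ x * β k x - dzb k χ x * β j x) *
        (conj (dzb j χ x * β k x - dzb k χ x * β j x) * wt Ψ x)).re / 2 := by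
  obtain ⟨δ, hδ, hδV⟩ := (show IsCompact (tsupport χ) from hχ.comp).exists_cthickening_subset_open
    hV hχ.supp
  set K := cthickening δ (tsupport χ) with hKdef
  have hK : IsCompact K := (show IsCompact (tsupport χ) from hχ.comp).cthickening
  have hsub : tsupport χ ⊆ K := self_subset_cthickening _
  let r : ℕ → ℝ := fun i => δ / (i + 1)
  have hr : ∀ i, 0 < r i := fun i => by positivity
  have hrδ : ∀ i, r i ≤ δ := fun i => div_le_self hδ.le (by simp)
  have hr0 : Tendsto r atTop (𝓝 0) := by
    have := tendsto_one_div_add_atTop_nhds_zero_nat.const_mul δ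
    simpa [r, div_eq_mul_inv] using this
  have hrV : ∀ i, cthickening (r i) (tsupport χ) ⊆ V := fun i =>
    (cthickening_mono (hrδ i) _).trans hδV
  have hΨ1 : ∀ k, SmoothOn (dz k ♯Ψ) V := fun k =>
    contDiffOn_dd hV (contDiffOn_ofReal hΨ)
  have hχΨ := fun k => hχ.mul hV (hΨ1 k)
  let F : Fin n → Fn n := fun k x => χ x * β k x
  let G : Fn n := fun x =>
    (∑ k, (dz k χ x * β k x + χ x * dz k ♯Ψ x * β k x)) - χ x * γ x
  let C : Fin n → Fin n → Fn n := fun j k x => dzb j χ x * β k x - dzb k χ x * β j x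
  have hdd0 : ∀ (c : ℂ) k, ∀ x ∉ tsupport χ, dd c k χ x = 0 := fun c k x hx =>
    image_eq_zero_of_notMem_tsupport fun h => hx (IsTest.support_dd h)
  have hχ0 : ∀ x ∉ tsupport χ, χ x = 0 := fun x hx => image_eq_zero_of_notMem_tsupport hx
  have hF0 : ∀ k, ∀ x ∉ tsupport χ, F k x = 0 := fun k x hx => by simp [F, hχ0 x hx]
  have hG0 : ∀ x ∉ tsupport χ, G x = 0 := fun x hx => by simp [G, hχ0 x hx, hdd0 _ _ x hx]
  have hC0 : ∀ j k, ∀ x ∉ tsupport χ, C j k x = 0 := fun j k x hx => by simp [C, hdd0 _ _ x hx]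
  have hFm : ∀ k, Measurable (F k) := fun k => hχ.continuous.measurable.mul (hm k)
  have hGm : Measurable G := by
    refine (Finset.measurable_sum _ fun k _ => ?_).sub
      (hχ.continuous.measurable.mul hγ.continuous.measurable)
    exact (hχ.dd.continuous.measurable.mul (hm k)).add
      ((hχΨ k).continuous.measurable.mul (hm k))
  have hCm : ∀ j k, Measurable (C j k) := fun j k =>
    (hχ.dd.continuous.measurable.mul (hm k)).sub (hχ.dd.continuous.measurable.mul (hm j))
  have hF2 : ∀ k, MemLp (F k) 2 volume := fun k => (hβ k).memLp (hm k) hχ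
  have hG2 : MemLp G 2 volume :=
    (memLp_finsetSum _ fun k _ => ((hβ k).memLp (hm k) hχ.dd).add
      ((hβ k).memLp (hm k) (hχΨ k))).sub (hχ.mul hV hγ.smooth.contDiffOn).memLp
  have hC2 : ∀ j k, MemLp (C j k) 2 volume := fun j k =>
    ((hβ k).memLp (hm k) hχ.dd).sub ((hβ j).memLp (hm j) hχ.dd)
  have loc : ∀ {f : Fn n}, MemLp f 2 volume → LocallyIntegrable f := fun h =>
    h.locallyIntegrable (by norm_num)
  have hft : ∀ i k, IsTest V (moll (r i) (F k)) := fun i k =>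
    isTest_moll (hr i) hχ.comp (hrV i) (loc (hF2 k)) (hF0 k)
  have hgt : ∀ i, IsTest V (moll (r i) G) := fun i =>
    isTest_moll (hr i) hχ.comp (hrV i) (loc hG2) hG0
  have hct : ∀ i j k, IsTest V (moll (r i) (C j k)) := fun i j k =>
    isTest_moll (hr i) hχ.comp (hrV i) (loc (hC2 j k)) (hC0 j k)
  have tF := fun k => tL2_moll hr hr0 (hFm k) (hF2 k) fun i => (hft i k).memLp
  have tG := tL2_moll hr hr0 hGm hG2 fun i => (hgt i).memLp
  have tC := fun j k => tL2_moll hr hr0 (hCm j k) (hC2 j k) fun i => (hct i j k).memLp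
  have z : ∀ {f : Fn n}, (∀ x ∉ tsupport χ, f x = 0) → ∀ i, ∀ x ∉ K, moll (r i) f x = 0 :=
    fun h i x hx => moll_eq_zero (hr i) h fun h' => hx
      (cthickening_mono (hrδ i) _ (thickening_subset_cthickening _ _ h'))
  have z' : ∀ {f : Fn n}, (∀ x ∉ tsupport χ, f x = 0) → ∀ x ∉ K, f x = 0 :=
    fun h x hx => h x fun h' => hx (hsub h')
  have hwK : ContinuousOn (wt Ψ) K := (contDiffOn_wt hΨ).continuousOn.mono hδV
  have hΨK : ∀ k, ContinuousOn (dz k ♯Ψ) K := fun k =>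
    (hΨ1 k).continuousOn.mono hδV
  have hΨ2K : ∀ j k, ContinuousOn (fun x => dzb j (dz k ♯Ψ) x * wt Ψ x) K :=
    fun j k => ((contDiffOn_dd hV (hΨ1 k)).continuousOn.mono hδV).mul hwK
  let D : Fn n := fun x => G x - ∑ k, dz k ♯Ψ x * F k x
  let Di : ℕ → Fn n := fun i x =>
    moll (r i) G x - ∑ k, dz k ♯Ψ x * moll (r i) (F k) x
  have tD : TL2 Di D := tG.sub (TL2.sum fun k _ =>
    (tF k).mul_on hK (hΨK k) (z (hF0 k)) (z' (hF0 k)))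
  have hDi0 : ∀ i, ∀ x ∉ K, Di i x = 0 := fun i x hx => by
    simp [Di, z hG0 i x hx, fun k => z (hF0 k) i x hx]
  have hD0 : ∀ x ∉ K, D x = 0 := fun x hx => by
    simp [D, z' hG0 x hx, fun k => z' (hF0 k) x hx]
  have hDD : ∀ x, D x = (∑ k, dz k χ x * β k x) - χ x * γ x := fun x => by
    simp only [D, G, F, sum_add_distrib]
    rw [show ∑ k, χ x * dz k ♯Ψ x * β k x =
      ∑ k, dz k ♯Ψ x * (χ x * β k x) from
      sum_congr rfl fun k _ => by ring]
    ring
  have hb := fun i => bochner hV hΨ (hft i)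
  have eD : ∀ i x, ∑ k, dl Ψ k (moll (r i) (F k)) x = Di i x := by
    intro i x
    simp only [dl, sum_sub_distrib, Di]
    congr 1
    have := moll_weak (hr i) (fun k => loc (hF2 k)) (fun _ => -I) (fun _ => 1) (fun k => k)
      (G := G) (fun θ hθ => by
        have := ha.cutoff hm hβ hV hΨ hγ hχ hθ
        simpa using this) x
    simpa using this
  have eC : ∀ i j k x, dzb j (moll (r i) (F k)) x - dzb k (moll (r i) (F j)) x =
      moll (r i) (C j k) x := by
    intro i j k x
    have := moll_weak (ι := Fin 2) (hr i) (F := ![F k, F j]) (G := C j k)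
      (by intro l; fin_cases l; exacts [loc (hF2 k), loc (hF2 j)])
      (fun _ => I) ![1, -1] ![j, k] (fun θ hθ => by
        have := hc.cutoff (j := j) (k := k) hm hβ hV hχ hθ
        simp only [Fin.sum_univ_two, Matrix.cons_val_zero, Matrix.cons_val_one]
        simp only [F, C]
        linear_combination -this) x
    simp only [Fin.sum_univ_two, Matrix.cons_val_zero, Matrix.cons_val_one] at this
    simpa [sub_eq_add_neg] using this
  simp_rw [eD, eC] at hb
  have l1 : Tendsto (fun i => (∑ j, ∑ k, ∫ x, moll (r i) (F k) x * (conj (moll (r i) (F j) x) *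
      (dzb j (dz k ♯Ψ) x * wt Ψ x))).re) atTop
      (𝓝 (∑ j, ∑ k, ∫ x, F k x * (conj (F j x) *
      (dzb j (dz k ♯Ψ) x * wt Ψ x))).re) :=
    (continuous_re.tendsto _).comp (tendsto_finsetSum _ fun j _ => tendsto_finsetSum _ fun k _ =>
      (tF k).pair_on hK (hΨ2K j k) (tF j) (z (hF0 k)) (z' (hF0 k)))
  have l2 := (continuous_re.tendsto _).comp (tD.pair_on hK hwK tD hDi0 hD0)
  have l3 := (continuous_re.tendsto _).comp
    (tendsto_finsetSum Finset.univ fun j _ => tendsto_finsetSum Finset.univ fun k _ =>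
      (tC j k).pair_on hK hwK (tC j k) (z (hC0 j k)) (z' (hC0 j k)))
  have := le_of_tendsto_of_tendsto' l1 (l2.add (l3.div_const 2)) fun i => by
    refine le_trans (le_of_eq ?_) (hb i)
    congr 1
    refine sum_congr rfl fun j _ => sum_congr rfl fun k _ =>
      integral_congr_all fun x => ?_
    ring
  simp only [hDD] at this
  exact this

section levi

variable {r : Cn n → ℝ} {β : Fin n → ℂ}

theorem ofReal_contDiffAt (h : ContDiffAt ℝ ∞ r x) : ContDiffAt ℝ ∞ ♯r x :=
  Complex.ofRealCLM.contDiff.contDiffAt.comp x h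

theorem eventually_differentiableAt {E F : Type*} [NormedAddCommGroup E] [NormedSpace ℝ E]
    [NormedAddCommGroup F] [NormedSpace ℝ F] {f : E → F} {x : E} (h : ContDiffAt ℝ ∞ f x) :
    ∀ᶠ y in 𝓝 x, DifferentiableAt ℝ f y :=
  ((h.of_le (show (1 : WithTop ℕ∞) ≤ (⊤ : ℕ∞) by exact_mod_cast le_top)).eventually (by simp)).mono
    fun _ hy => hy.differentiableAt (by simp)

theorem fderiv2_ofReal (h : ContDiffAt ℝ ∞ r x) (u v : Cn n) :
    fderiv ℝ (fderiv ℝ ♯r) x u v = (fderiv ℝ (fderiv ℝ r) x u v : ℂ) := by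
  have h1 : fderiv ℝ ♯r =ᶠ[𝓝 x]
      fun y => (ContinuousLinearMap.compL ℝ (Cn n) ℝ ℂ Complex.ofRealCLM) (fderiv ℝ r y) := by
    filter_upwards [eventually_differentiableAt h] with y hy
    exact (Complex.ofRealCLM.hasFDerivAt.comp y hy.hasFDerivAt).fderiv
  have h2 : DifferentiableAt ℝ (fderiv ℝ r) x :=
    (h.fderiv_right (m := ∞) (by simp)).differentiableAt (by simp)
  have h3 : HasFDerivAt (fun y => (ContinuousLinearMap.compL ℝ (Cn n) ℝ ℂ Complex.ofRealCLM)
      (fderiv ℝ r y)) _ x :=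
    ((ContinuousLinearMap.compL ℝ (Cn n) ℝ ℂ Complex.ofRealCLM).hasFDerivAt).comp x h2.hasFDerivAt
  rw [h1.fderiv_eq, h3.fderiv]
  rfl

theorem levi_eq (h : ContDiffAt ℝ ∞ r x) (v : Cn n) :
    levi r x v = (fderiv ℝ (fderiv ℝ r) x v v + fderiv ℝ (fderiv ℝ r) x (I • v) (I • v)) / 4 := by
  set Q := fderiv ℝ (fderiv ℝ r) x
  have hv : v = ∑ k, ((v k).re • eb k + (v k).im • (I • eb k)) := by
    refine (sum_smul_eb v).trans ?_
    refine sum_congr rfl fun k _ => ?_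
    conv_lhs => rw [← Complex.re_add_im (v k)]
    rw [add_smul, mul_smul]
    rfl
  have hIv : I • v = ∑ k, ((v k).re • (I • eb k) - (v k).im • eb k) := by
    conv_lhs => rw [hv]
    rw [Finset.smul_sum]
    refine sum_congr rfl fun k _ => ?_
    rw [smul_add, smul_comm I (v k).re, smul_comm I (v k).im, smul_smul, I_mul_I, neg_one_smul,
      smul_neg, sub_eq_add_neg]
  have key : levi r x v = ∑ j, ∑ k,
      ((Q (eb j) (eb k) + Q (I • eb j) (I • eb k)) * ((v k).re * (v j).re + (v k).im * (v j).im)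
      + (Q (eb j) (I • eb k) - Q (I • eb j) (eb k)) *
        ((v k).im * (v j).re - (v k).re * (v j).im)) / 4 := by
    rw [levi, Complex.re_sum]
    refine sum_congr rfl fun j _ => ?_
    rw [Complex.re_sum]
    refine sum_congr rfl fun k _ => ?_
    simp only [dzb, dz, dd_dd (ofReal_contDiffAt h), fderiv2_ofReal h]
    rw [show (v.ofLp k : ℂ) = (v k).re + (v k).im * I from (Complex.re_add_im _).symm,
      show (v.ofLp j : ℂ) = (v j).re + (v j).im * I from (Complex.re_add_im _).symm]
    simp [Q, Complex.div_ofNat_re, Complex.mul_re, Complex.mul_im, Complex.div_ofNat_im]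
    ring
  have e1 : Q v v = ∑ j, ∑ k, (Q (eb j) (eb k) * ((v j).re * (v k).re) +
      Q (eb j) (I • eb k) * ((v j).re * (v k).im) + Q (I • eb j) (eb k) * ((v j).im * (v k).re) +
      Q (I • eb j) (I • eb k) * ((v j).im * (v k).im)) := by
    conv_lhs => rw [hv]
    simp only [map_sum, map_add, map_smul, _root_.sum_apply,
      _root_.add_apply, _root_.smul_apply, smul_eq_mul, mul_sum]
    rw [← sum_comm]
    simp only [mul_add, sum_add_distrib]
    simp only [← sum_add_distrib]
    exact sum_congr rfl fun _ _ => sum_congr rfl fun _ _ => by ring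
  have e2 : Q (I • v) (I • v) = ∑ j, ∑ k, (Q (I • eb j) (I • eb k) * ((v j).re * (v k).re) -
      Q (I • eb j) (eb k) * ((v j).re * (v k).im) - Q (eb j) (I • eb k) * ((v j).im * (v k).re) +
      Q (eb j) (eb k) * ((v j).im * (v k).im)) := by
    rw [hIv]
    simp only [map_sum, map_sub, map_smul, _root_.sum_apply,
      _root_.sub_apply, _root_.smul_apply, smul_eq_mul, mul_sum]
    rw [← sum_comm]
    simp only [mul_sub, sum_add_distrib, sum_sub_distrib]
    simp only [← sum_add_distrib, ← sum_sub_distrib]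
    exact sum_congr rfl fun _ _ => sum_congr rfl fun _ _ => by ring
  rw [key, e1, e2, ← sum_add_distrib, Finset.sum_div]
  refine sum_congr rfl fun j _ => ?_
  rw [← sum_add_distrib, Finset.sum_div]
  refine sum_congr rfl fun k _ => ?_
  ring

theorem levi_add (h : ContDiffAt ℝ ∞ Φ x) (h' : ContDiffAt ℝ ∞ Ψ x) :
    levi (fun y => Φ y + Ψ y) x β = levi Φ x β + levi Ψ x β := by
  have hf : (fun y => fderiv ℝ (fun y => Φ y + Ψ y) y) =ᶠ[𝓝 x] fun y => fderiv ℝ Φ y + fderiv ℝ Ψ y := by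
    filter_upwards [eventually_differentiableAt h, eventually_differentiableAt h'] with y hy hy'
    exact fderiv_fun_add hy hy'
  have d : ∀ {r : Cn n → ℝ}, ContDiffAt ℝ ∞ r x → DifferentiableAt ℝ (fderiv ℝ r) x := fun h =>
    (h.fderiv_right (m := ∞) (by simp)).differentiableAt (by simp)
  have hh := levi_eq (h.add h') (WithLp.toLp 2 β)
  rw [show ((WithLp.toLp 2 β : Cn n) : Fin n → ℂ) = β from rfl] at hh
  rw [hh, show levi Φ x β = levi Φ x (WithLp.toLp 2 β : Cn n) from rfl, levi_eq h,
    show levi Ψ x β = levi Ψ x (WithLp.toLp 2 β : Cn n) from rfl, levi_eq h', hf.fderiv_eq,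
    fderiv_fun_add (d h) (d h')]
  simp only [_root_.add_apply]
  ring

theorem levi_comp {F F' : ℝ → ℝ} {F'' : ℝ} (h : ContDiffAt ℝ ∞ r x)
    (hF : ∀ᶠ τ in 𝓝 (r x), HasDerivAt F (F' τ) τ) (hF' : HasDerivAt F' F'' (r x)) :
    levi (fun y => F (r y)) x β = F' (r x) * levi r x β
      + F'' * ‖∑ k, dz k ♯r x * β k‖ ^ 2 := by
  have hr : ∀ᶠ y in 𝓝 x, DifferentiableAt ℝ r y := eventually_differentiableAt h
  have e1 : ∀ j k, dzb j (dz k fun y => ((F (r y) : ℝ) : ℂ)) x =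
      (F'' : ℂ) * dzb j ♯r x * dz k ♯r x +
      F' (r x) * dzb j (dz k ♯r) x := by
    intro j k
    have : (dz k fun y => ((F (r y) : ℝ) : ℂ)) =ᶠ[𝓝 x]
        fun y => ((F' (r y) : ℝ) : ℂ) * dz k ♯r y := by
      filter_upwards [hr, h.continuousAt.eventually hF] with y hy hy'
      exact dd_comp_real hy' hy
    have e := dd_congr (c := I) (j := j) this
    simp only [dzb] at e ⊢
    rw [e]
    have hd : DifferentiableAt ℝ (fun y => ((F' (r y) : ℝ) : ℂ)) x :=
      Complex.ofRealCLM.differentiableAt.comp x (hF'.differentiableAt.comp x hr.self_of_nhds)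
    have hd' : DifferentiableAt ℝ (dz k ♯r) x := by
      have := ofReal_contDiffAt h
      have h2 : ContDiffAt ℝ ∞ (fderiv ℝ ♯r) x := this.fderiv_right (by simp)
      have h3 : DifferentiableAt ℝ (fderiv ℝ ♯r) x := h2.differentiableAt (by simp)
      unfold dz dd
      fun_prop
    have e2 : dd I j (fun y => ((F' (r y) : ℝ) : ℂ) * dz k ♯r y) x = _ :=
      dd_mul hd hd'
    rw [e2, dd_comp_real hF' hr.self_of_nhds]
  have e3 : ‖∑ k, dz k ♯r x * β k‖ ^ 2 =
      (∑ j, ∑ k, dzb j ♯r x * dz k ♯r x * β k * conj (β j)).re := by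
    rw [← Complex.ofReal_re (_ ^ 2), Complex.ofReal_pow, ← Complex.mul_conj', map_sum,
      Finset.sum_mul_sum, sum_comm]
    congr 1
    refine sum_congr rfl fun j _ => sum_congr rfl fun k _ => ?_
    rw [map_mul, dzb_ofReal]; ring
  rw [levi, e3, levi, ← Complex.re_ofReal_mul, ← Complex.re_ofReal_mul, ← Complex.add_re]
  congr 1
  simp only [mul_sum, ← sum_add_distrib]
  refine sum_congr rfl fun j _ => sum_congr rfl fun k _ => ?_
  rw [e1]; ring

end levi

/-- A smoothly bounded strictly pseudoconvex domain with its defining function. -/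
structure Dom (V W : Set (Cn n)) (ρ : Cn n → ℝ) : Prop where
  hW : IsOpen W
  hVW : closure V ⊆ W
  hρ : SmoothOn ρ W
  psh : StrictPlurisubharmonicOn ρ W
  hV : V = {ζ | ρ ζ < 0}
  bd : Bornology.IsBounded V
  grad : ∀ ζ ∈ frontier V, fderiv ℝ ρ ζ ≠ 0

variable (D : Dom V W ρ)

namespace Dom

include D

theorem subW : V ⊆ W := subset_closure.trans D.hVW

theorem neg (hx : x ∈ V) : ρ x < 0 := by
  have := D.hV ▸ hx; exact this

theorem nonneg (hx : x ∉ V) : 0 ≤ ρ x := by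
  by_contra! h
  exact hx (D.hV ▸ h)

theorem isOpen : IsOpen V := by
  have : V = W ∩ ρ ⁻¹' Iio 0 := by
    ext x
    exact ⟨fun hx => ⟨D.subW hx, D.neg hx⟩, fun hx => D.hV ▸ hx.2⟩
  rw [this]
  exact D.hρ.continuousOn.isOpen_inter_preimage D.hW isOpen_Iio

theorem meas : MeasurableSet V := D.isOpen.measurableSet

theorem compact : IsCompact (closure V) := D.bd.isCompact_closure

theorem isCompact_le {ε : ℝ} (hε : 0 < ε) : IsCompact {x | ρ x ≤ -ε} := by
  have : {x | ρ x ≤ -ε} = closure V ∩ ρ ⁻¹' Iic (-ε) := by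
    ext x
    refine ⟨fun hx => ⟨subset_closure ?_, hx⟩, fun hx => hx.2⟩
    by_contra h
    have := D.nonneg h
    simp only [mem_ofPred_eq] at hx
    linarith
  rw [this]
  exact D.compact.of_isClosed_subset ((D.hρ.continuousOn.mono D.hVW).preimage_isClosed_of_isClosed
    isClosed_closure isClosed_Iic) inter_subset_left

theorem smooth : SmoothOn ρ V := D.hρ.mono D.subW

theorem contDiffAt (hx : x ∈ V) : ContDiffAt ℝ ∞ ρ x :=
  D.smooth.contDiffAt (D.isOpen.mem_nhds hx)

theorem bound {E : Type*} [SeminormedAddCommGroup E] {f : Cn n → E}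
    (hf : ContinuousOn f W) : ∃ C > 0, ∀ x ∈ closure V, ‖f x‖ ≤ C := by
  obtain ⟨C, hC⟩ := D.compact.exists_bound_of_continuousOn (hf.mono D.hVW)
  exact ⟨max C 1, by positivity, fun x hx => (hC x hx).trans (le_max_left _ _)⟩

theorem levi_pos :
    ∃ c > 0, ∀ x ∈ closure V, ∀ β : Fin n → ℂ, c * ∑ k, ‖β k‖ ^ 2 ≤ levi ρ x β := by
  have hat : ∀ x ∈ W, ContDiffAt ℝ ∞ ρ x := fun x hx => D.hρ.contDiffAt (D.hW.mem_nhds hx)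
  have h1 : SmoothOn (fderiv ℝ ρ) W := D.hρ.fderiv_of_isOpen D.hW (by simp)
  have h2 : ContinuousOn (fderiv ℝ (fderiv ℝ ρ)) W :=
    (h1.fderiv_of_isOpen D.hW (m := ∞) (by simp)).continuousOn
  let G : Cn n × Cn n → ℝ := fun p =>
    fderiv ℝ (fderiv ℝ ρ) p.1 p.2 p.2 + fderiv ℝ (fderiv ℝ ρ) p.1 (I • p.2) (I • p.2)
  have hG : ContinuousOn G (closure V ×ˢ sphere 0 1) := by
    have h3 : ContinuousOn (fun p : Cn n × Cn n => fderiv ℝ (fderiv ℝ ρ) p.1)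
        (closure V ×ˢ sphere 0 1) := h2.comp continuousOn_fst fun p hp => D.hVW hp.1
    have h4 : ContinuousOn (fun p : Cn n × Cn n => p.2) (closure V ×ˢ sphere 0 1) := continuousOn_snd
    exact ((h3.clm_apply h4).clm_apply h4).add
      ((h3.clm_apply (h4.const_smul I)).clm_apply (h4.const_smul I))
  have hK : IsCompact (closure V ×ˢ sphere (0 : Cn n) 1) := D.compact.prod (isCompact_sphere _ _)
  have hpos : ∀ p ∈ closure V ×ˢ sphere (0 : Cn n) 1, 0 < G p := by
    rintro ⟨x, v⟩ ⟨hx, hv⟩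
    have hv0 : v ≠ 0 := by
      rintro rfl
      simp at hv
    have := D.psh x (D.hVW hx) v hv0
    simpa [G, iteratedFDeriv_two_apply] using this
  obtain ⟨c, hc, hc'⟩ : ∃ c > 0, ∀ p ∈ closure V ×ˢ sphere (0 : Cn n) 1, c ≤ G p := by
    rcases (closure V ×ˢ sphere (0 : Cn n) 1).eq_empty_or_nonempty with h | h
    · exact ⟨1, one_pos, by simp [h]⟩
    · obtain ⟨p, hp, hm⟩ := hK.exists_isMinOn h hG
      exact ⟨G p, hpos p hp, fun q hq => hm hq⟩
  refine ⟨c / 4, by positivity, fun x hx β => ?_⟩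
  have e : levi ρ x β = levi ρ x (WithLp.toLp 2 β : Cn n) := rfl
  rw [e, levi_eq (hat x (D.hVW hx))]
  set v : Cn n := WithLp.toLp 2 β
  have hn : ∑ k, ‖β k‖ ^ 2 = ‖v‖ ^ 2 := by rw [EuclideanSpace.norm_sq_eq]
  rw [hn]
  by_cases hv : v = 0
  · simp [hv]
  have hv' : ‖v‖ ≠ 0 := by simpa using hv
  have := hc' (x, (‖v‖⁻¹ : ℝ) • v) ⟨hx, by simp [norm_smul, hv']⟩
  simp only [G, smul_comm I (‖v‖⁻¹ : ℝ), map_smul, _root_.smul_apply, smul_eq_mul] at this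
  have h5 := mul_le_mul_of_nonneg_left this (sq_nonneg ‖v‖)
  have h6 : ∀ a b : ℝ, ‖v‖ ^ 2 * (‖v‖⁻¹ * (‖v‖⁻¹ * a) + ‖v‖⁻¹ * (‖v‖⁻¹ * b)) = a + b := by
    intro a b; field_simp
  rw [h6] at h5
  linarith

theorem isTest_cut {g : ℝ → ℝ} (hg : ContDiff ℝ ∞ g) {ε : ℝ} (hε : 0 < ε)
    (h0 : ∀ τ, -ε < τ → g τ = 0) : IsTest V (fun x => (g (ρ x) : ℂ)) := by
  have hs : tsupport (fun x => (g (ρ x) : ℂ)) ⊆ {x | ρ x ≤ -ε} := by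
    refine closure_minimal (fun x hx => ?_) (D.isCompact_le hε).isClosed
    by_contra h
    exact hx (by simp [h0 _ (not_le.1 h)])
  have hsV : tsupport (fun x => (g (ρ x) : ℂ)) ⊆ V := fun x hx => by
    rw [D.hV]
    exact lt_of_le_of_lt (show ρ x ≤ -ε from hs hx) (by simpa using hε)
  refine ⟨?_, (D.isCompact_le hε).of_isClosed_subset (isClosed_tsupport _) hs, hsV⟩
  rw [contDiff_iff_contDiffAt]
  intro x
  by_cases hx : x ∈ V
  · exact ofReal_contDiffAt (hg.contDiffAt.comp x (D.contDiffAt hx))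
  · have : (fun x => (g (ρ x) : ℂ)) =ᶠ[𝓝 x] fun _ => 0 := by
      have := (isClosed_tsupport (fun x => (g (ρ x) : ℂ))).isOpen_compl.mem_nhds
        (fun h => hx (hsV h))
      filter_upwards [this] with y hy
      exact image_eq_zero_of_notMem_tsupport (f := fun x => (g (ρ x) : ℂ)) hy
    exact contDiffAt_const.congr_of_eventuallyEq this

end Dom

theorem MemLp.integrable_mul_conj (hf : MemLp f 2 volume) (hg : MemLp g 2 volume) :
    Integrable fun x => f x * conj (g x) :=
  MemLp.integrable_mul (p := 2) (q := 2) hf hg.star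

theorem LL.memLp_mul (hV : IsOpen V) {m : Fn n} (hF : Measurable F) (h : LL V F)
    (hθ : IsTest V θ) (hm : SmoothOn m V) : MemLp (fun x => m x * (θ x * F x)) 2 volume :=
  (h.memLp hF (hθ.mul' hV hm)).ae_eq (.of_forall fun x => by simp only; ring)

theorem re_integral_eq (hf : Integrable f) : (∫ x, f x).re = ∫ x, (f x).re :=
  (integral_re hf).symm

theorem bochner_real (hV : IsOpen V) (hΨ : SmoothOn Ψ V) (hm : ∀ k, Measurable (β k))
    (hβ : ∀ k, LL V (β k)) (hc : WeakClosed V β) (ha : WeakAdj V Ψ β γ) (hγ : IsTest V γ)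
    {g : Cn n → ℝ} (hg : IsTest V ♯g) (hgχ : χ = ♯g) :
    IntegrableOn (fun x => (g x ^ 2 * levi Ψ x (fun k => β k x) -
      ‖(∑ k, dz k χ x * β k x) - χ x * γ x‖ ^ 2 -
      (∑ j, ∑ k, ‖dzb j χ x * β k x - dzb k χ x * β j x‖ ^ 2) / 2) * expR (-Ψ x)) V ∧
    ∫ x in V, (g x ^ 2 * levi Ψ x (fun k => β k x) -
      ‖(∑ k, dz k χ x * β k x) - χ x * γ x‖ ^ 2 -
      (∑ j, ∑ k, ‖dzb j χ x * β k x - dzb k χ x * β j x‖ ^ 2) / 2) * expR (-Ψ x) ≤ 0 := by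
  have hχ : IsTest V χ := hgχ ▸ hg
  have hB := bochner_weak hV hΨ hm hβ hc ha hγ hχ
  have hwt : SmoothOn (wt Ψ) V := contDiffOn_wt hΨ
  have hwr : ∀ x, conj (wt Ψ x) = wt Ψ x := fun x => by rw [wt, Complex.conj_ofReal]
  have i1 : ∀ j k, Integrable fun x => χ x * β k x * (conj (χ x * β j x) *
        (dzb j (dz k ♯Ψ) x * wt Ψ x)) := by
    intro j k
    have h1 : SmoothOn (fun x => dzb j (dz k ♯Ψ) x * wt Ψ x) V :=
      (contDiffOn_dd hV (contDiffOn_dd hV (contDiffOn_ofReal hΨ))).mul hwt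
    refine (MemLp.integrable_mul_conj ((hβ k).memLp_mul hV (hm k) hχ h1)
      ((hβ j).memLp (hm j) hχ)).congr (.of_forall fun x => ?_)
    simp only; ring
  have key : ∀ u : Fn n, MemLp u 2 volume → MemLp (fun x => wt Ψ x * u x) 2 volume →
      Integrable (fun x => u x * (conj (u x) * wt Ψ x)) := fun u h h' =>
    (MemLp.integrable_mul_conj h h').congr (.of_forall fun x => by
      simp only [map_mul, hwr]; ring)
  have hre : ∀ (a : ℂ) (x : Cn n), (a * (conj a * wt Ψ x)).re = ‖a‖ ^ 2 * expR (-Ψ x) := by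
    intro a x
    rw [← mul_assoc, Complex.mul_conj', wt, ← Complex.ofReal_pow, ← Complex.ofReal_mul,
      Complex.ofReal_re]
  have i2 : Integrable fun x => ((∑ k, dz k χ x * β k x) - χ x * γ x) *
        (conj ((∑ k, dz k χ x * β k x) - χ x * γ x) * wt Ψ x) := by
    refine key (fun x => (∑ k, dz k χ x * β k x) - χ x * γ x) ?_ ?_
    · exact (memLp_finsetSum _ fun k _ => (hβ k).memLp (hm k) hχ.dd).sub
        (hχ.mul hV hγ.smooth.contDiffOn).memLp
    · refine ((memLp_finsetSum Finset.univ fun k _ => (hβ k).memLp_mul hV (hm k)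
        (hχ.dd (c := -I) (j := k)) hwt).sub
        ((hχ.mul hV hγ.smooth.contDiffOn).mul' hV hwt).memLp).ae_eq
          (.of_forall fun x => ?_)
      simp only [Pi.sub_apply, mul_sub, mul_sum]
  have i3 : ∀ j k, Integrable fun x => (dzb j χ x * β k x - dzb k χ x * β j x) *
        (conj (dzb j χ x * β k x - dzb k χ x * β j x) * wt Ψ x) := by
    intro j k
    refine key (fun x => dzb j χ x * β k x - dzb k χ x * β j x) ?_ ?_
    · exact ((hβ k).memLp (hm k) hχ.dd).sub ((hβ j).memLp (hm j) hχ.dd)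
    · refine (((hβ k).memLp_mul hV (hm k) (hχ.dd (c := I) (j := j)) hwt).sub
        ((hβ j).memLp_mul hV (hm j) (hχ.dd (c := I) (j := k)) hwt)).ae_eq (.of_forall fun x => ?_)
      simp only [Pi.sub_apply, mul_sub]
  simp only [Complex.re_sum, re_integral_eq (i1 _ _), re_integral_eq i2, re_integral_eq (i3 _ _),
    hre] at hB
  have r1 : ∀ j k, Integrable fun x => (χ x * β k x * (conj (χ x * β j x) *
        (dzb j (dz k ♯Ψ) x * wt Ψ x))).re := fun j k => (i1 j k).re
  have r2 := i2.re
  have r3 : ∀ j k, Integrable fun x => ‖dzb j χ x * β k x - dzb k χ x * β j x‖ ^ 2 *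
      expR (-Ψ x) := fun j k => (i3 j k).re.congr (.of_forall fun x => hre _ x)
  replace r2 : Integrable fun x => ‖(∑ k, dz k χ x * β k x) - χ x * γ x‖ ^ 2 * expR (-Ψ x) :=
    r2.congr (.of_forall fun x => hre _ x)
  have e1 : ∀ x, ∑ j, ∑ k, (χ x * β k x * (conj (χ x * β j x) *
        (dzb j (dz k ♯Ψ) x * wt Ψ x))).re =
      g x ^ 2 * levi Ψ x (fun k => β k x) * expR (-Ψ x) := by
    intro x
    simp only [← Complex.re_sum]
    rw [levi, mul_assoc, mul_comm _ (expR _), ← Complex.re_ofReal_mul, ← Complex.re_ofReal_mul]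
    congr 1
    simp only [mul_sum]
    refine sum_congr rfl fun j _ => sum_congr rfl fun k _ => ?_
    simp only [hgχ, map_mul, Complex.conj_ofReal, wt]
    push_cast
    ring
  have s1 : Integrable fun x => g x ^ 2 * levi Ψ x (fun k => β k x) * expR (-Ψ x) :=
    (integrable_finsetSum Finset.univ fun j _ => integrable_finsetSum Finset.univ fun k _ =>
      r1 j k).congr (.of_forall fun x => e1 x)
  have s3 : Integrable fun x => (∑ j, ∑ k, ‖dzb j χ x * β k x - dzb k χ x * β j x‖ ^ 2) / 2 *
      expR (-Ψ x) := by
    refine ((integrable_finsetSum Finset.univ fun j _ => integrable_finsetSum Finset.univ fun k _ =>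
      r3 j k).div_const 2).congr (.of_forall fun x => ?_)
    simp only [← sum_mul]; ring
  have I1 : ∑ j, ∑ k, ∫ x, (χ x * β k x * (conj (χ x * β j x) *
        (dzb j (dz k ♯Ψ) x * wt Ψ x))).re =
      ∫ x, g x ^ 2 * levi Ψ x (fun k => β k x) * expR (-Ψ x) := by
    simp only [← e1]
    rw [integral_finsetSum _ fun j _ => integrable_finsetSum _ fun k _ => r1 j k]
    refine sum_congr rfl fun j _ => (integral_finsetSum _ fun k _ => r1 j k).symm
  have I3 : (∑ j, ∑ k, ∫ x, ‖dzb j χ x * β k x - dzb k χ x * β j x‖ ^ 2 * expR (-Ψ x)) / 2 =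
      ∫ x, (∑ j, ∑ k, ‖dzb j χ x * β k x - dzb k χ x * β j x‖ ^ 2) / 2 * expR (-Ψ x) := by
    simp only [div_mul_eq_mul_div, sum_mul]
    rw [integral_div, integral_finsetSum _ fun j _ => integrable_finsetSum _ fun k _ => r3 j k]
    congr 1
    refine sum_congr rfl fun j _ => (integral_finsetSum _ fun k _ => r3 j k).symm
  rw [I1, I3] at hB
  have hI : Integrable (fun x => (g x ^ 2 * levi Ψ x (fun k => β k x) -
      ‖(∑ k, dz k χ x * β k x) - χ x * γ x‖ ^ 2 -
      (∑ j, ∑ k, ‖dzb j χ x * β k x - dzb k χ x * β j x‖ ^ 2) / 2) * expR (-Ψ x)) := by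
    simp only [sub_mul]
    exact (s1.sub r2).sub s3
  refine ⟨hI.integrableOn, ?_⟩
  rw [setIntegral_eq_integral_of_forall_compl_eq_zero]
  · simp only [sub_mul]
    rw [integral_sub (s1.sub' r2) s3, integral_sub s1 r2]
    linarith
  · intro x hx
    have h0 : g x = 0 := by
      have := hg.eq_zero hx
      simpa using this
    have h1 : χ x = 0 := hχ.eq_zero hx
    have h2 : ∀ k, dz k χ x = 0 := fun k => (hχ.dd).eq_zero hx
    have h3 : ∀ k, dzb k χ x = 0 := fun k => (hχ.dd).eq_zero hx
    simp [h0, h1, h2, h3]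

/-- The cutoff function `τ ↦ e^{η/τ} T(-2^j τ - 1)`. -/
def cutE (η : ℝ) (j : ℕ) (τ : ℝ) : ℝ := expR (η / τ) * smoothTransition (-2 ^ j * τ - 1)

/-- The part of the squared derivative of `cutE` caused by the compactly supported factor. -/
def cutErr (η : ℝ) (j : ℕ) (τ : ℝ) : ℝ :=
  2 * (expR (η / τ) * (2 ^ j * deriv smoothTransition (-2 ^ j * τ - 1))) ^ 2

theorem cutE_eq_zero {j : ℕ} (h : -((2 : ℝ) ^ j)⁻¹ < τ) : cutE η j τ = 0 := by
  rw [cutE, smoothTransition.zero_of_nonpos, mul_zero]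
  have h2 : (0 : ℝ) < 2 ^ j := by positivity
  have := mul_lt_mul_of_pos_left h h2
  rw [mul_neg, mul_inv_cancel₀ h2.ne'] at this
  linarith

theorem contDiff_cutE (η : ℝ) (j : ℕ) : ContDiff ℝ ∞ (cutE η j) := by
  rw [contDiff_iff_contDiffAt]
  intro τ
  have h2 : (0 : ℝ) < ((2 : ℝ) ^ j)⁻¹ := by positivity
  rcases lt_or_ge τ 0 with h | h
  · have h1 : ContDiffAt ℝ ∞ (fun τ : ℝ => expR (η / τ)) τ :=
      (contDiffAt_const.div contDiffAt_id h.ne).exp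
    have h3 : ContDiffAt ℝ ∞ (fun τ : ℝ => smoothTransition (-2 ^ j * τ - 1)) τ :=
      smoothTransition.contDiff.contDiffAt.comp τ
        ((contDiffAt_const.mul contDiffAt_id).sub contDiffAt_const)
    exact h1.mul h3
  · refine (contDiffAt_const (c := (0 : ℝ))).congr_of_eventuallyEq ?_
    filter_upwards [Ioi_mem_nhds (show -((2 : ℝ) ^ j)⁻¹ < τ by linarith)] with y hy
    exact cutE_eq_zero hy

theorem cutE_mem (hη : 0 ≤ η) {j : ℕ} (hτ : τ < 0) : cutE η j τ ∈ Icc (0 : ℝ) 1 := by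
  have h1 : expR (η / τ) ≤ 1 := Real.exp_le_one_iff.2 (div_nonpos_of_nonneg_of_nonpos hη hτ.le)
  exact ⟨mul_nonneg (exp_pos _).le (smoothTransition.nonneg _),
    mul_le_one₀ h1 (smoothTransition.nonneg _) (smoothTransition.le_one _)⟩

theorem deriv_cutE_sq_le {j : ℕ} (hτ : τ < 0) :
    deriv (cutE η j) τ ^ 2 ≤ 2 * η ^ 2 * (τ ^ 4)⁻¹ * cutE η j τ ^ 2 + cutErr η j τ := by
  have h1 : HasDerivAt (fun τ : ℝ => expR (η / τ)) (expR (η / τ) * (-η / τ ^ 2)) τ := by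
    have := ((hasDerivAt_inv hτ.ne).const_mul η).exp
    simp only [← div_eq_mul_inv] at this
    convert this using 1
    field_simp
  have hd : Differentiable ℝ smoothTransition :=
    (smoothTransition.contDiff (n := 1)).differentiable (by simp)
  have h2 : HasDerivAt (fun τ : ℝ => smoothTransition (-2 ^ j * τ - 1))
      (deriv smoothTransition (-2 ^ j * τ - 1) * (-2 ^ j * 1)) τ :=
    (hd _).hasDerivAt.comp τ (((hasDerivAt_id τ).const_mul _).sub_const _)
  rw [show deriv (cutE η j) τ = _ from (h1.mul h2).deriv, cutErr, cutE]
  set a := expR (η / τ)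
  set b := smoothTransition (-2 ^ j * τ - 1)
  set d := deriv smoothTransition (-2 ^ j * τ - 1)
  have e : (τ ^ 4)⁻¹ = (τ ^ 2)⁻¹ ^ 2 := by rw [← inv_pow]; ring
  rw [e, div_eq_mul_inv]
  nlinarith [sq_nonneg (a * (-η * (τ ^ 2)⁻¹) * b - a * (d * (-2 ^ j * 1)))]

theorem cutErr_nonneg {j : ℕ} : 0 ≤ cutErr η j τ := by unfold cutErr; positivity

theorem deriv_smoothTransition_of_gt {x : ℝ} (hx : 1 < x) : deriv smoothTransition x = 0 := by
  have : smoothTransition =ᶠ[𝓝 x] fun _ => 1 := by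
    filter_upwards [Ioi_mem_nhds hx] with y hy
    exact smoothTransition.one_of_one_le hy.le
  rw [this.deriv_eq, deriv_const]

theorem deriv_smoothTransition_of_lt {x : ℝ} (hx : x < 0) : deriv smoothTransition x = 0 := by
  have : smoothTransition =ᶠ[𝓝 x] fun _ => 0 := by
    filter_upwards [Iio_mem_nhds hx] with y hy
    exact smoothTransition.zero_of_nonpos hy.le
  rw [this.deriv_eq, deriv_const]

theorem continuous_deriv_smoothTransition : Continuous (deriv smoothTransition) :=
  (smoothTransition.contDiff (n := 1)).continuous_deriv (by simp)

theorem exists_bound_deriv_smoothTransition : ∃ C > 0, ∀ x, |deriv smoothTransition x| ≤ C := by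
  obtain ⟨C, hC⟩ := (isCompact_Icc (a := (0 : ℝ)) (b := 1)).exists_bound_of_continuousOn
    continuous_deriv_smoothTransition.continuousOn
  refine ⟨max C 1, by positivity, fun x => ?_⟩
  rcases lt_or_ge x 0 with h | h
  · simp [deriv_smoothTransition_of_lt h]
  rcases lt_or_ge 1 x with h' | h'
  · simp [deriv_smoothTransition_of_gt h']
  · exact (hC x ⟨h, h'⟩).trans (le_max_left _ _)

theorem cutErr_le (hη : 0 < η) : ∃ C, ∀ j, ∀ τ < 0, cutErr η j τ ≤ C := by
  obtain ⟨C, hC, hC'⟩ := exists_bound_deriv_smoothTransition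
  refine ⟨2 * (2 / η * C) ^ 2, fun j τ hτ => ?_⟩
  rw [cutErr]
  have h1 : expR (η / τ) * 2 ^ j * |deriv smoothTransition (-2 ^ j * τ - 1)| ≤
      2 / η * C := by
    rcases lt_or_ge 1 (-2 ^ j * τ - 1) with h | h
    · rw [deriv_smoothTransition_of_gt h]
      simp only [abs_zero, mul_zero]; positivity
    · refine mul_le_mul ?_ (hC' _) (abs_nonneg _) (by positivity)
      have h2 : expR (η / τ) * (η / (-τ)) ≤ 1 := by
        have := Real.add_one_le_exp (η / (-τ))
        have e : expR (η / τ) * expR (η / (-τ)) = 1 := by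
          rw [← rexp_add, div_neg, add_neg_cancel, Real.exp_zero]
        have := mul_le_mul_of_nonneg_left this (exp_pos (η / τ)).le
        rw [e] at this
        nlinarith [exp_pos (η / τ)]
      have h3 : (2 : ℝ) ^ j * (-τ) ≤ 2 := by linarith
      have hτ' : 0 < -τ := by linarith
      rw [le_div_iff₀ hη]
      have h4 : expR (η / τ) * η ≤ -τ := by
        rw [← mul_div_assoc, div_le_one hτ'] at h2
        exact h2
      nlinarith [show (0 : ℝ) < 2 ^ j by positivity]
  have h2 : |expR (η / τ) * (2 ^ j * deriv smoothTransition (-2 ^ j * τ - 1))| ≤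
      2 / η * C := by
    rw [← mul_assoc, abs_mul, abs_of_pos (by positivity : 0 < expR (η / τ) * 2 ^ j)]
    exact h1
  have := sq_le_sq' (by linarith [abs_nonneg (expR (η / τ) *
    (2 ^ j * deriv smoothTransition (-2 ^ j * τ - 1))), neg_abs_le (expR (η / τ) *
    (2 ^ j * deriv smoothTransition (-2 ^ j * τ - 1)))]) (le_trans (le_abs_self _) h2)
  linarith

theorem eventually_two_pow (hτ : τ < 0) (C : ℝ) : ∀ᶠ j : ℕ in atTop, C < -2 ^ j * τ - 1 := by
  have h := (tendsto_pow_atTop_atTop_of_one_lt (one_lt_two (α := ℝ))).atTop_mul_const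
    (show 0 < -τ by linarith)
  filter_upwards [h.eventually_gt_atTop (C + 1)] with j hj
  linarith

theorem tendsto_cutErr (hτ : τ < 0) : Tendsto (fun j => cutErr η j τ) atTop (𝓝 0) := by
  refine tendsto_const_nhds.congr' ?_
  filter_upwards [eventually_two_pow hτ 1] with j hj
  rw [cutErr, deriv_smoothTransition_of_gt hj]; simp

theorem continuousOn_cutErr (η : ℝ) (j : ℕ) : ContinuousOn (cutErr η j) (Iio 0) := by
  have h1 : ContinuousOn (fun τ : ℝ => expR (η / τ)) (Iio 0) :=
    (continuousOn_const.div continuousOn_id fun x hx => ne_of_lt hx).rexp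
  have h2 : Continuous fun τ : ℝ => 2 ^ j * deriv smoothTransition (-2 ^ j * τ - 1) :=
    continuous_const.mul (continuous_deriv_smoothTransition.comp (by fun_prop))
  exact continuousOn_const.mul ((h1.mul h2.continuousOn).pow 2)

theorem levi_sum_bound {P b : Fin n → ℂ} {D : ℂ} (hD : D = ∑ k, P k * b k) :
    ‖D‖ ^ 2 ≤ (∑ k, ‖P k‖ ^ 2) * ∑ k, ‖b k‖ ^ 2 := by
  have h1 : ‖D‖ ≤ ∑ k, ‖P k‖ * ‖b k‖ := by
    rw [hD]
    exact (norm_sum_le _ _).trans (sum_le_sum fun k _ => (norm_mul_le _ _))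
  calc ‖D‖ ^ 2 ≤ (∑ k, ‖P k‖ * ‖b k‖) ^ 2 := by gcongr
    _ ≤ _ := Finset.sum_mul_sq_le_sq_mul_sq _ _ _

theorem antisymm_sum_bound (P b : Fin n → ℂ) :
    (∑ j, ∑ k, ‖P j * b k - P k * b j‖ ^ 2) / 2 ≤ 2 * ((∑ k, ‖P k‖ ^ 2) * ∑ k, ‖b k‖ ^ 2) := by
  have h : ∀ j k, ‖P j * b k - P k * b j‖ ^ 2 ≤
      2 * (‖P j‖ ^ 2 * ‖b k‖ ^ 2) + 2 * (‖P k‖ ^ 2 * ‖b j‖ ^ 2) := by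
    intro j k
    have h1 := norm_sub_le (P j * b k) (P k * b j)
    rw [norm_mul, norm_mul] at h1
    nlinarith [sq_nonneg (‖P j‖ * ‖b k‖ - ‖P k‖ * ‖b j‖), norm_nonneg (P j * b k - P k * b j),
      norm_nonneg (P j), norm_nonneg (P k), norm_nonneg (b j), norm_nonneg (b k)]
  have h2 := sum_le_sum fun j (_ : j ∈ Finset.univ) =>
    sum_le_sum fun k (_ : k ∈ Finset.univ) => h j k
  refine (div_le_div_of_nonneg_right h2 (by norm_num)).trans (le_of_eq ?_)
  simp only [sum_add_distrib, ← mul_sum, ← sum_mul]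
  ring

theorem Dom.dz_bound (D : Dom V W ρ) :
    ∃ C > 0, ∀ x ∈ closure V, ∑ k, ‖dz k ♯ρ x‖ ^ 2 ≤ C := by
  have : ContinuousOn (fun x => ∑ k, ‖dz k ♯ρ x‖ ^ 2) W :=
    continuousOn_finsetSum _ fun k _ =>
      ((contDiffOn_dd D.hW (contDiffOn_ofReal D.hρ)).continuousOn.norm.pow 2)
  obtain ⟨C, hC, h⟩ := D.bound this
  exact ⟨C, hC, fun x hx => (le_abs_self _).trans (h x hx)⟩

theorem apriori_cut (D : Dom V W ρ) (hΦ : SmoothOn Φ V) {c θ : ℝ} (hσ : 0 < σ)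
    (hΨ : Ψ = fun x => Φ x + -σ * (ρ x ^ 3)⁻¹)
    (hm : ∀ k, Measurable (β k)) (hβ : ∀ k, LL V (β k))
    (hc : WeakClosed V β) (ha : WeakAdj V Ψ β γ) (hγ : IsTest V γ)
    (hlev : ∀ x ∈ closure V, ∀ β : Fin n → ℂ, c * ∑ k, ‖β k‖ ^ 2 ≤ levi ρ x β)
    (hC : ∀ x ∈ closure V, ∑ k, ‖dz k ♯ρ x‖ ^ 2 ≤ C)
    (hθ : 0 < θ) (hη : 0 < η) (hη' : (3 + 1 / θ) * C * (2 * η ^ 2) ≤ 3 * c * σ) (j : ℕ) :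
    ∃ G : Cn n → ℝ, IntegrableOn G V ∧ ∫ x in V, G x ≤ 0 ∧ ∀ x ∈ V,
      (cutE η j (ρ x) ^ 2 * levi Φ x (fun k => β k x) - (1 + θ) * ‖γ x‖ ^ 2
      - (3 + 1 / θ) * C * (cutErr η j (ρ x) * ∑ k, ‖β k x‖ ^ 2)) * expR (-Ψ x) ≤ G x := by
  have h2j : (0 : ℝ) < ((2 : ℝ) ^ j)⁻¹ := by positivity
  have hg := D.isTest_cut (contDiff_cutE η j) h2j fun τ => cutE_eq_zero
  have hF : ∀ τ < 0, HasDerivAt (fun τ : ℝ => -σ * (τ ^ 3)⁻¹) (3 * σ * (τ ^ 4)⁻¹) τ := by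
    intro τ hτ
    have := ((hasDerivAt_pow 3 τ).inv (pow_ne_zero 3 hτ.ne)).const_mul (-σ)
    have h0 := hτ.ne
    refine HasDerivAt.congr_deriv (f := fun τ : ℝ => _) this ?_
    field_simp
    push_cast
    ring
  have hF' : ∀ τ < 0, HasDerivAt (fun τ : ℝ => 3 * σ * (τ ^ 4)⁻¹) (-12 * σ * (τ ^ 5)⁻¹) τ := by
    intro τ hτ
    have := ((hasDerivAt_pow 4 τ).inv (pow_ne_zero 4 hτ.ne)).const_mul (3 * σ)
    have h0 := hτ.ne
    refine HasDerivAt.congr_deriv (f := fun τ : ℝ => _) this ?_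
    field_simp
    push_cast
    ring
  have hsm : ∀ x ∈ V, ContDiffAt ℝ ∞ (fun x => -σ * (ρ x ^ 3)⁻¹) x := fun x hx =>
    contDiffAt_const.mul (((D.contDiffAt hx).pow 3).inv (pow_ne_zero 3 (D.neg hx).ne))
  have hΨs : SmoothOn Ψ V := by
    rw [hΨ]
    exact hΦ.add fun x hx => (hsm x hx).contDiffWithinAt
  obtain ⟨hI, h0⟩ := bochner_real D.isOpen hΨs hm hβ hc ha hγ hg rfl
  refine ⟨_, hI, h0, fun x hx => mul_le_mul_of_nonneg_right ?_ (exp_pos _).le⟩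
  set τ := ρ x with hτdef
  have hτ : τ < 0 := D.neg hx
  set B := ∑ k, ‖β k x‖ ^ 2 with hB
  have hB0 : 0 ≤ B := sum_nonneg fun k _ => sq_nonneg _
  have hlΨ : levi Φ x (fun k => β k x) + 3 * σ * (τ ^ 4)⁻¹ * (c * B) ≤
      levi Ψ x (fun k => β k x) := by
    rw [hΨ, levi_add (hΦ.contDiffAt (D.isOpen.mem_nhds hx)) (hsm x hx),
      levi_comp (F := fun τ => -σ * (τ ^ 3)⁻¹) (F' := fun τ => 3 * σ * (τ ^ 4)⁻¹) (D.contDiffAt hx) ?_ (hF' _ hτ)]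
    · have h1 := hlev x (subset_closure hx) fun k => β k x
      have h2 : (τ ^ 5)⁻¹ ≤ 0 := inv_nonpos.2 (by
        rw [show τ ^ 5 = τ ^ 4 * τ by ring]
        exact mul_nonpos_of_nonneg_of_nonpos (by positivity) hτ.le)
      have h3 : 0 ≤ -12 * σ * (τ ^ 5)⁻¹ := by nlinarith
      have h4 : 0 ≤ 3 * σ * (τ ^ 4)⁻¹ := by positivity
      have := mul_nonneg h3 (sq_nonneg ‖∑ k, dz k ♯ρ x * β k x‖)
      have := mul_le_mul_of_nonneg_left h1 h4
      simp only [← hτdef]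
      linarith
    · filter_upwards [Iio_mem_nhds hτ] with y hy using hF y hy
  set g := cutE η j τ
  set g' := deriv (cutE η j) τ
  have hdd : ∀ c k, dd c k (fun x => ((cutE η j (ρ x) : ℝ) : ℂ)) x =
      (g' : ℂ) * dd c k ♯ρ x := fun c k =>
    dd_comp_real ((contDiff_cutE η j).differentiable (by simp) _).hasDerivAt
      ((D.contDiffAt hx).differentiableAt (by simp))
  have hP := hC x (subset_closure hx)
  set P := ∑ k, ‖dz k ♯ρ x‖ ^ 2
  have hP0 : 0 ≤ P := sum_nonneg fun k _ => sq_nonneg _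
  have hg'0 : 0 ≤ g' ^ 2 := sq_nonneg _
  have hE1 : ‖(∑ k, dz k (fun x => ((cutE η j (ρ x) : ℝ) : ℂ)) x * β k x) - (g : ℂ) * γ x‖ ^ 2 ≤
      (1 + θ) * ‖γ x‖ ^ 2 + (1 + 1 / θ) * (g' ^ 2 * (P * B)) := by
    have e : ∑ k, dz k (fun x => ((cutE η j (ρ x) : ℝ) : ℂ)) x * β k x =
        (g' : ℂ) * ∑ k, dz k ♯ρ x * β k x := by
      rw [mul_sum]
      refine sum_congr rfl fun k _ => ?_
      simp only [dz, hdd]; ring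
    rw [e]
    have h1 := levi_sum_bound (P := fun k => dz k ♯ρ x) (b := fun k => β k x) rfl
    set S := ∑ k, dz k ♯ρ x * β k x
    have h2 := norm_sub_le ((g' : ℂ) * S) ((g : ℂ) * γ x)
    have h3 : ‖(g' : ℂ) * S‖ ^ 2 ≤ g' ^ 2 * (P * B) := by
      rw [norm_mul, mul_pow, norm_real, norm_eq_abs, sq_abs]
      exact mul_le_mul_of_nonneg_left h1 hg'0
    have hgm := cutE_mem (j := j) hη.le hτ
    have h4 : ‖(g : ℂ) * γ x‖ ≤ ‖γ x‖ := by
      rw [norm_mul, norm_real, norm_eq_abs, abs_of_nonneg hgm.1]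
      exact mul_le_of_le_one_left (norm_nonneg _) hgm.2
    set a := ‖(g' : ℂ) * S‖
    have h5 : ‖(g' : ℂ) * S - (g : ℂ) * γ x‖ ≤ a + ‖γ x‖ := h2.trans (by gcongr)
    have ha0 : 0 ≤ a := norm_nonneg _
    have h6 : (a + ‖γ x‖) ^ 2 ≤ (1 + θ) * ‖γ x‖ ^ 2 + (1 + 1 / θ) * a ^ 2 := by
      have : (0 : ℝ) ≤ (θ * ‖γ x‖ - a) ^ 2 / θ := by positivity
      have e : (θ * ‖γ x‖ - a) ^ 2 / θ = θ * ‖γ x‖ ^ 2 - 2 * a * ‖γ x‖ + 1 / θ * a ^ 2 := by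
        field_simp
        ring
      nlinarith
    have h7 : (1 + 1 / θ) * a ^ 2 ≤ (1 + 1 / θ) * (g' ^ 2 * (P * B)) :=
      mul_le_mul_of_nonneg_left h3 (by positivity)
    have h8 : ‖(g' : ℂ) * S - (g : ℂ) * γ x‖ ^ 2 ≤ (a + ‖γ x‖) ^ 2 := by gcongr
    linarith
  have hE2 : (∑ j', ∑ k, ‖dzb j' (fun x => ((cutE η j (ρ x) : ℝ) : ℂ)) x * β k x -
      dzb k (fun x => ((cutE η j (ρ x) : ℝ) : ℂ)) x * β j' x‖ ^ 2) / 2 ≤ 2 * (g' ^ 2 * (P * B)) := by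
    have h1 := antisymm_sum_bound (fun k => dzb k (fun x => ((cutE η j (ρ x) : ℝ) : ℂ)) x)
      (fun k => β k x)
    have e : ∑ k, ‖dzb k (fun x => ((cutE η j (ρ x) : ℝ) : ℂ)) x‖ ^ 2 = g' ^ 2 * P := by
      rw [mul_sum]
      refine sum_congr rfl fun k _ => ?_
      simp only [dzb, hdd]
      rw [norm_mul, mul_pow, norm_real, norm_eq_abs, sq_abs]
      have : dd I k ♯ρ x = conj (dz k ♯ρ x) := dzb_ofReal
      rw [this, Complex.norm_conj]
    rw [e] at h1
    linarith
  have hg'2 : g' ^ 2 ≤ 2 * η ^ 2 * (τ ^ 4)⁻¹ * g ^ 2 + cutErr η j τ := deriv_cutE_sq_le hτ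
  have hK : 0 ≤ 3 + 1 / θ := by positivity
  have f1 : (3 + 1 / θ) * (g' ^ 2 * (P * B)) ≤
      (3 + 1 / θ) * ((2 * η ^ 2 * (τ ^ 4)⁻¹ * g ^ 2 + cutErr η j τ) * (C * B)) := by
    refine mul_le_mul_of_nonneg_left (mul_le_mul hg'2 (by gcongr) (by positivity) ?_) hK
    have := cutErr_nonneg (η := η) (τ := τ) (j := j)
    positivity
  have f2 : (3 + 1 / θ) * C * (2 * η ^ 2) * ((τ ^ 4)⁻¹ * g ^ 2 * B) ≤
      3 * c * σ * ((τ ^ 4)⁻¹ * g ^ 2 * B) := mul_le_mul_of_nonneg_right hη' (by positivity)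
  have f3 := mul_le_mul_of_nonneg_left hlΨ (sq_nonneg g)
  nlinarith

theorem apriori (D : Dom V W ρ) (hΦ : SmoothOn Φ V) (hL : ∀ x ∈ V, ∀ β, 0 ≤ levi Φ x β)
    (hσ : 0 < σ) (hΨ : Ψ = fun x => Φ x + -σ * (ρ x ^ 3)⁻¹)
    (hm : ∀ k, Measurable (β k)) (hβ : ∀ k, LL V (β k))
    (hb : IntegrableOn (fun x => (∑ k, ‖β k x‖ ^ 2) * expR (-Ψ x)) V)
    (hc : WeakClosed V β) (ha : WeakAdj V Ψ β γ) (hγ : IsTest V γ) :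
    ∫⁻ x in V, ofR (levi Φ x (fun k => β k x) * expR (-Ψ x)) ≤
      NV V (fun x => expR (-Ψ x)) γ := by
  obtain ⟨c, hc0, hlev⟩ := D.levi_pos
  obtain ⟨C, hC0, hC⟩ := D.dz_bound
  have hΨs : SmoothOn Ψ V := by
    rw [hΨ]
    exact hΦ.add (contDiffOn_const.mul ((D.smooth.pow 3).inv
      fun x hx => pow_ne_zero 3 (D.neg hx).ne))
  have hγi : IntegrableOn (fun x => ‖γ x‖ ^ 2 * expR (-Ψ x)) V := by
    have h1 := (hγ.integrable_mul (g := fun x => conj (γ x) * wt Ψ x) D.isOpen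
      ((contDiffOn_conj hγ.smooth.contDiffOn).mul (contDiffOn_wt hΨs))).re
    refine h1.integrableOn.congr_fun (fun x _ => ?_) D.meas
    simp only
    rw [← mul_assoc, Complex.mul_conj', wt, ← Complex.ofReal_pow, ← Complex.ofReal_mul]
    exact Complex.ofReal_re _
  set A := ∫ x in V, ‖γ x‖ ^ 2 * expR (-Ψ x) with hA
  have hNA : NV V (fun x => expR (-Ψ x)) γ = ofR A := by
    rw [hA, ofReal_integral_eq_lintegral_ofReal hγi
      (.of_forall fun x => by positivity), NV]
    refine lintegral_congr fun x => ?_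
    rw [eofReal_mul (by positivity), eofReal_pow (norm_nonneg _), ofReal_norm]
  have hlm : ∀ η j, AEMeasurable (fun x => ofR (cutE η j (ρ x) ^ 2 *
      (levi Φ x (fun k => β k x) * expR (-Ψ x)))) (vol V) := by
    intro η j
    have h1 : AEMeasurable (fun x => cutE η j (ρ x)) (vol V) :=
      ((contDiff_cutE η j).continuous.comp_continuousOn D.smooth.continuousOn).aemeasurable D.meas
    have h2 : AEMeasurable (fun x => expR (-Ψ x)) (vol V) :=
      (hΨs.continuousOn.neg.rexp).aemeasurable D.meas
    have h3 : AEMeasurable (fun x => levi Φ x (fun k => β k x)) (vol V) := by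
      unfold levi
      refine Complex.measurable_re.comp_aemeasurable ?_
      refine Finset.aemeasurable_fun_sum _ fun j _ => Finset.aemeasurable_fun_sum _ fun k _ => ?_
      refine AEMeasurable.mul (AEMeasurable.mul ?_ (hm k).aemeasurable)
        (Complex.continuous_conj.measurable.comp (hm j)).aemeasurable
      exact (contDiffOn_dd D.isOpen (contDiffOn_dd D.isOpen
        (contDiffOn_ofReal hΦ))).continuousOn.aemeasurable D.meas
    exact ((h1.pow_const 2).mul (h3.mul h2)).ennreal_ofReal
  have hEi : ∀ η > 0, ∀ j, IntegrableOn (fun x => cutErr η j (ρ x) *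
      ((∑ k, ‖β k x‖ ^ 2) * expR (-Ψ x))) V := by
    intro η hη j
    obtain ⟨B, hB⟩ := cutErr_le hη
    refine Integrable.bdd_mul (c := B) hb ?_ ?_
    · exact ((continuousOn_cutErr η j).comp D.smooth.continuousOn
        fun x hx => D.neg hx).aestronglyMeasurable D.meas
    · refine (ae_restrict_iff' D.meas).2 (.of_forall fun x hx => ?_)
      rw [norm_eq_abs, abs_of_nonneg cutErr_nonneg]
      exact hB j _ (D.neg hx)
  have hE0 : ∀ η > 0, Tendsto (fun j => ∫ x in V, cutErr η j (ρ x) *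
      ((∑ k, ‖β k x‖ ^ 2) * expR (-Ψ x))) atTop (𝓝 0) := by
    intro η hη
    obtain ⟨B, hB⟩ := cutErr_le hη
    have := tendsto_integral_of_dominated_convergence (μ := vol V) (f := fun _ => (0 : ℝ))
      (F := fun j x => cutErr η j (ρ x) * ((∑ k, ‖β k x‖ ^ 2) * expR (-Ψ x)))
      (fun x => B * ((∑ k, ‖β k x‖ ^ 2) * expR (-Ψ x)))
      (fun j => (hEi η hη j).aestronglyMeasurable) (hb.const_mul B) ?_ ?_
    · simpa using this
    · refine fun j => (ae_restrict_iff' D.meas).2 (.of_forall fun x hx => ?_)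
      have h0 : 0 ≤ (∑ k, ‖β k x‖ ^ 2) * expR (-Ψ x) := by positivity
      rw [norm_eq_abs, abs_of_nonneg (mul_nonneg cutErr_nonneg h0)]
      exact mul_le_mul_of_nonneg_right (hB j _ (D.neg hx)) h0
    · refine (ae_restrict_iff' D.meas).2 (.of_forall fun x hx => ?_)
      simpa using (tendsto_cutErr (η := η) (D.neg hx)).mul_const
        ((∑ k, ‖β k x‖ ^ 2) * expR (-Ψ x))
  have hstep : ∀ m : ℕ, ∃ η > 0, η ≤ 1 / ((m : ℝ) + 1) ∧ ∃ j ≥ m,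
      ∫⁻ x in V, ofR (cutE η j (ρ x) ^ 2 *
        (levi Φ x (fun k => β k x) * expR (-Ψ x))) ≤
      ofR ((1 + 1 / ((m : ℝ) + 1)) * A + 1 / ((m : ℝ) + 1)) := by
    intro m
    set θ := 1 / ((m : ℝ) + 1) with hθ
    have hθ0 : 0 < θ := by positivity
    set K := (3 + 1 / θ) * C with hK
    have hK0 : 0 < K := by positivity
    obtain ⟨η, hη, hη1, hη2⟩ : ∃ η > 0, η ≤ θ ∧ K * (2 * η ^ 2) ≤ 3 * c * σ := by
      have h : Tendsto (fun η : ℝ => K * (2 * η ^ 2)) (𝓝[>] 0) (𝓝 0) := by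
        have : Tendsto (fun η : ℝ => K * (2 * η ^ 2)) (𝓝 0) (𝓝 (K * (2 * 0 ^ 2))) :=
          Continuous.tendsto (by fun_prop) 0
        simpa using this.mono_left nhdsWithin_le_nhds
      have h1 := h.eventually_lt_const (show 0 < 3 * c * σ by positivity)
      obtain ⟨η, h2, h3, h4⟩ := (h1.and (Ioc_mem_nhdsGT hθ0)).exists
      exact ⟨η, h3, h4, h2.le⟩
    have h5 := ((hE0 η hη).const_mul K)
    rw [mul_zero] at h5
    obtain ⟨j, hj, hjm⟩ := ((h5.eventually_lt_const hθ0).and (eventually_ge_atTop m)).exists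
    refine ⟨η, hη, hη1, j, hjm, ?_⟩
    obtain ⟨G, hGi, hG0, hG⟩ := apriori_cut D hΦ hσ hΨ hm hβ hc ha hγ hlev hC hθ0 hη hη2 j
    have hR : IntegrableOn (fun x => G x + ((1 + θ) * (‖γ x‖ ^ 2 * expR (-Ψ x)) +
        K * (cutErr η j (ρ x) * ((∑ k, ‖β k x‖ ^ 2) * expR (-Ψ x))))) V :=
      hGi.add ((hγi.const_mul _).add ((hEi η hη j).const_mul _))
    have hle : ∀ x ∈ V, cutE η j (ρ x) ^ 2 * (levi Φ x (fun k => β k x) * expR (-Ψ x)) ≤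
        G x + ((1 + θ) * (‖γ x‖ ^ 2 * expR (-Ψ x)) +
        K * (cutErr η j (ρ x) * ((∑ k, ‖β k x‖ ^ 2) * expR (-Ψ x)))) := fun x hx => by
      have := hG x hx
      rw [← hK] at this
      linarith
    have hnn : ∀ x ∈ V, 0 ≤ cutE η j (ρ x) ^ 2 * (levi Φ x (fun k => β k x) * expR (-Ψ x)) :=
      fun x hx => mul_nonneg (sq_nonneg _) (mul_nonneg (hL x hx _) (exp_pos _).le)
    calc _ ≤ ∫⁻ x in V, ofR (G x + ((1 + θ) * (‖γ x‖ ^ 2 * expR (-Ψ x)) +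
        K * (cutErr η j (ρ x) * ((∑ k, ‖β k x‖ ^ 2) * expR (-Ψ x))))) :=
          setLIntegral_mono_ae' D.meas (.of_forall fun x hx =>
            ofReal_le_ofReal (hle x hx))
      _ = ofR (∫ x in V, (G x + ((1 + θ) * (‖γ x‖ ^ 2 * expR (-Ψ x)) +
        K * (cutErr η j (ρ x) * ((∑ k, ‖β k x‖ ^ 2) * expR (-Ψ x)))))) :=
          (ofReal_integral_eq_lintegral_ofReal hR ((ae_restrict_iff' D.meas).2
            (.of_forall fun x hx => (hnn x hx).trans (hle x hx)))).symm
      _ ≤ _ := by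
        refine ofReal_le_ofReal ?_
        rw [integral_add hGi (hR.sub hGi |>.congr (.of_forall fun x => by simp)),
          integral_add (hγi.const_mul _) ((hEi η hη j).const_mul _), integral_const_mul,
          integral_const_mul]
        linarith
  choose η hη0 hη1 j hj hle using hstep
  have hpt : ∀ x ∈ V, Tendsto (fun m => ofR (cutE (η m) (j m) (ρ x) ^ 2 *
      (levi Φ x (fun k => β k x) * expR (-Ψ x)))) atTop
      (𝓝 (ofR (levi Φ x (fun k => β k x) * expR (-Ψ x)))) := by
    intro x hx
    have hη : Tendsto η atTop (𝓝 0) := squeeze_zero (fun m => (hη0 m).le) hη1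
      tendsto_one_div_add_atTop_nhds_zero_nat
    have h1 : Tendsto (fun m => cutE (η m) (j m) (ρ x)) atTop (𝓝 1) := by
      have h2 : Tendsto (fun m => expR (η m / ρ x)) atTop (𝓝 1) := by
        simpa using (hη.div_const (ρ x)).rexp
      refine h2.congr' ?_
      filter_upwards [(tendsto_atTop_mono hj tendsto_id).eventually
        (eventually_two_pow (D.neg hx) 1)] with m hm
      rw [cutE, smoothTransition.one_of_one_le hm.le, mul_one]
    have h3 := ((h1.pow 2).mul_const (levi Φ x (fun k => β k x) * expR (-Ψ x)))
    simp only [one_pow, one_mul] at h3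
    exact ENNReal.tendsto_ofReal h3
  calc _ = ∫⁻ x in V, liminf (fun m => ofR (cutE (η m) (j m) (ρ x) ^ 2 *
      (levi Φ x (fun k => β k x) * expR (-Ψ x)))) atTop :=
        setLIntegral_congr_fun D.meas fun x hx => (hpt x hx).liminf_eq.symm
    _ ≤ liminf (fun m => ∫⁻ x in V, ofR (cutE (η m) (j m) (ρ x) ^ 2 *
      (levi Φ x (fun k => β k x) * expR (-Ψ x)))) atTop :=
        lintegral_liminf_le' fun m => hlm _ _
    _ ≤ liminf (fun m : ℕ => ofR ((1 + 1 / ((m : ℝ) + 1)) * A + 1 / ((m : ℝ) + 1)))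
        atTop := liminf_le_liminf (.of_forall hle)
    _ = _ := by
      rw [hNA]
      refine Tendsto.liminf_eq (ENNReal.tendsto_ofReal ?_)
      have h := tendsto_one_div_add_atTop_nhds_zero_nat (𝕜 := ℝ)
      simpa using ((h.const_add 1).mul_const A).add h

theorem NV_mono_set {E : Type*} [NormedAddCommGroup E] {f : Cn n → E}
    (h : K ⊆ V) : NV K w f ≤ NV V w f := lintegral_mono_set h

theorem NV_one {E : Type*} [NormedAddCommGroup E] {f : Cn n → E} :
    NV V (fun _ => 1) f = ∫⁻ x in V, ‖f x‖ₑ ^ 2 := by simp [NV]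

theorem NV_lt_top_of_compact {E : Type*} [NormedAddCommGroup E] {f : Cn n → E}
    (hV : MeasurableSet V) (hf : Continuous f) (hc : HasCompactSupport f) (hs : tsupport f ⊆ V)
    (hw : ContinuousOn w V) : NV V w f < ⊤ := by
  obtain ⟨C, hC⟩ := hc.isCompact.exists_bound_of_continuousOn (hw.mono hs)
  have h1 : NV V w f ≤ ofR |C| * NV V (fun _ => 1) f := by
    refine NV_mono hV (abs_nonneg _) fun x hx => ?_
    by_cases h : x ∈ tsupport f
    · have : w x ≤ |C| := (le_abs_self _).trans ((hC x h).trans (le_abs_self _))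
      nlinarith [sq_nonneg ‖f x‖]
    · simp [image_eq_zero_of_notMem_tsupport h]
  refine h1.trans_lt (mul_lt_top ofReal_lt_top ?_)
  rw [NV_one, ← memLp_two_iff hf.aestronglyMeasurable]
  exact (hf.memLp_of_hasCompactSupport hc).restrict V

theorem LL_of_NV (hw : ContinuousOn w V) (h0 : ∀ x ∈ V, 0 < w x) (h : NV V w f < ⊤) : LL V f := by
  intro K hK hKc
  rcases K.eq_empty_or_nonempty with rfl | hne
  · simp
  obtain ⟨y, hy, hmin⟩ := hKc.exists_isMinOn hne (hw.mono hK)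
  have hy0 := h0 y (hK hy)
  have h1 : NV K (fun _ => 1) f ≤ ofR (w y)⁻¹ * NV K w f := by
    refine NV_mono hKc.measurableSet (by positivity) fun x hx => ?_
    rw [mul_one, mul_comm (‖f x‖ ^ 2), ← mul_assoc]
    have : w y ≤ w x := hmin hx
    have : 1 ≤ (w y)⁻¹ * w x := by
      rw [inv_mul_eq_div, le_div_iff₀ hy0]; linarith
    nlinarith [sq_nonneg ‖f x‖]
  rw [← NV_one]
  exact h1.trans_lt (mul_lt_top ofReal_lt_top ((NV_mono_set hK).trans_lt h))

theorem aem_of_contOn (hV : IsOpen V) (hw : ContinuousOn w V) : AEMeasurable w (vol V) :=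
  hw.aemeasurable hV.measurableSet

theorem IsTest.NV_lt_top (hV : IsOpen V) (h : IsTest V θ)
    (hw : ContinuousOn w V) : NV V w θ < ⊤ :=
  NV_lt_top_of_compact hV.measurableSet h.continuous h.comp h.supp hw

/-- Orthogonal projection onto the weakly `∂̄`-closed forms. -/
theorem exists_closed_proj (hV : IsOpen V) (hw : ContinuousOn w V) (h0 : ∀ x ∈ V, 0 < w x)
    {b : Fin n → Fn n} (hb : ∀ k, IsTest V (b k)) :
    ∃ β : Fin n → Fn n, (∀ k, Measurable (β k)) ∧ (∀ k, NV V w (β k) < ⊤) ∧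
      WeakClosed V β ∧ ∀ h : Fin n → Fn n, (∀ k, AESM (h k) (vol V)) →
        (∀ k, NV V w (h k) < ⊤) → WeakClosed V h →
        ∫ x in V, (∑ k, (b k x - β k x) * conj (h k x)) * w x = 0 := by
  let e : (Fin n → Fn n) → Cn n → EuclideanSpace ℂ (Fin n) := fun f x =>
    WithLp.toLp 2 fun k => f k x
  have hem : ∀ f : Fin n → Fn n, (∀ k, AESM (f k) (vol V)) →
      AESM (e f) (vol V) := fun f hf =>
    ((PiLp.continuous_toLp 2 fun _ : Fin n => ℂ).comp_aestronglyMeasurable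
      (aemeasurable_pi_iff.2 fun k => (hf k).aemeasurable).aestronglyMeasurable)
  have hec : ∀ f : Fin n → Fn n, (∀ k, Continuous (f k)) → Continuous (e f) := fun f hf =>
    (PiLp.continuous_toLp 2 fun _ : Fin n => ℂ).comp (continuous_pi hf)
  have hNV : ∀ f : Fin n → Fn n, (∀ k, AESM (f k) (vol V)) →
      (∀ k, NV V w (f k) < ⊤) → NV V w (e f) < ⊤ := by
    intro f hf hf'
    have : NV V w (e f) = ∑ k, NV V w (f k) := by
      simp only [NV]
      rw [← lintegral_finsetSum' (f := fun k x => ‖f k x‖ₑ ^ 2 * ofR (w x)) _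
        fun k _ => ((hf k).enorm.pow_const 2).mul ((aem_of_contOn hV hw).ennreal_ofReal)]
      refine lintegral_congr fun x => ?_
      rw [← sum_mul]
      congr 1
      simp only [enorm_sq_eq]
      rw [EuclideanSpace.norm_sq_eq, ENNReal.ofReal_sum_of_nonneg fun k _ => sq_nonneg _]
    rw [this]
    exact ENNReal.sum_lt_top.2 fun k _ => hf' k
  let s : (Fn n) → Fin n → Fin n → Fin n → Fn n := fun θ j k l x =>
    (if l = k then conj (dzb j θ x) else 0) - (if l = j then conj (dzb k θ x) else 0)
  have hst : ∀ θ, IsTest V θ → ∀ j k l, IsTest V (s θ j k l) := by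
    intro θ hθ j k l
    refine IsTest.sub (f := fun x => if l = k then conj (dzb j θ x) else 0)
      (g := fun x => if l = j then conj (dzb k θ x) else 0) ?_ ?_
    · by_cases h : l = k
      · simpa [h] using hθ.dd.star
      · simpa [h] using IsTest.zero
    · by_cases h : l = j
      · simpa [h] using hθ.dd.star
      · simpa [h] using IsTest.zero
  let S : Set (Cn n → EuclideanSpace ℂ (Fin n)) :=
    {σ | ∃ θ, IsTest V θ ∧ ∃ j k, σ = e (s θ j k)}
  have hinn : ∀ (f g : Fin n → Fn n) x, inner ℂ (e f x) (e g x) =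
      ∑ k, g k x * conj (f k x) := fun f g x => by
    simp [e, PiLp.inner_apply]
  have hpair : ∀ θ, IsTest V θ → ∀ j k, ∀ f : Fin n → Fn n,
      (∫ x in V, inner ℂ (e (s θ j k) x) (e f x)) =
        ∫ x, (f k x * dzb j θ x - f j x * dzb k θ x) := by
    intro θ hθ j k f
    rw [← setIntegral_eq_integral_of_forall_compl_eq_zero (s := V)
      (f := fun x => f k x * dzb j θ x - f j x * dzb k θ x)]
    · refine integral_congr_all fun x => ?_
      simp only [hinn, s, map_sub, mul_sub, sum_sub_distrib]
      simp [apply_ite conj]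
    · intro x hx
      have h1 : ∀ j, dzb j θ x = 0 := fun j => hθ.dd.eq_zero hx
      simp [h1]
  have hLL : ∀ f : Fin n → Fn n, (∀ k, NV V w (f k) < ⊤) → ∀ k, LL V (f k) :=
    fun f hf k => LL_of_NV hw h0 (hf k)
  have hS1 : ∀ σ ∈ S, AESM σ (vol V) := by
    rintro σ ⟨θ, hθ, j, k, rfl⟩
    exact hem _ fun l => (hst θ hθ j k l).continuous.aestronglyMeasurable
  have hS2 : ∀ σ ∈ S, NV V (fun x => (w x)⁻¹) σ < ⊤ := by
    rintro σ ⟨θ, hθ, j, k, rfl⟩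
    refine NV_lt_top_of_compact (w := fun x => (w x)⁻¹) hV.measurableSet
      (hec _ fun l => (hst θ hθ j k l).continuous) ?_ ?_ (hw.inv₀ fun x hx => (h0 x hx).ne')
    · refine hθ.comp.of_isClosed_subset (isClosed_tsupport _) ?_
      refine (closure_minimal ?_ (isClosed_tsupport _))
      intro x hx
      by_contra hc
      refine hx ?_
      ext l
      simp only [e, s]
      have h1 : ∀ j, dzb j θ x = 0 := fun j =>
        image_eq_zero_of_notMem_tsupport fun h => hc (IsTest.support_dd h)
      simp [h1]
    · refine (closure_minimal ?_ (isClosed_tsupport _)).trans hθ.supp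
      intro x hx
      by_contra hc
      refine hx ?_
      ext l
      simp only [e, s]
      have h1 : ∀ j, dzb j θ x = 0 := fun j =>
        image_eq_zero_of_notMem_tsupport fun h => hc (IsTest.support_dd h)
      simp [h1]
  obtain ⟨p, hp, hpX, hpS, hpo⟩ := exists_proj hV.measurableSet h0 (aem_of_contOn hV hw) S hS1 hS2
    (X := e b) (hem b fun k => (hb k).continuous.aestronglyMeasurable)
    (hNV b (fun k => (hb k).continuous.aestronglyMeasurable) fun k => (hb k).NV_lt_top hV hw)
  · let β : Fin n → Fn n := fun k x => p x k
    have hβe : e β = p := by ext x k; rfl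
    have hβm : ∀ k, Measurable (β k) := fun k =>
      ((EuclideanSpace.proj (𝕜 := ℂ) k).continuous.comp_stronglyMeasurable hp).measurable
    have hβN : ∀ k, NV V w (β k) < ⊤ := fun k => by
      have h1 : NV V w (β k) ≤ ofR 1 * NV V w p := by
        refine NV_mono hV.measurableSet zero_le_one fun x hx => ?_
        rw [one_mul]
        have := h0 x hx
        gcongr
        exact PiLp.norm_apply_le (p x) k
      refine h1.trans_lt (mul_lt_top ofReal_lt_top (hpX.trans_lt ?_))
      exact hNV b (fun k => (hb k).continuous.aestronglyMeasurable) fun k => (hb k).NV_lt_top hV hw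
    have hint : ∀ f : Fin n → Fn n, (∀ k, Measurable (f k)) → (∀ k, LL V (f k)) →
        ∀ θ, IsTest V θ → ∀ j k, Integrable fun x => f k x * dzb j θ x :=
      fun f hf hl θ hθ j k => (hl k).integrable (hf k) hθ.dd
    refine ⟨β, hβm, hβN, ?_, ?_⟩
    · intro θ hθ j k
      have := hpS _ ⟨θ, hθ, j, k, rfl⟩
      rw [← hβe, hpair θ hθ, integral_sub (hint β hβm (hLL β hβN) θ hθ j k)
        (hint β hβm (hLL β hβN) θ hθ k j)] at this
      exact sub_eq_zero.1 this
    · intro h hm hN hc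
      have := hpo (e h) (hem h hm) (hNV h hm hN) ?_
      · rw [← this]
        refine integral_congr_all fun x => ?_
        have e1 : e b x - p x = e (fun k x => b k x - β k x) x := by
          ext k; rfl
        simp only [e1, hinn]
      · rintro σ ⟨θ, hθ, j, k, rfl⟩
        have hi : ∀ j k, Integrable fun x => h k x * dzb j θ x := by
          intro j k
          have h1 : Integrable fun x => (V.indicator ((hm k).mk (h k))) x * dzb j θ x := by
            refine LL.integrable (((hm k).stronglyMeasurable_mk.measurable).indicator
              hV.measurableSet) ?_ hθ.dd
            refine LL_of_NV hw h0 (lt_of_eq_of_lt ?_ (hN k))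
            refine NV_congr_ae ?_
            filter_upwards [(hm k).ae_eq_mk, ae_restrict_mem hV.measurableSet] with x hx hxV
            rw [indicator_of_mem hxV, hx]
          refine h1.congr ?_
          have := (ae_restrict_iff' hV.measurableSet).1 (hm k).ae_eq_mk
          filter_upwards [this] with x hx
          by_cases hxV : x ∈ V
          · rw [indicator_of_mem hxV, hx hxV]
          · have h1 : dzb j θ x = 0 := hθ.dd.eq_zero hxV
            simp [h1]
        rw [hpair θ hθ, integral_sub (hi j k) (hi k j), hc θ hθ j k, sub_self]

theorem lintegral_mul_sq_le {α : Type*} [MeasurableSpace α] {μ : Measure α} {f g : α → ℝ≥0∞}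
    (hf : AEMeasurable f μ) (hg : AEMeasurable g μ) :
    (∫⁻ x, f x * g x ∂μ) ^ 2 ≤ (∫⁻ x, f x ^ 2 ∂μ) * ∫⁻ x, g x ^ 2 ∂μ := by
  have h := ENNReal.lintegral_mul_le_Lp_mul_Lq μ Real.HolderConjugate.two_two hf hg
  simp only [Pi.mul_apply, ENNReal.rpow_two] at h
  calc _ ≤ _ := pow_le_pow_left' h 2
    _ = _ := by
      rw [mul_pow, ← ENNReal.rpow_two, ← ENNReal.rpow_two, ← ENNReal.rpow_mul, ← ENNReal.rpow_mul]
      norm_num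

theorem contOn_exp_neg (hΦ : SmoothOn Φ V) :
    ContinuousOn (fun x => expR (-Φ x)) V := (hΦ.neg.exp).continuousOn

theorem weakClosed_dzb (hV : IsOpen V) (hq : SmoothOn q V) :
    WeakClosed V fun k => dzb k q := by
  intro θ hθ j k
  have h1 : ∀ j k, ∫ x, dzb k q x * dzb j θ x = -∫ x, θ x * dzb j (dzb k q) x := fun j k => by
    rw [← hθ.ibp hV (contDiffOn_dd hV hq)]
    exact integral_congr_all fun x => mul_comm _ _
  rw [h1, h1]
  congr 1
  refine integral_congr_all fun x => ?_
  by_cases hx : x ∈ V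
  · simp only [dzb]
    rw [dd_comm (hq.contDiffAt (hV.mem_nhds hx))]
  · simp only [hθ.eq_zero hx, zero_mul]

theorem dual_estimate_aux (D : Dom V W ρ) (hΦ : SmoothOn Φ V)
    (hL : ∀ x ∈ V, ∀ β, 0 ≤ levi Φ x β) (hσ : 0 < σ)
    (hΨ : Ψ = fun x => Φ x + -σ * (ρ x ^ 3)⁻¹) (hq : SmoothOn q V)
    (hBc : ContinuousOn B V) (hB0 : ∀ x ∈ V, 0 ≤ B x)
    (hB : ∀ x ∈ V, ∀ β : Fin n → ℂ,
      ‖∑ k, dzb k q x * conj (β k)‖ ^ 2 ≤ B x * levi Φ x β)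
    {R : ℝ≥0∞} (hBR : ∫⁻ x in V, ofR (B x * expR (-Φ x)) ≤ R)
    (hqL : ∀ k, NV V (fun x => expR (-Ψ x)) (dzb k q) < ⊤)
    {c : Fin n → Fn n} (hc : ∀ k, IsTest V (c k)) :
    ‖∫ x in V, q x * ∑ k, dzb k (c k) x‖ₑ ^ 2 ≤
      R * NV V (fun x => expR (Ψ x)) (fun x => ∑ k, dzb k (c k) x) := by
  have hV := D.isOpen
  have hΨs : SmoothOn Ψ V := by
    rw [hΨ]
    exact hΦ.add (contDiffOn_const.mul ((D.smooth.pow 3).inv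
      fun x hx => pow_ne_zero 3 (D.neg hx).ne))
  have hΨn : SmoothOn (fun x => -Ψ x) V := hΨs.neg
  have hwtn : SmoothOn (wt fun x => -Ψ x) V := contDiffOn_wt hΨn
  have hwt1 : ∀ x, wt Ψ x * wt (fun x => -Ψ x) x = 1 := fun x => by
    simp only [wt, ← Complex.ofReal_mul, ← rexp_add]; simp
  have hwr : ∀ Ψ : Cn n → ℝ, ∀ x, conj (wt Ψ x) = wt Ψ x := fun Ψ x => by
    rw [wt, Complex.conj_ofReal]
  set w : Cn n → ℝ := fun x => expR (-Ψ x) with hw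
  have hwc : ContinuousOn w V := contOn_exp_neg hΨs
  have hw0 : ∀ x ∈ V, 0 < w x := fun x _ => exp_pos _
  let b : Fin n → Fn n := fun k x => conj (c k x) * wt (fun x => -Ψ x) x
  have hb : ∀ k, IsTest V (b k) := fun k => (hc k).star.mul hV hwtn
  have hbw : ∀ k x, b k x * wt Ψ x = conj (c k x) := fun k x => by
    simp only [b]; rw [mul_assoc, mul_comm (wt _ x), hwt1, mul_one]
  let γ : Fn n := fun x => -((∑ k, dz k (fun x => conj (c k x)) x) * wt (fun x => -Ψ x) x)
  have hγ : IsTest V γ := ((IsTest.sum fun k _ => (hc k).star.dd).mul hV hwtn).neg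
  have hγw : ∀ x, γ x * wt Ψ x = -∑ k, dz k (fun x => conj (c k x)) x := fun x => by
    simp only [γ]; rw [neg_mul, mul_assoc, mul_comm (wt _ x), hwt1, mul_one]
  have hcz : ∀ k x, dz k (fun x => conj (c k x)) x = conj (dzb k (c k) x) := fun k x => by
    simp only [dz, dzb, dd_conj]; simp
  obtain ⟨β, hβm, hβN, hβc, hβo⟩ := exists_closed_proj hV hwc hw0 hb
  have hβL : ∀ k, LL V (β k) := fun k => LL_of_NV hwc hw0 (hβN k)
  have hcw : ∀ x, ((w x : ℝ) : ℂ) = wt Ψ x := fun x => rfl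
  -- integrability of the pairings of `β` against square integrable fields
  have hpi : ∀ f g : Fn n, AESM f (vol V) → AESM g (vol V) →
      NV V w f < ⊤ → NV V w g < ⊤ → IntegrableOn (fun x => f x * conj (g x) * w x) V := by
    intro f g hf hg hfN hgN
    have h1 := (memLp_sqrt D.meas hw0 (aem_of_contOn hV hwc) hf).2 hfN
    have h2 := (memLp_sqrt D.meas hw0 (aem_of_contOn hV hwc) hg).2 hgN
    have := MemLp.integrable_mul (p := 2) (q := 2) h1 h2.star
    refine this.congr (.of_forall fun x => ?_)
    have e : (√(w x) : ℂ) * (√(w x) : ℂ) = w x := by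
      rw [← Complex.ofReal_mul, Real.mul_self_sqrt (exp_pos _).le]
    simp only [Pi.mul_apply, Pi.star_apply, smul_eq_mul, star_mul', RCLike.star_def,
      Complex.conj_ofReal]
    rw [← e]; ring
  have hbN : ∀ k, NV V w (b k) < ⊤ := fun k => (hb k).NV_lt_top hV hwc
  have hbm : ∀ k, AESM (b k) (vol V) := fun k =>
    (hb k).continuous.aestronglyMeasurable
  have hβm' : ∀ k, AESM (β k) (vol V) := fun k => (hβm k).aestronglyMeasurable
  have horth : ∀ h : Fin n → Fn n, (∀ k, AESM (h k) (vol V)) →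
      (∀ k, NV V w (h k) < ⊤) → WeakClosed V h →
      (∑ k, ∫ x in V, b k x * conj (h k x) * w x) = ∫ x in V, (∑ k, β k x * conj (h k x)) * w x := by
    intro h hm hN hcl
    have h1 := hβo h hm hN hcl
    rw [← integral_finsetSum _ fun k _ => hpi _ _ (hbm k) (hm k) (hbN k) (hN k), ← sub_eq_zero,
      ← integral_sub, ← h1]
    · refine integral_congr_all fun x => ?_
      simp only [sum_mul, sub_mul, sum_sub_distrib]
    · exact integrable_finsetSum _ fun k _ => hpi _ _ (hbm k) (hm k) (hbN k) (hN k)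
    · simp only [sum_mul]
      exact integrable_finsetSum _ fun k _ => hpi _ _ (hβm' k) (hm k) (hβN k) (hN k)
  have hadj : WeakAdj V Ψ β γ := by
    intro v hv
    have h1 := horth (fun k => dzb k fun x => conj (v x))
      (fun k => hv.star.dd.continuous.aestronglyMeasurable)
      (fun k => hv.star.dd.NV_lt_top hV hwc) (weakClosed_dzb hV hv.star.smooth.contDiffOn)
    have hvz : ∀ k x, conj (dzb k (fun x => conj (v x)) x) = dz k v x := fun k x => by
      simp only [dz, dzb, dd_conj]; simp
    simp only [hvz, sum_mul] at h1
    rw [integral_finsetSum] at h1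
    · calc _ = ∑ k, ∫ x in V, β k x * dz k v x * w x := by
            refine sum_congr rfl fun k _ => ?_
            rw [setIntegral_eq_integral_of_forall_compl_eq_zero]
            · simp only [mul_assoc]; rfl
            · intro x hx
              have : dz k v x = 0 := hv.dd.eq_zero hx
              simp [this]
        _ = ∑ k, ∫ x, dz k v x * conj (c k x) := by
            rw [← h1]
            refine sum_congr rfl fun k _ => ?_
            rw [setIntegral_eq_integral_of_forall_compl_eq_zero]
            · refine integral_congr_all fun x => ?_
              simp only [hcw]
              rw [← hbw]; ring
            · intro x hx
              have : dz k v x = 0 := hv.dd.eq_zero hx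
              simp [this]
        _ = ∑ k, -∫ x, v x * dz k (fun x => conj (c k x)) x := by
            refine sum_congr rfl fun k _ => ?_
            exact hv.ibp hV (hc k).star.smooth.contDiffOn
        _ = _ := by
            rw [Finset.sum_neg_distrib, ← integral_finsetSum _ fun k _ =>
              hv.integrable_mul hV ((hc k).star.dd.smooth.contDiffOn), ← integral_neg]
            refine integral_congr_all fun x => ?_
            simp only [mul_comm (v x) (wt Ψ x), ← mul_assoc, hγw]
            rw [← mul_sum]; ring
    · intro k _
      have := hpi _ _ (hβm' k) (hv.star.dd (c := I) (j := k)).continuous.aestronglyMeasurable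
        (hβN k) (hv.star.dd.NV_lt_top hV hwc)
      simp only [hvz] at this
      exact this
  have hβi : IntegrableOn (fun x => (∑ k, ‖β k x‖ ^ 2) * expR (-Ψ x)) V := by
    simp only [sum_mul]
    refine integrable_finsetSum _ fun k _ => ?_
    refine (hpi _ _ (hβm' k) (hβm' k) (hβN k) (hβN k)).norm.congr (.of_forall fun x => ?_)
    simp only [norm_mul, RCLike.norm_conj, norm_real, norm_eq_abs, w, Real.abs_exp]
    ring
  have hap := apriori D hΦ hL hσ hΨ hβm hβL hβi hβc hadj hγ
  have hqm : ∀ k, AESM (dzb k q) (vol V) := fun k =>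
    ((contDiffOn_dd hV hq).continuousOn).aestronglyMeasurable D.meas
  have hq1 := horth (fun k => dzb k q) hqm hqL (weakClosed_dzb hV hq)
  have hq2 : (∑ k, ∫ x in V, b k x * conj (dzb k q x) * w x) =
      -conj (∫ x in V, q x * ∑ k, dzb k (c k) x) := by
    have h1 : ∀ k, ∫ x in V, b k x * conj (dzb k q x) * w x =
        -∫ x, conj (q x) * dz k (fun x => conj (c k x)) x := by
      intro k
      have h2 := (hc k).star.ibp (c := -I) (j := k) hV (contDiffOn_conj hq)
      rw [setIntegral_eq_integral_of_forall_compl_eq_zero]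
      · have h3 : ∀ x, b k x * conj (dzb k q x) * w x =
            conj (c k x) * dd (-I) k (fun y => conj (q y)) x := fun x => by
          rw [hcw, mul_right_comm, hbw, dd_conj]; simp
        simp only [h3]
        rw [← neg_eq_iff_eq_neg.2 h2]
        congr 1
        exact integral_congr_all fun x => mul_comm _ _
      · intro x hx
        simp [(hb k).eq_zero hx]
    simp only [h1, Finset.sum_neg_distrib]
    rw [← integral_conj, setIntegral_eq_integral_of_forall_compl_eq_zero, ← integral_finsetSum]
    · congr 1
      refine integral_congr_all fun x => ?_
      simp only [map_mul, map_sum, hcz, mul_sum]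
    · intro k _
      exact ((hc k).star.dd.mul' hV (contDiffOn_conj hq)).integrable
    · intro x hx
      have : ∀ k, dzb k (c k) x = 0 := fun k => (hc k).dd.eq_zero hx
      simp [this]
  have hγN : NV V w γ = NV V (fun x => expR (Ψ x)) (fun x => ∑ k, dzb k (c k) x) := by
    refine setLIntegral_congr_fun D.meas fun x _ => ?_
    have : γ x = -conj (∑ k, dzb k (c k) x) * wt (fun x => -Ψ x) x := by
      simp only [γ, hcz, map_sum, neg_mul]
    simp only [this, w, enorm_sq_eq]
    rw [← eofReal_mul (by positivity), ← eofReal_mul (by positivity), norm_mul,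
      norm_neg, RCLike.norm_conj, wt, norm_real, norm_eq_abs, Real.abs_exp, mul_pow,
      mul_assoc, ← Real.exp_nat_mul, ← rexp_add]
    congr 3
    push_cast; ring
  calc ‖∫ x in V, q x * ∑ k, dzb k (c k) x‖ₑ ^ 2
      = ‖∫ x in V, (∑ k, β k x * conj (dzb k q x)) * w x‖ₑ ^ 2 := by
        rw [← hq1, hq2, enorm_neg]
        simp only [← ofReal_norm, RCLike.norm_conj]
    _ ≤ (∫⁻ x in V, ofR (√(B x * w x)) *
          ofR (√(levi Φ x (fun k => β k x) * w x))) ^ 2 := by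
        gcongr
        refine (enorm_integral_le_lintegral_enorm _).trans (setLIntegral_mono' D.meas fun x hx => ?_)
        rw [← ofReal_norm, ← eofReal_mul (Real.sqrt_nonneg _)]
        refine ofReal_le_ofReal ?_
        have hw' := (hw0 x hx).le
        rw [← Real.sqrt_mul (mul_nonneg (hB0 x hx) hw')]
        refine Real.le_sqrt_of_sq_le ?_
        have h1 := hB x hx fun k => β k x
        have h2 : ‖∑ k, β k x * conj (dzb k q x)‖ = ‖∑ k, dzb k q x * conj (β k x)‖ := by
          rw [← RCLike.norm_conj]
          simp [mul_comm]
        rw [norm_mul, h2, norm_real, norm_eq_abs, abs_of_nonneg hw', mul_pow]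
        nlinarith [mul_le_mul_of_nonneg_right h1 (sq_nonneg (w x))]
    _ ≤ (∫⁻ x in V, ofR (√(B x * w x)) ^ 2) *
          ∫⁻ x in V, ofR (√(levi Φ x (fun k => β k x) * w x)) ^ 2 := by
        refine lintegral_mul_sq_le ?_ ?_
        · exact (aem_of_contOn hV (hBc.mul hwc).sqrt).ennreal_ofReal
        · have : AEMeasurable (fun x => levi Φ x fun k => β k x) (vol V) := by
            unfold levi
            refine Complex.measurable_re.comp_aemeasurable ?_
            refine Finset.aemeasurable_fun_sum _ fun j _ => Finset.aemeasurable_fun_sum _ fun k _ => ?_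
            refine AEMeasurable.mul (AEMeasurable.mul ?_ (hβm k).aemeasurable)
              (Complex.continuous_conj.measurable.comp_aemeasurable (hβm j).aemeasurable)
            exact (contDiffOn_dd hV (contDiffOn_dd hV (contDiffOn_ofReal hΦ))).continuousOn.aemeasurable
              D.meas
          exact (this.mul (aem_of_contOn hV hwc)).sqrt.ennreal_ofReal
    _ ≤ R * NV V (fun x => expR (Ψ x)) (fun x => ∑ k, dzb k (c k) x) := by
        rw [← hγN]
        gcongr
        · refine le_trans (setLIntegral_mono' D.meas fun x hx => ?_) hBR
          rw [← eofReal_pow (Real.sqrt_nonneg _),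
            sq_sqrt (mul_nonneg (hB0 x hx) (hw0 x hx).le)]
          refine ofReal_le_ofReal (mul_le_mul_of_nonneg_left ?_ (hB0 x hx))
          refine Real.exp_le_exp.2 (neg_le_neg ?_)
          have : (ρ x ^ 3)⁻¹ ≤ 0 := inv_nonpos.2 (by
            have := D.neg hx
            rw [show ρ x ^ 3 = ρ x ^ 2 * ρ x by ring]
            exact mul_nonpos_of_nonneg_of_nonpos (by positivity) this.le)
          rw [hΨ]; simp only; nlinarith
        · refine le_trans (setLIntegral_mono' D.meas fun x hx => ?_) hap
          rw [← eofReal_pow (Real.sqrt_nonneg _),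
            sq_sqrt (mul_nonneg (hL x hx _) (hw0 x hx).le)]

theorem setIntegral_mul_test (hθ : IsTest V θ) :
    ∫ x in V, F x * θ x = ∫ x, F x * θ x :=
  setIntegral_eq_integral_of_forall_compl_eq_zero fun x hx => by rw [hθ.eq_zero hx, mul_zero]

/-- A weakly holomorphic locally `L²` function is a.e. holomorphic. -/
theorem weyl_LL (hV : IsOpen V) (hm : AESM F (vol V)) (hF : LL V F)
    (hh : ∀ θ, IsTest V θ → ∀ k, ∫ x in V, F x * dzb k θ x = 0) :
    ∃ g, HolOn g V ∧ ∀ᵐ x ∂(vol V), F x = g x := by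
  have he : V.indicator (hm.mk F) =ᵐ[vol V] F := by
    filter_upwards [hm.ae_eq_mk, ae_restrict_mem hV.measurableSet] with x hx hxV
    rw [indicator_of_mem hxV, hx]
  have h1 : WeakHol V (V.indicator (hm.mk F)) := by
    intro θ hθ k
    rw [← setIntegral_mul_test hθ.dd, ← hh θ hθ k]
    refine integral_congr_ae ?_
    filter_upwards [he] with x hx
    rw [hx]
  have h2 : ∀ K ⊆ V, IsCompact K → ∫⁻ x in K, ‖V.indicator (hm.mk F) x‖ₑ ^ 2 < ⊤ := by
    intro K hK hKc
    refine lt_of_eq_of_lt (lintegral_congr_ae ?_) (hF K hK hKc)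
    filter_upwards [ae_restrict_of_ae_restrict_of_subset hK he] with x hx
    rw [hx]
  obtain ⟨g, hg, hg'⟩ := weyl (F := V.indicator (hm.mk F)) hV h1
    (hm.stronglyMeasurable_mk.measurable.indicator hV.measurableSet) h2
  refine ⟨g, hg, ?_⟩
  filter_upwards [hg', he] with x h1 h2
  rw [← h2, h1]

/-- The weighted Bergman projection. -/
theorem exists_hol_proj (hV : IsOpen V) (hw : ContinuousOn w V) (h0 : ∀ x ∈ V, 0 < w x)
    {X : Fn n} (hX : AESM X (vol V)) (hX' : NV V w X < ⊤) :
    ∃ p, HolOn p V ∧ NV V w p ≤ NV V w X ∧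
      ∀ h, HolOn h V → NV V w h < ⊤ →
        ∫ x in V, h x * conj (X x - p x) * w x = 0 := by
  let S : Set (Fn n) := {σ | ∃ θ, IsTest V θ ∧ ∃ k, σ = fun x => conj (dzb k θ x)}
  have hS1 : ∀ σ ∈ S, AESM σ (vol V) := by
    rintro σ ⟨θ, hθ, k, rfl⟩
    exact hθ.dd.star.continuous.aestronglyMeasurable
  have hS2 : ∀ σ ∈ S, NV V (fun x => (w x)⁻¹) σ < ⊤ := by
    rintro σ ⟨θ, hθ, k, rfl⟩
    exact hθ.dd.star.NV_lt_top hV (hw.inv₀ fun x hx => (h0 x hx).ne')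
  obtain ⟨p, hp, hpX, hpS, hpo⟩ := exists_proj hV.measurableSet h0 (aem_of_contOn hV hw) S hS1 hS2
    hX hX'
  have hpN : NV V w p < ⊤ := hpX.trans_lt hX'
  obtain ⟨g, hg, hpg⟩ := weyl_LL hV hp.aestronglyMeasurable (LL_of_NV hw h0 hpN) (by
    intro θ hθ k
    have := hpS _ ⟨θ, hθ, k, rfl⟩
    simpa using this)
  refine ⟨g, hg, (NV_congr_ae hpg).symm.trans_le hpX, fun h hh hN => ?_⟩
  have h1 := hpo h (hh.continuousOn.aestronglyMeasurable hV.measurableSet) hN ?_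
  · have h2 : ∫ x in V, conj (inner ℂ (h x) (X x - p x) * w x) = 0 := by
      rw [integral_conj, h1, map_zero]
    rw [← h2]
    refine integral_congr_ae ?_
    filter_upwards [hpg] with x hx
    rw [hx]
    simp [mul_comm]
  · rintro σ ⟨θ, hθ, k, rfl⟩
    have h1 := hθ.ibp (c := I) (j := k) hV (hol_smooth hV hh)
    have h2 : ∀ x, inner ℂ (conj (dzb k θ x)) (h x) = h x * dzb k θ x := fun x => by simp
    simp only [h2]
    rw [setIntegral_mul_test hθ.dd]
    simp only [mul_comm (h _)]
    rw [h1, neg_eq_zero]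
    refine (integral_congr_all fun x => ?_).trans (integral_zero _ _)
    by_cases hx : x ∈ V
    · rw [show dd I k h x = 0 from hol_dzb hV hh hx, mul_zero]
    · rw [hθ.eq_zero hx, zero_mul]

theorem dual_estimate (D : Dom V W ρ) (hΦ : SmoothOn Φ V)
    (hL : ∀ x ∈ V, ∀ β, 0 ≤ levi Φ x β) (hq : SmoothOn q V)
    (hBc : ContinuousOn B V) (hB0 : ∀ x ∈ V, 0 ≤ B x)
    (hB : ∀ x ∈ V, ∀ β : Fin n → ℂ,
      ‖∑ k, dzb k q x * conj (β k)‖ ^ 2 ≤ B x * levi Φ x β)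
    (hBR : ∫⁻ x in V, ofR (B x * expR (-Φ x)) ≤ ofR R)
    (hqL : ∀ σ > 0, ∀ k, NV V (fun x => expR (-(Φ x + -σ * (ρ x ^ 3)⁻¹))) (dzb k q) < ⊤)
    {c : Fin n → Fn n} (hc : ∀ k, IsTest V (c k)) :
    ‖∫ x in V, q x * ∑ k, dzb k (c k) x‖ₑ ^ 2 ≤
      ofR R * NV V (fun x => expR (Φ x)) (fun x => ∑ k, dzb k (c k) x) := by
  set u : Fn n := fun x => ∑ k, dzb k (c k) x with hu
  have hut : IsTest V u := IsTest.sum fun k _ => (hc k).dd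
  set N := NV V (fun x => expR (Φ x)) u with hN
  have hNt : N < ⊤ := hut.NV_lt_top D.isOpen hΦ.continuousOn.rexp
  obtain ⟨M, hM⟩ := hut.comp.isCompact.exists_bound_of_continuousOn
    (f := fun x => -(ρ x ^ 3)⁻¹) ((((D.smooth.continuousOn).pow 3).inv₀
      fun x hx => pow_ne_zero 3 (D.neg hx).ne).neg.mono hut.supp)
  have key : ∀ σ > 0, ‖∫ x in V, q x * u x‖ₑ ^ 2 ≤
      ofR R * (ofR (expR (σ * M)) * N) := by
    intro σ hσ
    refine (dual_estimate_aux D hΦ hL hσ rfl hq hBc hB0 hB (R := R.toNNReal) hBR (hqL σ hσ)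
      hc).trans ?_
    change ofR R * _ ≤ _
    gcongr
    refine NV_mono D.meas (exp_pos _).le fun x hx => ?_
    by_cases h : x ∈ tsupport u
    · have h1 := (le_abs_self _).trans (hM x h)
      have : expR (Φ x + -σ * (ρ x ^ 3)⁻¹) ≤ expR (σ * M) * expR (Φ x) := by
        rw [← rexp_add]
        refine Real.exp_le_exp.2 ?_
        nlinarith
      have := mul_le_mul_of_nonneg_left this (sq_nonneg ‖u x‖)
      simp only [hu] at this ⊢
      linarith
    · have : u x = 0 := image_eq_zero_of_notMem_tsupport h
      have h2 : ∑ k, dzb k (c k) x = 0 := this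
      simp only [h2, this, norm_zero]
      simp
  have hlim : Tendsto (fun σ : ℝ => ofR R * (ofR (expR (σ * M)) * N))
      (𝓝[>] 0) (𝓝 (ofR R * N)) := by
    refine ENNReal.Tendsto.const_mul ?_ (Or.inr ofReal_ne_top)
    have h1 : Tendsto (fun σ : ℝ => expR (σ * M)) (𝓝[>] 0) (𝓝 1) := by
      have : Continuous fun σ : ℝ => expR (σ * M) := by fun_prop
      simpa using (this.tendsto 0).mono_left nhdsWithin_le_nhds
    have h2 := ENNReal.Tendsto.mul_const (b := N) (ENNReal.tendsto_ofReal h1) (Or.inr hNt.ne)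
    simpa using h2
  exact ge_of_tendsto hlim (eventually_mem_nhdsWithin.mono fun σ hσ => key σ hσ)

/-- Hörmander's theorem with the sharp pointwise bound. -/
theorem hormander (D : Dom V W ρ) (hΦ : SmoothOn Φ V)
    (hL : ∀ x ∈ V, ∀ β, 0 ≤ levi Φ x β) (hq : SmoothOn q V)
    (hBc : ContinuousOn B V) (hB0 : ∀ x ∈ V, 0 ≤ B x)
    (hB : ∀ x ∈ V, ∀ β : Fin n → ℂ,
      ‖∑ k, dzb k q x * conj (β k)‖ ^ 2 ≤ B x * levi Φ x β)
    (hR : 0 ≤ R)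
    (hBR : ∫⁻ x in V, ofR (B x * expR (-Φ x)) ≤ ofR R)
    (hqL : ∀ σ > 0, ∀ k, NV V (fun x => expR (-(Φ x + -σ * (ρ x ^ 3)⁻¹))) (dzb k q) < ⊤) :
    ∃ f, HolOn f V ∧
      NV V (fun x => expR (-Φ x)) (fun x => q x - f x) ≤ ofR R := by
  have hV := D.isOpen
  set w : Cn n → ℝ := fun x => expR (-Φ x) with hw
  have hwc : ContinuousOn w V := contOn_exp_neg hΦ
  have hw0 : ∀ x ∈ V, 0 < w x := fun x _ => exp_pos _
  have hwi : (fun x => (w x)⁻¹) = fun x => expR (Φ x) := by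
    ext x; simp only [w, Real.exp_neg, inv_inv]
  let S : Submodule ℂ (Fn n) :=
    { carrier := {u | ∃ c : Fin n → Fn n, (∀ k, IsTest V (c k)) ∧ u = fun x => ∑ k, dzb k (c k) x}
      add_mem' := by
        rintro _ _ ⟨c, hc, rfl⟩ ⟨d, hd, rfl⟩
        refine ⟨fun k x => c k x + d k x, fun k => (hc k).add (hd k), ?_⟩
        ext x
        simp only [Pi.add_apply, ← sum_add_distrib]
        exact sum_congr rfl fun k _ => (dd_add ((hc k).diff x) ((hd k).diff x)).symm
      zero_mem' := ⟨fun _ _ => 0, fun _ => IsTest.zero, by ext x; simp⟩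
      smul_mem' := by
        rintro a _ ⟨c, hc, rfl⟩
        refine ⟨fun k x => a * c k x, fun k => (hc k).const_mul a, ?_⟩
        ext x
        simp only [Pi.smul_apply, smul_eq_mul, mul_sum]
        exact sum_congr rfl fun k _ => (dd_const_mul a ((hc k).diff x)).symm }
  have hSt : ∀ u ∈ S, IsTest V u := by
    rintro _ ⟨c, hc, rfl⟩
    exact IsTest.sum fun k _ => (hc k).dd
  obtain ⟨U, hU, hUN, hUS⟩ := exists_riesz (w := w) (q := q) (R := R) D.meas hw0
    (aem_of_contOn hV hwc) S
    (fun u hu => (hSt u hu).continuous.aestronglyMeasurable)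
    (fun u hu => (hSt u hu).NV_lt_top hV (hwc.inv₀ fun x hx => (hw0 x hx).ne'))
    (fun u hu => ((hSt u hu).mul' hV hq).integrable.integrableOn) hR (by
      rintro _ ⟨c, hc, rfl⟩
      rw [hwi]
      exact dual_estimate D hΦ hL hq hBc hB0 hB hBR hqL hc)
  have hUL : LL V U := LL_of_NV hwc hw0 (hUN.trans_lt ofReal_lt_top)
  have hqL : LL V q := by
    intro K hK hKc
    rw [← memLp_two_iff ((hq.continuousOn.mono hK).aestronglyMeasurable hKc.measurableSet)]
    obtain ⟨C, hC⟩ := hKc.exists_bound_of_continuousOn (hq.continuousOn.mono hK)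
    have : IsFiniteMeasure (volume.restrict K) := ⟨by simpa using hKc.measure_lt_top⟩
    exact MemLp.of_bound ((hq.continuousOn.mono hK).aestronglyMeasurable hKc.measurableSet) C
      ((ae_restrict_iff' hKc.measurableSet).2 (.of_forall hC))
  have h1 : LL V fun x => q x - U x := by
    intro K hK hKc
    have h1 := NV_add_le (f := q) (g := fun x => -U x) (w := fun _ => 1) hKc.measurableSet
      (fun x _ => zero_le_one) ((hq.continuousOn.mono hK).aestronglyMeasurable hKc.measurableSet)
      aemeasurable_const
    simp only [NV_one, enorm_neg, ← sub_eq_add_neg] at h1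
    refine h1.trans_lt (add_lt_top.2 ⟨mul_lt_top (by simp) (hqL K hK hKc),
      mul_lt_top (by simp) (hUL K hK hKc)⟩)
  have h2 : ∀ θ, IsTest V θ → ∀ k, ∫ x in V, (q x - U x) * dzb k θ x = 0 := by
    intro θ hθ k
    have hmem : dzb k θ ∈ S := by
      refine ⟨fun l => if l = k then θ else fun _ => 0, fun l => ?_, ?_⟩
      · by_cases h : l = k
        · simpa [h] using hθ
        · simpa [h] using IsTest.zero
      · ext x
        rw [Finset.sum_eq_single k]
        · simp
        · intro l _ hl; simp [hl]
        · simp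
    have h1 := hUS _ hmem
    simp only [sub_mul]
    rw [integral_sub, h1, sub_self]
    · exact (hθ.dd.mul' hV hq).integrable.integrableOn
    · exact (LL.integrable hU.measurable hUL hθ.dd).integrableOn
  obtain ⟨f, hf, hfe⟩ := weyl_LL (F := fun x => q x - U x) hV
    ((hq.continuousOn.aestronglyMeasurable D.meas).sub hU.aestronglyMeasurable) h1 h2
  refine ⟨f, hf, (NV_congr_ae ?_).trans_le hUN⟩
  filter_upwards [hfe] with x hx
  rw [← hx]; ring

/-- The weights `φ + Aρ - (M+1) log (-ρ) - log (δ - ρ)`. -/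
def pot (ρ φ : Cn n → ℝ) (A : ℝ) (M : ℕ) (δ : ℝ) (x : Cn n) : ℝ :=
  φ x + (A * ρ x - (M + 1) * Real.log (-ρ x) - Real.log (δ - ρ x))

/-- The weight `(-ρ)^M`. -/
def sw (ρ : Cn n → ℝ) (M : ℕ) (x : Cn n) : ℝ := (-ρ x) ^ M

namespace Dom

include D

theorem pos (hx : x ∈ V) : 0 < -ρ x := neg_pos.2 (D.neg hx)

theorem sw_pos (hx : x ∈ V) : 0 < sw ρ M x := pow_pos (D.pos hx) _

theorem sw_nonneg : ∀ x ∈ V, 0 ≤ sw ρ M x := fun _ hx => (D.sw_pos hx).le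

theorem contDiffOn_sw : SmoothOn (sw ρ M) V := D.smooth.neg.pow _

theorem contOn_sw : ContinuousOn (sw ρ M) V := D.contDiffOn_sw.continuousOn

theorem aem_sw : AEMeasurable (sw ρ M) (vol V) := aem_of_contOn D.isOpen D.contOn_sw

theorem contDiffOn_pot (hφ : SmoothOn φ V) (hδ : 0 ≤ δ) :
    SmoothOn (pot ρ φ A M δ) V := by
  refine hφ.add (((contDiffOn_const.mul D.smooth).sub (contDiffOn_const.mul
    (D.smooth.neg.log fun x hx => ?_))).sub ((contDiffOn_const.sub D.smooth).log fun x hx => ?_))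
  · exact (D.pos hx).ne'
  · have := D.neg hx; exact (by linarith : 0 < δ - ρ x).ne'

theorem exp_pot (hδ : 0 ≤ δ) (hx : x ∈ V) :
    expR (-pot ρ φ A M δ x) =
      expR (-φ x) * expR (-(A * ρ x)) * (sw ρ (M + 1) x * (δ - ρ x)) := by
  have h1 := D.neg hx
  have h2 : (0 : ℝ) < -ρ x := by linarith
  have h3 : 0 < δ - ρ x := by linarith
  rw [pot, show -(φ x + (A * ρ x - (M + 1) * Real.log (-ρ x) - Real.log (δ - ρ x))) =
    -φ x + -(A * ρ x) + (((M + 1 : ℕ) : ℝ) * Real.log (-ρ x) + Real.log (δ - ρ x)) by push_cast; ring,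
    rexp_add, rexp_add, rexp_add, Real.exp_log h3, Real.exp_nat_mul, Real.exp_log h2, sw]

theorem levi_pot : ∃ c > 0, ∀ (φ : Cn n → ℝ) (A : ℝ) (M : ℕ) (δ : ℝ),
    SmoothOn φ V → 0 ≤ δ →
    (∀ x ∈ V, ∀ β, 0 ≤ levi φ x β + A * levi ρ x β) → ∀ x ∈ V, ∀ β,
      c / (-ρ x) * ∑ k, ‖β k‖ ^ 2 + (1 / (ρ x) ^ 2 + 1 / (δ - ρ x) ^ 2) *
        ‖∑ k, dz k ♯ρ x * β k‖ ^ 2 ≤ levi (pot ρ φ A M δ) x β := by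
  obtain ⟨c, hc, hl⟩ := D.levi_pos
  refine ⟨c, hc, fun φ A M δ hφ hδ hA x hx β => ?_⟩
  have hρ := D.neg hx
  have hd := D.contDiffAt hx
  have h1 : ∀ τ < 0, HasDerivAt
      (fun τ : ℝ => A * τ - (M + 1) * Real.log (-τ) - Real.log (δ - τ))
      (A - (M + 1) * τ⁻¹ + (δ - τ)⁻¹) τ := fun τ hτ => by
    have h3 : δ - τ ≠ 0 := by linarith
    have h4 : -τ ≠ 0 := by linarith
    have := (((hasDerivAt_id τ).const_mul A).sub (((hasDerivAt_id τ).neg.log h4).const_mul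
      ((M : ℝ) + 1))).sub (((hasDerivAt_id τ).const_sub δ).log h3)
    refine HasDerivAt.congr_deriv (f := fun τ : ℝ => _) this ?_
    have h0 := hτ.ne
    simp only [id, Pi.neg_apply]
    field_simp
    ring
  have h2 : HasDerivAt (fun τ : ℝ => A - (M + 1) * τ⁻¹ + (δ - τ)⁻¹)
      ((M + 1) * (1 / (ρ x) ^ 2) + 1 / (δ - ρ x) ^ 2) (ρ x) := by
    have h3 : δ - ρ x ≠ 0 := by linarith
    have := (((hasDerivAt_inv hρ.ne).const_mul ((M : ℝ) + 1)).const_sub A).add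
      (((hasDerivAt_id (ρ x)).const_sub δ).fun_inv h3)
    refine HasDerivAt.congr_deriv (f := fun τ : ℝ => _) this ?_
    have h0 := hρ.ne
    simp only [id]
    field_simp
  have h3 := levi_comp (β := β) hd ((eventually_lt_nhds hρ).mono h1) h2
  have h4 : ContDiffAt ℝ ∞ (fun y => A * ρ y - (M + 1) * Real.log (-ρ y) - Real.log (δ - ρ y)) x := by
    refine ((contDiffAt_const.mul hd).sub (contDiffAt_const.mul
      (hd.neg.log ?_))).sub ((contDiffAt_const.sub hd).log ?_)
    · exact (neg_pos.2 hρ).ne'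
    · exact (by linarith : 0 < δ - ρ x).ne'
  rw [show pot ρ φ A M δ = fun y => φ y + _ from rfl,
    levi_add (hφ.contDiffAt (D.isOpen.mem_nhds hx)) h4, h3]
  have h5 := hl x (subset_closure hx) β
  have h6 := hA x hx β
  set S := ∑ k, ‖β k‖ ^ 2 with hS
  have hS0 : 0 ≤ S := sum_nonneg fun k _ => sq_nonneg _
  set N := ‖∑ k, dz k ♯ρ x * β k‖ ^ 2
  have hN : 0 ≤ N := sq_nonneg _
  have h7 : 0 < -(ρ x)⁻¹ := by rw [← inv_neg]; exact inv_pos.2 (by linarith)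
  have h8 : 0 < (δ - ρ x)⁻¹ := inv_pos.2 (by linarith)
  have h9 : c / (-ρ x) * S = -(ρ x)⁻¹ * (c * S) := by rw [div_eq_mul_inv, inv_neg]; ring
  have hL : 0 ≤ levi ρ x β := (mul_nonneg hc.le hS0).trans h5
  have e1 : 0 ≤ M * (1 / ρ x ^ 2) * N := by positivity
  have e2 := mul_le_mul_of_nonneg_left h5 h7.le
  have e3 := mul_nonneg h8.le hL
  have e4 : 0 ≤ (M : ℝ) * (-(ρ x)⁻¹ * levi ρ x β) := by positivity
  rw [h9]
  nlinarith

end Dom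

theorem norm_sum_mul_sq_le {ι : Type*} (s : Finset ι) (a b : ι → ℂ) :
    ‖∑ k ∈ s, a k * b k‖ ^ 2 ≤ (∑ k ∈ s, ‖a k‖ ^ 2) * ∑ k ∈ s, ‖b k‖ ^ 2 := by
  have h := Finset.sum_mul_sq_le_sq_mul_sq s (fun k => ‖a k‖) (fun k => ‖b k‖)
  refine (pow_le_pow_left₀ (norm_nonneg _) (norm_sum_le _ _) 2).trans ?_
  simpa only [norm_mul] using h

section

variable {w₁ w₂ : Cn n → ℝ}

theorem lintegral_pair_sq_le (hV : MeasurableSet V) (hf : AESM f (vol V))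
    (hg : AESM g (vol V)) (hw₁ : AEMeasurable w₁ (vol V))
    (hw₂ : AEMeasurable w₂ (vol V)) (h0 : ∀ x ∈ V, 0 ≤ w x)
    (h : ∀ x ∈ V, 0 ≤ w₁ x ∧ w x ^ 2 ≤ w₁ x * w₂ x) :
    (∫⁻ x in V, ‖f x * conj (g x) * w x‖ₑ) ^ 2 ≤ NV V w₁ f * NV V w₂ g := by
  have h1 : ∀ {w : Cn n → ℝ} {f : Fn n}, NV V w f =
      ∫⁻ x in V, (‖f x‖ₑ * ofR (w x) ^ (1 / 2 : ℝ)) ^ 2 := by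
    intro w f
    refine lintegral_congr fun x => ?_
    rw [mul_pow, ← ENNReal.rpow_natCast (_ ^ (1 / 2 : ℝ)), ← ENNReal.rpow_mul]
    norm_num
  rw [h1, h1]
  refine (pow_le_pow_left' (setLIntegral_mono' hV fun x hx => ?_) 2).trans
    (lintegral_mul_sq_le ?_ ?_)
  · obtain ⟨h2, h3⟩ := h x hx
    rw [enorm_mul, enorm_mul, RCLike.enorm_conj, mul_mul_mul_comm]
    refine mul_le_mul_right ?_ _
    rw [← ENNReal.mul_rpow_of_nonneg _ _ (by norm_num), ← eofReal_mul h2,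
      ENNReal.ofReal_rpow_of_nonneg ((sq_nonneg _).trans h3) (by norm_num), ← ofReal_norm,
      norm_real, norm_of_nonneg (h0 x hx), ← Real.sqrt_eq_rpow]
    exact ofReal_le_ofReal (Real.le_sqrt_of_sq_le h3)
  · exact hf.enorm.mul (hw₁.ennreal_ofReal.pow_const _)
  · exact hg.enorm.mul (hw₂.ennreal_ofReal.pow_const _)

theorem enorm_pair_sq_le (hV : MeasurableSet V) (hf : AESM f (vol V))
    (hg : AESM g (vol V)) (hw₁ : AEMeasurable w₁ (vol V))
    (hw₂ : AEMeasurable w₂ (vol V)) (h0 : ∀ x ∈ V, 0 ≤ w x)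
    (h : ∀ x ∈ V, 0 ≤ w₁ x ∧ w x ^ 2 ≤ w₁ x * w₂ x) :
    ‖∫ x in V, f x * conj (g x) * w x‖ₑ ^ 2 ≤ NV V w₁ f * NV V w₂ g :=
  (pow_le_pow_left' (enorm_integral_le_lintegral_enorm _) 2).trans
    (lintegral_pair_sq_le hV hf hg hw₁ hw₂ h0 h)

theorem integrable_pair (hV : MeasurableSet V) (hf : AESM f (vol V))
    (hg : AESM g (vol V)) (hw : AEMeasurable w (vol V))
    (hw₁ : AEMeasurable w₁ (vol V)) (hw₂ : AEMeasurable w₂ (vol V)) (h0 : ∀ x ∈ V, 0 ≤ w x)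
    (h : ∀ x ∈ V, 0 ≤ w₁ x ∧ w x ^ 2 ≤ w₁ x * w₂ x) (hfN : NV V w₁ f < ⊤) (hgN : NV V w₂ g < ⊤) :
    IntegrableOn (fun x => f x * conj (g x) * w x) V := by
  refine ⟨(hf.mul ((RCLike.continuous_conj).comp_aestronglyMeasurable hg)).mul
    (continuous_ofReal.comp_aestronglyMeasurable hw.aestronglyMeasurable), ?_⟩
  have := (lintegral_pair_sq_le hV hf hg hw₁ hw₂ h0 h).trans_lt (mul_lt_top hfN hgN)
  exact (ENNReal.pow_lt_top_iff.1 this).resolve_right (by norm_num)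

theorem integrable_pair_same (hV : MeasurableSet V) (hf : AESM f (vol V))
    (hg : AESM g (vol V)) (hw : AEMeasurable w (vol V)) (h0 : ∀ x ∈ V, 0 ≤ w x)
    (hfN : NV V w f < ⊤) (hgN : NV V w g < ⊤) :
    IntegrableOn (fun x => f x * conj (g x) * w x) V :=
  integrable_pair hV hf hg hw hw hw h0 (fun x hx => ⟨h0 x hx, (sq (w x)).le⟩) hfN hgN

theorem NV_eq_re (hV : MeasurableSet V) (hf : AESM f (vol V))
    (hw : AEMeasurable w (vol V)) (h0 : ∀ x ∈ V, 0 ≤ w x) (hfN : NV V w f < ⊤) :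
    NV V w f = ofR (∫ x in V, f x * conj (f x) * w x).re := by
  have h := integrable_pair_same hV hf hf hw h0 hfN hfN
  have e : ∀ x, (f x * conj (f x) * w x).re = ‖f x‖ ^ 2 * w x := fun x => by
    rw [Complex.mul_conj, ← Complex.ofReal_mul, Complex.ofReal_re, Complex.normSq_eq_norm_sq]
  have h2 := integral_re h
  simp only [RCLike.re_eq_complex_re] at h2
  have h3 := h.re
  simp only [RCLike.re_eq_complex_re] at h3
  rw [← h2, ofReal_integral_eq_lintegral_ofReal h3]
  · refine setLIntegral_congr_fun hV fun x hx => ?_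
    simp only [e]
    rw [eofReal_mul (by positivity), eofReal_pow (norm_nonneg _), ofReal_norm]
  · refine (ae_restrict_iff' hV).2 (.of_forall fun x hx => ?_)
    simp only [e, Pi.zero_apply]
    exact mul_nonneg (sq_nonneg _) (h0 x hx)

theorem NV_sub_le (hV : MeasurableSet V) (hw : ∀ x ∈ V, 0 ≤ w x)
    (hf : AESM f (vol V)) (hwm : AEMeasurable w (vol V)) :
    NV V w (fun x => f x - g x) ≤ 2 * NV V w f + 2 * NV V w g := by
  have := NV_add_le (g := fun x => -g x) hV hw hf hwm
  simpa only [← sub_eq_add_neg, NV_neg] using this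

theorem NV_sub_lt_top (hV : MeasurableSet V) (hw : ∀ x ∈ V, 0 ≤ w x)
    (hf : AESM f (vol V)) (hwm : AEMeasurable w (vol V)) (h : NV V w f < ⊤)
    (h' : NV V w g < ⊤) : NV V w (fun x => f x - g x) < ⊤ :=
  (NV_sub_le hV hw hf hwm).trans_lt (add_lt_top.2
    ⟨mul_lt_top (by simp) h, mul_lt_top (by simp) h'⟩)

/-- Orthogonality gives minimality. -/
theorem NV_le_of_orth (hV : MeasurableSet V) (hf : AESM f (vol V))
    (hg : AESM g (vol V)) (hw : AEMeasurable w (vol V)) (h0 : ∀ x ∈ V, 0 ≤ w x)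
    (hfN : NV V w f < ⊤) (hgN : NV V w g < ⊤)
    (ho : ∫ x in V, g x * conj (f x) * w x = 0) :
    NV V w f ≤ NV V w (fun x => f x - g x) := by
  rw [NV_eq_re hV hf hw h0 hfN, NV_eq_re (f := fun x => f x - g x) hV (hf.sub hg) hw h0 (NV_sub_lt_top hV h0 hf hw hfN hgN)]
  refine ofReal_le_ofReal ?_
  have i1 := integrable_pair_same hV hf hf hw h0 hfN hfN
  have i2 := integrable_pair_same hV hg hf hw h0 hgN hfN
  have i3 := integrable_pair_same hV hf hg hw h0 hfN hgN
  have i4 := integrable_pair_same hV hg hg hw h0 hgN hgN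
  have e1 : ∫ x in V, f x * conj (g x) * w x = 0 := by
    have := congrArg conj ho
    rw [map_zero, ← integral_conj] at this
    rw [← this]
    exact integral_congr_all fun x => by simp [mul_comm]
  have e2 : ∫ x in V, (f x - g x) * conj (f x - g x) * w x =
      (∫ x in V, f x * conj (f x) * w x) + ∫ x in V, g x * conj (g x) * w x := by
    have : ∫ x in V, (f x - g x) * conj (f x - g x) * w x =
      ∫ x in V, (f x * conj (f x) * w x + g x * conj (g x) * w x) -
        (g x * conj (f x) * w x + f x * conj (g x) * w x) :=
      integral_congr_all fun x => by simp; ring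
    rw [this, integral_sub (i1.fun_add i4) (i2.fun_add i3), integral_add i1 i4, integral_add i2 i3, ho,
      e1]
    simp
  rw [e2, Complex.add_re]
  have h2 := integral_re i4
  simp only [RCLike.re_eq_complex_re] at h2
  have h3 : 0 ≤ (∫ x in V, g x * conj (g x) * w x).re := by
    rw [← h2]
    refine setIntegral_nonneg hV fun x hx => ?_
    rw [Complex.mul_conj, ← Complex.ofReal_mul, Complex.ofReal_re]
    exact mul_nonneg (normSq_nonneg _) (h0 x hx)
  linarith

end

theorem levi_zero (β : Fin n → ℂ) : levi (fun _ => (0 : ℝ)) x β = 0 := by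
  rw [show β = (WithLp.toLp 2 β : Cn n) from rfl, levi_eq contDiffAt_const]
  simp

namespace Dom

include D

theorem exists_bound_rho : ∃ S > 0, ∀ x ∈ V, -ρ x ≤ S := by
  obtain ⟨S, hS, h⟩ := D.bound (f := ρ) D.hρ.continuousOn
  exact ⟨S, hS, fun x hx => (neg_le_abs _).trans (h x (subset_closure hx))⟩

theorem exp_cube_le (hσ : 0 < σ) (hx : x ∈ V) :
    expR (σ * (ρ x ^ 3)⁻¹) ≤ (-ρ x) ^ 3 / σ := by
  have h1 : 0 < -ρ x := D.pos hx
  have h2 : σ * (ρ x ^ 3)⁻¹ = -(σ / (-ρ x) ^ 3) := by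
    rw [Odd.neg_pow (by decide), div_neg, neg_neg, div_eq_mul_inv]
  have h3 : 0 < σ / (-ρ x) ^ 3 := by positivity
  rw [h2, Real.exp_neg, ← inv_div σ ((-ρ x) ^ 3)]
  exact inv_anti₀ h3 ((le_add_of_nonneg_right zero_le_one).trans (Real.add_one_le_exp _))

theorem NV_exp_cube_lt_top (hP : ∀ x ∈ V, |φ x| ≤ P) (hδ : 0 ≤ δ) (hg : NV V (sw ρ (M + 2)) g < ⊤) (hσ : 0 < σ) :
    NV V (fun x => expR (-(pot ρ φ A M δ x + -σ * (ρ x ^ 3)⁻¹))) g < ⊤ := by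
  obtain ⟨S, hS, hS'⟩ := D.exists_bound_rho
  refine (NV_mono (C := expR (P + |A| * S) * ((δ + S) * (S ^ 2 / σ))) D.meas (by positivity)
    fun x hx => ?_).trans_lt (mul_lt_top ofReal_lt_top hg)
  have h1 : 0 < -ρ x := D.pos hx
  have h2 : -ρ x ≤ S := hS' x hx
  rw [show -(pot ρ φ A M δ x + -σ * (ρ x ^ 3)⁻¹) = -pot ρ φ A M δ x + σ * (ρ x ^ 3)⁻¹ by ring,
    rexp_add, D.exp_pot hδ hx, ← rexp_add]
  have h3 : expR (-φ x + -(A * ρ x)) ≤ expR (P + |A| * S) := by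
    refine Real.exp_le_exp.2 (add_le_add ((neg_le_abs _).trans (hP x hx)) ?_)
    rw [← mul_neg]
    exact mul_le_mul (le_abs_self _) h2 h1.le (abs_nonneg _)
  have h5 : δ - ρ x ≤ δ + S := by linarith
  have h6 : (-ρ x) ^ 3 / σ ≤ (-ρ x) * (S ^ 2 / σ) := by
    rw [← mul_div_assoc]
    refine div_le_div_of_nonneg_right ?_ hσ.le
    nlinarith [pow_le_pow_left₀ h1.le h2 2]
  have h7 : 0 ≤ δ - ρ x := by linarith
  calc ‖g x‖ ^ 2 * (expR (-φ x + -(A * ρ x)) * (sw ρ (M + 1) x * (δ - ρ x)) *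
        expR (σ * (ρ x ^ 3)⁻¹))
      ≤ ‖g x‖ ^ 2 * (expR (P + |A| * S) * (sw ρ (M + 1) x * (δ + S)) *
        ((-ρ x) * (S ^ 2 / σ))) := by
        have := D.sw_pos (M := M + 1) hx
        gcongr
        exact (D.exp_cube_le hσ hx).trans h6
    _ = _ := by simp only [sw]; ring

theorem contOn_exp_pot (hφ : SmoothOn φ V) (hδ : 0 ≤ δ) :
    ContinuousOn (fun x => expR (-pot ρ φ A M δ x)) V :=
  contOn_exp_neg (D.contDiffOn_pot hφ hδ)

theorem hormander_pot (hφ : SmoothOn φ V) (hP : ∀ x ∈ V, |φ x| ≤ P)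
    (hA : ∀ x ∈ V, ∀ β, 0 ≤ levi φ x β + A * levi ρ x β) (hδ : 0 ≤ δ)
    (hq : SmoothOn q V) (hq' : ∀ k, NV V (sw ρ (M + 2)) (dzb k q) < ⊤)
    (hBc : ContinuousOn B V) (hB0 : ∀ x ∈ V, 0 ≤ B x)
    (hB : ∀ x ∈ V, ∀ β : Fin n → ℂ,
      ‖∑ k, dzb k q x * conj (β k)‖ ^ 2 ≤ B x * levi (pot ρ φ A M δ) x β)
    {R : ℝ≥0∞} (hR : R < ⊤)
    (hBR : ∫⁻ x in V, ofR (B x * expR (-pot ρ φ A M δ x)) ≤ R) :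
    ∃ f, HolOn f V ∧
      NV V (fun x => expR (-pot ρ φ A M δ x)) (fun x => q x - f x) ≤ R := by
  obtain ⟨c, hc, hl⟩ := D.levi_pot
  rw [← ENNReal.ofReal_toReal hR.ne] at hBR ⊢
  refine hormander D (D.contDiffOn_pot hφ hδ) (fun x hx β => ?_) hq hBc hB0 hB
    ENNReal.toReal_nonneg hBR fun σ hσ k => D.NV_exp_cube_lt_top hP hδ (hq' k) hσ
  refine le_trans ?_ (hl φ A M δ hφ hδ hA x hx β)
  have := D.pos hx
  positivity

/-- Solving `∂̄` with a gain of one power of the distance to the boundary. -/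
theorem dbar_gain (M : ℕ) : ∃ C : ℝ≥0∞, C < ⊤ ∧ ∀ q : Fn n, SmoothOn q V →
    (∀ k, NV V (sw ρ (M + 2)) (dzb k q) < ⊤) → ∃ f, HolOn f V ∧
      NV V (sw ρ (M + 1)) (fun x => q x - f x) ≤ C * ∑ k, NV V (sw ρ (M + 2)) (dzb k q) := by
  obtain ⟨c, hc, hl⟩ := D.levi_pot
  obtain ⟨S, hS, hS'⟩ := D.exists_bound_rho
  refine ⟨ofR ((1 + S) / c), ofReal_lt_top, fun q hq hq' => ?_⟩
  have hV := D.isOpen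
  have hφ : SmoothOn (fun _ : Cn n => (0 : ℝ)) V := contDiffOn_const
  have hφ0 : ∀ x ∈ V, ∀ β : Fin n → ℂ, 0 ≤ levi (fun _ => (0 : ℝ)) x β + 0 * levi ρ x β :=
    fun x _ β => by simp [levi_zero]
  have hcd : ∀ k, ContinuousOn (dzb k q) V := fun k => (contDiffOn_dd hV hq).continuousOn
  have hpe : ∀ x ∈ V, expR (-pot ρ (fun _ => 0) 0 M 1 x) = sw ρ (M + 1) x * (1 - ρ x) :=
    fun x hx => by rw [D.exp_pot zero_le_one hx]; simp
  set Q : Cn n → ℝ := fun x => ∑ k, ‖dzb k q x‖ ^ 2 with hQ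
  have hQ0 : ∀ x, 0 ≤ Q x := fun x => sum_nonneg fun k _ => sq_nonneg _
  have hB : ∀ x ∈ V, ∀ β : Fin n → ℂ, ‖∑ k, dzb k q x * conj (β k)‖ ^ 2 ≤
      Q x * (-ρ x / c) * levi (pot ρ (fun _ => 0) 0 M 1) x β := by
    intro x hx β
    have h1 := hl _ 0 M 1 hφ zero_le_one hφ0 x hx β
    have h2 := D.pos hx
    have h3 := norm_sum_mul_sq_le Finset.univ (fun k => dzb k q x) (fun k => conj (β k))
    simp only [RCLike.norm_conj] at h3
    refine h3.trans ?_
    have h4 : c / -ρ x * ∑ k, ‖β k‖ ^ 2 ≤ levi (pot ρ (fun _ => 0) 0 M 1) x β :=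
      (le_add_of_nonneg_right (by positivity)).trans h1
    have h5 := mul_le_mul_of_nonneg_left h4 (div_pos h2 hc).le
    rw [← mul_assoc, div_mul_div_cancel₀ hc.ne', div_self h2.ne', one_mul] at h5
    rw [mul_assoc]
    exact mul_le_mul_of_nonneg_left h5 (hQ0 x)
  have hR : ofR ((1 + S) / c) * ∑ k, NV V (sw ρ (M + 2)) (dzb k q) < ⊤ :=
    mul_lt_top ofReal_lt_top (ENNReal.sum_lt_top.2 fun k _ => hq' k)
  have hBR : ∫⁻ x in V, ofR (Q x * (-ρ x / c) *
      expR (-pot ρ (fun _ => 0) 0 M 1 x)) ≤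
      ofR ((1 + S) / c) * ∑ k, NV V (sw ρ (M + 2)) (dzb k q) := by
    have h1 : ∑ k, NV V (sw ρ (M + 2)) (dzb k q) =
        ∫⁻ x in V, ∑ k, ‖dzb k q x‖ₑ ^ 2 * ofR (sw ρ (M + 2) x) := by
      simp only [NV]
      refine (lintegral_finsetSum' _ fun k _ => ?_).symm
      exact (((hcd k).aestronglyMeasurable D.meas).enorm.pow_const 2).mul
        D.aem_sw.ennreal_ofReal
    rw [h1, ← lintegral_const_mul' _ _ ofReal_ne_top]
    refine setLIntegral_mono' D.meas fun x hx => ?_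
    have h2 := D.pos hx
    have h3 := D.sw_pos (M := M + 1) hx
    have h5 := D.sw_pos (M := M + 2) hx
    have e : ∑ k, ‖dzb k q x‖ₑ ^ 2 = ofR (Q x) := by
      rw [hQ, ENNReal.ofReal_sum_of_nonneg fun _ _ => sq_nonneg _]
      exact sum_congr rfl fun k _ => by
        rw [eofReal_pow (norm_nonneg _), ofReal_norm]
    rw [← sum_mul, e, ← eofReal_mul (hQ0 x), ← eofReal_mul (by positivity)]
    refine ofReal_le_ofReal ?_
    rw [hpe x hx]
    have h4 : 1 - ρ x ≤ 1 + S := by linarith [hS' x hx]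
    have h6 := hQ0 x
    have h7 : Q x * (-ρ x / c) * (sw ρ (M + 1) x * (1 - ρ x)) ≤
        Q x * (-ρ x / c) * (sw ρ (M + 1) x * (1 + S)) :=
      mul_le_mul_of_nonneg_left (mul_le_mul_of_nonneg_left h4 h3.le)
        (mul_nonneg h6 (div_nonneg h2.le hc.le))
    refine h7.trans_eq ?_
    simp only [sw]; ring
  have hBc : ContinuousOn (fun x => Q x * (-ρ x / c)) V :=
    (continuousOn_finsetSum _ fun k _ => (hcd k).norm.pow 2).mul
      (D.smooth.continuousOn.neg.div_const c)
  have hB0 : ∀ x ∈ V, 0 ≤ Q x * (-ρ x / c) :=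
    fun x hx => mul_nonneg (hQ0 x) (div_nonneg (D.pos hx).le hc.le)
  obtain ⟨f, hf, hfN⟩ := D.hormander_pot (P := 0) (M := M) (A := 0) (δ := 1) hφ (by simp) hφ0
    zero_le_one hq hq' hBc hB0 hB hR hBR
  refine ⟨f, hf, le_trans ?_ hfN⟩
  refine (NV_mono (C := 1) (g := fun x => q x - f x)
    (w' := fun x => expR (-pot ρ (fun _ => 0) 0 M 1 x)) D.meas zero_le_one
    fun x hx => ?_).trans_eq (by simp)
  have h1 := D.sw_pos (M := M + 1) hx
  have h2 := D.neg hx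
  rw [one_mul, hpe x hx]
  refine mul_le_mul_of_nonneg_left ?_ (sq_nonneg _)
  nlinarith

end Dom

theorem tendsto_NV_mul (hV : MeasurableSet V) {m : ℕ → Cn n → ℝ} (hf : AESM f (vol V)) (hw : AEMeasurable w (vol V)) (h0 : ∀ x ∈ V, 0 ≤ w x)
    (hm : ∀ i, AEMeasurable (m i) (vol V)) (hmC : ∀ i, ∀ x ∈ V, m i x ≤ C)
    (hm0 : ∀ x ∈ V, Tendsto (fun i => m i x) atTop (𝓝 0)) (hN : NV V w f < ⊤) :
    Tendsto (fun i => NV V (fun x => m i x * w x) f) atTop (𝓝 0) := by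
  have h := tendsto_lintegral_of_dominated_convergence' (μ := vol V)
    (F := fun i x => ‖f x‖ₑ ^ 2 * ofR (m i x * w x)) (f := fun _ => 0)
    (fun x => ofR C * (‖f x‖ₑ ^ 2 * ofR (w x)))
    (fun i => (hf.enorm.pow_const 2).mul ((hm i).mul hw).ennreal_ofReal)
    (fun i => (ae_restrict_iff' hV).2 (.of_forall fun x hx => ?_)) ?_
    ((ae_restrict_iff' hV).2 (.of_forall fun x hx => ?_))
  · simpa [NV] using h
  · beta_reduce
    rw [mul_left_comm, ← ENNReal.ofReal_mul' (h0 x hx)]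
    gcongr
    · exact h0 x hx
    · exact hmC i x hx
  · rw [lintegral_const_mul' _ _ ofReal_ne_top]
    exact (mul_lt_top ofReal_lt_top hN).ne
  · have h1 : Tendsto (fun i => m i x * w x) atTop (𝓝 0) := by
      simpa using (hm0 x hx).mul_const (w x)
    have h2 := ENNReal.Tendsto.const_mul (a := ‖f x‖ₑ ^ 2) (ENNReal.tendsto_ofReal h1)
      (Or.inr (by simp))
    simpa using h2

theorem cutErr_mul_sq_le : ∃ C > 0, ∀ j, ∀ τ < 0, cutErr 0 j τ * τ ^ 2 ≤ C := by
  obtain ⟨C, hC, h⟩ := exists_bound_deriv_smoothTransition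
  refine ⟨8 * C ^ 2, by positivity, fun j τ hτ => ?_⟩
  set y := -2 ^ j * τ - 1 with hy
  rw [cutErr, zero_div, Real.exp_zero, one_mul, ← hy]
  rcases lt_or_ge 1 y with h1 | h1
  · rw [deriv_smoothTransition_of_gt h1]; simp; positivity
  rcases lt_or_ge y 0 with h2 | h2
  · rw [deriv_smoothTransition_of_lt h2]; simp; positivity
  have h3 : deriv smoothTransition y ^ 2 ≤ C ^ 2 := sq_le_sq.2 ((h y).trans (le_abs_self C))
  have h4 : (2 ^ j * τ) ^ 2 ≤ 2 ^ 2 := by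
    have : (2 : ℝ) ^ j * τ = -(y + 1) := by rw [hy]; ring
    rw [this, neg_sq]
    exact pow_le_pow_left₀ (by linarith) (by linarith) 2
  calc 2 * (2 ^ j * deriv smoothTransition y) ^ 2 * τ ^ 2
      = 2 * ((2 ^ j * τ) ^ 2 * deriv smoothTransition y ^ 2) := by ring
    _ ≤ 2 * (2 ^ 2 * C ^ 2) := by gcongr
    _ = _ := by ring

theorem cutErr_mul_le {j : ℕ} :
    cutErr 0 j τ * ((2 ^ j)⁻¹ - τ) ≤ cutErr 0 j τ * (2 * -τ) := by
  by_cases h : -2 ^ j * τ - 1 < 0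
  · rw [cutErr, deriv_smoothTransition_of_lt h]; simp
  · refine mul_le_mul_of_nonneg_left ?_ cutErr_nonneg
    have h2 : (0 : ℝ) < 2 ^ j := by positivity
    have : ((2 : ℝ) ^ j)⁻¹ ≤ -τ := by
      rw [inv_le_iff_one_le_mul₀ h2]; linarith
    linarith

theorem tendsto_cutE (hτ : τ < 0) : ∀ᶠ j in atTop, cutE 0 j τ = 1 := by
  filter_upwards [eventually_two_pow hτ 1] with j hj
  rw [cutE, zero_div, Real.exp_zero, one_mul, smoothTransition.one_of_one_le hj.le]

namespace Dom

include D

/-- The cutoff functions of `V`. -/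
theorem isTest_cutE (j : ℕ) : IsTest V fun x => (cutE 0 j (ρ x) : ℂ) :=
  D.isTest_cut (contDiff_cutE 0 j) (ε := ((2 : ℝ) ^ j)⁻¹) (by positivity) fun _ h => cutE_eq_zero h

theorem dd_cutE (j : ℕ) (hx : x ∈ V) :
    dd c k (fun y => (cutE 0 j (ρ y) : ℂ)) x =
      ((deriv (cutE 0 j) (ρ x) : ℝ) : ℂ) * dd c k ♯ρ x :=
  dd_comp_real (((contDiff_cutE 0 j).differentiable (by simp)).differentiableAt.hasDerivAt)
    ((D.contDiffAt hx).differentiableAt (by simp))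

theorem cut_approx (hf : HolOn f V)
    (j : ℕ) : ∃ F, HolOn F V ∧ NV V (sw ρ (M + 1)) F < ⊤ ∧
      NV V (sw ρ (M + 2)) (fun x => cutE 0 j (ρ x) * f x - F x) ≤
      NV V (fun x => (2 * (cutErr 0 j (ρ x) * ρ x ^ 2)) * sw ρ (M + 2) x) f := by
  obtain ⟨c, hc, hl⟩ := D.levi_pot
  have hV := D.isOpen
  have hfs := hol_smooth hV hf
  set δ : ℝ := ((2 : ℝ) ^ j)⁻¹ with hδ
  have hδ0 : 0 < δ := by positivity
  have hφ : SmoothOn (fun _ : Cn n => (0 : ℝ)) V := contDiffOn_const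
  have hφ0 : ∀ x ∈ V, ∀ β : Fin n → ℂ, 0 ≤ levi (fun _ => (0 : ℝ)) x β + 0 * levi ρ x β :=
    fun x _ β => by simp [levi_zero]
  have hpe : ∀ x ∈ V, expR (-pot ρ (fun _ => 0) 0 M δ x) = sw ρ (M + 1) x * (δ - ρ x) :=
    fun x hx => by rw [D.exp_pot hδ0.le hx]; simp
  have hχ := D.isTest_cutE j
  have hq : IsTest V fun x => cutE 0 j (ρ x) * f x := hχ.mul hV hfs
  have hcE : ContinuousOn (fun x => cutErr 0 j (ρ x)) V :=
    (continuousOn_cutErr 0 j).comp D.smooth.continuousOn fun x hx => D.neg hx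
  have hdq : ∀ x ∈ V, ∀ k, dzb k (fun x => cutE 0 j (ρ x) * f x) x =
      ((deriv (cutE 0 j) (ρ x) : ℝ) : ℂ) * dzb k ♯ρ x * f x := by
    intro x hx k
    have h1 : dd I k f x = 0 := hol_dzb hV hf hx
    rw [dzb, dd_mul (hχ.diff x) (diffAt hV hfs hx), D.dd_cutE j hx, h1, mul_zero, add_zero]
  have hB : ∀ x ∈ V, ∀ β : Fin n → ℂ,
      ‖∑ k, dzb k (fun x => cutE 0 j (ρ x) * f x) x * conj (β k)‖ ^ 2 ≤
      (‖f x‖ ^ 2 * (cutErr 0 j (ρ x) * ρ x ^ 2)) * levi (pot ρ (fun _ => 0) 0 M δ) x β := by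
    intro x hx β
    have e : ∑ k, dzb k (fun x => cutE 0 j (ρ x) * f x) x * conj (β k) =
        ((deriv (cutE 0 j) (ρ x) : ℝ) : ℂ) * f x * conj (∑ k, dz k ♯ρ x * β k) := by
      rw [map_sum, mul_sum]
      refine sum_congr rfl fun k _ => ?_
      rw [hdq x hx, dzb_ofReal, map_mul]; ring
    have h1 := hl _ 0 M δ hφ hδ0.le hφ0 x hx β
    have h2 := D.neg hx
    have h6 : 0 < -ρ x := by linarith
    have h3 := deriv_cutE_sq_le (η := 0) (j := j) h2
    rw [e, norm_mul, norm_mul, RCLike.norm_conj, norm_real, mul_pow, mul_pow,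
      norm_eq_abs, sq_abs]
    set N := ‖∑ k, dz k ♯ρ x * β k‖ ^ 2
    have h4 : N ≤ ρ x ^ 2 * levi (pot ρ (fun _ => 0) 0 M δ) x β := by
      have h5 : 1 / ρ x ^ 2 * N ≤ levi (pot ρ (fun _ => 0) 0 M δ) x β := by
        refine le_trans ?_ h1
        rw [add_mul]
        have : 0 ≤ c / -ρ x * ∑ k, ‖β k‖ ^ 2 := by positivity
        have : 0 ≤ 1 / (δ - ρ x) ^ 2 * N := by positivity
        linarith
      have := mul_le_mul_of_nonneg_left h5 (sq_nonneg (ρ x))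
      rwa [← mul_assoc, mul_one_div_cancel (pow_ne_zero 2 h2.ne), one_mul] at this
    have h5 : deriv (cutE 0 j) (ρ x) ^ 2 ≤ cutErr 0 j (ρ x) := by simpa using h3
    calc _ ≤ cutErr 0 j (ρ x) * ‖f x‖ ^ 2 * (ρ x ^ 2 * levi (pot ρ (fun _ => 0) 0 M δ) x β) := by
          have := cutErr_nonneg (η := 0) (j := j) (τ := ρ x)
          gcongr
      _ = _ := by ring
  have hBR : ∫⁻ x in V, ofR ((‖f x‖ ^ 2 * (cutErr 0 j (ρ x) * ρ x ^ 2)) *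
      expR (-pot ρ (fun _ => 0) 0 M δ x)) ≤
      NV V (fun x => (2 * (cutErr 0 j (ρ x) * ρ x ^ 2)) * sw ρ (M + 2) x) f := by
    refine setLIntegral_mono' D.meas fun x hx => ?_
    rw [enorm_sq_eq, ← eofReal_mul (sq_nonneg _)]
    refine ofReal_le_ofReal ?_
    rw [hpe x hx]
    have h1 := mul_le_mul_of_nonneg_left (cutErr_mul_le (j := j) (τ := ρ x))
      (mul_nonneg (mul_nonneg (sq_nonneg ‖f x‖) (sq_nonneg (ρ x))) (D.sw_pos (M := M + 1) hx).le)
    refine le_trans (le_of_eq ?_) (h1.trans (le_of_eq ?_))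
    · ring
    · simp only [sw]; ring
  set R := NV V (fun x => (2 * (cutErr 0 j (ρ x) * ρ x ^ 2)) * sw ρ (M + 2) x) f with hRdef
  have hR : R < ⊤ := by
    have h1 : IsTest V fun x => (cutE 0 (j + 1) (ρ x) : ℂ) * f x := (D.isTest_cutE _).mul hV hfs
    have hwc : ContinuousOn (fun x => (2 * (cutErr 0 j (ρ x) * ρ x ^ 2)) * sw ρ (M + 2) x) V :=
      (continuousOn_const.mul (hcE.mul (D.smooth.continuousOn.pow 2))).mul D.contOn_sw
    refine lt_of_le_of_lt (lintegral_mono fun x => ?_) (h1.NV_lt_top hV hwc)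
    beta_reduce
    by_cases h : -2 ^ j * ρ x - 1 < 0
    · have h0 : cutErr 0 j (ρ x) = 0 := by
        rw [cutErr, deriv_smoothTransition_of_lt h]; simp
      rw [h0]; simp
    · have : cutE 0 (j + 1) (ρ x) = 1 := by
        rw [cutE, zero_div, Real.exp_zero, one_mul, smoothTransition.one_of_one_le]
        rw [pow_succ]; linarith
      rw [this]; simp
  obtain ⟨F, hF, hFN⟩ := D.hormander_pot (P := 0) (M := M) (A := 0) (δ := δ) hφ (by simp) hφ0
    hδ0.le hq.smooth.contDiffOn (fun k => hq.dd.NV_lt_top hV D.contOn_sw)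
    ((hfs.continuousOn.norm.pow 2).mul (hcE.mul (D.smooth.continuousOn.pow 2)))
    (fun x hx => mul_nonneg (sq_nonneg _) (mul_nonneg cutErr_nonneg (sq_nonneg _))) hB hR hBR
  have hqF : AESM (fun x => cutE 0 j (ρ x) * f x) (vol V) :=
    hq.continuous.aestronglyMeasurable
  refine ⟨F, hF, ?_, le_trans ?_ hFN⟩
  · have h1 : NV V (sw ρ (M + 1)) (fun x => cutE 0 j (ρ x) * f x - F x) < ⊤ := by
      refine (NV_mono (C := δ⁻¹) (g := fun x => cutE 0 j (ρ x) * f x - F x)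
        (w' := fun x => expR (-pot ρ (fun _ => 0) 0 M δ x)) D.meas (by positivity)
        fun x hx => ?_).trans_lt (mul_lt_top ofReal_lt_top (hFN.trans_lt hR))
      have h1 := D.sw_pos (M := M + 1) hx
      have h2 := D.neg hx
      rw [hpe x hx, mul_left_comm]
      refine mul_le_mul_of_nonneg_left ?_ (sq_nonneg _)
      rw [mul_left_comm]
      refine le_mul_of_one_le_right h1.le ?_
      rw [inv_mul_eq_div, one_le_div hδ0]
      linarith
    have h2 := NV_sub_lt_top D.meas (fun x hx => (D.sw_pos (M := M + 1) hx).le) hqF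
      D.aem_sw (hq.NV_lt_top hV D.contOn_sw) h1
    simpa using h2
  · refine (NV_mono (C := 1) (g := fun x => cutE 0 j (ρ x) * f x - F x)
      (w' := fun x => expR (-pot ρ (fun _ => 0) 0 M δ x)) D.meas zero_le_one
      fun x hx => ?_).trans_eq (by simp)
    have h1 := D.sw_pos (M := M + 1) hx
    rw [one_mul, hpe x hx]
    refine mul_le_mul_of_nonneg_left ?_ (sq_nonneg _)
    rw [show sw ρ (M + 2) x = sw ρ (M + 1) x * -ρ x from pow_succ _ _]
    exact mul_le_mul_of_nonneg_left (by linarith) h1.le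

theorem dense_hol (hf : HolOn f V) (hN : NV V (sw ρ (M + 2)) f < ⊤) :
    ∃ F : ℕ → Fn n, (∀ j, HolOn (F j) V ∧ NV V (sw ρ (M + 1)) (F j) < ⊤) ∧
      Tendsto (fun j => NV V (sw ρ (M + 2)) (fun x => f x - F j x)) atTop (𝓝 0) := by
  have hV := D.isOpen
  choose F hF1 hF2 hF3 using fun j => D.cut_approx (M := M) hf j
  refine ⟨F, fun j => ⟨hF1 j, hF2 j⟩, ?_⟩
  obtain ⟨C, hC, hC'⟩ := cutErr_mul_sq_le
  have hfm : AESM f (vol V) := hf.continuousOn.aestronglyMeasurable D.meas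
  have hρm : AEMeasurable ρ (vol V) := aem_of_contOn hV D.smooth.continuousOn
  have hw := D.aem_sw (M := M + 2)
  have t1 := tendsto_NV_mul (m := fun j x => 2 * (cutErr 0 j (ρ x) * ρ x ^ 2)) (C := 2 * C)
    D.meas hfm hw D.sw_nonneg
    (fun j => aem_of_contOn hV (continuousOn_const.mul (((continuousOn_cutErr 0 j).comp
      D.smooth.continuousOn fun x hx => D.neg hx).mul (D.smooth.continuousOn.pow 2))))
    (fun j x hx => by linarith [hC' j _ (D.neg hx)])
    (fun x hx => by
      simpa using ((tendsto_cutErr (η := 0) (D.neg hx)).mul_const (ρ x ^ 2)).const_mul 2) hN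
  have t2 := tendsto_NV_mul (m := fun j x => (1 - cutE 0 j (ρ x)) ^ 2) (C := 1)
    D.meas hfm hw D.sw_nonneg
    (fun j => (((contDiff_cutE 0 j).continuous.measurable.comp_aemeasurable hρm).const_sub 1).pow_const 2)
    (fun j x hx => by
      have := cutE_mem (le_refl (0 : ℝ)) (j := j) (D.neg hx)
      exact pow_le_one₀ (by linarith [this.2]) (by linarith [this.1]))
    (fun x hx => tendsto_const_nhds.congr' ((tendsto_cutE (D.neg hx)).mono fun j hj => by simp [hj])) hN
  have t3 : Tendsto (fun j => 2 * NV V (fun x => (1 - cutE 0 j (ρ x)) ^ 2 * sw ρ (M + 2) x) f +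
      2 * NV V (fun x => (2 * (cutErr 0 j (ρ x) * ρ x ^ 2)) * sw ρ (M + 2) x) f) atTop (𝓝 0) := by
    simpa using (ENNReal.Tendsto.const_mul (a := 2) t2 (Or.inr (by simp))).add
      (ENNReal.Tendsto.const_mul (a := 2) t1 (Or.inr (by simp)))
  refine tendsto_of_tendsto_of_tendsto_of_le_of_le tendsto_const_nhds t3 (fun _ => zero_le) fun j => ?_
  have hχ := D.isTest_cutE j
  have h1 := NV_add_le (w := sw ρ (M + 2)) (f := fun x => f x - cutE 0 j (ρ x) * f x)
    (g := fun x => cutE 0 j (ρ x) * f x - F j x) D.meas D.sw_nonneg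
    (hfm.sub (hχ.continuous.aestronglyMeasurable.mul hfm)) hw
  simp only [sub_add_sub_cancel] at h1
  refine h1.trans (add_le_add (mul_le_mul_right ?_ _) (mul_le_mul_right (hF3 j) _))
  refine (NV_mono (C := 1) (g := f) (w' := fun x => (1 - cutE 0 j (ρ x)) ^ 2 * sw ρ (M + 2) x) D.meas
    zero_le_one fun x hx => le_of_eq ?_).trans_eq (by simp)
  have : f x - cutE 0 j (ρ x) * f x = ((1 - cutE 0 j (ρ x) : ℝ) : ℂ) * f x := by push_cast; ring
  rw [this, norm_mul, mul_pow, norm_real, norm_eq_abs, sq_abs]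
  ring

end Dom

theorem NV_le_of_tendsto {w' : ℕ → Cn n → ℝ} {R : ℝ≥0∞} (hV : MeasurableSet V)
    (hf : AESM f (vol V)) (hw : ∀ i, AEMeasurable (w' i) (vol V))
    (h : ∀ x ∈ V, Tendsto (fun i => w' i x) atTop (𝓝 (w x))) (hR : ∀ i, NV V (w' i) f ≤ R) :
    NV V w f ≤ R := by
  calc NV V w f = ∫⁻ x in V, liminf (fun i => ‖f x‖ₑ ^ 2 * ofR (w' i x)) atTop := by
        refine setLIntegral_congr_fun hV fun x hx => ?_
        exact (ENNReal.Tendsto.const_mul (ENNReal.tendsto_ofReal (h x hx))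
          (Or.inr (by simp))).liminf_eq.symm
    _ ≤ liminf (fun i => NV V (w' i) f) atTop :=
        lintegral_liminf_le' fun i => (hf.enorm.pow_const 2).mul (hw i).ennreal_ofReal
    _ ≤ R := (liminf_le_liminf (.of_forall hR)).trans (by simp)

theorem norm_sum_add_mul_sq_le (a b : Fin n → ℂ) (v X : ℂ) {c : ℝ} (hc : 0 < c) :
    ‖∑ k, a k * conj (b k) + v * X‖ ^ 2 ≤
      (‖v‖ ^ 2 / 2 + c⁻¹ * ∑ k, ‖a k‖ ^ 2) * (c * ∑ k, ‖b k‖ ^ 2 + 2 * ‖X‖ ^ 2) := by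
  have h1 := norm_sum_mul_sq_le Finset.univ a (fun k => conj (b k))
  simp only [RCLike.norm_conj] at h1
  set S := ∑ k, a k * conj (b k)
  set α := ∑ k, ‖a k‖ ^ 2
  set β := ∑ k, ‖b k‖ ^ 2
  have hα : 0 ≤ α := sum_nonneg fun _ _ => sq_nonneg _
  have hβ : 0 ≤ β := sum_nonneg fun _ _ => sq_nonneg _
  have h2 : ‖S + v * X‖ ^ 2 ≤ (‖S‖ + ‖v‖ * ‖X‖) ^ 2 := by
    refine pow_le_pow_left₀ (norm_nonneg _) ((norm_add_le _ _).trans ?_) 2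
    rw [norm_mul]
  set u := ‖v‖ ^ 2 / 2 * (c * β) with hu
  set y := c⁻¹ * α * (2 * ‖X‖ ^ 2) with hy
  have hu0 : 0 ≤ u := by positivity
  have hy0 : 0 ≤ y := by positivity
  have h3 : 2 * ‖S‖ * (‖v‖ * ‖X‖) ≤ u + y := by
    refine (pow_le_pow_iff_left₀ (by positivity) (by positivity) two_ne_zero).1 ?_
    have h4 : u * y = α * β * (‖v‖ * ‖X‖) ^ 2 := by
      rw [hu, hy]; field_simp
    have h5 : ‖S‖ ^ 2 * (‖v‖ * ‖X‖) ^ 2 ≤ α * β * (‖v‖ * ‖X‖) ^ 2 := by gcongr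
    nlinarith [sq_nonneg (u - y)]
  calc _ ≤ _ := h2
    _ = ‖S‖ ^ 2 + 2 * ‖S‖ * (‖v‖ * ‖X‖) + ‖v‖ ^ 2 * ‖X‖ ^ 2 := by ring
    _ ≤ α * β + (u + y) + ‖v‖ ^ 2 * ‖X‖ ^ 2 := by gcongr
    _ = _ := by rw [hu, hy]; field_simp; ring

/-- The multiplier used for estimating Bergman projections of test functions. -/
def gainMul (A δ τ : ℝ) : ℝ := expR (A * τ) / (δ - τ)

theorem hasDerivAt_gainMul (h : 0 < δ - τ) :
    HasDerivAt (gainMul A δ) (gainMul A δ τ * (A + (δ - τ)⁻¹)) τ := by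
  have h1 : HasDerivAt (fun τ => expR (A * τ)) (expR (A * τ) * (A * 1)) τ :=
    ((hasDerivAt_id τ).const_mul A).exp
  have := h1.div ((hasDerivAt_id τ).const_sub δ) h.ne'
  refine HasDerivAt.congr_deriv (f := fun τ : ℝ => _) this ?_
  simp only [gainMul, id]
  field_simp
  ring

namespace Dom

include D

theorem contDiffOn_gainMul (hδ : 0 ≤ δ) :
    SmoothOn (fun x => gainMul A δ (ρ x)) V :=
  (contDiffOn_const.mul D.smooth).exp.div (contDiffOn_const.sub D.smooth) fun x hx => by
    have := D.neg hx; exact (by linarith : 0 < δ - ρ x).ne'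

theorem gainMul_pos (hδ : 0 ≤ δ) (hx : x ∈ V) :
    0 < gainMul A δ (ρ x) :=
  div_pos (exp_pos _) (by have := D.neg hx; linarith)

theorem dzb_gainMul (hδ : 0 ≤ δ) (hf : SmoothOn f V) (hx : x ∈ V) (k : Fin n) : dzb k (fun y => (gainMul A δ (ρ y) : ℂ) * f y) x =
      gainMul A δ (ρ x) * (dzb k f x + A * dzb k ♯ρ x * f x +
        dzb k ♯ρ x * (f x / (δ - ρ x : ℝ))) := by
  have h1 := D.neg hx
  have h2 : 0 < δ - ρ x := by linarith
  have h3 := dd_comp_real (c := I) (j := k) (hasDerivAt_gainMul (A := A) h2)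
    ((D.contDiffAt hx).differentiableAt (by simp))
  rw [dzb, dd_mul (diffAt D.isOpen (contDiffOn_ofReal (D.contDiffOn_gainMul hδ)) hx)
    (diffAt D.isOpen hf hx), h3]
  push_cast
  rw [div_eq_mul_inv]
  ring

theorem gain_bound (hφ : SmoothOn φ V) (hP : ∀ x ∈ V, |φ x| ≤ P)
    (hA : ∀ x ∈ V, ∀ β, 0 ≤ levi φ x β + A * levi ρ x β) (hv : SmoothOn v V) (hvN : NV V (sw ρ (M + 1)) v < ⊤)
    (hdv : ∀ k, NV V (sw ρ (M + 1)) (dzb k v) < ⊤)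
    (ho : ∀ h, HolOn h V → NV V (sw ρ (M + 1)) h < ⊤ →
      ∫ x in V, h x * conj (v x) * (expR (-φ x) * sw ρ (M + 1) x : ℝ) = 0) :
    ∃ R < ⊤, ∀ δ > 0, NV V (fun x => gainMul A δ (ρ x) * (expR (-φ x) * sw ρ (M + 1) x)) v ≤ R := by
  obtain ⟨c, hc, hl⟩ := D.levi_pot
  have hV := D.isOpen
  obtain ⟨S, hS, hS'⟩ := D.exists_bound_rho
  set a : Fin n → Fn n := fun k x => dzb k v x + A * dzb k ♯ρ x * v x with ha
  have hac : ∀ k, ContinuousOn (a k) V := fun k => ((contDiffOn_dd hV hv).continuousOn).add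
    ((continuousOn_const.mul (contDiffOn_dd hV (contDiffOn_ofReal D.smooth)).continuousOn).mul
      hv.continuousOn)
  have haN : ∀ k, NV V (sw ρ (M + 1)) (a k) < ⊤ := by
    intro k
    obtain ⟨C, hC, hC'⟩ := D.bound (contDiffOn_dd (c := I) (j := k) D.hW
      (contDiffOn_ofReal D.hρ)).continuousOn
    refine (NV_add_le D.meas D.sw_nonneg
      ((contDiffOn_dd hV hv).continuousOn.aestronglyMeasurable D.meas)
      D.aem_sw).trans_lt (add_lt_top.2
      ⟨mul_lt_top (by simp) (hdv k), mul_lt_top (by simp) ?_⟩)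
    refine (NV_mono (C := (|A| * C) ^ 2) (g := v) (w' := sw ρ (M + 1)) D.meas (by positivity)
      fun x hx => ?_).trans_lt (mul_lt_top ofReal_lt_top hvN)
    rw [norm_mul, norm_mul, mul_pow, norm_real, norm_eq_abs, mul_assoc]
    have := hC' x (subset_closure hx)
    have := (D.sw_pos (M := M + 1) hx).le
    gcongr
  obtain ⟨K, hK, hK'⟩ : ∃ K > 0, ∀ x ∈ V, expR (A * ρ x) * expR (-φ x) ≤ K := by
    refine ⟨expR (|A| * S + P), exp_pos _, fun x hx => ?_⟩
    rw [← rexp_add]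
    refine Real.exp_le_exp.2 (add_le_add ?_ ((neg_le_abs _).trans (hP x hx)))
    refine (le_abs_self _).trans ?_
    rw [abs_mul, abs_of_neg (D.neg hx)]
    exact mul_le_mul_of_nonneg_left (hS' x hx) (abs_nonneg _)
  set R₁ : ℝ≥0∞ := ofR (K / c) * ∑ k, NV V (sw ρ (M + 1)) (a k) with hR₁
  have hR₁t : R₁ < ⊤ :=
    mul_lt_top ofReal_lt_top (ENNReal.sum_lt_top.2 fun k _ => haN k)
  refine ⟨2 * R₁, mul_lt_top (by simp) hR₁t, fun δ hδ => ?_⟩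
  have hpos : ∀ x ∈ V, 0 < δ - ρ x := fun x hx => by have := D.neg hx; linarith
  set Φ := pot ρ φ A M δ
  set E : Cn n → ℝ := fun x => gainMul A δ (ρ x) with hE
  have hEs : SmoothOn E V := D.contDiffOn_gainMul hδ.le
  have hE0 : ∀ x ∈ V, 0 < E x := fun x hx => D.gainMul_pos hδ.le hx
  have hpe : ∀ x ∈ V, expR (-Φ x) = expR (-φ x) * expR (-(A * ρ x)) *
      (sw ρ (M + 1) x * (δ - ρ x)) := fun x hx => D.exp_pot hδ.le hx
  have hEpe : ∀ x ∈ V, E x * expR (-Φ x) = expR (-φ x) * sw ρ (M + 1) x := by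
    intro x hx
    rw [hpe x hx, hE]
    simp only [gainMul]
    rw [Real.exp_neg (A * ρ x)]
    have := (hpos x hx).ne'
    have := (exp_pos (A * ρ x)).ne'
    field_simp
  set v' : Fn n := fun x => (E x : ℂ) * v x with hv'
  have hv's : SmoothOn v' V := (contDiffOn_ofReal hEs).mul hv
  have hd : ∀ x ∈ V, ∀ k, dzb k v' x = E x * (a k x + dzb k ♯ρ x *
      (v x / (δ - ρ x : ℝ))) := fun x hx k => D.dzb_gainMul hδ.le hv hx k
  have hEb : ∀ x ∈ V, E x ≤ expR (|A| * S) / δ := by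
    intro x hx
    refine div_le_div₀ (exp_pos _).le (Real.exp_le_exp.2 ((le_abs_self _).trans ?_)) hδ
      (by linarith [D.neg hx])
    rw [abs_mul, abs_of_neg (D.neg hx)]
    exact mul_le_mul_of_nonneg_left (hS' x hx) (abs_nonneg _)
  have hNv' : NV V (fun x => expR (-Φ x)) v' =
      NV V (fun x => E x * (expR (-φ x) * sw ρ (M + 1) x)) v := by
    refine setLIntegral_congr_fun D.meas fun x hx => ?_
    have h0 := hE0 x hx
    simp only [hv', enorm_mul, mul_pow]
    rw [← hEpe x hx, ← ofReal_norm (E x : ℂ), norm_real, norm_of_nonneg h0.le,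
      ← eofReal_pow h0.le, mul_assoc, mul_left_comm, ← eofReal_mul (by positivity),
      ← mul_assoc, sq (E x)]
  have hwle : ∀ x ∈ V, expR (-φ x) ≤ expR P := fun x hx =>
    Real.exp_le_exp.2 ((neg_le_abs _).trans (hP x hx))
  have hv'N : NV V (fun x => expR (-Φ x)) v' < ⊤ := by
    rw [hNv']
    refine (NV_mono (C := expR (|A| * S) / δ * expR P) (g := v) (w' := sw ρ (M + 1)) D.meas
      (by positivity) fun x hx => ?_).trans_lt (mul_lt_top ofReal_lt_top hvN)
    have h1 := (D.sw_pos (M := M + 1) hx).le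
    have h2 := hEb x hx
    have h3 := hwle x hx
    rw [mul_left_comm (expR (|A| * S) / δ * expR P)]
    refine mul_le_mul_of_nonneg_left ?_ (sq_nonneg _)
    rw [← mul_assoc]
    gcongr
  set B : Cn n → ℝ := fun x => ‖v' x‖ ^ 2 / 2 + E x ^ 2 * (-ρ x / c * ∑ k, ‖a k x‖ ^ 2) with hB
  have hBc : ContinuousOn B V := by
    refine ((hv's.continuousOn.norm.pow 2).div_const 2).add ((hEs.continuousOn.pow 2).mul
      ((D.smooth.continuousOn.neg.div_const c).mul ?_))
    exact continuousOn_finsetSum _ fun k _ => (hac k).norm.pow 2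
  have hB0 : ∀ x ∈ V, 0 ≤ B x := fun x hx => by
    have := D.pos hx
    positivity
  have hBL : ∀ x ∈ V, ∀ β : Fin n → ℂ, ‖∑ k, dzb k v' x * conj (β k)‖ ^ 2 ≤ B x * levi Φ x β := by
    intro x hx β
    have h1 := hl φ A M δ hφ hδ.le hA x hx β
    have h2 := D.neg hx
    have h3 := neg_pos.2 h2
    have h4 := hpos x hx
    set Y := ∑ k, dz k ♯ρ x * β k with hY
    have e : ∑ k, dzb k v' x * conj (β k) =
        E x * (∑ k, a k x * conj (β k) + v x * (conj Y / (δ - ρ x : ℝ))) := by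
      rw [hY, map_sum, Finset.sum_div, mul_sum, ← sum_add_distrib, mul_sum]
      refine sum_congr rfl fun k _ => ?_
      rw [hd x hx, dzb_ofReal, map_mul]; ring
    have h5 := norm_sum_add_mul_sq_le (fun k => a k x) β (v x) (conj Y / (δ - ρ x : ℝ))
      (div_pos hc h3)
    rw [norm_div, RCLike.norm_conj, norm_real, norm_of_nonneg h4.le] at h5
    have h6 : c / -ρ x * ∑ k, ‖β k‖ ^ 2 + 2 * (‖Y‖ / (δ - ρ x)) ^ 2 ≤ levi Φ x β := by
      refine le_trans ?_ h1
      have h7 : 1 / (δ - ρ x) ^ 2 ≤ 1 / ρ x ^ 2 := by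
        refine one_div_le_one_div_of_le (sq_pos_of_neg h2) ?_
        rw [← neg_sq (ρ x)]
        exact pow_le_pow_left₀ h3.le (by linarith) 2
      have h8 := mul_le_mul_of_nonneg_right h7 (sq_nonneg ‖Y‖)
      rw [div_pow, add_mul]
      have h9 : ‖Y‖ ^ 2 / (δ - ρ x) ^ 2 = 1 / (δ - ρ x) ^ 2 * ‖Y‖ ^ 2 := by ring
      rw [h9]
      linarith
    rw [e, norm_mul, mul_pow, norm_real, norm_eq_abs, sq_abs]
    calc _ ≤ E x ^ 2 * ((‖v x‖ ^ 2 / 2 + (c / -ρ x)⁻¹ * ∑ k, ‖a k x‖ ^ 2) * levi Φ x β) := by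
          refine mul_le_mul_of_nonneg_left (h5.trans (mul_le_mul_of_nonneg_left h6 ?_)) (sq_nonneg _)
          positivity
      _ = _ := by
          rw [hB]; simp only [hv', norm_mul, mul_pow, norm_real, norm_eq_abs, sq_abs,
            inv_div]
          ring
  have hvm : AESM v (vol V) := hv.continuousOn.aestronglyMeasurable D.meas
  have hv'm : AESM v' (vol V) := hv's.continuousOn.aestronglyMeasurable D.meas
  have hΦm : AEMeasurable (fun x => expR (-Φ x)) (vol V) :=
    aem_of_contOn hV (D.contOn_exp_pot hφ hδ.le)
  have hBR : ∫⁻ x in V, ofR (B x * expR (-Φ x)) ≤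
      ofR (1 / 2) * NV V (fun x => expR (-Φ x)) v' + R₁ := by
    have h1 : ∑ k, NV V (sw ρ (M + 1)) (a k) =
        ∫⁻ x in V, ∑ k, ‖a k x‖ₑ ^ 2 * ofR (sw ρ (M + 1) x) := by
      simp only [NV]
      refine (lintegral_finsetSum' _ fun k _ => ?_).symm
      exact (((hac k).aestronglyMeasurable D.meas).enorm.pow_const 2).mul
        D.aem_sw.ennreal_ofReal
    rw [hR₁, h1, NV, ← lintegral_const_mul' _ _ ofReal_ne_top,
      ← lintegral_const_mul' _ _ ofReal_ne_top, ← lintegral_add_left']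
    · refine setLIntegral_mono' D.meas fun x hx => ?_
      have h2 := D.pos hx
      have h3 := D.sw_pos (M := M + 1) hx
      have e : ∑ k, ‖a k x‖ₑ ^ 2 = ofR (∑ k, ‖a k x‖ ^ 2) := by
        rw [ENNReal.ofReal_sum_of_nonneg fun _ _ => sq_nonneg _]
        exact sum_congr rfl fun k _ => by
          rw [eofReal_pow (norm_nonneg _), ofReal_norm]
      have hs0 : 0 ≤ ∑ k, ‖a k x‖ ^ 2 := sum_nonneg fun _ _ => sq_nonneg _
      rw [← sum_mul, e, enorm_sq_eq,
        ← eofReal_mul (by positivity), ← eofReal_mul (by positivity),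
        ← eofReal_mul (by positivity), ← eofReal_mul (by positivity),
        ← ENNReal.ofReal_add (by positivity) (by positivity)]
      refine ofReal_le_ofReal ?_
      have h5 : E x ^ 2 * expR (-Φ x) * -ρ x ≤ K * sw ρ (M + 1) x := by
        rw [sq, mul_assoc (E x), hEpe x hx, hE]
        simp only [gainMul]
        have h6 : -ρ x / (δ - ρ x) ≤ 1 := (div_le_one (hpos x hx)).2 (by linarith)
        calc _ = (expR (A * ρ x) * expR (-φ x) * sw ρ (M + 1) x) * (-ρ x / (δ - ρ x)) := by
              ring
          _ ≤ (expR (A * ρ x) * expR (-φ x) * sw ρ (M + 1) x) * 1 := by gcongr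
          _ ≤ _ := by rw [mul_one]; exact mul_le_mul_of_nonneg_right (hK' x hx) h3.le
      have h7 := mul_le_mul_of_nonneg_left h5 (div_nonneg hs0 hc.le)
      rw [hB]
      calc _ = 1 / 2 * (‖v' x‖ ^ 2 * expR (-Φ x)) + (∑ k, ‖a k x‖ ^ 2) / c *
            (E x ^ 2 * expR (-Φ x) * -ρ x) := by ring
        _ ≤ 1 / 2 * (‖v' x‖ ^ 2 * expR (-Φ x)) + (∑ k, ‖a k x‖ ^ 2) / c *
            (K * sw ρ (M + 1) x) := by linarith
        _ = _ := by ring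
    · exact ((hv'm.enorm.pow_const 2).mul hΦm.ennreal_ofReal).const_mul _
  have hdN : ∀ k, NV V (sw ρ (M + 2)) (dzb k v') < ⊤ := by
    intro k
    obtain ⟨C, hC, hC'⟩ := D.bound (contDiffOn_dd (c := I) (j := k) D.hW
      (contDiffOn_ofReal D.hρ)).continuousOn
    have h1 : NV V (sw ρ (M + 1)) (fun x => a k x + dzb k ♯ρ x *
        (v x / (δ - ρ x : ℝ))) < ⊤ := by
      refine (NV_add_le D.meas D.sw_nonneg
        ((hac k).aestronglyMeasurable D.meas)
        D.aem_sw).trans_lt (add_lt_top.2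
        ⟨mul_lt_top (by simp) (haN k), mul_lt_top (by simp) ?_⟩)
      refine (NV_mono (C := (C / δ) ^ 2) (g := v) (w' := sw ρ (M + 1)) D.meas (by positivity)
        fun x hx => ?_).trans_lt (mul_lt_top ofReal_lt_top hvN)
      have h2 := hC' x (subset_closure hx)
      have h3 := (D.sw_pos (M := M + 1) hx).le
      have h4 := D.neg hx
      rw [norm_mul, norm_div, norm_real, norm_of_nonneg (hpos x hx).le,
        mul_div_left_comm, mul_pow, mul_comm (‖v x‖ ^ 2), mul_assoc]
      have h5 : ‖dd I k ♯ρ x‖ / (δ - ρ x) ≤ C / δ :=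
        div_le_div₀ hC.le h2 hδ (by linarith)
      have h6 : 0 ≤ ‖dd I k ♯ρ x‖ / (δ - ρ x) :=
        div_nonneg (norm_nonneg _) (hpos x hx).le
      exact mul_le_mul_of_nonneg_right (pow_le_pow_left₀ h6 h5 2) (by positivity)
    refine (NV_mono (C := (expR (|A| * S) / δ) ^ 2 * S) (w' := sw ρ (M + 1)) D.meas
      (by positivity) fun x hx => ?_).trans_lt (mul_lt_top ofReal_lt_top h1)
    have h3 := (D.sw_pos (M := M + 1) hx).le
    have h4 := D.pos hx
    have h5 := hE0 x hx
    rw [hd x hx, norm_mul, mul_pow, norm_real, norm_of_nonneg h5.le,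
      show sw ρ (M + 2) x = sw ρ (M + 1) x * -ρ x from pow_succ _ _]
    calc _ = (E x ^ 2 * -ρ x) * (‖a k x + dzb k ♯ρ x *
        (v x / (δ - ρ x : ℝ))‖ ^ 2 * sw ρ (M + 1) x) := by ring
      _ ≤ _ := mul_le_mul_of_nonneg_right (mul_le_mul (pow_le_pow_left₀ h5.le (hEb x hx) 2)
          (hS' x hx) h4.le (by positivity)) (by positivity)
  obtain ⟨g, hg, hgN⟩ := D.hormander_pot hφ hP hA hδ.le hv's hdN hBc hB0 hBL
    (add_lt_top.2 ⟨mul_lt_top ofReal_lt_top hv'N, hR₁t⟩) hBR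
  have hgm : AESM g (vol V) := hg.continuousOn.aestronglyMeasurable D.meas
  have hgt : NV V (fun x => expR (-Φ x)) g < ⊤ := by
    have := NV_sub_lt_top D.meas (fun x _ => (exp_pos (-Φ x)).le) hv'm hΦm hv'N
      (hgN.trans_lt (add_lt_top.2 ⟨mul_lt_top ofReal_lt_top hv'N, hR₁t⟩))
    simpa using this
  have hgs : NV V (sw ρ (M + 1)) g < ⊤ := by
    refine (NV_mono (C := expR (P + |A| * S) / δ) (g := g) (w' := fun x => expR (-Φ x)) D.meas
      (by positivity) fun x hx => ?_).trans_lt (mul_lt_top ofReal_lt_top hgt)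
    have h1 := D.sw_pos (M := M + 1) hx
    have h2 := D.neg hx
    rw [mul_left_comm, hpe x hx]
    refine mul_le_mul_of_nonneg_left ?_ (sq_nonneg _)
    have h3 : 1 ≤ expR (P + |A| * S) * (expR (-φ x) * expR (-(A * ρ x))) := by
      rw [← rexp_add, ← rexp_add]
      refine Real.one_le_exp ?_
      have h4 := (le_abs_self _).trans (hP x hx)
      have h5 : A * ρ x ≤ |A| * S := by
        refine (le_abs_self _).trans ?_
        rw [abs_mul, abs_of_neg h2]
        exact mul_le_mul_of_nonneg_left (hS' x hx) (abs_nonneg _)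
      linarith
    have h6 : 1 ≤ (δ - ρ x) / δ := (one_le_div hδ).2 (by linarith)
    calc sw ρ (M + 1) x = 1 * 1 * sw ρ (M + 1) x := by ring
      _ ≤ (expR (P + |A| * S) * (expR (-φ x) * expR (-(A * ρ x)))) * ((δ - ρ x) / δ) *
          sw ρ (M + 1) x := by gcongr
      _ = _ := by ring
  have horth : ∫ x in V, g x * conj (v' x) * (expR (-Φ x) : ℝ) = 0 := by
    rw [← ho g hg hgs]
    refine setIntegral_congr_fun D.meas fun x hx => ?_
    simp only [hv', map_mul, conj_ofReal]
    rw [← hEpe x hx]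
    push_cast
    ring
  have h := (NV_le_of_orth D.meas hv'm hgm hΦm (fun x _ => (exp_pos (-Φ x)).le) hv'N hgt
    horth).trans hgN
  rw [← hNv']
  set N := NV V (fun x => expR (-Φ x)) v'
  have h2 : ofR (1 / 2) * N + ofR (1 / 2) * N = N := by
    rw [← add_mul, ← ENNReal.ofReal_add (by norm_num) (by norm_num)]; norm_num
  have h3 : ofR (1 / 2) * N ≤ R₁ := by
    have h4 : ofR (1 / 2) * N + ofR (1 / 2) * N ≤
      ofR (1 / 2) * N + R₁ := by rw [h2]; exact h
    exact (ENNReal.add_le_add_iff_left (mul_lt_top ofReal_lt_top hv'N).ne).1 h4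
  rw [← h2, two_mul]
  exact add_le_add h3 h3

end Dom

theorem pair_conj (f g : Fn n) (w : Cn n → ℝ) :
    ∫ x in V, g x * conj (f x) * w x = conj (∫ x in V, f x * conj (g x) * w x) := by
  rw [← integral_conj]
  refine integral_congr_all fun x => ?_
  simp only [map_mul, conj_conj, conj_ofReal]
  ring

theorem eqOn_zero_of_NV (hV : IsOpen V) (hw : ContinuousOn w V) (h0 : ∀ x ∈ V, 0 < w x)
    (hf : ContinuousOn f V) (h : NV V w f = 0) : EqOn f (fun _ => 0) V := by
  refine Measure.eqOn_open_of_ae_eq (μ := volume) ?_ hV hf continuousOn_const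
  have hm : AEMeasurable (fun x => ‖f x‖ₑ ^ 2 * ofR (w x)) (vol V) :=
    ((hf.aestronglyMeasurable hV.measurableSet).enorm.pow_const 2).mul
      (aem_of_contOn hV hw).ennreal_ofReal
  filter_upwards [(lintegral_eq_zero_iff' hm).1 h, ae_restrict_mem hV.measurableSet] with x hx hxV
  simp only [Pi.zero_apply, mul_eq_zero, ENNReal.ofReal_eq_zero, (h0 x hxV).not_ge, or_false] at hx
  simpa using hx

/-- The weight `(-ρ)^M e^{-φ}`. -/
def ww (ρ φ : Cn n → ℝ) (M : ℕ) (x : Cn n) : ℝ := expR (-φ x) * sw ρ M x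

namespace Dom

include D

theorem ww_pos (hx : x ∈ V) : 0 < ww ρ φ M x :=
  mul_pos (exp_pos _) (D.sw_pos hx)

theorem contOn_ww (hφ : ContinuousOn φ V) : ContinuousOn (ww ρ φ M) V :=
  (hφ.neg.rexp).mul D.contOn_sw

theorem ww_le (hP : ∀ x ∈ V, |φ x| ≤ P) (hx : x ∈ V) :
    ww ρ φ M x ≤ expR P * sw ρ M x :=
  mul_le_mul_of_nonneg_right (Real.exp_le_exp.2 ((neg_le_abs _).trans (hP x hx))) (D.sw_pos hx).le

theorem le_ww (hP : ∀ x ∈ V, |φ x| ≤ P) (hx : x ∈ V) :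
    sw ρ M x ≤ expR P * ww ρ φ M x := by
  rw [ww, ← mul_assoc, ← rexp_add]
  refine le_mul_of_one_le_left (D.sw_pos hx).le (Real.one_le_exp ?_)
  linarith [(le_abs_self _).trans (hP x hx)]

theorem NV_ww_le (hP : ∀ x ∈ V, |φ x| ≤ P) (f : Fn n) :
    NV V (ww ρ φ M) f ≤ ofR (expR P) * NV V (sw ρ M) f :=
  NV_mono D.meas (exp_pos _).le fun x hx => by
    rw [mul_left_comm]; exact mul_le_mul_of_nonneg_left (D.ww_le hP hx) (sq_nonneg _)

theorem NV_sw_le (hP : ∀ x ∈ V, |φ x| ≤ P) (f : Fn n) :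
    NV V (sw ρ M) f ≤ ofR (expR P) * NV V (ww ρ φ M) f :=
  NV_mono D.meas (exp_pos _).le fun x hx => by
    rw [mul_left_comm]; exact mul_le_mul_of_nonneg_left (D.le_ww hP hx) (sq_nonneg _)

theorem NV_ww_lt_top (hP : ∀ x ∈ V, |φ x| ≤ P) (f : Fn n) :
    NV V (ww ρ φ M) f < ⊤ ↔ NV V (sw ρ M) f < ⊤ :=
  ⟨fun h => (D.NV_sw_le hP f).trans_lt (mul_lt_top ofReal_lt_top h),
    fun h => (D.NV_ww_le hP f).trans_lt (mul_lt_top ofReal_lt_top h)⟩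

theorem NV_sw_succ_le : ∃ S : ℝ≥0∞, S < ⊤ ∧ ∀ M (f : Fn n),
    NV V (sw ρ (M + 1)) f ≤ S * NV V (sw ρ M) f := by
  obtain ⟨S, hS, hS'⟩ := D.exists_bound_rho
  refine ⟨ofR S, ofReal_lt_top, fun M f => NV_mono D.meas hS.le fun x hx => ?_⟩
  rw [mul_left_comm, show sw ρ (M + 1) x = -ρ x * sw ρ M x from pow_succ' _ _]
  exact mul_le_mul_of_nonneg_left (mul_le_mul_of_nonneg_right (hS' x hx) (D.sw_pos hx).le)
    (sq_nonneg _)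

theorem NV_sw_succ_lt_top (h : NV V (sw ρ M) f < ⊤) :
    NV V (sw ρ (M + 1)) f < ⊤ := by
  obtain ⟨S, hS, hS'⟩ := D.NV_sw_succ_le
  exact (hS' M f).trans_lt (mul_lt_top hS h)

/-- Bergman projections of test functions gain one power of the distance to the boundary. -/
theorem proj_gain (hφ : SmoothOn φ V) (hP : ∀ x ∈ V, |φ x| ≤ P)
    (hA : ∀ x ∈ V, ∀ β, 0 ≤ levi φ x β + A * levi ρ x β) {η p : Fn n} (hη : IsTest V η)
    (hp : HolOn p V) (hpN : NV V (ww ρ φ (M + 1)) p < ⊤)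
    (ho : ∀ h, HolOn h V → NV V (ww ρ φ (M + 1)) h < ⊤ →
      ∫ x in V, h x * conj (η x - p x) * ww ρ φ (M + 1) x = 0) :
    NV V (sw ρ M) p < ⊤ := by
  have hV := D.isOpen
  have hps := hol_smooth hV hp
  set v : Fn n := fun x => η x - p x with hv
  have hvs : SmoothOn v V := hη.smooth.contDiffOn.sub hps
  have hηm : AESM η (vol V) := hη.continuous.aestronglyMeasurable
  have hvm : AESM v (vol V) := hvs.continuousOn.aestronglyMeasurable D.meas
  have hvN : NV V (sw ρ (M + 1)) v < ⊤ := NV_sub_lt_top D.meas D.sw_nonneg hηm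
    D.aem_sw (hη.NV_lt_top hV D.contOn_sw) ((D.NV_ww_lt_top hP p).1 hpN)
  have hdv : ∀ k, NV V (sw ρ (M + 1)) (dzb k v) < ⊤ := by
    intro k
    have h1 : EqOn (dzb k v) (dzb k η) V := by
      intro x hx
      have h2 : dd I k p x = 0 := hol_dzb hV hp hx
      rw [hv, dzb, dd_sub (hη.diff x) (diffAt hV hps hx), h2, sub_zero]
    rw [NV_congr D.meas h1]
    exact hη.dd.NV_lt_top hV D.contOn_sw
  obtain ⟨R, hR, h⟩ := D.gain_bound (M := M) hφ hP hA hvs hvN hdv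
    fun h hh hN => ho h hh ((D.NV_ww_lt_top hP h).2 hN)
  have h1 : NV V (fun x => expR (A * ρ x) * ww ρ φ M x) v ≤ R := by
    refine NV_le_of_tendsto D.meas hvm (fun i => aem_of_contOn hV
      ((D.contDiffOn_gainMul (A := A) (δ := 1 / ((i : ℝ) + 1)) (by positivity)).continuousOn.mul
        (D.contOn_ww hφ.continuousOn))) (fun x hx => ?_) (fun i => h _ (by positivity))
    have h2 := D.pos hx
    have h3 : Tendsto (fun i : ℕ => 1 / ((i : ℝ) + 1) - ρ x) atTop (𝓝 (0 - ρ x)) :=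
      tendsto_one_div_add_atTop_nhds_zero_nat.sub_const _
    have h4 := ((tendsto_const_nhds (x := expR (A * ρ x))).div h3 (by simpa using h2.ne')).mul_const
      (ww ρ φ (M + 1) x)
    refine Tendsto.congr' (.of_forall fun i => rfl) (h4.trans_eq ?_)
    congr 1
    simp only [ww, sw, pow_succ, zero_sub]
    have h5 := (D.neg hx).ne
    field_simp
  obtain ⟨S, hS, hS'⟩ := D.exists_bound_rho
  have h2 : NV V (sw ρ M) v < ⊤ := by
    refine (NV_mono (C := expR (|A| * S) * expR P) (g := v)
      (w' := fun x => expR (A * ρ x) * ww ρ φ M x) D.meas (by positivity)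
      fun x hx => ?_).trans_lt (mul_lt_top ofReal_lt_top (h1.trans_lt hR))
    rw [mul_left_comm (_ * _)]
    refine mul_le_mul_of_nonneg_left ?_ (sq_nonneg _)
    have h3 : 1 ≤ expR (|A| * S) * expR (A * ρ x) := by
      rw [← rexp_add]
      refine Real.one_le_exp ?_
      have h5 : -(A * ρ x) ≤ |A| * S := by
        refine (neg_le_abs _).trans ?_
        rw [abs_mul, abs_of_neg (D.neg hx)]
        exact mul_le_mul_of_nonneg_left (hS' x hx) (abs_nonneg _)
      linarith
    calc sw ρ M x ≤ expR P * ww ρ φ M x := D.le_ww hP hx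
      _ ≤ (expR (|A| * S) * expR (A * ρ x)) * (expR P * ww ρ φ M x) :=
        le_mul_of_one_le_left (mul_pos (exp_pos _) (D.ww_pos hx)).le h3
      _ = _ := by ring
  have h3 := NV_sub_lt_top D.meas D.sw_nonneg hηm
    D.aem_sw (hη.NV_lt_top hV D.contOn_sw) h2
  simpa [hv] using h3

/-- Nondegeneracy of the pairing with weight `(-ρ)^(M+1) e^{-φ}`. -/
theorem nondegenerate (hφ : SmoothOn φ V) (hP : ∀ x ∈ V, |φ x| ≤ P)
    (hA : ∀ x ∈ V, ∀ β, 0 ≤ levi φ x β + A * levi ρ x β) (hg : HolOn g V) (hgN : NV V (sw ρ (M + 2)) g < ⊤)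
    (ho : ∀ h, HolOn h V → NV V (sw ρ M) h < ⊤ →
      ∫ x in V, h x * conj (g x) * ww ρ φ (M + 1) x = 0) : EqOn g (fun _ => 0) V := by
  have hV := D.isOpen
  have hgm : AESM g (vol V) := hg.continuousOn.aestronglyMeasurable D.meas
  have hwc : ContinuousOn (ww ρ φ (M + 1)) V := D.contOn_ww hφ.continuousOn
  have hw0 : ∀ x ∈ V, 0 ≤ ww ρ φ (M + 1) x := fun x hx => (D.ww_pos hx).le
  have hsm : ∀ N, AEMeasurable (sw ρ N) (vol V) := fun N => D.aem_sw
  have hwm : AEMeasurable (ww ρ φ (M + 1)) (vol V) := aem_of_contOn hV hwc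
  have hwm2 : AEMeasurable (fun x => expR P ^ 2 * sw ρ (M + 2) x) (vol V) :=
    (hsm _).const_mul _
  have hww : ∀ x ∈ V, 0 ≤ expR P ^ 2 * sw ρ (M + 2) x ∧
      ww ρ φ (M + 1) x ^ 2 ≤ expR P ^ 2 * sw ρ (M + 2) x * sw ρ M x := by
    intro x hx
    refine ⟨mul_nonneg (sq_nonneg _) (D.sw_pos hx).le, ?_⟩
    calc _ ≤ (expR P * sw ρ (M + 1) x) ^ 2 :=
          pow_le_pow_left₀ (hw0 x hx) (D.ww_le hP hx) 2
      _ = _ := by simp only [sw]; ring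
  have hNc : ∀ f : Fn n, NV V (fun x => expR P ^ 2 * sw ρ (M + 2) x) f ≤
      ofR (expR P ^ 2) * NV V (sw ρ (M + 2)) f := fun f =>
    NV_mono D.meas (by positivity) fun x hx => le_of_eq (by ring)
  obtain ⟨F, hF, hFt⟩ := D.dense_hol hg hgN
  have hFm : ∀ j, AESM (F j) (vol V) := fun j =>
    (hF j).1.continuousOn.aestronglyMeasurable D.meas
  have lim : ∀ q : Fn n, AESM q (vol V) → NV V (sw ρ M) q < ⊤ →
      (∀ j, ∫ x in V, F j x * conj (q x) * ww ρ φ (M + 1) x = 0) →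
      ∫ x in V, g x * conj (q x) * ww ρ φ (M + 1) x = 0 := by
    intro q hq hqN h
    have h1 : ∀ j, ‖∫ x in V, g x * conj (q x) * ww ρ φ (M + 1) x‖ₑ ^ 2 ≤
        ofR (expR P ^ 2) * NV V (sw ρ (M + 2)) (fun x => g x - F j x) *
          NV V (sw ρ M) q := by
      intro j
      have h2 := enorm_pair_sq_le (w := ww ρ φ (M + 1)) D.meas (hgm.sub (hFm j)) hq hwm2 (hsm M) hw0 hww
      refine le_trans (le_of_eq ?_) (h2.trans (mul_le_mul_left (hNc _) _))
      congr 2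
      have hFs : NV V (sw ρ (M + 2)) (F j) < ⊤ := D.NV_sw_succ_lt_top (hF j).2
      have i1 := integrable_pair D.meas hgm hq hwm hwm2 (hsm M) hw0 hww
        ((hNc g).trans_lt (mul_lt_top ofReal_lt_top hgN)) hqN
      have i2 := integrable_pair D.meas (hFm j) hq hwm hwm2 (hsm M) hw0 hww
        ((hNc _).trans_lt (mul_lt_top ofReal_lt_top hFs)) hqN
      rw [← sub_zero (∫ x in V, _), ← h j, ← integral_sub i1 i2]
      refine integral_congr_all fun x => ?_
      simp only [Pi.sub_apply]; ring
    have h2 : Tendsto (fun j => ofR (expR P ^ 2) *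
        NV V (sw ρ (M + 2)) (fun x => g x - F j x) * NV V (sw ρ M) q) atTop (𝓝 0) := by
      have := ENNReal.Tendsto.mul_const (b := NV V (sw ρ M) q) (ENNReal.Tendsto.const_mul
        (a := ofR (expR P ^ 2)) hFt (Or.inr (by simp))) (Or.inr hqN.ne)
      simpa using this
    have h3 := le_of_tendsto_of_tendsto' tendsto_const_nhds h2 h1
    simpa using h3
  have key : ∀ η, IsTest V η → ∫ x in V, g x * conj (η x) * ww ρ φ (M + 1) x = 0 := by
    intro η hη
    have hηm : AESM η (vol V) := hη.continuous.aestronglyMeasurable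
    have hηN : ∀ N, NV V (sw ρ N) η < ⊤ := fun N => hη.NV_lt_top hV D.contOn_sw
    obtain ⟨p, hp, hpN, hpo⟩ := exists_hol_proj hV hwc (fun x hx => D.ww_pos hx) hηm
      (hη.NV_lt_top hV hwc)
    have hpN' := hpN.trans_lt (hη.NV_lt_top hV hwc)
    have hpM : NV V (sw ρ M) p < ⊤ := D.proj_gain hφ hP hA hη hp hpN' hpo
    have hpm : AESM p (vol V) := hp.continuousOn.aestronglyMeasurable D.meas
    have h1 := lim (fun x => η x - p x) (hηm.sub hpm) (NV_sub_lt_top D.meas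
      D.sw_nonneg hηm (hsm M) (hηN M) hpM)
      fun j => hpo _ (hF j).1 ((D.NV_ww_lt_top hP _).2 (hF j).2)
    have h2 : ∫ x in V, g x * conj (p x) * ww ρ φ (M + 1) x = 0 := by
      rw [pair_conj, ho p hp hpM, map_zero]
    have hgN2 := (hNc g).trans_lt (mul_lt_top ofReal_lt_top hgN)
    have i1 := integrable_pair D.meas hgm hηm hwm hwm2 (hsm M) hw0 hww hgN2 (hηN M)
    have i2 := integrable_pair D.meas hgm hpm hwm hwm2 (hsm M) hw0 hww hgN2 hpM
    rw [← h1, ← sub_zero (∫ x in V, _), ← h2, ← integral_sub i1 i2]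
    refine integral_congr_all fun x => ?_
    simp only [map_sub]; ring
  refine eqOn_zero_of_NV hV hwc (fun x hx => D.ww_pos hx) hg.continuousOn ?_
  have hχc : ∀ j, ContinuousOn (fun x => cutE 0 j (ρ x)) V := fun j =>
    (contDiff_cutE 0 j).continuous.comp_continuousOn D.smooth.continuousOn
  have hχw : ∀ j, ContinuousOn (fun x => cutE 0 j (ρ x) * ww ρ φ (M + 1) x) V := fun j =>
    (hχc j).mul hwc
  have hχ0 : ∀ j, ∀ x ∈ V, 0 ≤ cutE 0 j (ρ x) := fun j x hx => (cutE_mem le_rfl (D.neg hx)).1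
  refine le_antisymm (NV_le_of_tendsto (w' := fun j x => cutE 0 j (ρ x) * ww ρ φ (M + 1) x) D.meas
    hgm (fun j => aem_of_contOn hV (hχw j)) (fun x hx => ?_) fun j => ?_) zero_le
  · refine tendsto_const_nhds.congr' ((tendsto_cutE (D.neg hx)).mono fun j hj => ?_)
    beta_reduce
    rw [hj, one_mul]
  · have hη : IsTest V fun x => (cutE 0 j (ρ x) : ℂ) * g x :=
      (D.isTest_cutE j).mul hV (hol_smooth hV hg)
    have hη2 : IsTest V fun x => (cutE 0 (j + 1) (ρ x) : ℂ) * g x :=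
      (D.isTest_cutE _).mul hV (hol_smooth hV hg)
    have hfin : NV V (fun x => cutE 0 j (ρ x) * ww ρ φ (M + 1) x) g < ⊤ := by
      refine lt_of_le_of_lt (setLIntegral_mono' D.meas fun x hx => ?_)
        (hη2.NV_lt_top hV (hχw j))
      by_cases h : -2 ^ j * ρ x - 1 < 0
      · have h0 : cutE 0 j (ρ x) = 0 := by
          rw [cutE, smoothTransition.zero_of_nonpos h.le, mul_zero]
        beta_reduce
        rw [h0]; simp
      · have : cutE 0 (j + 1) (ρ x) = 1 := by
          rw [cutE, zero_div, Real.exp_zero, one_mul, smoothTransition.one_of_one_le]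
          rw [pow_succ]; linarith
        beta_reduce
        rw [this]; simp
    rw [NV_eq_re D.meas hgm (aem_of_contOn hV (hχw j))
      (fun x hx => mul_nonneg (hχ0 j x hx) (hw0 x hx)) hfin, ENNReal.ofReal_eq_zero.2]
    refine le_of_eq ((congrArg Complex.re (Eq.trans ?_ (key _ hη))).trans zero_re)
    refine integral_congr_all fun x => ?_
    simp only [map_mul, conj_ofReal, ofReal_mul]; ring

end Dom

theorem exists_abs_deriv_cutE_mul_le : ∃ C > 0, ∀ j, ∀ τ < 0, |deriv (cutE 0 j) τ| * -τ ≤ C := by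
  obtain ⟨C, hC, h⟩ := cutErr_mul_sq_le
  refine ⟨√C, Real.sqrt_pos.2 hC, fun j τ hτ => Real.le_sqrt_of_sq_le ((le_trans ?_ (h j τ hτ)))⟩
  have h1 := deriv_cutE_sq_le (η := 0) (j := j) hτ
  rw [mul_pow, sq_abs, neg_sq]
  refine mul_le_mul_of_nonneg_right ?_ (sq_nonneg _)
  simpa using h1

theorem mul_norm_sq_re (a : ℂ) (r : ℝ) : (a * conj a * r).re = ‖a‖ ^ 2 * r := by
  rw [Complex.mul_conj, ← Complex.ofReal_mul, Complex.ofReal_re, Complex.normSq_eq_norm_sq]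

theorem IsTest.setIntegral_eq (hθ : IsTest V θ) : ∫ x in V, θ x = ∫ x, θ x :=
  setIntegral_eq_integral_of_forall_compl_eq_zero fun _ hx => hθ.eq_zero hx

namespace Dom

include D

theorem dz_le :
    ∃ C > 0, ∀ x ∈ closure V, ∀ k, ‖dz k ♯ρ x‖ ≤ C := by
  obtain ⟨C, hC, h⟩ := D.dz_bound
  refine ⟨√C, Real.sqrt_pos.2 hC, fun x hx k => Real.le_sqrt_of_sq_le ((le_trans ?_ (h x hx)))⟩
  exact Finset.single_le_sum (f := fun k => ‖dz k ♯ρ x‖ ^ 2)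
    (fun _ _ => sq_nonneg _) (Finset.mem_univ k)

/-- Weighted Cauchy estimate. -/
theorem cauchy (M : ℕ) : ∃ C : ℝ, 0 < C ∧ ∀ (j : Fin n) (f : Fn n),
    HolOn f V →
    NV V (sw ρ (M + 2)) (dz j f) ≤ ofR C * NV V (sw ρ M) f := by
  obtain ⟨C₁, hC₁, h₁⟩ := exists_abs_deriv_cutE_mul_le
  obtain ⟨C₂, hC₂, h₂⟩ := D.dz_le
  set C : ℝ := (2 * C₁ + (M + 2)) * C₂ with hC
  have hC0 : 0 < C := by positivity
  refine ⟨C ^ 2, by positivity, fun j f hf => ?_⟩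
  rcases eq_or_ne (NV V (sw ρ M) f) ⊤ with hN | hN
  · rw [hN, ENNReal.mul_top (by simpa using hC0.ne')]; exact le_top
  have hN := hN.lt_top
  have hV := D.isOpen
  have hfs := hol_smooth hV hf
  have hfm : AESM f (vol V) := hfs.continuousOn.aestronglyMeasurable D.meas
  have hd := hol_dz (j := j) hV hf
  have hds := hol_smooth hV hd
  have hdm : AESM (dz j f) (vol V) := hds.continuousOn.aestronglyMeasurable D.meas
  have iM := integrable_pair_same D.meas hfm hfm D.aem_sw
    D.sw_nonneg hN hN
  set G : ℕ → ℝ → ℝ := fun i τ => cutE 0 i τ ^ 2 * (-τ) ^ (M + 2) with hG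
  have hGs : ∀ i, ContDiff ℝ ∞ (G i) := fun i =>
    ((contDiff_cutE 0 i).pow 2).mul (contDiff_neg.pow _)
  have hκ : ∀ i, IsTest V fun x => (G i (ρ x) : ℂ) := fun i =>
    D.isTest_cut (hGs i) (ε := ((2 : ℝ) ^ i)⁻¹) (by positivity) fun τ h => by
      simp [hG, cutE_eq_zero (η := 0) h]
  have hG0 : ∀ i, ∀ x ∈ V, 0 ≤ G i (ρ x) := fun i x hx =>
    mul_nonneg (sq_nonneg _) (pow_nonneg (D.pos hx).le _)
  have hGc : ∀ i, ContinuousOn (fun x => G i (ρ x)) V := fun i =>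
    (hGs i).continuous.comp_continuousOn D.smooth.continuousOn
  have hGd : ∀ i, ∀ τ < 0, |deriv (G i) τ| ≤ (2 * C₁ + (M + 2)) * (cutE 0 i τ * (-τ) ^ (M + 1)) := by
    intro i τ hτ
    have h3 : HasDerivAt (cutE 0 i) (deriv (cutE 0 i) τ) τ :=
      ((contDiff_cutE 0 i).differentiable (by simp)).differentiableAt.hasDerivAt
    have h4 := (h3.pow 2).mul ((hasDerivAt_neg τ).pow (M + 2))
    have h5 : deriv (G i) τ = _ := h4.deriv
    rw [h5]
    obtain ⟨hc0, hc1⟩ := cutE_mem (η := 0) (j := i) le_rfl hτ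
    have h6 := h₁ i τ hτ
    have h7 : 0 < -τ := neg_pos.2 hτ
    set c := cutE 0 i τ
    set d := deriv (cutE 0 i) τ
    calc _ = |c * (-τ) ^ (M + 1) * (2 * (d * -τ) - (M + 2) * c)| := by
            congr 1; simp only [Pi.pow_apply]; push_cast; simp only [pow_succ]; ring
      _ = c * (-τ) ^ (M + 1) * |2 * (d * -τ) - (M + 2) * c| := by
            rw [abs_mul, abs_of_nonneg (by positivity)]
      _ ≤ c * (-τ) ^ (M + 1) * (2 * C₁ + (M + 2)) := by
            refine mul_le_mul_of_nonneg_left ((abs_sub _ _).trans (add_le_add ?_ ?_)) (by positivity)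
            · rw [abs_mul, abs_two, abs_mul, abs_of_pos h7]; linarith
            · rw [abs_of_nonneg (by positivity)]
              exact mul_le_of_le_one_right (by positivity) hc1
      _ = _ := by ring
  refine NV_le_of_tendsto (w' := fun i x => G i (ρ x)) D.meas hdm (fun i => aem_of_contOn hV (hGc i))
    (fun x hx => ?_) fun i => ?_
  · refine tendsto_const_nhds.congr' ((tendsto_cutE (D.neg hx)).mono fun i hi => ?_)
    simp [hG, hi, sw]
  set κ : Fn n := fun x => (G i (ρ x) : ℂ) with hκd
  have hcd : SmoothOn (fun x => conj (dz j f x)) V := contDiffOn_conj hds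
  have hθ : IsTest V fun x => κ x * conj (dz j f x) := (hκ i).mul hV hcd
  have hdθ : ∀ x ∈ V, dd (-I) j (fun x => κ x * conj (dz j f x)) x =
      (deriv (G i) (ρ x) : ℝ) * dz j ♯ρ x * conj (dz j f x) := by
    intro x hx
    have h3 : dd I j (dz j f) x = 0 := hol_dzb hV hd hx
    have h4 : dd (-I) j κ x = (deriv (G i) (ρ x) : ℝ) * dd (-I) j ♯ρ x :=
      dd_comp_real (((hGs i).differentiable (by simp)).differentiableAt.hasDerivAt)
        ((D.contDiffAt hx).differentiableAt (by simp))
    rw [dd_mul ((hκ i).diff x) (diffAt hV hcd hx), dd_conj, h4, map_neg, conj_I, neg_neg, h3]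
    simp
  have i1 : IntegrableOn (fun x => dz j f x * conj (dz j f x) * G i (ρ x)) V := by
    have : (fun x => dz j f x * conj (dz j f x) * G i (ρ x)) =
        fun x => κ x * (conj (dz j f x) * dz j f x) := by ext x; simp only [hκd]; ring
    rw [this]
    exact ((hκ i).mul hV (hcd.mul hds)).integrable.integrableOn
  have key := hθ.ibp (c := -I) (j := j) hV hfs
  have e1 : ∫ x, κ x * conj (dz j f x) * dd (-I) j f x =
      ∫ x in V, dz j f x * conj (dz j f x) * G i (ρ x) := by
    rw [← (hθ.mul hV hds).setIntegral_eq]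
    refine integral_congr_all fun x => ?_
    simp only [hκd, dz]; ring
  have e2 : ∫ x, dd (-I) j (fun x => κ x * conj (dz j f x)) x * f x =
      ∫ x in V, (deriv (G i) (ρ x) : ℝ) * dz j ♯ρ x * conj (dz j f x) * f x := by
    rw [← (hθ.dd.mul hV hfs).setIntegral_eq]
    refine setIntegral_congr_fun D.meas fun x hx => ?_
    simp only [hdθ x hx]
  rw [e1, e2] at key
  set Y := ∫ x in V, dz j f x * conj (dz j f x) * G i (ρ x) with hY
  set Z := ∫ x in V, f x * conj (f x) * sw ρ M x with hZ
  have hYr : Y.re = ∫ x in V, ‖dz j f x‖ ^ 2 * G i (ρ x) := by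
    rw [hY]
    refine (integral_re i1).symm.trans ?_
    simp only [RCLike.re_eq_complex_re, mul_norm_sq_re]
  have hZr : Z.re = ∫ x in V, ‖f x‖ ^ 2 * sw ρ M x := by
    rw [hZ]
    refine (integral_re iM).symm.trans ?_
    simp only [RCLike.re_eq_complex_re, mul_norm_sq_re]
  have j1 : IntegrableOn (fun x => ‖dz j f x‖ ^ 2 * G i (ρ x)) V := by
    have := i1.re
    simp only [RCLike.re_eq_complex_re, mul_norm_sq_re] at this
    exact this
  have j2 : IntegrableOn (fun x => ‖f x‖ ^ 2 * sw ρ M x) V := by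
    have := iM.re
    simp only [RCLike.re_eq_complex_re, mul_norm_sq_re] at this
    exact this
  have bd : Y.re ≤ 2⁻¹ * Y.re + 2⁻¹ * C ^ 2 * Z.re := by
    have h3 : Y.re ≤ ‖∫ x in V, (deriv (G i) (ρ x) : ℝ) * dz j ♯ρ x *
        conj (dz j f x) * f x‖ := by
      rw [key, norm_neg]; exact re_le_norm _
    refine h3.trans ?_
    rw [hYr, hZr, ← integral_const_mul, ← integral_const_mul, ← integral_add (j1.const_mul _) (j2.const_mul _)]
    refine norm_integral_le_of_norm_le ((j1.const_mul _).add (j2.const_mul _))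
      ((ae_restrict_mem D.meas).mono fun x hx => ?_)
    have hτ := D.pos hx
    obtain ⟨hc0, hc1⟩ := cutE_mem (η := 0) (j := i) le_rfl (D.neg hx)
    rw [norm_mul, norm_mul, norm_mul, norm_real, norm_eq_abs, RCLike.norm_conj]
    set X := ‖dz j f x‖
    set c := cutE 0 i (ρ x)
    calc _ ≤ (2 * C₁ + (M + 2)) * (c * (-ρ x) ^ (M + 1)) * C₂ * X * ‖f x‖ := by
          gcongr
          · exact hGd i _ (D.neg hx)
          · exact h₂ x (subset_closure hx) j
      _ = (X * c * -ρ x) * (C * ‖f x‖) * (-ρ x) ^ M := by rw [hC, pow_succ]; ring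
      _ ≤ (2⁻¹ * (X * c * -ρ x) ^ 2 + 2⁻¹ * (C * ‖f x‖) ^ 2) * (-ρ x) ^ M := by
          refine mul_le_mul_of_nonneg_right ?_ (by positivity)
          nlinarith [sq_nonneg (X * c * -ρ x - C * ‖f x‖)]
      _ = _ := by simp only [hG, sw]; ring
  have hfin : NV V (fun x => G i (ρ x)) (dz j f) < ⊤ := by
    have h3 := j1.lintegral_lt_top
    refine lt_of_le_of_lt (setLIntegral_mono' D.meas fun x hx => le_of_eq ?_) h3
    beta_reduce
    rw [eofReal_mul (p := ‖dz j f x‖ ^ 2) (sq_nonneg _), eofReal_pow (norm_nonneg _),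
      ofReal_norm]
  rw [NV_eq_re D.meas hdm (aem_of_contOn hV (hGc i)) (hG0 i) hfin,
    NV_eq_re D.meas hfm D.aem_sw D.sw_nonneg hN,
    ← eofReal_mul (by positivity)]
  refine ofReal_le_ofReal ?_
  change Y.re ≤ C ^ 2 * Z.re
  linarith

theorem exists_lip : ∃ L > 0, ∃ δ > 0, ∀ x ∈ closure V, ∀ y, dist y x ≤ δ →
    y ∈ W ∧ |ρ y - ρ x| ≤ L * dist y x := by
  obtain ⟨δ, hδ, hδW⟩ := D.compact.exists_cthickening_subset_open D.hW D.hVW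
  have h1 : ContinuousOn (fderiv ℝ ρ) W := D.hρ.continuousOn_fderiv_of_isOpen D.hW (by simp)
  obtain ⟨L, hL⟩ := D.compact.cthickening (r := δ) |>.exists_bound_of_continuousOn (h1.mono hδW)
  refine ⟨max L 1, by positivity, δ, hδ, fun x hx y hy => ?_⟩
  have hsub : closedBall x δ ⊆ cthickening δ (closure V) := closedBall_subset_cthickening hx δ
  refine ⟨hδW (hsub hy), ?_⟩
  rw [← norm_eq_abs, dist_eq_norm]
  exact (convex_closedBall x δ).norm_image_sub_le_of_norm_fderiv_le (𝕜 := ℝ)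
    (fun z hz => diffAt D.hW D.hρ (hδW (hsub hz)))
    (fun z hz => (hL z (hsub hz)).trans (le_max_left _ _)) (mem_closedBall_self hδ.le) hy

/-- Pointwise bounds for holomorphic functions in weighted `L²` spaces. -/
theorem pointwise (M : ℕ) : ∃ C : ℝ, 0 < C ∧ ∀ f : Fn n,
    HolOn f V → ∀ x ∈ V, ‖f x‖ₑ ^ 2 ≤
      ofR (C / (-ρ x) ^ (Module.finrank ℝ (Cn n) + M)) * NV V (sw ρ M) f := by
  obtain ⟨C, hC, h⟩ := hol_interior n
  obtain ⟨L, hL, δ, hδ, hLδ⟩ := D.exists_lip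
  obtain ⟨S, hS, hS'⟩ := D.exists_bound_rho
  set d := Module.finrank ℝ (Cn n)
  set K := max (2 * L) (S / δ) with hK
  have hK0 : 0 < K := by positivity
  refine ⟨C * K ^ d * 2 ^ M, by positivity, fun f hf x hx => ?_⟩
  have hs : 0 < -ρ x := D.pos hx
  have hr : 0 < -ρ x / K := by positivity
  have hb : ∀ y, dist y x ≤ -ρ x / K → y ∈ V ∧ -ρ x / 2 ≤ -ρ y := by
    intro y hy
    have h1 : -ρ x / K ≤ δ := by
      rw [div_le_iff₀ hK0]
      calc -ρ x ≤ S := hS' x hx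
        _ = δ * (S / δ) := by field_simp
        _ ≤ δ * K := by gcongr; exact le_max_right _ _
    have h2 := (hLδ x (subset_closure hx) y (hy.trans h1)).2
    have h3 : L * dist y x ≤ -ρ x / 2 := by
      rw [le_div_iff₀ hK0] at hy
      have h4 : dist y x * (2 * L) ≤ dist y x * K :=
        mul_le_mul_of_nonneg_left (le_max_left _ _) dist_nonneg
      linarith
    have h4 := (le_abs_self _).trans (h2.trans h3)
    refine ⟨?_, by linarith⟩
    rw [D.hV]
    change ρ y < 0
    linarith
  refine (h _ V f x hr D.isOpen (fun y hy => (hb y hy).1) hf).trans ?_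
  have h1 : ∫⁻ y in ball x (-ρ x / K), ‖f y‖ₑ ^ 2 ≤
      ofR ((2 / -ρ x) ^ M) * NV V (sw ρ M) f := by
    rw [← NV_one]
    refine le_trans (NV_mono (C := (2 / -ρ x) ^ M) (g := f) (w' := sw ρ M) measurableSet_ball
      (by positivity) fun y hy => ?_) (mul_le_mul_right (NV_mono_set fun y hy =>
        (hb y (mem_ball.1 hy).le).1) _)
    rw [mul_left_comm, sw, ← mul_pow]
    refine mul_le_mul_of_nonneg_left (one_le_pow₀ ?_) (sq_nonneg _)
    have := (hb y (mem_ball.1 hy).le).2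
    rw [div_mul_eq_mul_div, le_div_iff₀ hs]
    linarith
  refine (mul_le_mul_right h1 _).trans (le_of_eq ?_)
  rw [← mul_assoc, ← eofReal_mul (by positivity)]
  congr 2
  rw [div_pow, div_pow, pow_add]
  field_simp

end Dom

theorem NV_mul_le {b : Fn n} (hV : MeasurableSet V) (hb : ∀ x ∈ V, ‖b x‖ ≤ C)
    (hw : ∀ x ∈ V, 0 ≤ w x) (f : Fn n) :
    NV V w (fun x => b x * f x) ≤ ofR (C ^ 2) * NV V w f :=
  NV_mono hV (sq_nonneg _) fun x hx => by
    rw [norm_mul, mul_pow, mul_assoc]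
    exact mul_le_mul_of_nonneg_right (pow_le_pow_left₀ (norm_nonneg _) (hb x hx) 2)
      (mul_nonneg (sq_nonneg _) (hw x hx))

namespace Dom

include D

theorem integral_dzb_eq_zero {X : Fn n} (hX : SmoothOn X V)
    (h1 : IntegrableOn (fun x => X x / (ρ x : ℂ)) V) (h2 : IntegrableOn (dzb k X) V) :
    ∫ x in V, dzb k X x = 0 := by
  have hV := D.isOpen
  obtain ⟨C₁, hC₁, h₁⟩ := exists_abs_deriv_cutE_mul_le
  obtain ⟨C₂, hC₂, h₂⟩ := D.dz_le
  have hχ := D.isTest_cutE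
  have e : ∀ i, ∫ x in V, (cutE 0 i (ρ x) : ℂ) * dzb k X x =
      -∫ x in V, dd I k (fun y => (cutE 0 i (ρ y) : ℂ)) x * X x := by
    intro i
    rw [((hχ i).mul hV (contDiffOn_dd hV hX)).setIntegral_eq, ((hχ i).dd.mul hV hX).setIntegral_eq,
      (hχ i).ibp hV hX, neg_neg]
  have l1 : Tendsto (fun i => ∫ x in V, (cutE 0 i (ρ x) : ℂ) * dzb k X x) atTop
      (𝓝 (∫ x in V, dzb k X x)) := by
    refine tendsto_integral_of_dominated_convergence (fun x => ‖dzb k X x‖)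
      (fun i => ((hχ i).mul hV (contDiffOn_dd hV hX)).continuous.aestronglyMeasurable) h2.norm
      (fun i => (ae_restrict_mem D.meas).mono fun x hx => ?_)
      ((ae_restrict_mem D.meas).mono fun x hx => ?_)
    · obtain ⟨hc0, hc1⟩ := cutE_mem (η := 0) (j := i) le_rfl (D.neg hx)
      rw [norm_mul, norm_real, norm_of_nonneg hc0]
      exact mul_le_of_le_one_left (norm_nonneg _) hc1
    · exact tendsto_const_nhds.congr' ((tendsto_cutE (D.neg hx)).mono fun j hj => by simp [hj])
  have l2 : Tendsto (fun i => ∫ x in V, dd I k (fun y => (cutE 0 i (ρ y) : ℂ)) x * X x) atTop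
      (𝓝 (∫ x in V, (0 : ℂ))) := by
    refine tendsto_integral_of_dominated_convergence (fun x => C₁ * C₂ * ‖X x / (ρ x : ℂ)‖)
      (fun i => ((hχ i).dd.mul hV hX).continuous.aestronglyMeasurable) (h1.norm.const_mul _)
      (fun i => (ae_restrict_mem D.meas).mono fun x hx => ?_)
      ((ae_restrict_mem D.meas).mono fun x hx => ?_)
    · have h3 : ‖dd I k ♯ρ x‖ ≤ C₂ := by
        have := dzb_ofReal (k := k) (x := x) (Ψ := ρ)
        simp only [dzb] at this
        rw [this, RCLike.norm_conj]
        exact h₂ x (subset_closure hx) k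
      have h4 := D.pos hx
      have h5 := (D.neg hx).ne
      rw [D.dd_cutE i hx, norm_mul, norm_mul, norm_div, norm_real, norm_real, norm_eq_abs,
        norm_eq_abs, abs_of_neg (D.neg hx)]
      calc _ = (|deriv (cutE 0 i) (ρ x)| * -ρ x) * ‖dd I k ♯ρ x‖ *
            (‖X x‖ / -ρ x) := by field_simp
        _ ≤ _ := by
          gcongr
          exact h₁ i _ (D.neg hx)
    · have h3 : Tendsto (fun i => deriv (cutE 0 i) (ρ x)) atTop (𝓝 0) := by
        have h4 : Tendsto (fun i => deriv (cutE 0 i) (ρ x) ^ 2) atTop (𝓝 0) :=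
          squeeze_zero (fun _ => sq_nonneg _) (fun i => by
            simpa using deriv_cutE_sq_le (η := 0) (j := i) (D.neg hx)) (tendsto_cutErr (D.neg hx))
        rw [tendsto_zero_iff_abs_tendsto_zero]
        simpa [Real.sqrt_sq_eq_abs, Function.comp_def] using h4.sqrt
      have h4 := ((continuous_ofReal.tendsto _).comp h3).mul_const
        (dd I k ♯ρ x * X x)
      simp only [ofReal_zero, zero_mul] at h4
      refine h4.congr fun i => ?_
      rw [D.dd_cutE i hx, mul_assoc]; rfl
  have := tendsto_nhds_unique l1 ((l2.neg).congr fun i => (e i).symm)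
  simpa using this

theorem dzb_ww (hφ : SmoothOn φ V) (hx : x ∈ V) :
    dd I k (fun y => (ww ρ φ (M + 1) y : ℂ)) x =
      -(ww ρ φ (M + 1) x * conj (dz k ♯φ x)) -
        (M + 1) * (ww ρ φ M x * conj (dz k ♯ρ x)) := by
  have h1 : ∀ τ : ℝ, HasDerivAt (fun τ : ℝ => expR (-τ)) (-expR (-τ)) τ := fun τ => by
    simpa using (hasDerivAt_neg τ).exp
  have h2 : ∀ τ : ℝ, HasDerivAt (fun τ : ℝ => (-τ) ^ (M + 1)) (-((M + 1) * (-τ) ^ M)) τ := fun τ => by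
    simpa using (hasDerivAt_neg τ).fun_pow (M + 1)
  have e1 := dd_comp_real (c := I) (j := k) (h1 (φ x)) (diffAt D.isOpen hφ hx)
  have e2 := dd_comp_real (c := I) (j := k) (h2 (ρ x)) (diffAt D.isOpen D.smooth hx)
  have a1 : SmoothOn (fun y => ((expR (-φ y) : ℝ) : ℂ)) V :=
    contDiffOn_ofReal (hφ.neg.exp)
  have a2 : SmoothOn (fun y => (((-ρ y) ^ (M + 1) : ℝ) : ℂ)) V :=
    contDiffOn_ofReal (D.smooth.neg.pow _)
  have e3 : (fun y => (ww ρ φ (M + 1) y : ℂ)) =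
      fun y => ((expR (-φ y) : ℝ) : ℂ) * (((-ρ y) ^ (M + 1) : ℝ) : ℂ) := by
    ext y; simp only [ww, sw, ofReal_mul]
  have b1 := dzb_ofReal (k := k) (x := x) (Ψ := ρ)
  have b2 := dzb_ofReal (k := k) (x := x) (Ψ := φ)
  simp only [dzb] at b1 b2
  rw [e3, dd_mul (diffAt D.isOpen a1 hx) (diffAt D.isOpen a2 hx), e1, e2, b1, b2]
  simp only [ww, sw]; push_cast; ring

theorem int_pair (hφ : ContinuousOn φ V) (hP : ∀ x ∈ V, |φ x| ≤ P) {a b : ℕ}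
    (hab : a + b = 2 * M) (hf : ContinuousOn f V) (hg : ContinuousOn g V)
    (hfN : NV V (sw ρ a) f < ⊤) (hgN : NV V (sw ρ b) g < ⊤) :
    IntegrableOn (fun x => f x * conj (g x) * ww ρ φ M x) V := by
  refine integrable_pair (w₁ := fun x => expR P ^ 2 * sw ρ a x) (w₂ := sw ρ b) D.meas
    (hf.aestronglyMeasurable D.meas) (hg.aestronglyMeasurable D.meas)
    (aem_of_contOn D.isOpen (D.contOn_ww hφ)) (D.aem_sw.const_mul _) D.aem_sw
    (fun x hx => (D.ww_pos hx).le) (fun x hx => ⟨mul_nonneg (sq_nonneg _) (D.sw_pos hx).le, ?_⟩)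
    ((NV_mono (C := expR P ^ 2) (g := f) (w' := sw ρ a) D.meas (by positivity)
      fun x hx => le_of_eq (by ring)).trans_lt (mul_lt_top ofReal_lt_top hfN)) hgN
  refine (pow_le_pow_left₀ (D.ww_pos hx).le (D.ww_le hP hx) 2).trans (le_of_eq ?_)
  rw [mul_pow, mul_assoc, sw, sw, sw, ← pow_add, hab, ← pow_mul]
  ring

/-- Integration by parts in weighted pairings. -/
theorem ibp_pair (hφ : SmoothOn φ V) (hP : ∀ x ∈ V, |φ x| ≤ P) {P' : ℝ} (hP' : ∀ x ∈ V, ‖dz k ♯φ x‖ ≤ P') {h : Fn n}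
    (hh : HolOn h V) (hN : NV V (sw ρ M) h < ⊤) (hq : SmoothOn q V)
    (hqN : NV V (sw ρ M) q < ⊤) (hdN : NV V (sw ρ (M + 2)) (dz k q) < ⊤) :
    ∫ x in V, h x * conj (dz k q x - dz k ♯φ x * q x) * ww ρ φ (M + 1) x =
      (M + 1) * ∫ x in V, h x * conj (dz k ♯ρ x * q x) * ww ρ φ M x := by
  have hV := D.isOpen
  obtain ⟨C₂, hC₂, h₂⟩ := D.dz_le
  have hs0 : ∀ N, ∀ x ∈ V, 0 ≤ sw ρ N x := fun N x hx => (D.sw_pos hx).le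
  have hdq : SmoothOn (dz k q) V := contDiffOn_dd hV hq
  have hdφ : SmoothOn (dz k ♯φ) V := contDiffOn_dd hV (contDiffOn_ofReal hφ)
  have hdρ : SmoothOn (dz k ♯ρ) V :=
    contDiffOn_dd hV (contDiffOn_ofReal D.smooth)
  have j1 := D.int_pair (M := M) hφ.continuousOn hP (two_mul M).symm hh.continuousOn hq.continuousOn hN hqN
  have i1 := D.int_pair (M := M + 1) (a := M) (b := M + 2) hφ.continuousOn hP (by ring)
    hh.continuousOn hdq.continuousOn hN hdN
  have i2 := D.int_pair (g := fun x => dz k ♯φ x * q x) (M := M + 1) (a := M) (b := M + 2) hφ.continuousOn hP (by ring)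
    hh.continuousOn (hdφ.continuousOn.mul hq.continuousOn) hN (D.NV_sw_succ_lt_top
    (D.NV_sw_succ_lt_top ((NV_mul_le D.meas hP' (hs0 _) q).trans_lt
      (mul_lt_top ofReal_lt_top hqN))))
  have i3 := D.int_pair (g := fun x => dz k ♯ρ x * q x) (M := M) hφ.continuousOn hP (two_mul M).symm hh.continuousOn
    (hdρ.continuousOn.mul hq.continuousOn) hN ((NV_mul_le D.meas
      (fun x hx => h₂ x (subset_closure hx) k) (hs0 _) q).trans_lt
      (mul_lt_top ofReal_lt_top hqN))
  have hhs := hol_smooth hV hh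
  have hcq := contDiffOn_conj hq
  have hw : SmoothOn (fun x => (ww ρ φ (M + 1) x : ℂ)) V :=
    contDiffOn_ofReal (hφ.neg.exp.mul D.contDiffOn_sw)
  set X : Fn n := fun x => h x * conj (q x) * ww ρ φ (M + 1) x with hX
  have hXs : SmoothOn X V := (hhs.mul hcq).mul hw
  have e : ∀ x ∈ V, dzb k X x = (h x * conj (dz k q x) * ww ρ φ (M + 1) x -
      h x * conj (dz k ♯φ x * q x) * ww ρ φ (M + 1) x) -
      (M + 1) * (h x * conj (dz k ♯ρ x * q x) * ww ρ φ M x) := by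
    intro x hx
    have h0 : dd I k h x = 0 := hol_dzb hV hh hx
    simp only [dzb, hX]
    rw [dd_mul (diffAt hV (hhs.mul hcq) hx) (diffAt hV hw hx), dd_mul (diffAt hV hhs hx)
      (diffAt hV hcq hx), h0, dd_conj, D.dzb_ww hφ hx, conj_I]
    simp only [map_mul]; ring
  have hi := (i1.sub i2).sub (i3.const_mul ((M : ℂ) + 1))
  have := D.integral_dzb_eq_zero (k := k) hXs (j1.neg.congr ((ae_restrict_mem D.meas).mono fun x hx => by
      have : (ρ x : ℂ) ≠ 0 := by exact_mod_cast (D.neg hx).ne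
      simp only [hX, ww, sw, Pi.neg_apply]; push_cast; rw [pow_succ]; field_simp))
    (hi.congr ((ae_restrict_mem D.meas).mono fun x hx => (e x hx).symm))
  have i12 : IntegrableOn (fun x => h x * conj (dz k q x) * ww ρ φ (M + 1) x -
      h x * conj (dz k ♯φ x * q x) * ww ρ φ (M + 1) x) V := i1.sub i2
  rw [setIntegral_congr_fun D.meas e, integral_sub i12 (i3.const_mul _), sub_eq_zero,
    integral_const_mul] at this
  rw [← this]
  refine integral_congr_all fun x => ?_
  simp only [map_sub]; ring

end Dom

theorem isTest_moC (hr : 0 < r) (hz : closedBall z r ⊆ V) :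
    IsTest V (fun y => moC r (z - y)) := by
  have h0 : ∀ y, y ∉ closedBall z r → moC r (z - y) = 0 := fun y hy => moC_zero hr (by
    rw [mem_closedBall, dist_comm, dist_eq_norm] at hy; exact (not_le.1 hy).le)
  refine ⟨(moC_smooth r).comp (contDiff_const.sub contDiff_id),
    HasCompactSupport.intro (isCompact_closedBall z r) h0, ?_⟩
  exact (closure_minimal (fun y (hy : moC r (z - y) ≠ 0) => by_contra fun h => hy (h0 y h))
    isClosed_closedBall).trans hz

theorem setIntegral_moC (hV : IsOpen V) (hr : 0 < r) (hz : closedBall z r ⊆ V)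
    (hw0 : ∀ x ∈ V, 0 < w x) (hf : HolOn f V) (c : ℂ) :
    ∫ x in V, f x * conj (c * (moC r (z - x) * ((w x)⁻¹ : ℝ))) * w x = conj c * f z := by
  have e : ∀ x ∈ V, f x * conj (c * (moC r (z - x) * ((w x)⁻¹ : ℝ))) * w x =
      conj c * (moC r (z - x) * f x) := fun x hx => by
    have : (w x : ℂ) ≠ 0 := by exact_mod_cast (hw0 x hx).ne'
    simp only [moC, map_mul, conj_ofReal]
    rw [ofReal_inv]
    field_simp
  have hs := (isTest_moC hr hz).mul hV (hol_smooth hV hf)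
  rw [setIntegral_congr_fun hV.measurableSet e, integral_const_mul, hs.setIntegral_eq]
  congr 1
  rw [← mean_value hr hV hz hf, ← integral_sub_left_eq_self _ _ z]
  simp only [sub_sub_cancel]

theorem Dom.bootstrap (D : Dom V W ρ) (hz : z ∈ V) (M : ℕ) (P A : ℝ) :
    ∃ C : ℝ≥0∞, C < ⊤ ∧ ∀ φ : Cn n → ℝ, SmoothOn φ V → (∀ x ∈ V, |φ x| ≤ P) →
      (∀ x ∈ V, ∀ β, 0 ≤ levi φ x β + A * levi ρ x β) → ∀ q : Fn n, SmoothOn q V →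
      NV V (sw ρ (M + 2)) q < ⊤ → (∀ k, NV V (sw ρ (M + 2)) (dzb k q) < ⊤) → ∀ c : ℂ,
      (∀ h, HolOn h V → NV V (sw ρ M) h < ⊤ →
        ∫ x in V, h x * conj (q x) * ww ρ φ (M + 1) x = c * h z) →
      NV V (sw ρ (M + 1)) q ≤ C * (‖c‖ₑ ^ 2 + ∑ k, NV V (sw ρ (M + 2)) (dzb k q)) ∧
      ∀ h, HolOn h V → NV V (sw ρ (M + 1)) h < ⊤ →
        ∫ x in V, h x * conj (q x) * ww ρ φ (M + 1) x = c * h z := by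
  obtain ⟨r, hr, hrV⟩ := nhds_basis_closedBall.mem_iff.1 (D.isOpen.mem_nhds hz)
  obtain ⟨C₀, hC₀, hgain⟩ := D.dbar_gain M
  have hV := D.isOpen
  have ht := isTest_moC hr hrV
  have hswc : ∀ N, ContinuousOn (sw ρ N) V := fun N => D.contOn_sw
  have hs0 : ∀ N, ∀ x ∈ V, 0 ≤ sw ρ N x := fun N x hx => (D.sw_pos hx).le
  set N₀ := NV V (fun x => (sw ρ (M + 1) x)⁻¹) (fun y => moC r (z - y)) with hN₀
  have hN₀' : N₀ < ⊤ := ht.NV_lt_top hV ((hswc _).inv₀ fun x hx => (D.sw_pos hx).ne')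
  set E := ofR (expR P)
  have hE : E < ⊤ := ofReal_lt_top
  set E₂ := ofR (expR P ^ 2)
  refine ⟨4 * (E * E) * (E₂ * N₀) + (4 * (E * E) + 2) * C₀, ?_, ?_⟩
  · have := mul_lt_top hE hE
    have h2 : E₂ * N₀ < ⊤ := mul_lt_top ofReal_lt_top hN₀'
    exact add_lt_top.2 ⟨mul_lt_top (mul_lt_top (by simp) this) h2,
      mul_lt_top (add_lt_top.2 ⟨mul_lt_top (by simp) this, by simp⟩) hC₀⟩
  intro φ hφ hP hA q hq hqN hdN c hrep
  obtain ⟨f, hf, hfN⟩ := hgain q hq hdN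
  set Sd := ∑ k, NV V (sw ρ (M + 2)) (dzb k q) with hS
  have hS' : Sd < ⊤ := ENNReal.sum_lt_top.2 fun k _ => hdN k
  have hwc := D.contOn_ww (M := M + 1) hφ.continuousOn
  have hw0 : ∀ x ∈ V, 0 < ww ρ φ (M + 1) x := fun x hx => D.ww_pos hx
  let G : Fn n := fun x => conj c * (moC r (z - x) * ((ww ρ φ (M + 1) x)⁻¹ : ℝ))
  have hGc : ContinuousOn G V := continuousOn_const.mul (ht.continuous.continuousOn.mul
    (continuous_ofReal.comp_continuousOn (hwc.inv₀ fun x hx => (hw0 x hx).ne')))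
  have hGN : NV V (sw ρ (M + 1)) G ≤ ‖c‖ₑ ^ 2 * (E₂ * N₀) := by
    have h1 := NV_mono (C := ‖c‖ ^ 2 * expR P ^ 2) (w := sw ρ (M + 1)) (f := G)
      (w' := fun x => (sw ρ (M + 1) x)⁻¹) (g := fun y => moC r (z - y)) D.meas (by positivity)
      (fun x hx => ?_)
    · rwa [eofReal_mul (sq_nonneg _), mul_assoc, eofReal_pow (norm_nonneg _),
        ofReal_norm] at h1
    · have h2 := D.sw_pos (M := M + 1) hx
      have h3 := hw0 x hx
      have h4 : sw ρ (M + 1) x * (ww ρ φ (M + 1) x)⁻¹ ≤ expR P := by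
        rw [← div_eq_mul_inv, div_le_iff₀ h3]; exact D.le_ww hP hx
      simp only [G, norm_mul, RCLike.norm_conj, norm_real, norm_of_nonneg (inv_pos.2 h3).le]
      calc _ = ‖c‖ ^ 2 * (sw ρ (M + 1) x * (ww ρ φ (M + 1) x)⁻¹) ^ 2 *
            (‖moC r (z - x)‖ ^ 2 * (sw ρ (M + 1) x)⁻¹) := by field_simp
        _ ≤ _ := by
          have h5 : 0 ≤ sw ρ (M + 1) x * (ww ρ φ (M + 1) x)⁻¹ := by positivity
          gcongr
  let u : Fn n := fun x => q x - f x
  have huN : NV V (sw ρ (M + 1)) u ≤ C₀ * Sd := hfN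
  have huc : ContinuousOn u V := hq.continuousOn.sub hf.continuousOn
  let X : Fn n := fun x => G x - u x
  have hXc : ContinuousOn X V := hGc.sub huc
  have hXN : NV V (sw ρ (M + 1)) X ≤ 2 * (‖c‖ₑ ^ 2 * (E₂ * N₀)) + 2 * (C₀ * Sd) :=
    (NV_sub_le D.meas (hs0 _) (hGc.aestronglyMeasurable D.meas) D.aem_sw).trans (by gcongr)
  have hGt : NV V (sw ρ (M + 1)) G < ⊤ := hGN.trans_lt (mul_lt_top (by simp)
    (mul_lt_top ofReal_lt_top hN₀'))
  have hut : NV V (sw ρ (M + 1)) u < ⊤ := huN.trans_lt (mul_lt_top hC₀ hS')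
  have hXt : NV V (sw ρ (M + 1)) X < ⊤ :=
    NV_sub_lt_top D.meas (hs0 _) (hGc.aestronglyMeasurable D.meas) D.aem_sw hGt hut
  obtain ⟨p, hp, hpN, hpo⟩ := exists_hol_proj hV hwc hw0 (hXc.aestronglyMeasurable D.meas)
    ((D.NV_ww_lt_top hP X).2 hXt)
  have hpN' : NV V (sw ρ (M + 1)) p ≤ E * (E * NV V (sw ρ (M + 1)) X) :=
    (D.NV_sw_le hP p).trans (by gcongr; exact hpN.trans (D.NV_ww_le hP X))
  have hpt : NV V (sw ρ (M + 1)) p < ⊤ :=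
    hpN'.trans_lt (mul_lt_top hE (mul_lt_top hE hXt))
  have iG : ∀ h, HolOn h V → NV V (sw ρ (M + 1)) h < ⊤ →
      IntegrableOn (fun x => h x * conj (G x) * ww ρ φ (M + 1) x) V := fun h hh hN =>
    D.int_pair hφ.continuousOn hP (two_mul _).symm hh.continuousOn hGc hN hGt
  have iX : ∀ h, HolOn h V → NV V (sw ρ (M + 1)) h < ⊤ →
      IntegrableOn (fun x => h x * conj (X x - p x) * ww ρ φ (M + 1) x) V := fun h hh hN =>
    D.int_pair (g := fun x => X x - p x) hφ.continuousOn hP (two_mul _).symm hh.continuousOn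
      (hXc.sub hp.continuousOn) hN
      (NV_sub_lt_top D.meas (hs0 _) (hXc.aestronglyMeasurable D.meas) D.aem_sw hXt hpt)
  have eG : ∀ h, HolOn h V →
      ∫ x in V, h x * conj (G x) * ww ρ φ (M + 1) x = c * h z := fun h hh => by
    rw [setIntegral_moC hV hr hrV hw0 hh (conj c), conj_conj]
  have hsucc : ∀ h : Fn n, NV V (sw ρ M) h < ⊤ → NV V (sw ρ (M + 1)) h < ⊤ := fun h hN =>
    D.NV_sw_succ_lt_top hN
  have hfN2 : NV V (sw ρ (M + 2)) f < ⊤ := by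
    have h1 := NV_sub_lt_top (g := u) D.meas (hs0 _) (hq.continuousOn.aestronglyMeasurable D.meas)
      D.aem_sw hqN (D.NV_sw_succ_lt_top hut)
    simpa only [u, sub_sub_cancel] using h1
  have hfp : EqOn (fun x => f x - p x) (fun _ => 0) V := by
    refine D.nondegenerate hφ hP hA (hf.sub hp) (NV_sub_lt_top D.meas (hs0 _)
      (hf.continuousOn.aestronglyMeasurable D.meas) D.aem_sw hfN2 (D.NV_sw_succ_lt_top hpt))
      fun h hh hN => ?_
    have i3 : IntegrableOn (fun x => h x * conj (q x) * ww ρ φ (M + 1) x) V :=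
      D.int_pair (a := M) (b := M + 2) hφ.continuousOn hP (by ring) hh.continuousOn
        hq.continuousOn hN hqN
    have i1 := iX h hh (hsucc h hN)
    have i2 := iG h hh (hsucc h hN)
    have i12 : IntegrableOn (fun x => h x * conj (X x - p x) * ww ρ φ (M + 1) x -
      h x * conj (G x) * ww ρ φ (M + 1) x) V := i1.sub i2
    calc _ = ∫ x in V, (h x * conj (X x - p x) * ww ρ φ (M + 1) x -
          h x * conj (G x) * ww ρ φ (M + 1) x) + h x * conj (q x) * ww ρ φ (M + 1) x := by
          refine integral_congr_all fun x => ?_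
          simp only [X, u, map_sub]; ring
      _ = 0 := by
        rw [integral_add i12 i3, integral_sub i1 i2, hpo h hh
          ((D.NV_ww_lt_top hP h).2 (hsucc h hN)), eG h hh, hrep h hh hN]
        ring
  constructor
  · have e1 : NV V (sw ρ (M + 1)) q = NV V (sw ρ (M + 1)) (fun x => p x + u x) :=
      NV_congr D.meas fun x hx => by
        have := hfp hx
        simp only at this
        simp only [u]; linear_combination this
    rw [e1]
    refine (NV_add_le D.meas (hs0 _) (hp.continuousOn.aestronglyMeasurable D.meas)
      D.aem_sw).trans ?_
    calc _ ≤ 2 * (E * (E * (2 * (‖c‖ₑ ^ 2 * (E₂ * N₀)) + 2 * (C₀ * Sd)))) + 2 * (C₀ * Sd) := by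
          gcongr
          exact hpN'.trans (by gcongr)
      _ = 4 * (E * E) * (E₂ * N₀) * ‖c‖ₑ ^ 2 + (4 * (E * E) + 2) * C₀ * Sd := by ring
      _ ≤ _ := by
        rw [mul_add]
        exact add_le_add (mul_le_mul_left le_self_add _) (mul_le_mul_left le_add_self _)
  · intro h hh hN
    have i1 := iX h hh hN
    have i2 := iG h hh hN
    calc _ = ∫ x in V, h x * conj (G x) * ww ρ φ (M + 1) x -
          h x * conj (X x - p x) * ww ρ φ (M + 1) x := by
          refine setIntegral_congr_fun D.meas fun x hx => ?_
          have := hfp hx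
          simp only at this
          have : p x = f x := (sub_eq_zero.1 this).symm
          simp only [X, u, this, map_sub]; ring
      _ = _ := by
        rw [integral_sub i2 i1, hpo h hh ((D.NV_ww_lt_top hP h).2 hN), eG h hh, sub_zero]

section

variable {a b : ℂ → Fn n} {t : ℂ}

/-- Families of functions which are smooth near the closure of `Δ × V`. -/
def Cf (V : Set (Cn n)) (a : ℂ → Fn n) : Prop :=
  ∃ O, IsOpen O ∧ closedBall (0 : ℂ) 1 ×ˢ closure V ⊆ O ∧ SmoothOn (fun p => a p.1 p.2) O

namespace Cf

theorem add (ha : Cf V a) (hb : Cf V b) : Cf V fun t x => a t x + b t x := by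
  obtain ⟨O, h1, h2, h3⟩ := ha
  obtain ⟨O', h1', h2', h3'⟩ := hb
  exact ⟨O ∩ O', h1.inter h1', subset_inter h2 h2',
    (h3.mono inter_subset_left).add (h3'.mono inter_subset_right)⟩

theorem mul (ha : Cf V a) (hb : Cf V b) : Cf V fun t x => a t x * b t x := by
  obtain ⟨O, h1, h2, h3⟩ := ha
  obtain ⟨O', h1', h2', h3'⟩ := hb
  exact ⟨O ∩ O', h1.inter h1', subset_inter h2 h2',
    (h3.mono inter_subset_left).mul (h3'.mono inter_subset_right)⟩

theorem const (c : ℂ) : Cf V fun _ _ => c := ⟨univ, isOpen_univ, subset_univ _, contDiffOn_const⟩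

theorem neg (ha : Cf V a) : Cf V fun t x => -a t x := by
  simpa only [neg_one_mul] using (const (-1)).mul ha

theorem sub (ha : Cf V a) (hb : Cf V b) : Cf V fun t x => a t x - b t x := by
  simpa only [sub_eq_add_neg] using ha.add hb.neg

theorem sum {ι : Type*} {a : ι → ℂ → Fn n} (s : Finset ι) (h : ∀ i, Cf V (a i)) :
    Cf V fun t x => ∑ i ∈ s, a i t x := by
  classical
  induction s using Finset.induction_on with
  | empty => simpa using const 0
  | insert i s hi ih => simpa only [Finset.sum_insert hi] using (h i).add ih

theorem conjugate (ha : Cf V a) : Cf V fun t x => conj (a t x) := by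
  obtain ⟨O, h1, h2, h3⟩ := ha
  exact ⟨O, h1, h2, conjCLE.contDiff.comp_contDiffOn h3⟩

theorem inv (ha : Cf V a) (h0 : ∀ t ∈ closedBall (0 : ℂ) 1, ∀ x ∈ closure V, a t x ≠ 0) :
    Cf V fun t x => (a t x)⁻¹ := by
  obtain ⟨O, h1, h2, h3⟩ := ha
  exact ⟨_, h3.continuousOn.isOpen_inter_preimage h1 isOpen_compl_singleton,
    fun p hp => ⟨h2 hp, h0 p.1 hp.1 p.2 hp.2⟩, (h3.mono inter_subset_left).inv fun p hp => hp.2⟩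

theorem smooth (ha : Cf V a) (ht : t ∈ closedBall (0 : ℂ) 1) : SmoothOn (a t) V := by
  obtain ⟨O, h1, h2, h3⟩ := ha
  exact h3.comp (contDiff_prodMk_right t).contDiffOn fun x hx => h2 ⟨ht, subset_closure hx⟩

theorem bound (D : Dom V W ρ) (ha : Cf V a) :
    ∃ C > 0, ∀ t ∈ closedBall (0 : ℂ) 1, ∀ x ∈ V, ‖a t x‖ ≤ C := by
  obtain ⟨O, h1, h2, h3⟩ := ha
  obtain ⟨C, hC⟩ := ((isCompact_closedBall (0 : ℂ) 1).prod D.compact).exists_bound_of_continuousOn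
    (h3.continuousOn.mono h2)
  exact ⟨max C 1, by positivity,
    fun t ht x hx => (hC (t, x) ⟨ht, subset_closure hx⟩).trans (le_max_left _ _)⟩

theorem dd (ha : Cf V a) (c : ℂ) (j : Fin n) : Cf V fun t => dd c j (a t) := by
  obtain ⟨O, h1, h2, h3⟩ := ha
  have h4 : SmoothOn (fderiv ℝ fun p : ℂ × Cn n => a p.1 p.2) O :=
    h3.fderiv_of_isOpen h1 le_rfl
  refine ⟨O, h1, h2, ((((h4.clm_apply (contDiffOn_const (c := ((0 : ℂ), eb j)))).add
    ((contDiffOn_const (c := c)).mul (h4.clm_apply (contDiffOn_const (c := ((0 : ℂ), I • eb j)))))).div_const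
    2)).congr fun p hp => ?_⟩
  have h5 := ((h3.contDiffAt (h1.mem_nhds hp)).differentiableAt (by simp)).hasFDerivAt
  have h6 : HasFDerivAt (a p.1) ((fderiv ℝ (fun p : ℂ × Cn n => a p.1 p.2) p).comp
      (ContinuousLinearMap.inr ℝ ℂ (Cn n))) p.2 :=
    HasFDerivAt.comp (g := fun p : ℂ × Cn n => a p.1 p.2) (f := fun x => (p.1, x)) p.2 h5
      (hasFDerivAt_prodMk_right p.1 p.2)
  simp only [Berndtsson.dd, h6.fderiv]
  simp

theorem ofReal {r : ℂ × Cn n → ℝ} {O : Set (ℂ × Cn n)} (hO : IsOpen O)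
    (h : closedBall (0 : ℂ) 1 ×ˢ closure V ⊆ O) (hr : SmoothOn r O) :
    Cf V fun t x => (r (t, x) : ℂ) :=
  ⟨O, hO, h, ofRealCLM.contDiff.comp_contDiffOn hr⟩

theorem rho (D : Dom V W ρ) : Cf V fun _ x => (ρ x : ℂ) :=
  ofReal (r := fun p => ρ p.2) (isOpen_univ.prod D.hW) (prod_mono (subset_univ _) D.hVW)
    (D.hρ.comp contDiff_snd.contDiffOn fun _ hp => hp.2)

end Cf

/-- The module over the smooth families generated by `B`. -/
inductive Sp (V : Set (Cn n)) (B : Set (ℂ → Fn n)) : (ℂ → Fn n) → Prop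
  | base {p} : p ∈ B → Sp V B p
  | zero : Sp V B fun _ _ => 0
  | add {p s} : Sp V B p → Sp V B s → Sp V B fun t x => p t x + s t x
  | mul {a p} : Cf V a → Sp V B p → Sp V B fun t x => a t x * p t x
  | congr {p s} : (∀ t ∈ Δ, EqOn (p t) (s t) V) → Sp V B p → Sp V B s

namespace Sp

variable {B B' : Set (ℂ → Fn n)} {f g : ℂ → Fn n}

theorem sum {ι : Type*} {f : ι → ℂ → Fn n} (s : Finset ι) (h : ∀ i, Sp V B (f i)) :
    Sp V B fun t x => ∑ i ∈ s, f i t x := by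
  classical
  induction s using Finset.induction_on with
  | empty => simpa using zero
  | insert i s hi ih => simpa only [Finset.sum_insert hi] using (h i).add ih

theorem lift (hf : Sp V B f) (h : ∀ b ∈ B, Sp V B' b) : Sp V B' f := by
  induction hf with
  | base hb => exact h _ hb
  | zero => exact zero
  | add _ _ h1 h2 => exact h1.add h2
  | mul ha _ h1 => exact h1.mul ha
  | congr e _ h1 => exact h1.congr e

theorem smooth (hf : Sp V B f) (h : ∀ b ∈ B, ∀ t ∈ Δ, SmoothOn (b t) V) :
    ∀ t ∈ Δ, SmoothOn (f t) V := by
  induction hf with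
  | base hb => exact h _ hb
  | zero => exact fun _ _ => contDiffOn_const
  | add _ _ h1 h2 => exact fun t ht => (h1 t ht).add (h2 t ht)
  | mul ha _ h1 => exact fun t ht => (ha.smooth (ball_subset_closedBall ht)).mul (h1 t ht)
  | congr e _ h1 => exact fun t ht => (h1 t ht).congr fun x hx => (e t ht hx).symm

theorem dd (hV : IsOpen V) (hf : Sp V B f)
    (h : ∀ b ∈ B, ∀ t ∈ Δ, SmoothOn (b t) V) (h1 : ∀ b ∈ B, Sp V B' b)
    (h2 : ∀ b ∈ B, Sp V B' fun t => dd c j (b t)) : Sp V B' fun t => Berndtsson.dd c j (f t) := by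
  induction hf with
  | base hb => exact h2 _ hb
  | zero => exact zero.congr fun t _ x _ => by simp
  | add k1 k2 i1 i2 =>
    exact (i1.add i2).congr fun t ht x hx =>
      (dd_add (diffAt hV (k1.smooth h t ht) hx) (diffAt hV (k2.smooth h t ht) hx)).symm
  | mul ha k i =>
    exact (((k.lift h1).mul (ha.dd c j)).add (i.mul ha)).congr fun t ht x hx =>
      (dd_mul (diffAt hV (ha.smooth (ball_subset_closedBall ht)) hx)
        (diffAt hV (k.smooth h t ht) hx)).symm
  | congr e _ i => exact i.congr fun t ht => dd_congr_on hV (e t ht)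

/-- Uniform bounds in weighted `L²`. -/
def Bd (V : Set (Cn n)) (ρ : Cn n → ℝ) (M : ℕ) (f : ℂ → Fn n) : Prop :=
  ∃ C : ℝ≥0∞, C < ⊤ ∧ ∀ t ∈ Δ, NV V (sw ρ M) (f t) ≤ C

theorem Bd.mono (D : Dom V W ρ) (h : Bd V ρ m f) (hm : m ≤ M) : Bd V ρ M f := by
  induction hm with
  | refl => exact h
  | step _ ih =>
    obtain ⟨C, hC, h1⟩ := ih
    obtain ⟨S, hS, h2⟩ := D.NV_sw_succ_le
    exact ⟨S * C, mul_lt_top hS hC, fun t ht => (h2 _ _).trans (by gcongr; exact h1 t ht)⟩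

theorem bd (D : Dom V W ρ) (hf : Sp V B f)
    (h : ∀ b ∈ B, ∀ t ∈ Δ, SmoothOn (b t) V) (hb : ∀ b ∈ B, Bd V ρ M b) :
    Bd V ρ M f := by
  induction hf with
  | base h1 => exact hb _ h1
  | zero => exact ⟨0, by simp, fun t ht => by simp [NV]⟩
  | add k1 k2 i1 i2 =>
    obtain ⟨C, hC, h1⟩ := i1
    obtain ⟨C', hC', h1'⟩ := i2
    refine ⟨2 * C + 2 * C', add_lt_top.2 ⟨mul_lt_top (by simp) hC,
      mul_lt_top (by simp) hC'⟩, fun t ht => (NV_add_le D.meas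
      D.sw_nonneg ((k1.smooth h t ht).continuousOn.aestronglyMeasurable D.meas)
      D.aem_sw).trans ?_⟩
    gcongr
    exacts [h1 t ht, h1' t ht]
  | mul ha k i =>
    obtain ⟨C, hC, h1⟩ := i
    obtain ⟨C', hC', h1'⟩ := ha.bound D
    exact ⟨_, mul_lt_top ofReal_lt_top hC, fun t ht =>
      (NV_mul_le D.meas (h1' t (ball_subset_closedBall ht)) D.sw_nonneg _).trans
        (by gcongr; exact h1 t ht)⟩
  | congr e _ i =>
    obtain ⟨C, hC, h1⟩ := i
    exact ⟨C, hC, fun t ht => (NV_congr D.meas (e t ht)).symm.trans_le (h1 t ht)⟩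

end Sp

/-- Iterated derivatives `∂^β`. -/
def dzs (l : List (Fin n)) (f : Fn n) : Fn n := l.foldr dz f

theorem hol_dzs (hV : IsOpen V) (hf : HolOn f V) (l : List (Fin n)) :
    HolOn (dzs l f) V := by
  induction l with
  | nil => exact hf
  | cons j l ih => exact hol_dz hV ih

theorem Cf.levi_bound (D : Dom V W ρ) {φ : ℂ × Cn n → ℝ} (h : Cf V fun t x => (φ (t, x) : ℂ)) :
    ∃ A, ∀ t ∈ closedBall (0 : ℂ) 1, ∀ x ∈ V, ∀ β,
      0 ≤ levi (fun x => φ (t, x)) x β + A * levi ρ x β := by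
  choose C hC h1 using fun p : Fin n × Fin n => ((h.dd (-I) p.2).dd I p.1).bound D
  obtain ⟨c, hc, h2⟩ := D.levi_pos
  refine ⟨(∑ j, ∑ k, C (j, k)) / c, fun t ht x hx β => ?_⟩
  have h3 : |levi (fun x => φ (t, x)) x β| ≤ (∑ j, ∑ k, C (j, k)) * ∑ k, ‖β k‖ ^ 2 := by
    refine (abs_re_le_norm _).trans ((norm_sum_le _ _).trans ?_)
    rw [sum_mul]
    refine sum_le_sum fun j _ => (norm_sum_le _ _).trans ?_
    rw [sum_mul]
    refine sum_le_sum fun k _ => ?_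
    have hs : ∀ i, ‖β i‖ ^ 2 ≤ ∑ k, ‖β k‖ ^ 2 := fun i =>
      Finset.single_le_sum (f := fun k => ‖β k‖ ^ 2) (fun _ _ => sq_nonneg _) (Finset.mem_univ i)
    rw [norm_mul, norm_mul, RCLike.norm_conj, mul_assoc]
    exact mul_le_mul (h1 (j, k) t ht x hx)
      (by nlinarith [hs j, hs k, sq_nonneg (‖β k‖ - ‖β j‖)]) (by positivity) (hC _).le
  have h4 : 0 ≤ ∑ j, ∑ k, C (j, k) :=
    sum_nonneg fun j _ => sum_nonneg fun k _ => (hC _).le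
  have h5 := mul_le_mul_of_nonneg_left (h2 x (subset_closure hx) β) (div_nonneg h4 hc.le)
  rw [← mul_assoc, div_mul_cancel₀ _ hc.ne'] at h5
  linarith [(abs_le.1 h3).1]

end

section

variable {ι : Type*}

/-- The first order operator adjoint to multiplication by `∑ a_l ∂_lρ + ρ e`, up to a factor. -/
def TT (φ : ℂ × Cn n → ℝ) (a : Fin n → ℂ → Fn n) (e : ℂ → Fn n) (M : ℕ)
    (q : ℂ → Fn n) (t : ℂ) (x : Cn n) : ℂ :=
  ∑ l, (dz l (fun y => a l t y * q t y) x - dz l (fun y => (φ (t, y) : ℂ)) x * (a l t x * q t x)) -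
    ((M : ℂ) + 1) * e t x * q t x

/-- Words in the operators `TT` applied to `k`. -/
def gw (φ : ℂ × Cn n → ℝ) (a : ι → Fin n → ℂ → Fn n) (e : ι → ℂ → Fn n)
    (k : ℂ → Fn n) : List ι → ℂ → Fn n
  | [] => k
  | o :: w => TT φ (a o) (e o) w.length (gw φ a e k w)

def DB (k : ℂ → Fn n) (M : ℕ) : Set (ℂ → Fn n) :=
  {q | ∃ l : List (Fin n), l.length ≤ M ∧ q = fun t => dzs l (k t)}

def GB (φ : ℂ × Cn n → ℝ) (a : ι → Fin n → ℂ → Fn n) (e : ι → ℂ → Fn n)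
    (k : ℂ → Fn n) (M : ℕ) : Set (ℂ → Fn n) :=
  {q | ∃ w : List ι, w.length ≤ M ∧ q = gw φ a e k w}

variable {φ : ℂ × Cn n → ℝ} {a : ι → Fin n → ℂ → Fn n} {e : ι → ℂ → Fn n}
  {k q : ℂ → Fn n}

theorem DB_smooth (hV : IsOpen V) (hk : ∀ t ∈ Δ, HolOn (k t) V) :
    ∀ b ∈ DB k M, ∀ t ∈ Δ, SmoothOn (b t) V := by
  rintro _ ⟨l, -, rfl⟩ t ht
  exact hol_smooth hV (hol_dzs hV (hk t ht) l)

theorem DB_mono (h : m ≤ M) (hq : Sp V (DB k m) q) : Sp V (DB k M) q :=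
  hq.lift fun _ ⟨l, hl, hb⟩ => .base ⟨l, hl.trans h, hb⟩

theorem DB_dz (hV : IsOpen V) (hk : ∀ t ∈ Δ, HolOn (k t) V) (hq : Sp V (DB k M) q) : Sp V (DB k (M + 1)) fun t => dz j (q t) := by
  refine hq.dd hV (DB_smooth hV hk) (fun _ ⟨l, hl, hb⟩ => .base ⟨l, hl.trans (by simp), hb⟩) ?_
  rintro _ ⟨l, hl, rfl⟩
  exact .base ⟨j :: l, by simpa using hl, rfl⟩

theorem DB_dzb (hV : IsOpen V) (hk : ∀ t ∈ Δ, HolOn (k t) V) (hq : Sp V (DB k M) q) : Sp V (DB k M) fun t => dzb j (q t) := by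
  refine hq.dd hV (DB_smooth hV hk) (fun _ => .base) ?_
  rintro _ ⟨l, hl, rfl⟩
  exact Sp.zero.congr fun t ht x hx => (hol_dzb hV (hol_dzs hV (hk t ht) l) hx).symm

theorem DB_TT (hV : IsOpen V) (hk : ∀ t ∈ Δ, HolOn (k t) V)
    (hφ : Cf V fun t x => (φ (t, x) : ℂ)) {a : Fin n → ℂ → Fn n} {e : ℂ → Fn n}
    (ha : ∀ l, Cf V (a l)) (he : Cf V e) (hq : Sp V (DB k M) q) (m : ℕ) :
    Sp V (DB k (M + 1)) (TT φ a e m q) := by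
  have hq' := DB_mono M.le_succ hq
  refine ((Sp.sum Finset.univ fun l => (DB_dz hV hk (j := l) (hq.mul (ha l))).add
    ((hq'.mul (ha l)).mul (hφ.dd (-I) l).neg)).add
      (hq'.mul ((Cf.const (-((m : ℂ) + 1))).mul he))).congr fun t ht x hx => ?_
  simp only [TT, neg_mul, ← sub_eq_add_neg]

theorem DB_gw (hV : IsOpen V) (hk : ∀ t ∈ Δ, HolOn (k t) V)
    (hφ : Cf V fun t x => (φ (t, x) : ℂ)) (ha : ∀ o l, Cf V (a o l)) (he : ∀ o, Cf V (e o))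
    (w : List ι) : Sp V (DB k w.length) (gw φ a e k w) := by
  induction w with
  | nil => exact .base ⟨[], le_rfl, rfl⟩
  | cons o w ih => exact DB_TT hV hk hφ (ha o) (he o) ih _

theorem GB_dzs [Fintype ι] (hV : IsOpen V)
    (hk : ∀ t ∈ Δ, HolOn (k t) V)
    (hφ : Cf V fun t x => (φ (t, x) : ℂ)) (ha : ∀ o l, Cf V (a o l)) (he : ∀ o, Cf V (e o))
    {b : Fin n → ι → ℂ → Fn n} (hb : ∀ j o, Cf V (b j o))
    (hab : ∀ j, ∀ t ∈ Δ, ∀ x ∈ V, ∀ f : Fin n → ℂ,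
      ∑ o, b j o t x * ∑ l, a o l t x * f l = f j) (l : List (Fin n)) :
    Sp V (GB φ a e k l.length) fun t => dzs l (k t) := by
  have hs : ∀ w : List ι, ∀ t ∈ Δ, SmoothOn (gw φ a e k w t) V := fun w =>
    (DB_gw hV hk hφ ha he w).smooth (DB_smooth hV hk)
  induction l with
  | nil => exact .base ⟨[], le_rfl, rfl⟩
  | cons j l ih =>
    refine ih.dd hV ?_ (fun _ ⟨w, hw, hb⟩ => .base ⟨w, hw.trans (by simp), hb⟩) ?_
    · rintro _ ⟨w, -, rfl⟩
      exact hs w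
    rintro _ ⟨w, hw, rfl⟩
    have hgw : Sp V (GB φ a e k (j :: l).length) (gw φ a e k w) :=
      .base ⟨w, hw.trans (by simp), rfl⟩
    have hgo : ∀ o, Sp V (GB φ a e k (j :: l).length) (gw φ a e k (o :: w)) := fun o =>
      .base ⟨o :: w, by simpa using hw, rfl⟩
    refine (Sp.sum Finset.univ fun o => (((hgo o).add (hgw.mul
      ((Cf.sum Finset.univ fun l => ((hφ.dd (-I) l).mul (ha o l)).sub ((ha o l).dd (-I) l)).add
        ((Cf.const ((w.length : ℂ) + 1)).mul (he o))))).mul (hb j o))).congr fun t ht x hx => ?_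
    refine Eq.trans ?_ (hab j t ht x hx fun l => dz l (gw φ a e k w t) x)
    refine sum_congr rfl fun o _ => ?_
    congr 1
    have e1 : ∀ l, dz l (fun y => a o l t y * gw φ a e k w t y) x =
        dz l (a o l t) x * gw φ a e k w t x + a o l t x * dz l (gw φ a e k w t) x := fun l =>
      dd_mul (diffAt hV ((ha o l).smooth (ball_subset_closedBall ht)) hx) (diffAt hV (hs w t ht) hx)
    simp only [gw, TT, e1, add_mul, sum_mul]
    rw [sub_add_eq_add_sub, sub_eq_iff_eq_add, ← add_assoc, ← sum_add_distrib]
    congr 1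
    · refine sum_congr rfl fun l _ => ?_
      ring

theorem Dom.word_bound (D : Dom V W ρ) (hz : z ∈ V)
    (hk : ∀ t ∈ Δ, HolOn (k t) V) [Fintype ι]
    (hφ : Cf V fun t x => (φ (t, x) : ℂ)) (ha : ∀ o l, Cf V (a o l)) (he : ∀ o, Cf V (e o))
    {b : Fin n → ι → ℂ → Fn n} (hb : ∀ j o, Cf V (b j o))
    (hab : ∀ j, ∀ t ∈ Δ, ∀ x ∈ V, ∀ f : Fin n → ℂ,
      ∑ o, b j o t x * ∑ l, a o l t x * f l = f j)
    (hae : ∀ o, ∃ μ : ℝ, ∀ t ∈ Δ, ∀ x ∈ V,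
      ∑ l, a o l t x * dz l ♯ρ x = μ - ρ x * e o t x)
    (h0 : Sp.Bd V ρ 0 k) (hrep : ∀ t ∈ Δ, ∀ h, HolOn h V →
      NV V (sw ρ 0) h < ⊤ → ∫ x in V, h x * conj (k t x) * ww ρ (fun x => φ (t, x)) 0 x = h z)
    (M : ℕ) : ∀ w : List ι, w.length = M → Sp.Bd V ρ M (gw φ a e k w) ∧ ∃ c : ℂ,
      ∀ t ∈ Δ, ∀ h, HolOn h V → NV V (sw ρ M) h < ⊤ →
        ∫ x in V, h x * conj (gw φ a e k w t x) * ww ρ (fun x => φ (t, x)) M x = c * h z := by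
  induction M using Nat.strong_induction_on with
  | _ M ih =>
  have hV := D.isOpen
  rintro (_ | ⟨o, w⟩) hw
  · obtain rfl : M = 0 := hw.symm
    exact ⟨h0, 1, fun t ht h hh hN => by rw [one_mul]; exact hrep t ht h hh hN⟩
  obtain ⟨m, rfl⟩ : ∃ m, M = m + 1 := ⟨w.length, by simpa using hw.symm⟩
  have hwm : w.length = m := by simpa using hw
  have hgs : ∀ w : List ι, ∀ t ∈ Δ, SmoothOn (gw φ a e k w t) V := fun w =>
    (DB_gw hV hk hφ ha he w).smooth (DB_smooth hV hk)
  have hd : ∀ l : List (Fin n), l.length ≤ m → Sp.Bd V ρ l.length fun t => dzs l (k t) := by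
    intro l hl
    refine (GB_dzs hV hk hφ ha he hb hab l).bd D ?_ ?_
    · rintro _ ⟨w, -, rfl⟩
      exact hgs w
    · rintro _ ⟨w, hw, rfl⟩
      exact (ih w.length (by omega) w rfl).1.mono D hw
  have hd1 : ∀ f, Sp V (DB k (m + 1)) f → Sp.Bd V ρ (m + 2) f := by
    refine fun f hf => hf.bd D (DB_smooth hV hk) ?_
    rintro _ ⟨_ | ⟨j, l⟩, hl, rfl⟩
    · exact (hd [] (by simp)).mono D (by simp)
    · have hl' : l.length ≤ m := by simpa using hl
      obtain ⟨C, hC, h1⟩ := hd l hl'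
      obtain ⟨C', hC', h2⟩ := D.cauchy l.length
      exact Sp.Bd.mono D ⟨_, mul_lt_top ofReal_lt_top hC, fun t ht =>
        (h2 j _ (hol_dzs hV (hk t ht) l)).trans (by gcongr; exact h1 t ht)⟩ (by omega)
  obtain ⟨P, hP0, hP⟩ := hφ.bound D
  obtain ⟨A, hA⟩ := Cf.levi_bound D hφ
  obtain ⟨C, hC, hboot⟩ := D.bootstrap hz m P A
  obtain ⟨hBd, c, hc⟩ := ih m (by omega) w hwm
  obtain ⟨μ, hμ⟩ := hae o
  have hT : Sp V (DB k (m + 1)) (gw φ a e k (o :: w)) := by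
    simpa [hwm] using DB_gw hV hk hφ ha he (o :: w)
  obtain ⟨C₁, hC₁, hT1⟩ := hd1 _ hT
  choose C₂ hC₂ hT2 using fun j => hd1 _ (DB_dzb hV hk (j := j) hT)
  have hφs : ∀ t ∈ Δ, SmoothOn (fun x => φ (t, x)) V := fun t ht =>
    reCLM.contDiff.comp_contDiffOn (hφ.smooth (ball_subset_closedBall ht))
  have hφP : ∀ t ∈ Δ, ∀ x ∈ V, |φ (t, x)| ≤ P := fun t ht x hx => by
    simpa using hP t (ball_subset_closedBall ht) x hx
  have key : ∀ t ∈ Δ, _ := fun t ht => hboot (fun x => φ (t, x)) (hφs t ht)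
    (hφP t ht) (hA t (ball_subset_closedBall ht)) (gw φ a e k (o :: w) t) (hgs _ t ht)
    ((hT1 t ht).trans_lt hC₁) (fun j => (hT2 j t ht).trans_lt (hC₂ j)) ((m + 1) * μ * c) ?_
  · refine ⟨⟨C * (‖(m + 1) * μ * c‖ₑ ^ 2 + ∑ j, C₂ j), mul_lt_top hC
      (add_lt_top.2 ⟨ENNReal.pow_lt_top enorm_lt_top, ENNReal.sum_lt_top.2 fun j _ => hC₂ j⟩), fun t ht =>
      (key t ht).1.trans ?_⟩, _, fun t ht => (key t ht).2⟩
    gcongr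
    exact hT2 _ t ht
  intro h hh hN
  have ht' := ball_subset_closedBall ht
  have hqc := (hgs w t ht).continuousOn
  have hDw := hwm ▸ DB_gw hV hk hφ ha he w
  have hq : NV V (sw ρ m) (gw φ a e k w t) < ⊤ := by
    obtain ⟨C, hC, h1⟩ := hBd
    exact (h1 t ht).trans_lt hC
  have hm : ∀ {a' : ℂ → Fn n}, Cf V a' →
      NV V (sw ρ m) (fun x => a' t x * gw φ a e k w t x) < ⊤ := fun ha' => by
    obtain ⟨C, -, h1⟩ := ha'.bound D
    exact (NV_mul_le D.meas (h1 t ht') D.sw_nonneg _).trans_lt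
      (mul_lt_top ofReal_lt_top hq)
  have hdm : ∀ l, NV V (sw ρ (m + 2)) (fun x => dz l (fun y => a o l t y * gw φ a e k w t y) x)
      < ⊤ := fun l => by
    obtain ⟨C, hC, h1⟩ := hd1 _ (DB_dz hV hk (j := l) (hDw.mul (ha o l)))
    exact (h1 t ht).trans_lt hC
  have hib := fun l => D.ibp_pair (M := m) (k := l) (q := fun y => a o l t y * gw φ a e k w t y)
    (hφs t ht) (hφP t ht) (((hφ.dd (-I) l).bound D).choose_spec.2 t ht') hh hN
    (((ha o l).smooth ht').mul (hgs w t ht)) (hm (ha o l)) (hdm l)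
  have hφc := (hφs t ht).continuousOn
  have J : ∀ {a' : ℂ → Fn n}, Cf V a' → IntegrableOn (fun x =>
      h x * conj (a' t x * gw φ a e k w t x) * ww ρ (fun x => φ (t, x)) m x) V := fun ha' =>
    D.int_pair hφc (hφP t ht) (two_mul m).symm hh.continuousOn
      ((ha'.smooth ht').continuousOn.mul hqc) hN (hm ha')
  have J1 : ∀ {f}, Sp V (DB k (m + 1)) f → IntegrableOn (fun x =>
      h x * conj (f t x) * ww ρ (fun x => φ (t, x)) (m + 1) x) V := fun hf => by
    obtain ⟨C, hC, h1⟩ := hd1 _ hf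
    exact D.int_pair (a := m) (b := m + 2) hφc (hφP t ht) (by ring) hh.continuousOn
      (hf.smooth (DB_smooth hV hk) t ht).continuousOn hN ((h1 t ht).trans_lt hC)
  have hDw' := DB_mono m.le_succ hDw
  have I1 := fun l => J1 ((DB_dz hV hk (j := l) (hDw.mul (ha o l))).add
    ((hDw'.mul (ha o l)).mul (hφ.dd (-I) l).neg))
  have I2 := J1 ((hDw'.mul (he o)).mul (Cf.const ((m : ℂ) + 1)))
  have I3 := fun l => J (((Cf.rho D).dd (-I) l).mul (ha o l))
  have I4 := J ((Cf.rho D).mul (he o))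
  beta_reduce at I1 I2 I3 I4
  have e1 : ∀ x ∈ V, h x * conj (gw φ a e k (o :: w) t x) * ww ρ (fun x => φ (t, x)) (m + 1) x =
      ∑ l, h x * conj (dz l (fun y => a o l t y * gw φ a e k w t y) x +
        -dz l (fun y => (φ (t, y) : ℂ)) x * (a o l t x * gw φ a e k w t x)) *
          ww ρ (fun x => φ (t, x)) (m + 1) x -
      h x * conj (((m : ℂ) + 1) * (e o t x * gw φ a e k w t x)) *
        ww ρ (fun x => φ (t, x)) (m + 1) x := fun x hx => by
    rw [← sum_mul, ← mul_sum, ← map_sum, ← sub_mul, ← mul_sub, ← map_sub, gw, TT, hwm]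
    simp only [neg_mul, ← sub_eq_add_neg, mul_assoc]
  have e2 : ∀ x ∈ V, ∑ l, h x * conj (dz l ♯ρ x * a o l t x *
        gw φ a e k w t x) * ww ρ (fun x => φ (t, x)) m x + h x * conj (ρ x * e o t x *
        gw φ a e k w t x) * ww ρ (fun x => φ (t, x)) m x =
      μ * (h x * conj (gw φ a e k w t x) * ww ρ (fun x => φ (t, x)) m x) := fun x hx => by
    rw [← sum_mul, ← mul_sum, ← map_sum, ← add_mul, ← mul_add, ← map_add,
      ← sum_mul, ← add_mul]
    simp only [mul_comm _ (a o _ t x)]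
    rw [hμ t ht x hx, sub_add_cancel, map_mul, conj_ofReal]
    ring
  have e3 : ∫ x in V, h x * conj (((m : ℂ) + 1) * (e o t x * gw φ a e k w t x)) *
        ww ρ (fun x => φ (t, x)) (m + 1) x = -((m + 1) * ∫ x in V, h x * conj (ρ x * e o t x *
        gw φ a e k w t x) * ww ρ (fun x => φ (t, x)) m x) := by
    rw [← integral_const_mul, ← integral_neg]
    refine setIntegral_congr_fun D.meas fun x hx => ?_
    simp only [ww, sw, pow_succ, map_mul, map_add, map_one, conj_ofReal, map_natCast]
    push_cast
    ring
  rw [setIntegral_congr_fun D.meas e1, integral_sub (integrable_finsetSum _ fun l _ => I1 l) I2,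
    integral_finsetSum _ fun l _ => I1 l, e3, sub_neg_eq_add]
  simp only [neg_mul, ← sub_eq_add_neg]
  rw [sum_congr rfl fun l _ => hib l, ← mul_sum, ← mul_add]
  simp only [← mul_assoc (dz _ _ _)]
  rw [← integral_finsetSum _ fun l _ => I3 l, ← integral_add (integrable_finsetSum _ fun l _ => I3 l) I4,
    setIntegral_congr_fun D.meas e2, integral_const_mul, hc t ht h hh hN]
  ring

end

section

variable {φ : ℂ × Cn n → ℝ} {k : ℂ → Fn n}

namespace Dom

include D

theorem sq_ne_zero (hx : x ∈ closure V) :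
    ∑ l, conj (dz l ♯ρ x) * dz l ♯ρ x + (ρ x : ℂ) * ρ x ≠ 0 := by
  intro h
  simp only [← normSq_eq_conj_mul_self] at h
  norm_cast at h
  have h1 : ∀ l ∈ Finset.univ, 0 ≤ normSq (dz l ♯ρ x) := fun _ _ => normSq_nonneg _
  have h2 : ρ x = 0 := by nlinarith [sum_nonneg h1, sq_nonneg (ρ x)]
  rw [h2, mul_zero, add_zero, Finset.sum_eq_zero_iff_of_nonneg h1] at h
  have hd : DifferentiableAt ℝ ρ x :=
    (D.hρ.contDiffAt (D.hW.mem_nhds (D.hVW hx))).differentiableAt (by simp)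
  have h3 : fderiv ℝ ♯ρ x = ofRealCLM.comp (fderiv ℝ ρ x) :=
    (ofRealCLM.hasFDerivAt.comp x hd.hasFDerivAt).fderiv
  refine D.grad x ⟨hx, fun hi => (D.neg (interior_subset hi)).ne h2⟩ ?_
  have h4 : ∀ l, fderiv ℝ ρ x (eb l) = 0 ∧ fderiv ℝ ρ x (I • eb l) = 0 := fun l => by
    have := normSq_eq_zero.1 (h l (Finset.mem_univ l))
    simpa [dd, h3, Complex.ext_iff] using this
  refine ContinuousLinearMap.ext fun v => ?_
  have h5 : v = ∑ j, ((v j).re • eb j + (v j).im • (I • eb j)) := by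
    conv_lhs => rw [sum_smul_eb v]
    refine sum_congr rfl fun j _ => ?_
    rw [← Complex.coe_smul, ← Complex.coe_smul, smul_smul, ← add_smul, re_add_im]
  rw [h5]
  simp [h4]

/-- A priori bounds for the derivatives of the Bergman kernel. -/
theorem kernel_bound (hz : z ∈ V)
    (hk : ∀ t ∈ Δ, HolOn (k t) V)
    (hφ : Cf V fun t x => (φ (t, x) : ℂ)) (hkN : ∀ t ∈ Δ, NV V (sw ρ 0) (k t) < ⊤)
    (hrep : ∀ t ∈ Δ, ∀ h, HolOn h V →
      NV V (sw ρ 0) h < ⊤ → ∫ x in V, h x * conj (k t x) * ww ρ (fun x => φ (t, x)) 0 x = h z)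
    (l : List (Fin n)) : Sp.Bd V ρ l.length fun t => dzs l (k t) := by
  have hV := D.isOpen
  set r : Fin n → ℂ → Fn n := fun l _ x => dz l ♯ρ x
  have hr : ∀ l, Cf V (r l) := fun l => (Cf.rho D).dd (-I) l
  have hN := (Cf.sum Finset.univ fun l => (hr l).conjugate.mul (hr l)).add
    ((Cf.rho D).mul (Cf.rho D))
  have hi := hN.inv fun t _ x hx => D.sq_ne_zero hx
  set i : ℂ → Fn n := fun t x =>
    (∑ l, conj (r l t x) * r l t x + (ρ x : ℂ) * (ρ x : ℂ))⁻¹ with hid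
  have hi1 : ∀ t, ∀ x ∈ V, (∑ l, conj (r l t x) * r l t x + (ρ x : ℂ) * (ρ x : ℂ)) * i t x = 1 :=
    fun t x hx => mul_inv_cancel₀ (D.sq_ne_zero (subset_closure hx))
  set a : Option (Fin n) → Fin n → ℂ → Fn n := fun o l t x => o.elim
    (conj (r l t x) * i t x) fun j => (if l = j then 1 else 0) - r j t x * (conj (r l t x) * i t x)
  set e : Option (Fin n) → ℂ → Fn n := fun o t x => o.elim (ρ x * i t x)
    fun j => -(r j t x * (ρ x * i t x))
  set b : Fin n → Option (Fin n) → ℂ → Fn n := fun j o t x => o.elim (r j t x)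
    fun j' => if j' = j then 1 else 0
  have ha : ∀ o l, Cf V (a o l)
    | none, l => (hr l).conjugate.mul hi
    | some j, l => (Cf.const _).sub ((hr j).mul ((hr l).conjugate.mul hi))
  have he : ∀ o, Cf V (e o)
    | none => (Cf.rho D).mul hi
    | some j => ((hr j).mul ((Cf.rho D).mul hi)).neg
  have hb : ∀ j o, Cf V (b j o)
    | j, none => hr j
    | j, some j' => Cf.const _
  have hab : ∀ j, ∀ t ∈ Δ, ∀ x ∈ V, ∀ f : Fin n → ℂ,
      ∑ o, b j o t x * ∑ l, a o l t x * f l = f j := fun j t _ x _ f => by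
    simp only [Fintype.sum_option, a, b, Option.elim, ite_mul, one_mul, zero_mul, sub_mul, mul_sum,
      mul_assoc]
    simp
  have hae : ∀ o, ∃ μ : ℝ, ∀ t ∈ Δ, ∀ x ∈ V,
      ∑ l, a o l t x * dz l ♯ρ x = μ - ρ x * e o t x := by
    have h1 : ∀ t, ∀ x ∈ V, ∑ l, conj (r l t x) * i t x * r l t x = 1 - ρ x * (ρ x * i t x) :=
      fun t x hx => by
        rw [← hi1 t x hx, add_mul, sum_mul]
        simp only [mul_right_comm, mul_assoc, add_sub_cancel_right]
    rintro (_ | j)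
    · exact ⟨1, fun t _ x hx => by rw [ofReal_one]; exact h1 t x hx⟩
    · refine ⟨0, fun t _ x hx => ?_⟩
      simp only [a, e, Option.elim, sub_mul, ite_mul, one_mul, zero_mul, sum_sub_distrib,
        Finset.sum_ite_eq', Finset.mem_univ, if_true, mul_assoc, ← mul_sum]
      have := h1 t x hx
      simp only [mul_assoc] at this
      change _ - r j t x * ∑ l, conj (r l t x) * (i t x * r l t x) = _
      rw [this]
      change r j t x - _ = _
      push_cast
      ring
  obtain ⟨P, hP0, hP⟩ := hφ.bound D
  have hφP : ∀ t ∈ Δ, ∀ x ∈ V, |φ (t, x)| ≤ P := fun t ht x hx => by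
    simpa using hP t (ball_subset_closedBall ht) x hx
  obtain ⟨C, hC, hpt⟩ := D.pointwise 0
  have h0 : Sp.Bd V ρ 0 k := by
    set C' := ofR (C / (-ρ z) ^ (Module.finrank ℝ (Cn n) + 0))
    set E := ofR (expR P)
    refine ⟨E * (C' * E), by simp only [C', E]; finiteness, fun t ht => ?_⟩
    have h1 : NV V (ww ρ (fun x => φ (t, x)) 0) (k t) < ⊤ := (D.NV_ww_lt_top (hφP t ht) _).2 (hkN t ht)
    have hwc := D.contOn_ww (φ := fun x => φ (t, x)) (M := 0) (reCLM.continuous.comp_continuousOn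
      (hφ.smooth (ball_subset_closedBall ht)).continuousOn)
    have h2 := NV_eq_re D.meas ((hk t ht).continuousOn.aestronglyMeasurable D.meas)
      (aem_of_contOn hV hwc) (fun x hx => (D.ww_pos hx).le) h1
    rw [hrep t ht _ (hk t ht) (hkN t ht)] at h2
    set N := NV V (ww ρ (fun x => φ (t, x)) 0) (k t)
    have h3 : N ≤ ‖k t z‖ₑ := by
      rw [h2, ← ofReal_norm]
      exact ofReal_le_ofReal (re_le_norm _)
    have h4 := D.NV_sw_le (M := 0) (hφP t ht) (k t)
    have h5 : N * N ≤ C' * E * N := by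
      rw [mul_assoc, ← sq]
      exact (pow_le_pow_left' h3 2).trans ((hpt _ (hk t ht) z hz).trans (by gcongr))
    refine h4.trans ?_
    gcongr
    by_cases hN0 : N = 0
    · exact hN0.trans_le zero_le
    · exact (ENNReal.mul_le_mul_iff_left hN0 h1.ne).1 h5
  refine (GB_dzs hV hk hφ ha he hb hab l).bd D ?_ ?_
  · rintro _ ⟨w, -, rfl⟩
    exact (DB_gw hV hk hφ ha he w).smooth (DB_smooth hV hk)
  · rintro _ ⟨w, hw, rfl⟩
    exact (D.word_bound hz hk hφ ha he hb hab hae h0 hrep _ w rfl).1.mono D hw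

end Dom

end

section

universe u

variable {X Y : Type*} {Q F : Type u} [TopologicalSpace X] [CompactSpace X] [NormedAddCommGroup Q]
  [NormedSpace ℝ Q] [NormedAddCommGroup Y] [NormedSpace ℝ Y] [NormedAddCommGroup F]
  [NormedSpace ℝ F]

/-- The evaluation of a continuous family of operators at a vector. -/
def evalFam : C(X, Q →L[ℝ] F) →L[ℝ] Q →L[ℝ] C(X, F) :=
  LinearMap.mkContinuous₂ (LinearMap.mk₂ ℝ
    (fun (u : C(X, Q →L[ℝ] F)) (v : Q) => (⟨fun x => u x v, by fun_prop⟩ : C(X, F)))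
    (fun _ _ _ => rfl) (fun _ _ _ => rfl) (fun u v w => by ext; simp) (fun c u v => by ext; simp)) 1
    fun u v => (ContinuousMap.norm_le _ (by positivity)).2 fun x => by
      rw [one_mul]
      exact ((u x).le_opNorm v).trans (by gcongr; exact u.norm_coe_le_norm x)

/-- A family `g p` of functions, as a map into the space of continuous functions. -/
def fam (g : Q × Y → F) (c : C(X, Y)) (p : Q) : C(X, F) := by
  classical
  exact if h : Continuous fun x => g (p, c x) then ⟨_, h⟩ else 0

variable {O : Set (Q × Y)} {U : Set Q} {c : C(X, Y)} {g : Q × Y → F} {p : Q}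

theorem fam_apply (hg : ContinuousOn g O) (hO : ∀ x, (p, c x) ∈ O) (x : X) :
    fam g c p x = g (p, c x) := by
  have h : Continuous fun x => g (p, c x) := hg.comp_continuous (by fun_prop) hO
  simp [fam, h]

theorem hasFDerivAt_fam (hO : IsOpen O) (hU : IsOpen U) (h : ∀ p ∈ U, ∀ x, (p, c x) ∈ O)
    (hg : ContDiffOn ℝ 1 g O) (hp : p ∈ U) :
    HasFDerivAt (fam g c) (evalFam (fam (fun q => (fderiv ℝ g q).comp
      (ContinuousLinearMap.inl ℝ Q Y)) c p)) p := by
  set g' : Q × Y → Q →L[ℝ] F := fun q => (fderiv ℝ g q).comp (ContinuousLinearMap.inl ℝ Q Y)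
  have hg' : ContinuousOn g' O :=
    (hg.continuousOn_fderiv_of_isOpen hO le_rfl).clm_comp continuousOn_const
  refine hasFDerivAt_iff_isLittleO.2 (Asymptotics.isLittleO_iff.2 fun ε hε => ?_)
  have h1 : ∀ᶠ q in 𝓝 p, ∀ x ∈ (univ : Set X), ‖g' (q, c x) - g' (p, c x)‖ < ε := by
    refine isCompact_univ.eventually_forall_of_forall_eventually fun x _ => ?_
    have h2 := fun q (hq : q ∈ O) => (hg'.continuousAt (hO.mem_nhds hq))
    have h3 : Tendsto (fun z : Q × X => ‖g' (z.1, c z.2) - g' (p, c z.2)‖) (𝓝 (p, x)) (𝓝 0) := by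
      have a1 : ContinuousAt (fun z : Q × X => g' (z.1, c z.2)) (p, x) :=
        ContinuousAt.comp (x := (p, x)) (g := g') (f := fun z : Q × X => (z.1, c z.2))
          (h2 _ (h p hp x)) (by fun_prop)
      have a2 : ContinuousAt (fun z : Q × X => g' (p, c z.2)) (p, x) :=
        ContinuousAt.comp (x := (p, x)) (g := g') (f := fun z : Q × X => (p, c z.2))
          (h2 _ (h p hp x)) (by fun_prop)
      simpa using (a1.sub a2).norm.tendsto
    exact h3.eventually_lt_const hε
  obtain ⟨δ, hδ, hb⟩ := Metric.eventually_nhds_iff_ball.1 (h1.and (hU.mem_nhds hp))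
  filter_upwards [ball_mem_nhds p hδ] with q hq
  refine (ContinuousMap.norm_le _ (by positivity)).2 fun x => ?_
  have h4 := (convex_ball p δ).norm_image_sub_le_of_norm_hasFDerivWithin_le' (𝕜 := ℝ)
    (f := fun q => g (q, c x)) (f' := fun q => g' (q, c x)) (φ := g' (p, c x)) (C := ε)
    (fun q hq => (((hg.contDiffAt (hO.mem_nhds (h q (hb q hq).2 x))).differentiableAt
      (by simp)).hasFDerivAt.comp q (hasFDerivAt_prodMk_left q (c x))).hasFDerivWithinAt)
    (fun q hq => ((hb q hq).1 x (mem_univ x)).le) (mem_ball_self hδ) hq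
  have e1 := fam_apply hg.continuousOn (h p hp) x
  have e2 := fam_apply hg.continuousOn (h q (hb q hq).2) x
  have e3 := fam_apply hg' (h p hp) x
  rw [← e1, ← e2, ← e3] at h4
  exact h4

theorem contDiffOn_fam (hO : IsOpen O) (hU : IsOpen U) (h : ∀ p ∈ U, ∀ x, (p, c x) ∈ O)
    (hg : SmoothOn g O) : SmoothOn (fam g c) U := by
  refine contDiffOn_infty.2 fun m => ?_
  induction m generalizing F with
  | zero => exact contDiffOn_zero.2 fun p hp =>
      (hasFDerivAt_fam hO hU h (hg.of_le (by simp)) hp).continuousAt.continuousWithinAt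
  | succ m ih =>
    have hd := fun (p) (hp : p ∈ U) => hasFDerivAt_fam hO hU h (hg.of_le (by simp)) hp
    push_cast
    refine (contDiffOn_succ_iff_fderiv_of_isOpen hU).2 ⟨fun p hp =>
      (hd p hp).differentiableAt.differentiableWithinAt, by simp, ?_⟩
    have h1 := (evalFam (X := X) (Q := Q) (F := F)).contDiff.comp_contDiffOn
      (ih ((hg.fderiv_of_isOpen hO le_rfl).clm_comp (contDiffOn_const
        (c := ContinuousLinearMap.inl ℝ Q Y))))
    exact h1.congr fun p hp => (hd p hp).fderiv

end

section

variable {E : Type*} [NormedAddCommGroup E] [InnerProductSpace ℂ E] {T : Set ℂ}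

theorem contDiffOn_of_orthogonal [CompleteSpace E] {A : Set E} {L : ℂ → E →L[ℂ] E} {κ : ℂ → E}
    {e : E} (hL : SmoothOn L T) (hc : ∀ t ∈ T, ‖1 - c • L t‖ < 1)
    (hκ : ∀ t ∈ T, κ t ∈ A) (h : ∀ t ∈ T, ∀ f ∈ A, inner ℂ f (L t (κ t) - e) = 0) :
    SmoothOn κ T := by
  set S := (Submodule.span ℂ A).topologicalClosure
  have hS : IsClosed (S : Set E) := Submodule.isClosed_topologicalClosure _
  have : CompleteSpace S := hS.completeSpace_coe
  set P := S.starProjection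
  have hA : A ⊆ S := Submodule.subset_span.trans (Submodule.le_topologicalClosure _)
  set B : ℂ → E →L[ℂ] E := fun t => 1 - P * (1 - c • L t)
  have hu : ∀ t ∈ T, IsUnit (B t) := fun t ht => isUnit_one_sub_of_norm_lt_one <|
    (norm_mul_le _ _).trans_lt <| (mul_le_of_le_one_left (norm_nonneg _)
      S.starProjection_norm_le).trans_lt (hc t ht)
  have hB : SmoothOn B T := contDiffOn_const.sub
    (contDiffOn_const.mul (contDiffOn_const.sub (hL.const_smul c)))
  have h1 : SmoothOn (fun t => Ring.inverse (B t) (c • P e)) T := fun t ht => by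
    obtain ⟨x, hx⟩ := hu t ht
    have h2 := contDiffAt_ringInverse ℝ (n := ∞) x
    rw [hx] at h2
    exact (ContinuousLinearMap.apply ℂ E (c • P e)).restrictScalars ℝ |>.contDiff.contDiffAt
      |>.comp_contDiffWithinAt t (h2.comp_contDiffWithinAt t (hB t ht))
  refine h1.congr fun t ht => ?_
  have h3 : P (L t (κ t) - e) = 0 := by
    refine (S.starProjection_apply_eq_zero_iff).2 ?_
    rw [Submodule.orthogonal_closure, Submodule.mem_orthogonal]
    intro f hf
    induction hf using Submodule.span_induction with
    | mem f hf => exact h t ht f hf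
    | zero => simp
    | add f g _ _ hf hg => rw [inner_add_left, hf, hg, add_zero]
    | smul a f _ hf => rw [inner_smul_left, hf, mul_zero]
  have h4 : B t (κ t) = c • P e := by
    have h5 : P (κ t) = κ t := Submodule.starProjection_eq_self_iff.2 (hA (hκ t ht))
    simp only [B, _root_.sub_apply, one_apply_eq_self, mul_apply_eq_comp,
      map_sub, h5, sub_sub_cancel]
    rw [← sub_eq_zero.1 ((map_sub P _ _).symm.trans h3)]
    simp
  rw [← h4, ← mul_apply_eq_comp, Ring.inverse_mul_cancel _ (hu t ht)]
  rfl

/-- The iterated derivative of a family in parameter directions. -/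
def tder (w : List ℂ) (f : ℂ × Cn n → ℂ) : ℂ × Cn n → ℂ :=
  w.foldr (fun v g p => fderiv ℝ g p (v, 0)) f

theorem exists_tder_inner (hT : IsOpen T) {κ : ℂ → E} (hκ : SmoothOn κ T) (w : List ℂ) :
    ∃ κ' : ℂ → E, SmoothOn κ' T ∧ ∀ (f : ℂ × Cn n → ℂ) (U : Set (Cn n)) (G : Cn n → E),
      IsOpen U → SmoothOn G U → (∀ p ∈ T ×ˢ U, f p = inner ℂ (G p.2) (κ p.1)) →
      ∀ p ∈ T ×ˢ U, tder w f p = inner ℂ (G p.2) (κ' p.1) := by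
  induction w with
  | nil => exact ⟨κ, hκ, fun f U G _ _ h => h⟩
  | cons v w ih =>
    obtain ⟨κ', h1, h2⟩ := ih
    refine ⟨fun t => fderiv ℝ κ' t v, (h1.fderiv_of_isOpen hT le_rfl).clm_apply contDiffOn_const,
      fun f U G hU hG hf p hp => ?_⟩
    have h3 : tder w f =ᶠ[𝓝 p] fun p => inner ℂ (G p.2) (κ' p.1) :=
      eventually_of_mem ((hT.prod hU).mem_nhds hp) (h2 f U G hU hG hf)
    change fderiv ℝ (tder w f) p (v, 0) = _
    have hg := ((hG.contDiffAt (hU.mem_nhds hp.2)).differentiableAt (by simp)).hasFDerivAt.comp p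
      hasFDerivAt_snd
    have hk := ((h1.contDiffAt (hT.mem_nhds hp.1)).differentiableAt (by simp)).hasFDerivAt.comp p
      hasFDerivAt_fst
    have h4 := fderiv_inner_apply ℂ hg.differentiableAt hk.differentiableAt (v, 0)
    rw [hg.fderiv, hk.fderiv] at h4
    rw [h3.fderiv_eq]
    refine h4.trans ?_
    simp

end

section

variable {X : Type*} [TopologicalSpace X] [CompactSpace X] [MeasurableSpace X] [BorelSpace X]
  {μ : Measure X} [IsFiniteMeasure μ] {T : Set ℂ}

variable (μ) in
/-- Multiplication by continuous functions. -/
def mulL : C(X, ℂ) →L[ℂ] Lp ℂ 2 μ →L[ℂ] Lp ℂ 2 μ :=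
  ((ContinuousLinearMap.mul ℂ ℂ).holderL μ ⊤ 2 2).comp (ContinuousMap.toLp ⊤ μ ℂ)

theorem coe_mulL (u : C(X, ℂ)) (f : Lp ℂ 2 μ) : mulL μ u f =ᵐ[μ] fun x => u x * f x := by
  filter_upwards [ContinuousLinearMap.coeFn_holder (r := 2) (ContinuousLinearMap.mul ℂ ℂ)
    (ContinuousMap.toLp ⊤ μ ℂ u) f, ContinuousMap.coeFn_toLp (p := ⊤) (𝕜 := ℂ) μ u] with x h1 h2
  exact h1.trans (by rw [h2]; rfl)

theorem norm_mulL_le (u : C(X, ℂ)) : ‖mulL μ u‖ ≤ ‖u‖ := by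
  refine ((mulL μ).le_opNorm u).trans (mul_le_of_le_one_left (norm_nonneg _) ?_)
  refine (ContinuousLinearMap.opNorm_comp_le _ _).trans (mul_le_one₀
    ((ContinuousLinearMap.norm_holderL_le _).trans (ContinuousLinearMap.opNorm_mul_le ℂ ℂ))
    (norm_nonneg _) ?_)
  simpa using ContinuousMap.toLp_norm_le (p := ⊤) (E := ℂ) (𝕜 := ℂ) μ

theorem exists_smooth_toLp {k : ℂ → X → ℂ} {H : Set (X → ℂ)} {u : ℂ → C(X, ℂ)} {Λ : (X → ℂ) → ℂ} (hH : ∀ f ∈ H, MemLp f 2 μ) (hk : ∀ t ∈ T, k t ∈ H)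
    (hu : SmoothOn u T) (hc : ∀ t ∈ T, ‖1 - c • u t‖ < 1)
    (h : ∀ t ∈ T, ∀ f ∈ H, ∫ x, conj (f x) * (u t x * k t x) ∂μ = Λ f) :
    ∃ κ : ℂ → Lp ℂ 2 μ, SmoothOn κ T ∧ ∀ t ∈ T, κ t =ᵐ[μ] k t := by
  classical
  obtain rfl | ⟨t₀, ht₀⟩ := T.eq_empty_or_nonempty
  · exact ⟨0, contDiffOn_const, by simp⟩
  set κ : ℂ → Lp ℂ 2 μ := fun t => if h : MemLp (k t) 2 μ then h.toLp else 0
  have hκ : ∀ t ∈ T, κ t =ᵐ[μ] k t := fun t ht => by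
    simp only [κ, dif_pos (hH _ (hk t ht))]
    exact MemLp.coeFn_toLp _
  refine ⟨κ, ?_, hκ⟩
  have hi : ∀ t ∈ T, ∀ f : Lp ℂ 2 μ, ∀ g ∈ H, f =ᵐ[μ] g →
      inner ℂ f (mulL μ (u t) (κ t)) = Λ g := fun t ht f g hg hfg => by
    rw [L2.inner_def, ← h t ht g hg]
    refine integral_congr_ae ?_
    filter_upwards [coe_mulL (u t) (κ t), hκ t ht, hfg] with x h1 h2 h3
    rw [h1, h2, h3, RCLike.inner_apply, mul_comm]
  refine contDiffOn_of_orthogonal (A := {f : Lp ℂ 2 μ | ∃ g ∈ H, f =ᵐ[μ] g})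
    (L := fun t => mulL μ (u t)) (e := mulL μ (u t₀) (κ t₀)) (c := c)
    ((mulL μ).restrictScalars ℝ |>.contDiff.comp_contDiffOn hu) (fun t ht => ?_)
    (fun t ht => ⟨_, hk t ht, hκ t ht⟩) ?_
  · have h1 : mulL μ 1 = 1 := by
      ext1 f
      refine Lp.ext ((coe_mulL _ _).trans ?_)
      simp
    rw [← h1, ← map_smul, ← map_sub]
    exact (norm_mulL_le _).trans_lt (hc t ht)
  · rintro t ht f ⟨g, hg, hfg⟩
    rw [inner_sub_right, hi t ht f g hg hfg, hi t₀ ht₀ f g hg hfg, sub_self]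

end

section

variable {φ : ℂ × Cn n → ℝ} {k : ℂ → Fn n}

theorem mo_le (hr : 0 < r) (w : Cn n) :
    mo r w ≤ (r ^ Module.finrank ℝ (Cn n) * ∫ x, mo0 (n := n) 1 x)⁻¹ := by
  rw [mo, mo0_integral hr, div_eq_mul_inv]
  have := mo0_integral_pos (n := n) one_pos
  exact mul_le_of_le_one_left (by positivity) (mo0_le_one r w)

theorem Dom.exists_radius (D : Dom V W ρ) :
    ∃ η > 0, ∀ x ∈ V, closedBall x (η * -ρ x) ⊆ {y ∈ V | -ρ x / 2 ≤ -ρ y} := by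
  obtain ⟨L, hL, δ, hδ, hl⟩ := D.exists_lip
  obtain ⟨S, hS, hs⟩ := D.exists_bound_rho
  refine ⟨min (δ / S) (1 / (2 * L)), by positivity, fun x hx y hy => ?_⟩
  have h0 := D.neg hx
  have h1 : dist y x ≤ δ / S * -ρ x := hy.trans
    (mul_le_mul_of_nonneg_right (min_le_left _ _) (by linarith))
  have h2 : dist y x ≤ 1 / (2 * L) * -ρ x := hy.trans
    (mul_le_mul_of_nonneg_right (min_le_right _ _) (by linarith))
  have h3 := (hl x (subset_closure hx) y (h1.trans (by
    rw [div_mul_eq_mul_div, div_le_iff₀ hS]; gcongr; exact hs x hx))).2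
  have h4 : L * dist y x ≤ -ρ x / 2 := by
    calc _ ≤ L * (1 / (2 * L) * -ρ x) := by gcongr
      _ = _ := by field_simp
  have h5 := (abs_le.1 (h3.trans h4)).2
  exact ⟨by rw [D.hV]; change ρ y < 0; linarith, by linarith⟩

theorem Dom.kernel_smooth (D : Dom V W ρ) (hz : z ∈ V)
    (hk : ∀ t ∈ Δ, HolOn (k t) V)
    (hφ : Cf V fun t x => (φ (t, x) : ℂ))
    (hkN : ∀ t ∈ Δ, NV V (sw ρ 0) (k t) < ⊤)
    (hrep : ∀ t ∈ Δ, ∀ h : Fn n, HolOn h V → NV V (sw ρ 0) h < ⊤ →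
      ∫ x in V, h x * conj (k t x) * ww ρ (fun x => φ (t, x)) 0 x = h z) :
    SmoothOn (fun p : ℂ × Cn n => k p.1 p.2) (Δ ×ˢ V) ∧
    ∀ (w : List ℂ) (r : ℝ), r < 1 → ∃ C, ∀ p ∈ ball (0 : ℂ) r ×ˢ V,
      ‖tder w (fun p => k p.1 p.2) p‖ * (-ρ p.2) ^ Module.finrank ℝ (Cn n) ≤ C := by
  have : CompactSpace (closure V) := isCompact_iff_compactSpace.1 D.compact
  set d := Module.finrank ℝ (Cn n)
  have hemb := MeasurableEmbedding.subtype_coe (isClosed_closure (s := V)).measurableSet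
  set μ : Measure (closure V) := (vol V).comap (↑)
  have hμ : MeasurePreserving ((↑) : closure V → Cn n) μ (vol V) := ⟨hemb.measurable, by
    rw [hemb.map_comap, Subtype.range_coe, Measure.restrict_restrict isClosed_closure.measurableSet,
      inter_eq_right.2 subset_closure]⟩
  have : IsFiniteMeasure (vol V) := ⟨by simpa using D.bd.measure_lt_top⟩
  have : IsFiniteMeasure μ := ⟨by
    rw [← preimage_univ (f := ((↑) : closure V → Cn n)), hμ.measure_preimage
      MeasurableSet.univ.nullMeasurableSet]
    exact measure_lt_top _ _⟩
  set c : C(closure V, Cn n) := ⟨(↑), continuous_subtype_val⟩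
  have hN : ∀ h : Fn n, HolOn h V → (NV V (sw ρ 0) h < ⊤ ↔ MemLp h 2 (vol V)) :=
    fun h hh => by
      rw [memLp_two_iff (hh.continuousOn.aestronglyMeasurable D.meas)]
      simp [NV, sw]
  obtain ⟨O, hO, hO1, hO2⟩ := hφ
  have hO3 : SmoothOn (fun p => cexp (-(φ p : ℂ))) O := hO2.neg.cexp
  obtain ⟨B, hB⟩ := ((isCompact_closedBall (0 : ℂ) 1).prod D.compact).exists_bound_of_continuousOn
    (hO2.continuousOn.mono hO1)
  have hT : ∀ t ∈ Δ, ∀ x : closure V, (t, c x) ∈ O := fun t ht x =>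
    hO1 ⟨ball_subset_closedBall ht, x.2⟩
  have hu : ∀ t ∈ Δ, ∀ x, fam (fun p : ℂ × Cn n => cexp (-(φ p : ℂ))) c t x =
      (expR (-φ (t, x)) : ℝ) := fun t ht x => by
    rw [fam_apply hO3.continuousOn (hT t ht)]
    simp [c]
  obtain ⟨κ, hκ, hκk⟩ := exists_smooth_toLp (μ := μ) (T := Δ) (k := fun t x => k t x)
    (H := {f | ∃ h : Fn n, HolOn h V ∧ MemLp h 2 (vol V) ∧
      f = fun x : closure V => h x})
    (u := fam (fun p : ℂ × Cn n => cexp (-(φ p : ℂ))) c)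
    (c := (expR (-B) : ℝ)) (Λ := fun f => conj (f ⟨z, subset_closure hz⟩))
    (by rintro _ ⟨h, -, h1, rfl⟩; exact h1.comp_measurePreserving hμ)
    (fun t ht => ⟨k t, hk t ht, (hN _ (hk t ht)).1 (hkN t ht), rfl⟩)
    (contDiffOn_fam hO isOpen_ball hT hO3) (fun t ht => by
      refine (ContinuousMap.norm_lt_iff _ one_pos).2 fun x => ?_
      have h1 := hB (t, x) ⟨ball_subset_closedBall ht, x.2⟩
      rw [norm_real, norm_eq_abs, abs_le] at h1
      have h2 : expR (-B) * expR (-φ (t, x)) ≤ 1 := by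
        rw [← rexp_add, Real.exp_le_one_iff]; linarith
      have h3 : 0 < expR (-B) * expR (-φ (t, x)) := by positivity
      rw [ContinuousMap.sub_apply, ContinuousMap.smul_apply, hu t ht x, ContinuousMap.one_apply,
        smul_eq_mul, ← ofReal_mul, ← ofReal_one, ← ofReal_sub, norm_real, norm_eq_abs, abs_lt]
      constructor <;> linarith) (by
    rintro t ht _ ⟨h, h1, h2, rfl⟩
    change _ = conj (h z)
    rw [← hrep t ht h h1 ((hN h h1).2 h2), ← integral_conj, ← hμ.integral_comp hemb]
    refine integral_congr_ae (ae_of_all _ fun x => ?_)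
    simp only [hu t ht x, ww, sw, pow_zero, mul_one, map_mul, conj_conj, conj_ofReal]
    ring)
  set G : ℝ → Cn n → Lp ℂ 2 μ := fun r ζ => ContinuousMap.toLp 2 μ ℂ
    (fam (fun p : Cn n × Cn n => moC r (p.1 - p.2)) c ζ) with hGd
  have hg : ∀ r, ContDiff ℝ ∞ fun p : Cn n × Cn n => moC r (p.1 - p.2) := fun r =>
    (moC_smooth r).comp (contDiff_fst.sub contDiff_snd)
  have hF : ∀ r, ContDiff ℝ ∞ (fam (fun p : Cn n × Cn n => moC r (p.1 - p.2)) c) := fun r =>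
    contDiffOn_univ.1 (contDiffOn_fam isOpen_univ isOpen_univ (fun _ _ _ => mem_univ _)
      (hg r).contDiffOn)
  have hG : ∀ r, ContDiff ℝ ∞ (G r) := fun r =>
    ((ContinuousMap.toLp 2 μ ℂ).restrictScalars ℝ).contDiff.comp (hF r)
  have hGa : ∀ r ζ (x : closure V), fam (fun p : Cn n × Cn n => moC r (p.1 - p.2)) c ζ x =
      moC r (ζ - (x : Cn n)) :=
    fun r ζ x =>
    fam_apply (c := c) (p := ζ) (hg r).continuous.continuousOn (fun _ => mem_univ _) x
  have hkG : ∀ t ∈ Δ, ∀ ζ r, 0 < r → closedBall ζ r ⊆ V →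
      k t ζ = inner ℂ (G r ζ) (κ t) := fun t ht ζ r hr hζ => by
    have h1 := setIntegral_moC (w := fun _ => 1) D.isOpen hr hζ (fun _ _ => one_pos) (hk t ht) 1
    rw [map_one, one_mul] at h1
    rw [← h1, L2.inner_def, ← hμ.integral_comp hemb]
    refine integral_congr_ae ?_
    filter_upwards [hκk t ht, ContinuousMap.coeFn_toLp (p := 2) (𝕜 := ℂ) μ
      (fam (fun p : Cn n × Cn n => moC r (p.1 - p.2)) c ζ)] with x h2 h3
    rw [h2, hGd]
    simp only [h3, hGa, RCLike.inner_apply]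
    simp
  obtain ⟨η, hη, hr⟩ := D.exists_radius
  have hloc : ∀ ζ ∈ V, 0 < η / 2 * -ρ ζ ∧ ball ζ (η / 2 * -ρ ζ) ⊆ V ∧
      ∀ p ∈ Δ ×ˢ ball ζ (η / 2 * -ρ ζ),
        k p.1 p.2 = inner ℂ (G (η / 2 * -ρ ζ) p.2) (κ p.1) := fun ζ hζ => by
    have h0 := D.pos hζ
    have h1 : 0 < η / 2 * -ρ ζ := by positivity
    have h2 : ∀ y ∈ ball ζ (η / 2 * -ρ ζ), closedBall y (η / 2 * -ρ ζ) ⊆ V := fun y hy =>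
      ((closedBall_subset_closedBall' (by linarith [mem_ball.1 hy])).trans (hr ζ hζ)).trans
        fun _ h => h.1
    exact ⟨h1, fun y hy => h2 y hy (mem_closedBall_self h1.le), fun p hp =>
      hkG p.1 hp.1 p.2 _ h1 (h2 _ hp.2)⟩
  have hsm : ∀ r, SmoothOn (fun p : ℂ × Cn n => inner ℂ (G r p.2) (κ p.1))
      (ball 0 1 ×ˢ univ) := fun r => ((hG r).comp contDiff_snd).contDiffOn.inner ℂ
    (hκ.comp contDiffOn_fst fun p hp => hp.1)
  refine ⟨fun p hp => ?_, fun w r hr1 => ?_⟩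
  · obtain ⟨h1, h2, h3⟩ := hloc p.2 hp.2
    refine (((hsm (η / 2 * -ρ p.2)).contDiffAt ((isOpen_ball.prod isOpen_univ).mem_nhds ⟨hp.1, mem_univ _⟩))
      |>.congr_of_eventuallyEq ?_).contDiffWithinAt
    exact eventually_of_mem ((isOpen_ball.prod isOpen_ball).mem_nhds
      ⟨hp.1, mem_ball_self h1⟩) h3
  · obtain ⟨κ', h4, h5⟩ := exists_tder_inner (n := n) isOpen_ball hκ w
    obtain ⟨K, hK⟩ := (isCompact_closedBall (0 : ℂ) r).exists_bound_of_continuousOn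
      (h4.continuousOn.mono (closedBall_subset_ball hr1))
    set I := ∫ x, mo0 (n := n) 1 x
    have hI : 0 < I := mo0_integral_pos one_pos
    refine ⟨‖ContinuousMap.toLp (E := ℂ) 2 μ ℂ‖ * ((η / 2) ^ d * I)⁻¹ * K, fun p hp => ?_⟩
    obtain ⟨h1, h2, h3⟩ := hloc p.2 hp.2
    have h0 := D.pos hp.2
    rw [h5 _ _ _ isOpen_ball (hG _).contDiffOn h3 p ⟨ball_subset_ball hr1.le hp.1, mem_ball_self h1⟩]
    have h6 : ‖G (η / 2 * -ρ p.2) p.2‖ ≤ ‖ContinuousMap.toLp (E := ℂ) 2 μ ℂ‖ *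
        ((η / 2 * -ρ p.2) ^ d * I)⁻¹ := by
      refine (ContinuousLinearMap.le_opNorm _ _).trans (mul_le_mul_of_nonneg_left
        ((ContinuousMap.norm_le _ (by positivity)).2 fun x => ?_) (norm_nonneg _))
      rw [hGa, moC, norm_real, norm_of_nonneg (mo_nonneg _ _)]
      exact mo_le h1 _
    calc _ ≤ (‖ContinuousMap.toLp (E := ℂ) 2 μ ℂ‖ * ((η / 2 * -ρ p.2) ^ d * I)⁻¹ * K) *
        (-ρ p.2) ^ d := by
          gcongr
          exact (norm_inner_le_norm _ _).trans (by
            gcongr; exact hK _ (ball_subset_closedBall hp.1))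
      _ = _ := by rw [mul_pow]; field_simp

end

section

variable {k : ℂ → Fn n} {F : ℂ × Cn n → ℂ}

/-- The derivatives of a holomorphic family, in the variables and the parameter. -/
def gf (k : ℂ → Fn n) (w : List ℂ) (l : List (Fin n)) : ℂ × Cn n → ℂ :=
  tder w fun p => dzs l (k p.1) p.2

theorem gf_smooth (hV : IsOpen V) (hk : ∀ t ∈ Δ, HolOn (k t) V)
    (hs : SmoothOn (fun p : ℂ × Cn n => k p.1 p.2) (Δ ×ˢ V)) (w : List ℂ)
    (l : List (Fin n)) : SmoothOn (gf k w l) (Δ ×ˢ V) ∧ ∀ p ∈ Δ ×ˢ V,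
      ∀ v : Cn n, fderiv ℝ (gf k w l) p (0, v) = ∑ j, v j * gf k w (j :: l) p := by
  have hU : IsOpen (Δ ×ˢ V) := isOpen_ball.prod hV
  have hd : ∀ {F : ℂ × Cn n → ℂ}, SmoothOn F (Δ ×ˢ V) →
      SmoothOn (fderiv ℝ F) (Δ ×ˢ V) := fun h => h.fderiv_of_isOpen hU le_rfl
  have hda : ∀ {E : Type} [NormedAddCommGroup E] [NormedSpace ℝ E] {F : ℂ × Cn n → E},
      SmoothOn F (Δ ×ˢ V) → ∀ p ∈ Δ ×ˢ V, DifferentiableAt ℝ F p :=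
    fun h p hp => (h.contDiffAt (hU.mem_nhds hp)).differentiableAt (by simp)
  induction w generalizing l with
  | nil =>
    have h1 : ∀ l, SmoothOn (gf k [] l) (Δ ×ˢ V) → ∀ p ∈ Δ ×ˢ V,
        ∀ v : Cn n, fderiv ℝ (gf k [] l) p (0, v) = ∑ j, v j * gf k [] (j :: l) p := by
      intro l h p hp v
      have h2 := (hol_dzs hV (hk p.1 hp.1) l).differentiableAt (hV.mem_nhds hp.2)
      have h3 := (HasFDerivAt.comp (g := gf k [] l) (f := fun x => (p.1, x)) p.2
        (hda h p hp).hasFDerivAt (hasFDerivAt_prodMk_right (𝕜 := ℝ) p.1 p.2)).unique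
        (h2.hasFDerivAt.restrictScalars ℝ)
      refine (DFunLike.congr_fun h3 v).trans ((clm_sum_eb _ v).trans (sum_congr rfl
        fun j _ => congrArg (v j * ·) (dz_eq_fderiv h2).symm))
    refine ⟨?_, h1 l ?_⟩ <;>
    · induction l with
      | nil => exact hs
      | cons j l ih =>
        refine ((hd ih).clm_apply (contDiffOn_const (c := (0, eb j)))).congr fun p hp => ?_
        rw [h1 l ih p hp, Finset.sum_eq_single j] <;> simp +contextual [eb]
  | cons τ w ih =>
    have h1 : ∀ l v, ∀ p ∈ Δ ×ˢ V, ∀ u, fderiv ℝ (fun p => fderiv ℝ (gf k w l) p v) p u =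
        fderiv ℝ (fderiv ℝ (gf k w l)) p u v := fun l v p hp u => by
      rw [fderiv_clm_apply (hda (hd (ih l).1) p hp) (differentiableAt_const v)]
      simp
    refine ⟨(hd (ih l).1).clm_apply contDiffOn_const, fun p hp v => ?_⟩
    refine (h1 l _ p hp _).trans ?_
    rw [(((ih l).1.contDiffAt (hU.mem_nhds hp)).isSymmSndFDerivAt (by
      simpa using WithTop.coe_le_coe.2 (le_top : (2 : ℕ∞) ≤ ⊤))).eq, ← h1 l _ p hp,
      Filter.EventuallyEq.fderiv_eq (eventually_of_mem (hU.mem_nhds hp) fun p hp =>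
      (ih l).2 p hp v), fderiv_fun_sum fun j _ => (hda (ih _).1 p hp).const_mul _]
    simp only [_root_.sum_apply]
    refine sum_congr rfl fun j _ => ?_
    rw [fderiv_const_mul (hda (ih _).1 p hp)]
    rfl

/-- The fourth root of minus the defining function. -/
def qr (ρ : Cn n → ℝ) (x : Cn n) : ℝ := √√(-ρ x)

/-- Polynomial growth at the boundary, locally uniformly in the parameter. -/
def Bq (V : Set (Cn n)) (ρ : Cn n → ℝ) (F : ℂ × Cn n → ℂ) (m : ℕ) : Prop :=
  ∀ r < 1, ∃ C, ∀ p ∈ ball (0 : ℂ) r ×ˢ V, ‖F p‖ * qr ρ p.2 ^ m ≤ C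

theorem qr_nonneg (x : Cn n) : 0 ≤ qr ρ x := Real.sqrt_nonneg _

namespace Dom

include D

theorem qr_pow (hx : x ∈ V) : qr ρ x ^ 4 = -ρ x := by
  rw [qr, show 4 = 2 * 2 from rfl, pow_mul, sq_sqrt (Real.sqrt_nonneg _),
    sq_sqrt (D.pos hx).le]

theorem qr_pos (hx : x ∈ V) : 0 < qr ρ x :=
  Real.sqrt_pos.2 (Real.sqrt_pos.2 (D.pos hx))

theorem qr_le : ∃ Q ≥ 1, ∀ x ∈ V, qr ρ x ≤ Q := by
  obtain ⟨S, -, hs⟩ := D.exists_bound_rho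
  exact ⟨max 1 √√S, le_max_left _ _, fun x hx =>
    (Real.sqrt_le_sqrt (Real.sqrt_le_sqrt (hs x hx))).trans (le_max_right _ _)⟩

theorem bq_mono (h : Bq V ρ F m) (hm : m ≤ M) : Bq V ρ F M := fun r hr => by
  obtain ⟨C, hC⟩ := h r hr
  obtain ⟨Q, hQ1, hQ⟩ := D.qr_le
  refine ⟨C * Q ^ (M - m), fun p hp => ?_⟩
  have h0 := qr_nonneg (ρ := ρ) p.2
  rw [← Nat.add_sub_cancel' hm, pow_add, ← mul_assoc, Nat.add_sub_cancel_left]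
  gcongr
  · exact (by positivity : 0 ≤ ‖F p‖ * qr ρ p.2 ^ m).trans (hC p hp)
  · exact hC p hp
  · exact hQ _ hp.2

theorem inward {x₀ : Cn n} (h : x₀ ∈ closure V) :
    ∃ ν : Cn n, ∃ δ > 0, ∀ x ∈ V ∩ ball x₀ δ, ∀ τ ∈ Icc 0 δ,
      x + τ • ν ∈ V ∧ (-ρ x + τ) / 2 ≤ -ρ (x + τ • ν) := by
  by_cases hx : x₀ ∈ V
  · have h0 := D.pos hx
    have h1 : ∀ᶠ x in 𝓝 x₀, -ρ x₀ / 2 < -ρ x :=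
      (D.contDiffAt hx).continuousAt.neg.eventually_const_lt (by
        change _ < -ρ x₀; linarith)
    obtain ⟨R, hR, h2⟩ := Metric.eventually_nhds_iff_ball.1 h1
    refine ⟨0, min R (-ρ x₀ / 2), by positivity, fun x hx τ hτ => ?_⟩
    have h3 := h2 x (ball_subset_ball (min_le_left _ _) hx.2)
    have h4 := hτ.2.trans (min_le_right _ _)
    simp only [smul_zero, add_zero]
    exact ⟨hx.1, by linarith⟩
  · obtain ⟨v, hv⟩ := DFunLike.ne_iff.1 (D.grad x₀ (by rw [D.isOpen.frontier_eq]; exact ⟨h, hx⟩))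
    set ν := (-2 / fderiv ℝ ρ x₀ v) • v
    have h1 : ContinuousAt (fun x => fderiv ℝ ρ x ν) x₀ :=
      ((D.hρ.continuousOn_fderiv_of_isOpen D.hW (by simp)).clm_apply continuousOn_const).continuousAt
        (D.hW.mem_nhds (D.hVW h))
    have h2 : fderiv ℝ ρ x₀ ν < -1 := by
      rw [map_smul, smul_eq_mul, div_mul_cancel₀ _ hv]; norm_num
    obtain ⟨R, hR, hb⟩ := Metric.eventually_nhds_iff_ball.1
      ((h1.eventually_lt_const h2).and (D.hW.mem_nhds (D.hVW h)))
    refine ⟨ν, R / (1 + ‖ν‖), by positivity, fun x hx τ hτ => ?_⟩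
    have h3 : ∀ σ ∈ Icc 0 τ, x + σ • ν ∈ ball x₀ R := fun σ hσ => by
      have h4 := mem_ball.1 hx.2
      have h6 : dist (x + σ • ν) x = σ * ‖ν‖ := by
        rw [dist_eq_norm, add_sub_cancel_left, norm_smul, norm_of_nonneg hσ.1]
      have h7 := mul_le_mul_of_nonneg_right (hσ.2.trans hτ.2) (norm_nonneg ν)
      have h8 : R / (1 + ‖ν‖) + R / (1 + ‖ν‖) * ‖ν‖ = R := by field_simp
      rw [mem_ball]
      linarith [dist_triangle (x + σ • ν) x x₀]
    have h4 : ∀ σ ∈ Icc 0 τ, HasDerivAt (fun σ : ℝ => ρ (x + σ • ν)) (fderiv ℝ ρ (x + σ • ν) ν) σ :=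
      fun σ hσ => by
        have h5 := ((D.hρ.contDiffAt (D.hW.mem_nhds (hb _ (h3 σ hσ)).2)).differentiableAt
          (by simp)).hasFDerivAt.comp_hasDerivAt σ (((hasDerivAt_id σ).smul_const ν).const_add x)
        rw [one_smul] at h5
        exact h5
    have h5 := (convex_Icc 0 τ).image_sub_le_mul_sub_of_deriv_le
      (fun σ hσ => (h4 σ hσ).continuousAt.continuousWithinAt)
      (fun σ hσ => (h4 σ (interior_subset hσ)).differentiableAt.differentiableWithinAt) (C := -1)
      (fun σ hσ => by
        rw [(h4 σ (interior_subset hσ)).deriv]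
        exact (hb _ (h3 σ (interior_subset hσ))).1.le)
      0 (left_mem_Icc.2 hτ.1) τ (right_mem_Icc.2 hτ.1) hτ.1
    have h6 := D.neg hx.1
    have h7 := hτ.1
    simp only [zero_smul, add_zero] at h5
    exact ⟨by rw [D.hV]; change ρ _ < 0; linarith, by linarith⟩

end Dom

end

section

variable {k : ℂ → Fn n} {F : ℂ × Cn n → ℂ}

namespace Dom

include D

/-- Integrating a derivative bound inwards improves the growth at the boundary. -/
theorem bq_gain (hF : DifferentiableOn ℝ F (Δ ×ˢ V))
    (hd : ∀ v : Cn n, Bq V ρ (fun p => fderiv ℝ F p (0, v)) (m + 3)) (hM : Bq V ρ F M) :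
    Bq V ρ F m := fun r hr => by
  have hU : IsOpen (Δ ×ˢ V) := isOpen_ball.prod D.isOpen
  have h1 := D.compact.induction_on
    (p := fun s => ∃ C, ∀ p ∈ ball (0 : ℂ) r ×ˢ (s ∩ V), ‖F p‖ * qr ρ p.2 ^ m ≤ C)
    ⟨0, by simp⟩ (fun s t h ⟨C, hC⟩ => ⟨C, fun p hp => hC p ⟨hp.1, h hp.2.1, hp.2.2⟩⟩)
    (fun s t ⟨C, hC⟩ ⟨C', hC'⟩ => ⟨max C C', fun p hp => hp.2.1.elim
      (fun h => le_max_of_le_left (hC p ⟨hp.1, h, hp.2.2⟩))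
      (fun h => le_max_of_le_right (hC' p ⟨hp.1, h, hp.2.2⟩))⟩)
    (fun x₀ hx₀ => by
      obtain ⟨ν, δ, hδ, hν⟩ := D.inward hx₀
      obtain ⟨C, hC⟩ := hd ν r hr
      obtain ⟨C', hC'⟩ := hM r hr
      obtain ⟨Q, -, hQ⟩ := D.qr_le
      set T := √√δ
      have hT : T ^ 4 = δ := by
        rw [show 4 = 2 * 2 from rfl, pow_mul, sq_sqrt (Real.sqrt_nonneg _),
          sq_sqrt hδ.le]
      have hT0 : 0 < T := Real.sqrt_pos.2 (Real.sqrt_pos.2 hδ)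
      refine ⟨_, mem_nhdsWithin_of_mem_nhds (ball_mem_nhds x₀ hδ),
        C' / (T / 2) ^ M * Q ^ m + 2 ^ (m + 5) * C * T, fun p hp => ?_⟩
      obtain ⟨t, x⟩ := p
      obtain ⟨ht, hxB, hx⟩ := hp
      have ht1 : t ∈ Δ := ball_subset_ball hr.le ht
      have h4 : ∀ σ ∈ Icc 0 T, x + σ ^ 4 • ν ∈ V ∧ qr ρ x ≤ 2 * qr ρ (x + σ ^ 4 • ν) ∧
          σ ≤ 2 * qr ρ (x + σ ^ 4 • ν) := fun σ hσ => by
        have h5 := hν x ⟨hx, hxB⟩ (σ ^ 4) ⟨by have := hσ.1; positivity, hT ▸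
          pow_le_pow_left₀ hσ.1 hσ.2 4⟩
        have h6 := qr_nonneg (ρ := ρ) (x + σ ^ 4 • ν)
        have h7 := pow_nonneg hσ.1 4
        have h8 := D.neg hx
        refine ⟨h5.1, ?_, ?_⟩ <;>
        · refine le_of_pow_le_pow_left₀ four_ne_zero (by positivity) ?_
          rw [mul_pow, D.qr_pow h5.1]
          try rw [D.qr_pow hx]
          linarith [h5.2]
      have h5 : ∀ σ ∈ Icc 0 T, HasDerivAt (fun σ : ℝ => F (t, x + σ ^ 4 • ν))
          ((4 * σ ^ 3) • fderiv ℝ F (t, x + σ ^ 4 • ν) (0, ν)) σ := fun σ hσ => by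
        have h6 := (hF.differentiableAt (hU.mem_nhds ⟨ht1, (h4 σ hσ).1⟩)).hasFDerivAt.comp_hasDerivAt
          σ ((hasDerivAt_const σ t).prodMk (((hasDerivAt_pow 4 σ).smul_const ν).const_add x))
        refine h6.congr_deriv ?_
        rw [← map_smul]; simp
      have h6 : ∀ σ ∈ Icc 0 T, ‖(4 * σ ^ 3) • fderiv ℝ F (t, x + σ ^ 4 • ν) (0, ν)‖ * qr ρ x ^ m ≤
          2 ^ (m + 5) * C := fun σ hσ => by
        obtain ⟨h7, h8, h9⟩ := h4 σ hσ
        have h10 := hC (t, x + σ ^ 4 • ν) ⟨ht, h7⟩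
        have h13 := qr_nonneg (ρ := ρ) (x + σ ^ 4 • ν)
        have h11 := hσ.1
        have h12 := qr_nonneg (ρ := ρ) x
        rw [norm_smul, norm_of_nonneg (by positivity)]
        calc _ ≤ 4 * (2 * qr ρ (x + σ ^ 4 • ν)) ^ 3 * ‖fderiv ℝ F (t, x + σ ^ 4 • ν) (0, ν)‖ *
              (2 * qr ρ (x + σ ^ 4 • ν)) ^ m := by gcongr
          _ = 2 ^ (m + 5) * (‖fderiv ℝ F (t, x + σ ^ 4 • ν) (0, ν)‖ *
              qr ρ (x + σ ^ 4 • ν) ^ (m + 3)) := by ring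
          _ ≤ _ := by gcongr
      have hq := D.qr_pos hx
      have h7 := (convex_Icc 0 T).norm_image_sub_le_of_norm_hasDerivWithin_le
        (C := 2 ^ (m + 5) * C / qr ρ x ^ m)
        (fun σ hσ => (h5 σ hσ).hasDerivWithinAt) (fun σ hσ => by
          rw [le_div_iff₀ (by positivity)]; exact h6 σ hσ)
        (right_mem_Icc.2 hT0.le) (left_mem_Icc.2 hT0.le)
      rw [zero_sub, norm_neg, norm_of_nonneg hT0.le] at h7
      obtain ⟨h8, -, h9⟩ := h4 T (right_mem_Icc.2 hT0.le)
      have h10 : ‖F (t, x + T ^ 4 • ν)‖ ≤ C' / (T / 2) ^ M := by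
        rw [le_div_iff₀ (by positivity)]
        refine le_trans ?_ (hC' (t, x + T ^ 4 • ν) ⟨ht, h8⟩)
        gcongr
        linarith
      simp only [ne_eq, four_ne_zero, not_false_eq_true, zero_pow, zero_smul, add_zero] at h7
      have h11 : ‖F (t, x)‖ ≤ C' / (T / 2) ^ M + 2 ^ (m + 5) * C / qr ρ x ^ m * T := by
        have := norm_sub_norm_le (F (t, x)) (F (t, x + T ^ 4 • ν))
        linarith
      calc _ ≤ (C' / (T / 2) ^ M + 2 ^ (m + 5) * C / qr ρ x ^ m * T) * qr ρ x ^ m := by gcongr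
        _ = C' / (T / 2) ^ M * qr ρ x ^ m + 2 ^ (m + 5) * C * T := by field_simp
        _ ≤ _ := by
          have : 0 ≤ C' / (T / 2) ^ M := (norm_nonneg _).trans h10
          gcongr
          exact hQ x hx)
  obtain ⟨C, hC⟩ := h1
  exact ⟨C, fun p hp => hC p ⟨hp.1, subset_closure hp.2, hp.2⟩⟩

/-- Interpolation between a bounded function and its second derivative in the parameter. -/
theorem bq_landau (hF : SmoothOn F (Δ ×ˢ V)) (v : ℂ)
    (h0 : Bq V ρ F 0)
    (h2 : Bq V ρ (fun p => fderiv ℝ (fun p => fderiv ℝ F p (v, 0)) p (v, 0)) (2 * m)) :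
    Bq V ρ (fun p => fderiv ℝ F p (v, 0)) m := fun r hr => by
  have hU : IsOpen (Δ ×ˢ V) := isOpen_ball.prod D.isOpen
  have hF' : SmoothOn (fun p => fderiv ℝ F p (v, 0)) (Δ ×ˢ V) :=
    (hF.fderiv_of_isOpen hU le_rfl).clm_apply contDiffOn_const
  have hr' : (1 + r) / 2 ≤ 1 := by linarith
  obtain ⟨A, hA⟩ := h0 ((1 + r) / 2) (by linarith)
  obtain ⟨B, hB⟩ := h2 ((1 + r) / 2) (by linarith)
  obtain ⟨Q, hQ1, hQ⟩ := D.qr_le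
  set c := (1 - r) / 2 / ((‖v‖ + 1) * Q ^ m)
  have hc : 0 < c := div_pos (by linarith) (by positivity)
  refine ⟨(2 * A + c ^ 2 * B) / c, fun p hp => ?_⟩
  obtain ⟨t, x⟩ := p
  obtain ⟨ht, hx⟩ := hp
  have hq := D.qr_pos hx
  set h := c * qr ρ x ^ m
  have hh : 0 < h := by positivity
  have hm : ∀ σ ∈ Icc 0 h, t + σ • v ∈ ball (0 : ℂ) ((1 + r) / 2) := fun σ hσ => by
    rw [mem_ball_zero_iff] at ht ⊢
    have h5 : σ * ‖v‖ ≤ (1 - r) / 2 := calc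
      σ * ‖v‖ ≤ c * Q ^ m * (‖v‖ + 1) := by
        have := hσ.1
        gcongr
        · exact hσ.2.trans (mul_le_mul_of_nonneg_left
          (pow_le_pow_left₀ hq.le (hQ x hx) m) hc.le)
        · linarith
      _ = (1 - r) / 2 := by simp only [c]; field_simp
    have h6 := norm_add_le t (σ • v)
    rw [norm_smul, norm_of_nonneg hσ.1] at h6
    linarith
  have h4 : ∀ {G : ℂ × Cn n → ℂ}, SmoothOn G (Δ ×ˢ V) → ∀ σ ∈ Icc 0 h,
      HasDerivAt (fun σ : ℝ => G (t + σ • v, x)) (fderiv ℝ G (t + σ • v, x) (v, 0)) σ :=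
    fun {G} hG σ hσ => by
      have h5 : DifferentiableAt ℝ G (t + σ • v, x) := ((hG.differentiableOn (by simp)).differentiableAt (hU.mem_nhds
        ⟨ball_subset_ball hr' (hm σ hσ), hx⟩))
      have h6 := h5.hasFDerivAt.comp_hasDerivAt σ ((((hasDerivAt_id σ).smul_const v).const_add t).prodMk (hasDerivAt_const σ x))
      exact h6.congr_deriv (by rw [one_smul])
  have h5 : ∀ σ ∈ Icc 0 h, ‖fderiv ℝ F (t + σ • v, x) (v, 0) - fderiv ℝ F (t, x) (v, 0)‖ ≤
      B / qr ρ x ^ (2 * m) * h := fun σ hσ => by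
    have hB0 : ∀ σ ∈ Icc 0 h,
        ‖fderiv ℝ (fun p => fderiv ℝ F p (v, 0)) (t + σ • v, x) (v, 0)‖ ≤ B / qr ρ x ^ (2 * m) := fun σ hσ => by
      have := hB (t + σ • v, x) ⟨hm σ hσ, hx⟩
      rwa [← le_div_iff₀ (by positivity)] at this
    have h6 := (convex_Icc 0 h).norm_image_sub_le_of_norm_hasDerivWithin_le
      (fun σ hσ => (h4 hF' σ hσ).hasDerivWithinAt) hB0 (left_mem_Icc.2 hh.le) hσ
    simp only [zero_smul, add_zero, sub_zero, norm_of_nonneg hσ.1] at h6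
    exact h6.trans (mul_le_mul_of_nonneg_left hσ.2
      ((norm_nonneg _).trans (hB0 0 (left_mem_Icc.2 hh.le))))
  have h6 := (convex_Icc 0 h).norm_image_sub_le_of_norm_hasDerivWithin_le
    (fun σ hσ => ((h4 hF σ hσ).sub ((hasDerivAt_id σ).smul_const
      (fderiv ℝ F (t, x) (v, 0)))).hasDerivWithinAt) (fun σ hσ => by
        rw [one_smul]; exact h5 σ hσ) (left_mem_Icc.2 hh.le) (right_mem_Icc.2 hh.le)
  have hA1 := hA (t + h • v, x) ⟨hm h (right_mem_Icc.2 hh.le), hx⟩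
  have hA2 := hA (t, x) ⟨by simpa using hm 0 (left_mem_Icc.2 hh.le), hx⟩
  simp only [Pi.sub_apply, id, zero_smul, add_zero, sub_zero, norm_of_nonneg hh.le,
    pow_zero, mul_one] at h6 hA1 hA2
  have h7 : ‖fderiv ℝ F (t, x) (v, 0)‖ * h ≤ 2 * A + c ^ 2 * B := calc
    _ = ‖h • fderiv ℝ F (t, x) (v, 0)‖ := by
      rw [norm_smul, norm_of_nonneg hh.le, mul_comm]
    _ = ‖F (t + h • v, x) - F (t, x) -
        (F (t + h • v, x) - h • fderiv ℝ F (t, x) (v, 0) - F (t, x))‖ := by congr 1; ring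
    _ ≤ A + A + B / qr ρ x ^ (2 * m) * h * h := (norm_sub_le _ _).trans
      (add_le_add ((norm_sub_le _ _).trans (add_le_add hA1 hA2)) h6)
    _ = _ := by simp only [h]; field_simp; ring
  rw [le_div_iff₀ hc]
  refine le_trans (le_of_eq ?_) h7
  simp only [h]; ring

/-- The Cauchy estimate on balls of radius comparable to the defining function. -/
theorem bq_cauchy (hk : ∀ t ∈ Δ, HolOn (k t) V)
    (hs : SmoothOn (fun p : ℂ × Cn n => k p.1 p.2) (Δ ×ˢ V)) {w : List ℂ}
    {l : List (Fin n)} (h : Bq V ρ (gf k w l) m) (j : Fin n) :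
    Bq V ρ (gf k w (j :: l)) (m + 4) := fun r hr => by
  have hU : IsOpen (Δ ×ˢ V) := isOpen_ball.prod D.isOpen
  obtain ⟨C, hC⟩ := h r hr
  obtain ⟨η, hη, hr⟩ := D.exists_radius
  refine ⟨2 ^ m * C / η, fun p hp => ?_⟩
  obtain ⟨t, x⟩ := p
  obtain ⟨ht, hx⟩ := hp
  have ht1 : t ∈ Δ := ball_subset_ball (by assumption : r < 1).le ht
  have hq := D.qr_pos hx
  have hR : 0 < η * -ρ x := mul_pos hη (D.pos hx)
  obtain ⟨h1, h2⟩ := gf_smooth D.isOpen hk hs w l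
  have hin : ∀ a ∈ closedBall (0 : ℂ) (η * -ρ x), x + a • eb j ∈ V ∧
      qr ρ x ≤ 2 * qr ρ (x + a • eb j) := fun a ha => by
    have h3 := hr x hx (show x + a • eb j ∈ _ by
      rw [mem_closedBall_zero_iff] at ha
      rw [mem_closedBall, dist_eq_norm, add_sub_cancel_left, norm_smul]
      simpa [eb] using ha)
    refine ⟨h3.1, le_of_pow_le_pow_left₀ four_ne_zero
      (mul_nonneg zero_le_two (qr_nonneg _)) ?_⟩
    rw [mul_pow, D.qr_pow h3.1, D.qr_pow hx]
    linarith [h3.2, D.neg hx, D.neg h3.1]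
  have hd : ∀ a ∈ closedBall (0 : ℂ) (η * -ρ x), HasDerivAt (fun a => gf k w l (t, x + a • eb j))
      (gf k w (j :: l) (t, x + a • eb j)) a := fun a ha => by
    have hp : (t, x + a • eb j) ∈ Δ ×ˢ V := ⟨ht1, (hin a ha).1⟩
    have h3 := HasFDerivAt.comp (g := gf k w l) (f := fun a : ℂ => (t, x + a • eb j)) a
      ((h1.contDiffAt (hU.mem_nhds hp)).differentiableAt (by simp)).hasFDerivAt
      (((hasFDerivAt_const (𝕜 := ℝ) t a).prodMk
        (((ContinuousLinearMap.id ℝ ℂ).smulRight (eb j)).hasFDerivAt.const_add x)))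
    refine hasFDerivAt_of_restrictScalars ℝ h3 (ContinuousLinearMap.ext fun μ => ?_)
    change μ • gf k w (j :: l) _ = fderiv ℝ (gf k w l) _ (0, μ • eb j)
    rw [h2 _ hp, Finset.sum_eq_single j] <;> simp +contextual [eb]
  have h3 := norm_deriv_le_of_forall_mem_sphere_norm_le (C := 2 ^ m * C / qr ρ x ^ m) hR
    (DifferentiableOn.diffContOnCl (fun a ha => (hd a (closure_ball_subset_closedBall ha)).differentiableAt.differentiableWithinAt))
    fun a ha => by
      obtain ⟨h4, h5⟩ := hin a (sphere_subset_closedBall ha)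
      rw [le_div_iff₀ (by positivity)]
      calc _ ≤ ‖gf k w l (t, x + a • eb j)‖ * (2 * qr ρ (x + a • eb j)) ^ m := by gcongr
        _ = 2 ^ m * (‖gf k w l (t, x + a • eb j)‖ * qr ρ (x + a • eb j) ^ m) := by ring
        _ ≤ _ := by gcongr; exact hC (t, _) ⟨ht, h4⟩
  rw [(hd 0 (mem_closedBall_self hR.le)).deriv, zero_smul, add_zero, le_div_iff₀ hR,
    le_div_iff₀ (by positivity)] at h3
  rw [le_div_iff₀ hη]
  refine le_trans (le_of_eq ?_) h3
  rw [pow_add, D.qr_pow hx]; ring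

/-- Growth of the derivatives of half the expected order implies boundedness. -/
theorem bq_zero_of_growth 
    (hk : ∀ t ∈ Δ, HolOn (k t) V)
    (hs : SmoothOn (fun p : ℂ × Cn n => k p.1 p.2) (Δ ×ˢ V)) {w : List ℂ} {N : ℕ}
    (h : ∀ l, Bq V ρ (gf k w l) (N + 2 * l.length)) (l : List (Fin n)) :
    Bq V ρ (gf k w l) 0 := by
  have h1 : ∀ m l, Bq V ρ (gf k w l) (N + 2 * l.length - m) := fun m => by
    induction m with
    | zero => exact h
    | succ m ih =>
      intro l
      obtain ⟨h2, h3⟩ := gf_smooth D.isOpen hk hs w l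
      refine D.bq_gain (h2.differentiableOn (by simp)) (fun v r hr => ?_) (h l)
      choose C hC using fun j => D.bq_mono (ih (j :: l))
        (by rw [List.length_cons]; omega : _ ≤ N + 2 * l.length - (m + 1) + 3) r hr
      refine ⟨∑ j, ‖v j‖ * C j, fun p hp => ?_⟩
      beta_reduce
      rw [h3 p ⟨ball_subset_ball hr.le hp.1, hp.2⟩ v]
      refine (mul_le_mul_of_nonneg_right (norm_sum_le _ _)
        (pow_nonneg (qr_nonneg _) _)).trans ?_
      rw [sum_mul]
      refine sum_le_sum fun j _ => ?_
      rw [norm_mul, mul_assoc]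
      exact mul_le_mul_of_nonneg_left (hC j p hp) (norm_nonneg _)
  simpa using h1 (N + 2 * l.length) l

/-- All derivatives of the Bergman kernel, in the variables and the parameter, are bounded. -/
theorem gf_bounded (hz : z ∈ V) {φ : ℂ × Cn n → ℝ}
    (hk : ∀ t ∈ Δ, HolOn (k t) V)
    (hφ : Cf V fun t x => (φ (t, x) : ℂ))
    (hkN : ∀ t ∈ Δ, NV V (sw ρ 0) (k t) < ⊤)
    (hrep : ∀ t ∈ Δ, ∀ h : Fn n, HolOn h V →
      NV V (sw ρ 0) h < ⊤ → ∫ x in V, h x * conj (k t x) * ww ρ (fun x => φ (t, x)) 0 x = h z)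
    (w : List ℂ) (l : List (Fin n)) : Bq V ρ (gf k w l) 0 := by
  obtain ⟨hs, hg⟩ := D.kernel_smooth hz hk hφ hkN hrep
  set d := Module.finrank ℝ (Cn n)
  induction w generalizing l with
  | nil =>
    refine D.bq_zero_of_growth hk hs (N := 2 * d) (fun l r hr => ?_) l
    obtain ⟨C, hC, hC'⟩ := D.kernel_bound hz hk hφ hkN hrep l
    obtain ⟨A, hA, hA'⟩ := D.pointwise l.length
    refine ⟨√(A * C.toReal), fun p hp => Real.le_sqrt_of_sq_le ?_⟩
    have ht : p.1 ∈ Δ := ball_subset_ball hr.le hp.1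
    have hq := D.qr_pos hp.2
    have hn : 0 ≤ A / (-ρ p.2) ^ (d + l.length) := by rw [← D.qr_pow hp.2]; positivity
    have h1 := (hA' _ (hol_dzs D.isOpen (hk p.1 ht) l) p.2 hp.2).trans
      (mul_le_mul_right (hC' p.1 ht) _)
    rw [← ENNReal.ofReal_toReal hC.ne, ← eofReal_mul hn,
      enorm_sq_eq,
      ENNReal.ofReal_le_ofReal_iff (mul_nonneg hn ENNReal.toReal_nonneg), ← D.qr_pow hp.2, div_mul_eq_mul_div,
      le_div_iff₀ (by positivity)] at h1
    refine le_trans (le_of_eq ?_) h1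
    rw [mul_pow, ← pow_mul, ← pow_mul]
    change ‖dzs l (k p.1) p.2‖ ^ 2 * _ = _
    congr 2; ring
  | cons τ w ih =>
    refine D.bq_zero_of_growth hk hs (N := 2 * d) (fun l => ?_) l
    refine D.bq_landau (gf_smooth D.isOpen hk hs w l).1 τ (ih l) ?_
    have h1 : ∀ l : List (Fin n), Bq V ρ (gf k (τ :: τ :: w) l) (4 * d + 4 * l.length) :=
      fun l => by
        induction l with
        | nil =>
          intro r hr
          obtain ⟨C, hC⟩ := hg (τ :: τ :: w) r hr
          refine ⟨C, fun p hp => ?_⟩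
          rw [List.length_nil, mul_zero, add_zero, pow_mul, D.qr_pow hp.2]
          exact hC p hp
        | cons j l ih => exact D.bq_cauchy hk hs ih j
    exact (by ring : 4 * d + 4 * l.length = 2 * (2 * d + 2 * l.length)) ▸ h1 l

end Dom

end

section

variable {k : ℂ → Fn n}

namespace Dom

include D

/-- A mean value inequality near a boundary point, along a path through the domain. -/
theorem norm_image_sub_le {p : ℂ × Cn n} (hp : p ∈ Δ ×ˢ closure V) :
    ∃ C > 0, ∀ R > 0, ∃ r > 0, ∀ x ∈ Δ ×ˢ V ∩ ball p r,
      ∀ y ∈ Δ ×ˢ V ∩ ball p r, ∀ (g : ℂ × Cn n → ℂ) (L : ℂ × Cn n →L[ℝ] ℂ) (ε : ℝ),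
      DifferentiableOn ℝ g (Δ ×ˢ V) →
      (∀ q ∈ Δ ×ˢ V ∩ ball p R, ‖fderiv ℝ g q - L‖ ≤ ε) →
      ‖g y - g x - L (y - x)‖ ≤ C * ε * ‖y - x‖ := by
  obtain ⟨ν, δ, hδ, hν⟩ := D.inward hp.2
  obtain ⟨A, hA, δ', hδ', hL⟩ := D.exists_lip
  refine ⟨4 * A * ‖ν‖ + 1, by positivity, fun R hR => ?_⟩
  obtain ⟨r, hr, hr'⟩ := exists_between (lt_min (lt_min hδ (half_pos hδ'))
    (lt_min (div_pos hδ (by positivity : 0 < 4 * A))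
      (div_pos hR (by positivity : 0 < 1 + 4 * A * ‖ν‖))))
  simp only [lt_min_iff, lt_div_iff₀ (by positivity : 0 < 4 * A),
    lt_div_iff₀ (by positivity : 0 < 1 + 4 * A * ‖ν‖)] at hr'
  obtain ⟨⟨hr1, hr2⟩, hr3, hr4⟩ := hr'
  refine ⟨r, hr, fun x hx y hy g L ε hg hgL => ?_⟩
  have hU : IsOpen (Δ ×ˢ V) := isOpen_ball.prod D.isOpen
  have hseg : ∀ a b, segment ℝ a b ⊆ Δ ×ˢ V ∩ ball p R →
      ‖g b - g a - L (b - a)‖ ≤ ε * ‖b - a‖ := fun a b h =>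
    (convex_segment a b).norm_image_sub_le_of_norm_hasFDerivWithin_le'
      (fun q hq => (hg.differentiableAt (hU.mem_nhds (h hq).1)).hasFDerivAt.hasFDerivWithinAt)
      (fun q hq => hgL q (h hq)) (left_mem_segment ℝ a b) (right_mem_segment ℝ a b)
  have hyx : ‖y - x‖ < 2 * r := by
    have h1 := dist_triangle_right y x p
    have h2 := mem_ball.1 hx.2
    have h3 := mem_ball.1 hy.2
    rw [← dist_eq_norm]
    linarith
  set h := 2 * A * ‖y - x‖
  have hh : 0 ≤ h := by positivity
  have hhr : h ≤ 4 * A * r := by simp only [h]; nlinarith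
  have hin : ∀ x ∈ Δ ×ˢ V ∩ ball p r, ∀ τ ∈ Icc 0 h,
      x + τ • ((0 : ℂ), ν) ∈ Δ ×ˢ V ∩ ball p R ∧
      τ / 2 < -ρ (x + τ • ((0 : ℂ), ν)).2 := fun x hx τ hτ => by
    have h1 := hν x.2 ⟨hx.1.2, ball_subset_ball hr1.le
      (mem_ball.2 ((le_max_right _ _).trans_lt (mem_ball.1 hx.2)))⟩ τ
      ⟨hτ.1, by linarith [hτ.2]⟩
    refine ⟨⟨⟨by simpa using hx.1.1, h1.1⟩, ?_⟩, ?_⟩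
    · have h2 : dist (x + τ • ((0 : ℂ), ν)) x ≤ 4 * A * r * ‖ν‖ := by
        rw [dist_eq_norm, add_sub_cancel_left, norm_smul, norm_of_nonneg hτ.1, Prod.norm_mk,
          norm_zero, max_eq_right (norm_nonneg _)]
        exact mul_le_mul_of_nonneg_right (hτ.2.trans hhr) (norm_nonneg _)
      have h3 := mem_ball.1 hx.2
      rw [mem_ball]
      linarith [dist_triangle (x + τ • ((0 : ℂ), ν)) x p]
    · have h2 := D.neg hx.1.2
      have h3 := h1.2
      change τ / 2 < -ρ (x.2 + τ • ν)
      linarith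
  have hs : ∀ x ∈ Δ ×ˢ V ∩ ball p r,
      segment ℝ x (x + h • ((0 : ℂ), ν)) ⊆ Δ ×ˢ V ∩ ball p R := by
    rintro x hx _ hq
    rw [segment_eq_image'] at hq
    obtain ⟨s, hs, rfl⟩ := hq
    beta_reduce
    rw [add_sub_cancel_left, smul_smul]
    exact (hin x hx _ ⟨mul_nonneg hs.1 hh, mul_le_of_le_one_left hh hs.2⟩).1
  have hhh := right_mem_Icc.2 hh
  have hx' := hin x hx h hhh
  have hy' := hin y hy h hhh
  have hm : segment ℝ (x + h • ((0 : ℂ), ν)) (y + h • ((0 : ℂ), ν)) ⊆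
      Δ ×ˢ V ∩ ball p R := fun q hq => by
    refine ⟨⟨?_, ?_⟩, (convex_ball p R).segment_subset hx'.1.2 hy'.1.2 hq⟩
    · exact (((convex_ball (0 : ℂ) 1).prod (convex_univ (E := Cn n))).segment_subset
        ⟨hx'.1.1.1, mem_univ _⟩ ⟨hy'.1.1.1, mem_univ _⟩ hq).1
    · have h1 : ‖q - (x + h • ((0 : ℂ), ν))‖ ≤ ‖y - x‖ := by
        have := norm_sub_le_of_mem_segment hq
        rwa [add_sub_add_right_eq_sub] at this
      have h2 := (hL _ (subset_closure hx'.1.1.2) q.2 ?_).2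
      · have h3 : dist q.2 (x + h • ((0 : ℂ), ν)).2 ≤ ‖y - x‖ :=
          (dist_eq_norm q.2 _).trans_le ((norm_snd_le _).trans h1)
        have h4 := (abs_le.1 h2).2
        have h5 := mul_le_mul_of_nonneg_left h3 hA.le
        have h6 := hx'.2
        rw [D.hV]
        change ρ q.2 < 0
        simp only [h] at h6 h4 h5
        linarith
      · refine (dist_eq_norm q.2 _).trans_le ((norm_snd_le _).trans (h1.trans ?_))
        linarith
  have e1 := hseg _ _ (hs x hx)
  have e2 := hseg _ _ hm
  have e3 := hseg _ _ (hs y hy)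
  have hn : ‖h • ((0 : ℂ), ν)‖ = h * ‖ν‖ := by
    rw [norm_smul, norm_of_nonneg hh, Prod.norm_mk, norm_zero, max_eq_right (norm_nonneg _)]
  rw [add_sub_cancel_left, hn] at e1 e3
  rw [add_sub_add_right_eq_sub] at e2
  calc ‖g y - g x - L (y - x)‖ = ‖(g (x + h • ((0 : ℂ), ν)) - g x - L (h • ((0 : ℂ), ν))) +
        (g (y + h • ((0 : ℂ), ν)) - g (x + h • ((0 : ℂ), ν)) - L (y - x)) -
        (g (y + h • ((0 : ℂ), ν)) - g y - L (h • ((0 : ℂ), ν)))‖ := by congr 1; ring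
    _ ≤ ε * (h * ‖ν‖) + ε * ‖y - x‖ + ε * (h * ‖ν‖) :=
      (norm_sub_le _ _).trans (add_le_add ((norm_add_le _ _).trans (add_le_add e1 e2)) e3)
    _ = _ := by simp only [h]; ring

/-- A family of functions closed under differentiation, and bounded near the boundary, extends
smoothly to the closure. -/
theorem contDiffOn_extendFrom {ι J : Type} [Fintype J] {f : ι → ℂ × Cn n → ℂ}
    {σ : ι → J → ι} {ℓ : J → ℂ × Cn n →L[ℝ] ℂ}
    (hf : ∀ i, DifferentiableOn ℝ (f i) (Δ ×ˢ V))
    (hd : ∀ i, ∀ p ∈ Δ ×ˢ V, fderiv ℝ (f i) p = ∑ j, f (σ i j) p • ℓ j)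
    (hb : ∀ i, ∀ r < 1, ∃ C, ∀ p ∈ ball (0 : ℂ) r ×ˢ V, ‖f i p‖ ≤ C) (m : ℕ) (i : ι) :
    ContDiffOn ℝ m (extendFrom (Δ ×ˢ V) (f i)) (ball 0 1 ×ˢ closure V) := by
  set U := Δ ×ˢ V
  have hcl : Δ ×ˢ closure V ⊆ closure U := by
    rw [closure_prod_eq]; exact prod_mono subset_closure subset_rfl
  have hlim : ∀ i, ∀ p ∈ Δ ×ˢ closure V, ∃ y, Tendsto (f i) (𝓝[U] p) (𝓝 y) :=
    fun i p hp => by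
      obtain ⟨r, hr, hr1⟩ := exists_between (mem_ball_zero_iff.1 hp.1)
      choose C hC using fun j => hb (σ i j) r hr1
      obtain ⟨A, hA, h⟩ := D.norm_image_sub_le hp
      obtain ⟨δ, hδ, h⟩ := h (r - ‖p.1‖) (sub_pos.2 hr)
      have h1 : ∀ q ∈ U ∩ ball p (r - ‖p.1‖), ‖fderiv ℝ (f i) q - 0‖ ≤ ∑ j, C j * ‖ℓ j‖ :=
        fun q hq => by
          rw [sub_zero, hd i q hq.1]
          refine norm_sum_le_of_le _ fun j _ => (norm_smul (f (σ i j) q) (ℓ j)).trans_le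
            (mul_le_mul_of_nonneg_right (hC j q ⟨?_, hq.1.2⟩) (norm_nonneg _))
          have h2 := (le_max_left _ _).trans_lt (mem_ball.1 hq.2)
          have h3 := norm_sub_norm_le q.1 p.1
          rw [dist_eq_norm] at h2
          rw [mem_ball_zero_iff]
          linarith
      have h2 : LipschitzOnWith (A * ∑ j, C j * ‖ℓ j‖).toNNReal (f i) (U ∩ ball p δ) :=
        LipschitzOnWith.of_dist_le_mul fun y hy x hx => by
          have h3 := h x hx y hy (f i) 0 _ (hf i) h1
          rw [_root_.zero_apply, sub_zero] at h3
          rw [dist_eq_norm, dist_eq_norm]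
          exact h3.trans (mul_le_mul_of_nonneg_right (Real.le_coe_toNNReal _) (norm_nonneg _))
      have := mem_closure_iff_nhdsWithin_neBot.1 (hcl hp)
      have h3 : Cauchy (𝓝[U] p) := cauchy_nhds.mono nhdsWithin_le_nhds
      exact cauchy_map_iff_exists_tendsto.1 (h3.map_of_le h2.uniformContinuousOn
        (le_principal_iff.2 (inter_mem self_mem_nhdsWithin
          (mem_nhdsWithin_of_mem_nhds (ball_mem_nhds p hδ)))))
  have hlim' : ∀ i, ∀ p ∈ Δ ×ˢ closure V,
      Tendsto (f i) (𝓝[U] p) (𝓝 (extendFrom U (f i) p)) := fun i p hp =>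
    tendsto_extendFrom (hlim i p hp)
  have hder : ∀ i, ∀ p ∈ Δ ×ˢ closure V, HasFDerivWithinAt (extendFrom U (f i))
      (∑ j, extendFrom U (f (σ i j)) p • ℓ j) (ball 0 1 ×ˢ closure V) p := fun i p hp => by
    obtain ⟨A, hA, h⟩ := D.norm_image_sub_le hp
    refine .of_isLittleO (Asymptotics.isLittleO_iff.2 fun c hc => ?_)
    set L := ∑ j, extendFrom U (f (σ i j)) p • ℓ j
    have h1 : Tendsto (fderiv ℝ (f i)) (𝓝[U] p) (𝓝 L) :=
      (tendsto_finsetSum _ fun j _ => (hlim' (σ i j) p hp).smul_const (ℓ j)).congr'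
        (eventually_of_mem self_mem_nhdsWithin fun q hq => (hd i q hq).symm)
    obtain ⟨R, hR, hR'⟩ := Metric.mem_nhdsWithin_iff.1
      (h1 (Metric.closedBall_mem_nhds L (div_pos hc hA)))
    obtain ⟨r, hr, h⟩ := h R hR
    have h2 : ∀ x ∈ U ∩ ball p r, ∀ y ∈ U ∩ ball p r,
        ‖f i y - f i x - L (y - x)‖ ≤ c * ‖y - x‖ := fun x hx y hy => by
      have := h x hx y hy (f i) L (c / A) (hf i) fun q hq => by
        rw [← dist_eq_norm]; exact hR' ⟨hq.2, hq.1⟩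
      rwa [mul_div_cancel₀ _ hA.ne'] at this
    have hev : ∀ x ∈ ball p r, ∀ᶠ y in 𝓝[U] x, y ∈ U ∩ ball p r := fun x hx =>
      inter_mem self_mem_nhdsWithin (mem_nhdsWithin_of_mem_nhds (isOpen_ball.mem_nhds hx))
    have hid : ∀ x, Tendsto (fun y : ℂ × Cn n => y) (𝓝[U] x) (𝓝 x) := fun x => nhdsWithin_le_nhds
    have h3 : ∀ y ∈ U ∩ ball p r, ‖f i y - extendFrom U (f i) p - L (y - p)‖ ≤ c * ‖y - p‖ :=
      fun y hy => by
        have := mem_closure_iff_nhdsWithin_neBot.1 (hcl hp)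
        exact le_of_tendsto_of_tendsto ((((hlim' i p hp).const_sub (f i y)).sub
          ((L.continuous.tendsto _).comp ((hid p).const_sub y))).norm)
          (((hid p).const_sub y).norm.const_mul c)
          ((hev p (mem_ball_self hr)).mono fun x hx => h2 x hx y hy)
    refine eventually_of_mem (inter_mem self_mem_nhdsWithin (mem_nhdsWithin_of_mem_nhds
      (ball_mem_nhds p hr))) fun y hy => ?_
    have := mem_closure_iff_nhdsWithin_neBot.1 (hcl hy.1)
    exact le_of_tendsto_of_tendsto ((((hlim' i y hy.1).sub_const _).sub
      ((L.continuous.tendsto _).comp ((hid y).sub_const p))).norm)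
      (((hid y).sub_const p).norm.const_mul c) ((hev y hy.2).mono fun x hx => h3 x hx)
  induction m generalizing i with
  | zero => exact contDiffOn_zero.2 (continuousOn_extendFrom hcl (hlim i))
  | succ m ih =>
    rw [Nat.cast_add, Nat.cast_one]
    intro p hp
    refine (contDiffWithinAt_succ_iff_hasFDerivWithinAt (by simp)).2 ⟨_, ?_, by simp, _, hder i,
      ContDiffWithinAt.sum fun j _ => (ih (σ i j) p hp).smul contDiffWithinAt_const⟩
    rw [insert_eq_of_mem hp]; exact self_mem_nhdsWithin

/-- The derivatives of the Bergman kernel extend to the closure. -/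
theorem contDiffOn_extendFrom_kernel 
    (hk : ∀ t ∈ Δ, HolOn (k t) V)
    (hs : SmoothOn (fun p : ℂ × Cn n => k p.1 p.2) (Δ ×ˢ V))
    (hb : ∀ w l, Bq V ρ (gf k w l) 0) :
    SmoothOn (extendFrom (Δ ×ˢ V) fun p : ℂ × Cn n => k p.1 p.2)
      (ball 0 1 ×ˢ closure V) := by
  refine contDiffOn_infty.2 fun m => D.contDiffOn_extendFrom (ι := List ℂ × List (Fin n))
    (J := Option (Option (Fin n))) (f := fun i => gf k i.1 i.2)
    (σ := fun i j => j.elim (1 :: i.1, i.2) fun j => j.elim (I :: i.1, i.2) fun j =>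
      (i.1, j :: i.2))
    (ℓ := fun j => j.elim ((ofRealCLM ∘L reCLM) ∘L .fst ℝ ℂ (Cn n)) fun j => j.elim
      ((ofRealCLM ∘L imCLM) ∘L .fst ℝ ℂ (Cn n)) fun j =>
        ((EuclideanSpace.proj j : Cn n →L[ℂ] ℂ).restrictScalars ℝ) ∘L .snd ℝ ℂ (Cn n))
    (fun i => (gf_smooth D.isOpen hk hs i.1 i.2).1.differentiableOn (by simp))
    (fun i p hp => ContinuousLinearMap.ext fun ⟨τ, v⟩ => ?_)
    (fun i r hr => by simpa using hb i.1 i.2 r hr) m ([], [])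
  have h1 : ((τ, v) : ℂ × Cn n) = τ.re • (1, 0) + τ.im • (I, 0) + (0, v) := by
    ext <;> simp
  rw [h1, map_add, map_add, map_smul, map_smul, (gf_smooth D.isOpen hk hs i.1 i.2).2 p hp,
    _root_.sum_apply, Fintype.sum_option, Fintype.sum_option, ← add_assoc]
  refine congrArg₂ _ (congrArg₂ _ ?_ ?_) (sum_congr rfl fun j _ => ?_)
  · change τ.re • gf k (1 :: i.1) i.2 p = _
    simp [mul_comm]
  · change τ.im • gf k (I :: i.1) i.2 p = _
    simp [mul_comm]
  · simp [mul_comm]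

end Dom

end

theorem Dom.memA2_iff (D : Dom V W ρ)
    (hφ : ContinuousOn φ V) (hP : ∀ x ∈ V, |φ x| ≤ P) (h : Fn n) :
    MemA2 V φ h ↔ HolOn h V ∧ NV V (sw ρ 0) h < ⊤ := by
  refine and_congr_right fun hh => ?_
  rw [← D.NV_ww_lt_top hP h]
  have h1 : AESM (fun x => ‖h x‖ ^ 2 * expR (-φ x)) (volume.restrict V) :=
    ((hh.continuousOn.norm.pow 2).mul hφ.neg.rexp).aestronglyMeasurable D.meas
  have h2 : ∀ x, ‖‖h x‖ ^ 2 * expR (-φ x)‖ₑ =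
      ‖h x‖ₑ ^ 2 * ofR (ww ρ φ 0 x) := fun x => by
    simp [enorm_mul, ww, sw, Real.enorm_of_nonneg (exp_pos _).le]
  rw [IntegrableOn, Integrable, and_iff_right h1, HasFiniteIntegral]
  simp only [h2]
  rfl

/-- **Lemma 2.1.** Let `V = {ρ < 0}` be a smoothly bounded strictly pseudoconvex domain in
`ℂⁿ` and let `φ` be a function on `Δ × V` which is smooth up to the boundary.  Let
`K t ζ z = K_t(ζ,z)` be the Bergman kernel of `V` with weight `φ^t`.  Then for fixed `z ∈ V`,
`(t,ζ) ↦ K_t(ζ,z)` is smooth up to the boundary of `V` in `ζ` and depends smoothly on `t ∈ Δ`. -/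
theorem bergman_kernel_smooth_dependence (n : ℕ) (V : Set (Cn n))
    (ρ : Cn n → ℝ) (W : Set (Cn n)) (hW : IsOpen W) (hVW : closure V ⊆ W)
    (hρ : ContDiffOn ℝ (⊤ : ℕ∞) ρ W) (hρspsh : StrictPlurisubharmonicOn ρ W)
    (hV : V = {ζ | ρ ζ < 0}) (hVbd : Bornology.IsBounded V)
    (hgrad : ∀ ζ ∈ frontier V, fderiv ℝ ρ ζ ≠ 0)
    (φ : ℂ × Cn n → ℝ) (W' : Set (ℂ × Cn n)) (hW' : IsOpen W')
    (hW'cl : closure (Metric.ball (0:ℂ) 1 ×ˢ V) ⊆ W') (hφ : ContDiffOn ℝ (⊤ : ℕ∞) φ W')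
    (K : ℂ → Cn n → Cn n → ℂ)
    (hK : ∀ t ∈ Metric.ball (0:ℂ) 1, ∀ z ∈ V,
      IsBergmanKernelAt V (fun ζ => φ (t, ζ)) z (fun ζ => K t ζ z)) :
    ∀ z ∈ V, ∃ F : ℂ × Cn n → ℂ,
      ContDiffOn ℝ (⊤ : ℕ∞) F (Metric.ball (0:ℂ) 1 ×ˢ closure V) ∧
      ∀ t ∈ Metric.ball (0:ℂ) 1, ∀ ζ ∈ V, F (t, ζ) = K t ζ z := by
  intro z hz
  have D : Dom V W ρ := ⟨hW, hVW, hρ, hρspsh, hV, hVbd, hgrad⟩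
  rw [closure_prod_eq, closure_ball _ one_ne_zero] at hW'cl
  have hc := Cf.ofReal hW' hW'cl hφ
  obtain ⟨P, -, hP⟩ := hc.bound D
  have hA : ∀ t ∈ Δ, ∀ h : Fn n, MemA2 V (fun ζ => φ (t, ζ)) h ↔
      HolOn h V ∧ NV V (sw ρ 0) h < ⊤ := fun t ht h =>
    D.memA2_iff (hφ.continuousOn.comp (Continuous.prodMk_right t).continuousOn fun x hx =>
      hW'cl ⟨ball_subset_closedBall ht, subset_closure hx⟩)
      (fun x hx => by simpa using hP t (ball_subset_closedBall ht) x hx) h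
  set k : ℂ → Fn n := fun t ζ => K t ζ z
  have hk : ∀ t ∈ Δ, HolOn (k t) V := fun t ht => (hK t ht z hz).1.1
  have hkN : ∀ t ∈ Δ, NV V (sw ρ 0) (k t) < ⊤ := fun t ht =>
    ((hA t ht _).1 (hK t ht z hz).1).2
  have hrep : ∀ t ∈ Δ, ∀ h : Fn n, HolOn h V →
      NV V (sw ρ 0) h < ⊤ → ∫ x in V, h x * conj (k t x) * ww ρ (fun x => φ (t, x)) 0 x = h z :=
    fun t ht h hh hN => by
      simpa [ww, sw, k] using (hK t ht z hz).2 h ((hA t ht h).2 ⟨hh, hN⟩)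
  have hs := (D.kernel_smooth hz hk hc hkN hrep).1
  refine ⟨_, D.contDiffOn_extendFrom_kernel hk hs (D.gf_bounded hz hk hc hkN hrep),
    fun t ht ζ hζ => ?_⟩
  exact extendFrom_eq (subset_closure ⟨ht, hζ⟩) (hs.continuousOn _ ⟨ht, hζ⟩)

end Berndtsson
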